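/- Let N ≥ 2, 0 < R₀ < R₁, p ∈ (1,∞) and s ∈ (0, R₁ − R₀). Let u be a first eigenfunction of the p-Laplacian on Ω_s, and suppose the function t ↦ λ₁(p, Ω_t) is differentiable at s with derivative 0. Then there exists r₁ ∈ (R₀ + s, R₁) such that u(x) = u(−x₁, x₂, …, x_N) for every x = (x₁, …, x_N) with r₁ < ‖x‖ < R₁. -/

import Mathlib

open MeasureTheory Metric Set Filter
open scoped RealInnerProductSpace ENNReal Topology

/-- The first Dirichlet eigenvalue of the p-Laplacian on `Ω`, defined variationally as the
infimum of Rayleigh quotients of smooth, not identically zero functions with compact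
support contained in `Ω`. -/
noncomputable def lam1 {N : ℕ} (p : ℝ) (Ω : Set (EuclideanSpace ℝ (Fin N))) : ℝ :=
  sInf { r : ℝ | ∃ u : EuclideanSpace ℝ (Fin N) → ℝ,
    ContDiff ℝ (⊤ : ℕ∞) u ∧ u ≠ 0 ∧ HasCompactSupport u ∧ tsupport u ⊆ Ω ∧
    r = (∫ x in Ω, ‖gradient u x‖ ^ p) / (∫ x in Ω, |u x| ^ p) }

/-- The first standard basis vector `e₁` of `ℝ^N`. -/
noncomputable def e1 (N : ℕ) : EuclideanSpace ℝ (Fin N) :=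
  (WithLp.equiv 2 (Fin N → ℝ)).symm (fun i => if (i : ℕ) = 0 then 1 else 0)

/-- The eccentric annulus `Ω_s = B_{R₁}(0) \ closure (B_{R₀}(s e₁))`. -/
noncomputable def Om (N : ℕ) (R₀ R₁ s : ℝ) : Set (EuclideanSpace ℝ (Fin N)) :=
  ball 0 R₁ \ closure (ball (s • e1 N) R₀)

/-- `u` is a first eigenfunction of the p-Laplacian on `Ω` with eigenvalue `lam`:
C¹ on an open set containing the closure of `Ω`, positive in `Ω`, zero on `∂Ω`, and a weak
solution of `−Δ_p u = lam · u^{p−1}`. -/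
def IsFirstEigenfunction {N : ℕ} (p : ℝ) (Ω : Set (EuclideanSpace ℝ (Fin N)))
    (lam : ℝ) (u : EuclideanSpace ℝ (Fin N) → ℝ) : Prop :=
  (∃ V : Set (EuclideanSpace ℝ (Fin N)), IsOpen V ∧ closure Ω ⊆ V ∧ ContDiffOn ℝ 1 u V) ∧
  (∀ x ∈ Ω, 0 < u x) ∧
  (∀ x ∈ frontier Ω, u x = 0) ∧
  (∀ φ : EuclideanSpace ℝ (Fin N) → ℝ, ContDiff ℝ (⊤ : ℕ∞) φ → HasCompactSupport φ →
    tsupport φ ⊆ Ω →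
    ∫ x in Ω, ‖gradient u x‖ ^ (p - 2) * ⟪gradient u x, gradient φ x⟫ =
      lam * ∫ x in Ω, (u x) ^ (p - 1) * φ x)


set_option linter.unusedSectionVars false
set_option linter.unusedVariables false
set_option linter.unusedRCasesPattern false
set_option linter.unusedSimpArgs false


section FpSec
variable {E : Type*} [NormedAddCommGroup E] [InnerProductSpace ℝ E]

/-- the flux `‖ξ‖^(p-2) ξ` -/
noncomputable def Fp (p : ℝ) (ξ : E) : E := ‖ξ‖ ^ (p - 2) • ξ

lemma rpow_pm2_mul_sq {p t : ℝ} (hp : 1 < p) (ht : 0 ≤ t) : t ^ (p - 2) * t ^ 2 = t ^ p := by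
  rcases ht.eq_or_lt with h | h
  · subst h; rw [Real.zero_rpow (by linarith : p ≠ 0)]; simp
  · rw [← Real.rpow_natCast, ← Real.rpow_add h]; norm_num

lemma rpow_pm2_mul {p t : ℝ} (hp : 1 < p) (ht : 0 ≤ t) : t ^ (p - 2) * t = t ^ (p - 1) := by
  rcases ht.eq_or_lt with h | h
  · subst h; rw [Real.zero_rpow (by linarith : p - 1 ≠ 0)]; simp
  · conv_lhs => rw [← Real.rpow_one t, ← Real.rpow_mul h.le, ← Real.rpow_add h]
    ring_nf

lemma rpow_pm1_mul {p t : ℝ} (hp : 1 < p) (ht : 0 ≤ t) : t ^ (p - 1) * t = t ^ p := by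
  rw [← rpow_pm2_mul hp ht, ← rpow_pm2_mul_sq hp ht]; ring

lemma norm_Fp {p : ℝ} (hp : 1 < p) (ξ : E) : ‖Fp p ξ‖ = ‖ξ‖ ^ (p - 1) := by
  rw [Fp, norm_smul, Real.norm_of_nonneg (Real.rpow_nonneg (norm_nonneg _) _),
    rpow_pm2_mul hp (norm_nonneg _)]

lemma inner_Fp_self {p : ℝ} (hp : 1 < p) (ξ : E) : ⟪Fp p ξ, ξ⟫ = ‖ξ‖ ^ p := by
  rw [Fp, real_inner_smul_left, real_inner_self_eq_norm_sq, rpow_pm2_mul_sq hp (norm_nonneg _)]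

lemma Fp_smul {p : ℝ} (hp : 1 < p) {t : ℝ} (ht : 0 ≤ t) (ξ : E) :
    Fp p (t • ξ) = t ^ (p - 1) • Fp p ξ := by
  rw [Fp, Fp, norm_smul, Real.norm_of_nonneg ht, Real.mul_rpow ht (norm_nonneg _), smul_smul,
    smul_smul, ← rpow_pm2_mul hp ht]
  congr 1; ring

lemma Fp_zero {p : ℝ} : Fp p (0 : E) = 0 := by simp [Fp]

lemma continuous_Fp {p : ℝ} (hp : 1 < p) : Continuous (Fp p : E → E) := by
  rw [continuous_iff_continuousAt]
  intro ξ
  by_cases h : ξ = 0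
  · subst h
    have : Tendsto (fun ξ : E => ‖Fp p ξ‖) (𝓝 0) (𝓝 0) := by
      simp_rw [norm_Fp hp]
      have h2 : Continuous fun ξ : E => ‖ξ‖ ^ (p - 1) :=
        continuous_norm.rpow_const (fun x => Or.inr (by linarith))
      have := h2.tendsto 0
      rwa [norm_zero, Real.zero_rpow (by linarith)] at this
    rw [ContinuousAt, Fp_zero]
    exact tendsto_zero_iff_norm_tendsto_zero.mpr this
  · exact (continuousAt_id.norm.rpow_const (Or.inl (norm_ne_zero_iff.mpr h))).smul continuousAt_id

lemma inner_Fp_le {p : ℝ} (hp : 1 < p) (a b : E) : ⟪Fp p a, b⟫ ≤ ‖a‖ ^ (p - 1) * ‖b‖ := by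
  rw [← norm_Fp hp]; exact real_inner_le_norm _ _

lemma young_aux {p s t : ℝ} (hp : 1 < p) (hs : 0 ≤ s) (ht : 0 ≤ t) :
    p * (s ^ (p - 1) * t) ≤ t ^ p + (p - 1) * s ^ p := by
  have hp0 : 0 < p := by linarith
  have h := Real.geom_mean_le_arith_mean2_weighted (w₁ := 1 / p) (w₂ := (p - 1) / p)
    (by positivity) (div_nonneg (by linarith) hp0.le) (Real.rpow_nonneg ht p)
    (Real.rpow_nonneg hs p) (by field_simp; ring)
  rw [← Real.rpow_mul ht, ← Real.rpow_mul hs, mul_one_div_cancel hp0.ne', Real.rpow_one,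
    mul_div_cancel₀ _ hp0.ne'] at h
  calc p * (s ^ (p - 1) * t) = p * (t * s ^ (p - 1)) := by ring
    _ ≤ p * (1 / p * t ^ p + (p - 1) / p * s ^ p) := by gcongr
    _ = _ := by field_simp

lemma young_Fp {p : ℝ} (hp : 1 < p) (a b : E) :
    0 ≤ ‖b‖ ^ p + (p - 1) * ‖a‖ ^ p - p * ⟪Fp p a, b⟫ := by
  have h1 := young_aux hp (norm_nonneg a) (norm_nonneg b)
  have h2 := inner_Fp_le hp a b
  nlinarith

lemma Fp_mono_identity {p : ℝ} (hp : 1 < p) (a b : E) :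
    ⟪Fp p a - Fp p b, a - b⟫ = (‖a‖ ^ (p - 2) + ‖b‖ ^ (p - 2)) * (‖a‖ * ‖b‖ - ⟪a, b⟫) +
      (‖a‖ ^ (p - 1) - ‖b‖ ^ (p - 1)) * (‖a‖ - ‖b‖) := by
  have e : ⟪Fp p a - Fp p b, a - b⟫ =
      ‖a‖ ^ (p - 2) * ‖a‖ ^ 2 + ‖b‖ ^ (p - 2) * ‖b‖ ^ 2 -
        (‖a‖ ^ (p - 2) + ‖b‖ ^ (p - 2)) * ⟪a, b⟫ := by
    rw [inner_sub_left, inner_sub_right, inner_sub_right, Fp, Fp]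
    simp only [real_inner_smul_left, real_inner_self_eq_norm_sq]
    rw [real_inner_comm a b]; ring
  rw [e, ← rpow_pm2_mul hp (norm_nonneg a), ← rpow_pm2_mul hp (norm_nonneg b)]; ring

lemma rpow_mono_prod {q s t : ℝ} (hq : 0 < q) (hs : 0 ≤ s) (ht : 0 ≤ t) :
    0 ≤ (s ^ q - t ^ q) * (s - t) := by
  rcases le_total s t with h | h
  · exact mul_nonneg_of_nonpos_of_nonpos
      (sub_nonpos.mpr (Real.rpow_le_rpow hs h hq.le)) (sub_nonpos.mpr h)
  · exact mul_nonneg (sub_nonneg.mpr (Real.rpow_le_rpow ht h hq.le)) (sub_nonneg.mpr h)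

lemma rpow_mono_prod_pos {q s t : ℝ} (hq : 0 < q) (hs : 0 ≤ s) (ht : 0 ≤ t) (hne : s ≠ t) :
    0 < (s ^ q - t ^ q) * (s - t) := by
  rcases lt_or_gt_of_ne hne with h | h
  · exact mul_pos_of_neg_of_neg
      (sub_neg.mpr (Real.rpow_lt_rpow hs h hq)) (sub_neg.mpr h)
  · exact mul_pos (sub_pos.mpr (Real.rpow_lt_rpow ht h hq)) (sub_pos.mpr h)

lemma Fp_mono {p : ℝ} (hp : 1 < p) (a b : E) : 0 ≤ ⟪Fp p a - Fp p b, a - b⟫ := by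
  rw [Fp_mono_identity hp]
  have h1 := rpow_mono_prod (q := p - 1) (by linarith) (norm_nonneg a) (norm_nonneg b)
  have h2 := real_inner_le_norm a b
  have h3 : 0 ≤ ‖a‖ ^ (p - 2) + ‖b‖ ^ (p - 2) := by positivity
  nlinarith [mul_nonneg h3 (sub_nonneg.mpr h2)]

lemma Fp_mono_strict {p : ℝ} (hp : 1 < p) {a b : E} (hab : a ≠ b) :
    0 < ⟪Fp p a - Fp p b, a - b⟫ := by
  rw [Fp_mono_identity hp]
  have h2 := real_inner_le_norm a b
  have h3 : 0 ≤ ‖a‖ ^ (p - 2) + ‖b‖ ^ (p - 2) := by positivity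
  by_cases hn : ‖a‖ = ‖b‖
  · have ha : 0 < ‖a‖ := by
      rcases (norm_nonneg a).eq_or_lt with h | h
      · exfalso; apply hab
        have hb : ‖b‖ = 0 := by rw [← hn]; exact h.symm
        rw [norm_eq_zero.mp h.symm, norm_eq_zero.mp hb]
      · exact h
    have h4 : 0 < ‖a‖ * ‖b‖ - ⟪a, b⟫ := by
      have h5 : 0 < ‖a - b‖ ^ 2 := by
        have := norm_pos_iff.mpr (sub_ne_zero.mpr hab); positivity
      rw [norm_sub_sq_real] at h5
      rw [← hn] at h5 ⊢; nlinarith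
    rw [hn, sub_self, zero_mul, add_zero, ← hn]
    rw [← hn] at h4; positivity
  · have h1 := rpow_mono_prod_pos (q := p - 1) (by linarith) (norm_nonneg a) (norm_nonneg b) hn
    nlinarith [mul_nonneg h3 (sub_nonneg.mpr h2)]

lemma young_sum {p : ℝ} (hp : 1 < p) (a b : E) :
    (‖b‖ ^ p + (p - 1) * ‖a‖ ^ p - p * ⟪Fp p a, b⟫) +
      (‖a‖ ^ p + (p - 1) * ‖b‖ ^ p - p * ⟪Fp p b, a⟫) = p * ⟪Fp p a - Fp p b, a - b⟫ := by
  rw [inner_sub_left, inner_sub_right, inner_sub_right, inner_Fp_self hp, inner_Fp_self hp]; ring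

end FpSec

section BetaSec
/-- truncation `((t-δ)_+)^2/t`. -/
noncomputable def bet (δ t : ℝ) : ℝ := (max (t - δ) 0) ^ 2 / t

lemma bet_of_le {δ t : ℝ} (h : t ≤ δ) : bet δ t = 0 := by
  rw [bet, max_eq_right (by linarith)]; simp

lemma bet_of_ge {δ t : ℝ} (h : δ ≤ t) : bet δ t = (t - δ) ^ 2 / t := by
  rw [bet, max_eq_left (by linarith)]

/-- derivative of `bet`. -/
noncomputable def bet' (δ t : ℝ) : ℝ := if t ≤ δ then 0 else 1 - (δ / t) ^ 2

lemma hasDerivAt_bet {δ : ℝ} (hδ : 0 < δ) (t : ℝ) : HasDerivAt (bet δ) (bet' δ t) t := by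
  rcases lt_trichotomy t δ with h | h | h
  · rw [bet', if_pos h.le]
    refine (hasDerivAt_const t (0 : ℝ)).congr_of_eventuallyEq ?_
    filter_upwards [Iio_mem_nhds h] with x hx using bet_of_le (le_of_lt hx)
  · subst h
    rw [bet', if_pos le_rfl]
    have h1 : HasDerivAt (fun x : ℝ => (max (x - t) 0) ^ 2) 0 t := by
      rw [hasDerivAt_iff_isLittleO_nhds_zero]
      simp only [add_sub_cancel_left, sub_self, max_self, smul_zero, sub_zero, ne_eq,
        OfNat.ofNat_ne_zero, not_false_eq_true, zero_pow]
      have : (fun x : ℝ => (max x 0) ^ 2) =O[𝓝 0] fun x : ℝ => x ^ 2 := by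
        refine Asymptotics.IsBigO.of_bound 1 (Eventually.of_forall fun x => ?_)
        simp only [norm_pow, Real.norm_eq_abs, sq_abs, one_mul]
        rcases le_total x 0 with h | h
        · rw [max_eq_right h]; simp; positivity
        · rw [max_eq_left h]
      refine this.trans_isLittleO ?_
      exact (Asymptotics.isLittleO_pow_id one_lt_two)
    have := h1.div (hasDerivAt_id t) hδ.ne'
    refine this.congr_deriv ?_
    simp
  · rw [bet', if_neg (by linarith)]
    have h0 : t ≠ 0 := by linarith
    have h1 : HasDerivAt (fun x : ℝ => (x - δ) ^ 2 / x)
        ((2 * (t - δ) * t - (t - δ) ^ 2 * 1) / t ^ 2) t := by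
      have a : HasDerivAt (fun x : ℝ => (x - δ) ^ 2) (2 * (t - δ)) t := by
        exact (((hasDerivAt_id t).sub_const δ).pow 2).congr_deriv (by simp)
      exact a.div (hasDerivAt_id t) h0
    have h2 : (2 * (t - δ) * t - (t - δ) ^ 2 * 1) / t ^ 2 = 1 - (δ / t) ^ 2 := by
      field_simp; ring
    rw [h2] at h1
    refine h1.congr_of_eventuallyEq ?_
    filter_upwards [Ioi_mem_nhds h] with x hx using bet_of_ge (le_of_lt hx)

lemma continuous_bet' {δ : ℝ} (hδ : 0 < δ) : Continuous (bet' δ) := by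
  have : bet' δ = fun t => 1 - (δ / max t δ) ^ 2 := by
    ext t
    rw [bet']
    split_ifs with h
    · rw [max_eq_right h, div_self hδ.ne']; norm_num
    · rw [max_eq_left (by linarith)]
  rw [this]
  have h2 : ∀ t, max t δ ≠ 0 := fun t => (lt_of_lt_of_le hδ (le_max_right _ _)).ne'
  fun_prop (disch := exact h2 _)

lemma contDiff_bet {δ : ℝ} (hδ : 0 < δ) : ContDiff ℝ 1 (bet δ) := by
  rw [contDiff_one_iff_deriv]
  refine ⟨fun t => (hasDerivAt_bet hδ t).differentiableAt, ?_⟩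
  have : deriv (bet δ) = bet' δ := funext fun t => (hasDerivAt_bet hδ t).deriv
  rw [this]; exact continuous_bet' hδ

lemma bet'_nonneg {δ : ℝ} (hδ : 0 < δ) (t : ℝ) : 0 ≤ bet' δ t := by
  rw [bet']; split_ifs with h
  · exact le_rfl
  · have : δ / t ≤ 1 := (div_le_one (by linarith)).mpr (by linarith)
    have h0 : 0 ≤ δ / t := div_nonneg hδ.le (by linarith)
    nlinarith

lemma bet'_le_one {δ : ℝ} (t : ℝ) : bet' δ t ≤ 1 := by
  rw [bet']; split_ifs with h
  · norm_num
  · nlinarith [sq_nonneg (δ / t)]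

lemma bet_nonneg {δ : ℝ} (hδ : 0 < δ) (t : ℝ) : 0 ≤ bet δ t := by
  rcases le_total t δ with h | h
  · rw [bet_of_le h]
  · rw [bet_of_ge h]; exact div_nonneg (sq_nonneg _) (by linarith)

lemma bet_le {δ t : ℝ} (hδ : 0 < δ) (ht : 0 ≤ t) : bet δ t ≤ t := by
  rcases le_total t δ with h | h
  · rw [bet_of_le h]; exact ht
  · rw [bet_of_ge h, div_le_iff₀ (by linarith)]; nlinarith

lemma bet_ge {δ t : ℝ} (hδ : 0 < δ) (ht : 0 ≤ t) : t - 2 * δ ≤ bet δ t := by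
  rcases le_total t δ with h | h
  · rw [bet_of_le h]; linarith
  · rw [bet_of_ge h, le_div_iff₀ (by linarith)]; nlinarith

lemma bet_defect {δ : ℝ} (hδ : 0 < δ) (t : ℝ) :
    0 ≤ t * bet' δ t - bet δ t ∧ t * bet' δ t - bet δ t ≤ 2 * δ := by
  rcases le_or_gt t δ with h | h
  · rw [bet_of_le h, bet', if_pos h]; simp; exact hδ.le
  · rw [bet_of_ge h.le, bet', if_neg (by linarith)]
    have h0 : 0 < t := by linarith
    have : t * (1 - (δ / t) ^ 2) - (t - δ) ^ 2 / t = 2 * δ * (t - δ) / t := by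
      field_simp; ring
    rw [this]
    constructor
    · exact div_nonneg (by nlinarith) h0.le
    · rw [div_le_iff₀ h0]; nlinarith

lemma bet'_ge {δ t : ℝ} (hδ : 0 < δ) (ht : 2 * δ ≤ t) : 1 / 2 ≤ bet' δ t := by
  rw [bet', if_neg (by linarith)]
  have h0 : 0 < t := by linarith
  have h1 : δ / t ≤ 1 / 2 := by rw [div_le_iff₀ h0]; linarith
  have h2 : 0 ≤ δ / t := by positivity
  nlinarith

lemma tsupport_bet_subset {X : Type*} [TopologicalSpace X] {δ : ℝ} (t : X → ℝ)
    (ht : Continuous t) : tsupport (fun x => bet δ (t x)) ⊆ {x | δ ≤ t x} := by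
  refine closure_minimal ?_ (isClosed_le continuous_const ht)
  intro x hx
  by_contra h
  exact hx (bet_of_le (le_of_not_ge h))

end BetaSec


section GradCalc
variable {E : Type*} [NormedAddCommGroup E] [InnerProductSpace ℝ E] [CompleteSpace E]

lemma hasGrad_iff {f : E → ℝ} {g x : E} :
    HasGradientAt f g x ↔ HasFDerivAt f (innerSL ℝ g) x := Iff.rfl

lemma HasGradientAt.real_comp {f : E → ℝ} {g x : E} {h : ℝ → ℝ} {h' : ℝ}
    (hh : HasDerivAt h h' (f x)) (hf : HasGradientAt f g x) :
    HasGradientAt (fun y => h (f y)) (h' • g) x := by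
  rw [hasGrad_iff] at *
  have := hh.comp_hasFDerivAt x hf
  rw [map_smul]; exact this

lemma HasGradientAt.mul' {f₁ f₂ : E → ℝ} {g₁ g₂ x : E} (h₁ : HasGradientAt f₁ g₁ x)
    (h₂ : HasGradientAt f₂ g₂ x) :
    HasGradientAt (fun y => f₁ y * f₂ y) (f₁ x • g₂ + f₂ x • g₁) x := by
  rw [hasGrad_iff] at *
  have := h₁.mul h₂
  rw [map_add, map_smul, map_smul]; exact this

lemma HasGradientAt.add' {f₁ f₂ : E → ℝ} {g₁ g₂ x : E} (h₁ : HasGradientAt f₁ g₁ x)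
    (h₂ : HasGradientAt f₂ g₂ x) :
    HasGradientAt (fun y => f₁ y + f₂ y) (g₁ + g₂) x := by
  rw [hasGrad_iff] at *
  rw [map_add]; exact h₁.add h₂

lemma HasGradientAt.sub' {f₁ f₂ : E → ℝ} {g₁ g₂ x : E} (h₁ : HasGradientAt f₁ g₁ x)
    (h₂ : HasGradientAt f₂ g₂ x) :
    HasGradientAt (fun y => f₁ y - f₂ y) (g₁ - g₂) x := by
  rw [hasGrad_iff] at *
  rw [map_sub]; exact h₁.sub h₂

lemma HasGradientAt.add_const' {f₁ : E → ℝ} {g₁ x : E} (h₁ : HasGradientAt f₁ g₁ x) (c : ℝ) :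
    HasGradientAt (fun y => f₁ y + c) g₁ x := by
  rw [hasGrad_iff] at *
  exact h₁.add_const c

lemma HasGradientAt.congr' {f₁ f₂ : E → ℝ} {g x : E} (h₁ : HasGradientAt f₁ g x)
    (h : f₂ =ᶠ[𝓝 x] f₁) : HasGradientAt f₂ g x := by
  rw [hasGrad_iff] at *
  exact h₁.congr_of_eventuallyEq h

lemma hasGrad_inner (e x : E) : HasGradientAt (fun y => ⟪e, y⟫) e x := by
  rw [hasGrad_iff]; exact (innerSL ℝ e).hasFDerivAt

lemma hasGrad_norm {x : E} (hx : x ≠ 0) : HasGradientAt (fun y : E => ‖y‖) (‖x‖⁻¹ • x) x := by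
  have hx' : ‖x‖ ≠ 0 := norm_ne_zero_iff.mpr hx
  have h0 : HasGradientAt (fun y : E => ‖y‖ ^ 2) ((2 : ℝ) • x) x := by
    rw [hasGrad_iff, map_smul]
    have := (hasStrictFDerivAt_norm_sq x).hasFDerivAt
    refine this.congr_fderiv ?_
    ext y; simp
  have h1 := HasGradientAt.real_comp (f := fun y : E => ‖y‖ ^ 2) (x := x) (h := Real.sqrt)
    (Real.hasDerivAt_sqrt (pow_ne_zero 2 hx')) h0
  rw [Real.sqrt_sq (norm_nonneg _), smul_smul] at h1
  have h2 : (1 / (2 * ‖x‖) * 2) = ‖x‖⁻¹ := by field_simp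
  rw [h2] at h1
  refine h1.congr' (Eventually.of_forall fun y => ?_)
  exact (Real.sqrt_sq (norm_nonneg _)).symm

lemma hasGrad_radial {k : ℝ → ℝ} {k' : ℝ} {x : E} (hx : x ≠ 0) (hk : HasDerivAt k k' ‖x‖) :
    HasGradientAt (fun y : E => k ‖y‖) (k' • (‖x‖⁻¹ • x)) x :=
  HasGradientAt.real_comp hk (hasGrad_norm hx)

lemma ContDiff.hasGrad {u : E → ℝ} (hu : ContDiff ℝ 1 u) (x : E) :
    HasGradientAt u (gradient u x) x :=
  (hu.differentiable one_ne_zero x).hasGradientAt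

lemma continuous_toDual_symm : Continuous ((InnerProductSpace.toDual ℝ E).symm) :=
  (InnerProductSpace.toDual ℝ E).symm.continuous

lemma ContDiff.continuous_grad {u : E → ℝ} (hu : ContDiff ℝ 1 u) : Continuous (gradient u) :=
  continuous_toDual_symm.comp (hu.continuous_fderiv one_ne_zero)

lemma norm_gradient_sub (u v : E → ℝ) (x : E) :
    ‖gradient u x - gradient v x‖ = ‖fderiv ℝ u x - fderiv ℝ v x‖ := by
  rw [gradient, gradient, ← map_sub, LinearIsometryEquiv.norm_map]

lemma contDiff_one_of_grad {u : E → ℝ} {g : E → E} (h : ∀ x, HasGradientAt u (g x) x)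
    (hg : Continuous g) : ContDiff ℝ 1 u := by
  rw [contDiff_one_iff_fderiv]
  refine ⟨fun x => (h x).differentiableAt, ?_⟩
  have : fderiv ℝ u = fun x => innerSL ℝ (g x) := funext fun x => (hasGrad_iff.mp (h x)).fderiv
  rw [this]; exact (innerSL ℝ).continuous.comp hg

lemma tsupport_gradient_subset (u : E → ℝ) : tsupport (gradient u) ⊆ tsupport u := by
  refine closure_minimal ?_ (isClosed_tsupport u)
  intro x hx
  by_contra h
  apply hx
  have := (notMem_tsupport_iff_eventuallyEq.mp h).gradient_eq
  rw [this]; exact gradient_fun_const x (0:ℝ)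

lemma gradient_eq_zero_of_notMem {u : E → ℝ} {x : E} (h : x ∉ tsupport u) : gradient u x = 0 := by
  by_contra h2
  exact h (tsupport_gradient_subset u (subset_tsupport _ h2))

lemma HasGradientAt.comp_isom {u : E → ℝ} {g : E} (R : E ≃ₗᵢ[ℝ] E) {x : E}
    (h : HasGradientAt u g (R x)) : HasGradientAt (fun y => u (R y)) (R.symm g) x := by
  rw [hasGrad_iff] at *
  have h2 : HasFDerivAt (fun y => R y) (R.toContinuousLinearEquiv : E →L[ℝ] E) x :=
    R.toContinuousLinearEquiv.hasFDerivAt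
  have := HasFDerivAt.comp x (g := u) (f := fun y => R y) h h2
  refine this.congr_fderiv ?_
  ext y
  simp only [ContinuousLinearMap.comp_apply, innerSL_apply_apply]
  change ⟪g, R y⟫ = ⟪R.symm g, y⟫
  rw [← R.inner_map_map (R.symm g) y]; simp

end GradCalc

section Moll
variable {E : Type*} [NormedAddCommGroup E] [InnerProductSpace ℝ E] [CompleteSpace E]
  [FiniteDimensional ℝ E] [MeasurableSpace E] [BorelSpace E]

open ContinuousLinearMap in
lemma mollify {φ : E → ℝ} (h1 : ContDiff ℝ 1 φ) (hc : HasCompactSupport φ)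
    {ε η : ℝ} (hε : 0 < ε) (hη : 0 < η) :
    ∃ ψ : E → ℝ, ContDiff ℝ (⊤ : ℕ∞) ψ ∧ tsupport ψ ⊆ cthickening η (tsupport φ) ∧
      (∀ x, |ψ x - φ x| ≤ ε) ∧ ∀ x, ‖gradient ψ x - gradient φ x‖ ≤ ε := by
  have u1 : UniformContinuous φ := hc.uniformContinuous_of_continuous h1.continuous
  have u2 : UniformContinuous (fderiv ℝ φ) :=
    (hc.fderiv ℝ).uniformContinuous_of_continuous (h1.continuous_fderiv one_ne_zero)
  obtain ⟨d1, hd1, hh1⟩ := Metric.uniformContinuous_iff.mp u1 ε hε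
  obtain ⟨d2, hd2, hh2⟩ := Metric.uniformContinuous_iff.mp u2 ε hε
  set r := min η (min d1 d2) with hr
  have hr0 : 0 < r := lt_min hη (lt_min hd1 hd2)
  let b : ContDiffBump (0 : E) := ⟨r / 2, r, half_pos hr0, half_lt_self hr0⟩
  have hbl : LocallyIntegrable (b.normed (volume : Measure E)) volume :=
    b.continuous_normed.locallyIntegrable
  refine ⟨convolution (b.normed volume) φ (lsmul ℝ ℝ) volume, ?_, ?_, ?_, ?_⟩
  · exact (b.hasCompactSupport_normed).contDiff_convolution_left _ b.contDiff_normed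
      h1.continuous.locallyIntegrable
  · refine closure_minimal ?_ isClosed_cthickening
    refine (support_convolution_subset _).trans ?_
    rintro x ⟨y, hy, z, hz, rfl⟩
    rw [b.support_normed_eq, mem_ball_zero_iff] at hy
    refine mem_cthickening_of_dist_le _ z _ _ (subset_tsupport _ hz) ?_
    simp only [dist_eq_norm, add_sub_cancel_right]
    exact (hy.le).trans (min_le_left _ _)
  · intro x
    rw [← Real.dist_eq]
    refine b.dist_normed_convolution_le h1.continuous.aestronglyMeasurable fun y hy => ?_
    exact (hh1 (lt_of_lt_of_le hy ((min_le_right _ _).trans (min_le_left _ _)))).le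
  · intro x
    rw [norm_gradient_sub, ← dist_eq_norm,
      (hc.hasFDerivAt_convolution_right (lsmul ℝ ℝ) hbl h1 x).fderiv]
    have e : (convolution (b.normed volume) (fderiv ℝ φ) ((lsmul ℝ ℝ).precompR E) volume) =
        (convolution (b.normed volume) (fderiv ℝ φ) (lsmul ℝ ℝ) volume) := by
      have : ((lsmul ℝ ℝ : ℝ →L[ℝ] ℝ →L[ℝ] ℝ).precompR E) =
          (lsmul ℝ ℝ : ℝ →L[ℝ] (E →L[ℝ] ℝ) →L[ℝ] (E →L[ℝ] ℝ)) := by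
        ext a b c; simp [precompR_apply]
      rw [this]
    rw [e]
    refine b.dist_normed_convolution_le
      (h1.continuous_fderiv one_ne_zero).aestronglyMeasurable fun y hy => ?_
    exact (hh2 (lt_of_lt_of_le hy ((min_le_right _ _).trans (min_le_right _ _)))).le

lemma approx_seq {φ : E → ℝ} (h1 : ContDiff ℝ 1 φ) (hc : HasCompactSupport φ)
    {Ω : Set E} (hΩ : IsOpen Ω) (hs : tsupport φ ⊆ Ω) :
    ∃ K : Set E, IsCompact K ∧ K ⊆ Ω ∧ tsupport φ ⊆ K ∧ ∃ ψ : ℕ → E → ℝ,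
      (∀ n, ContDiff ℝ (⊤ : ℕ∞) (ψ n)) ∧ (∀ n, tsupport (ψ n) ⊆ K) ∧
      (∀ n x, |ψ n x - φ x| ≤ 1 / ((n : ℝ) + 1)) ∧
      ∀ n x, ‖gradient (ψ n) x - gradient φ x‖ ≤ 1 / ((n : ℝ) + 1) := by
  obtain ⟨η, hη, hsub⟩ := hc.exists_cthickening_subset_open hΩ hs
  have := fun n : ℕ => mollify h1 hc (ε := 1 / ((n : ℝ) + 1)) (by positivity) hη
  choose ψ a b c d using this
  exact ⟨_, hc.cthickening, hsub, self_subset_cthickening _, ψ, a, b, c, d⟩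

lemma tendsto_of_le_inv {X : Type*} [PseudoMetricSpace X] {f : ℕ → X} {a : X}
    (h : ∀ n, dist (f n) a ≤ 1 / ((n : ℝ) + 1)) : Tendsto f atTop (𝓝 a) :=
  tendsto_iff_dist_tendsto_zero.mpr
    (squeeze_zero (fun _ => dist_nonneg) h tendsto_one_div_add_atTop_nhds_zero_nat)

/-- limit passage for integrals of functions vanishing outside a fixed compact set. -/
lemma tendsto_integral_compact {K : Set E} (hK : IsCompact K) {f : ℕ → E → ℝ} {g : E → ℝ}
    (hf : ∀ n, Continuous (f n)) (C : ℝ) (hb : ∀ n, ∀ x, |f n x| ≤ C)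
    (h0 : ∀ n, ∀ x ∉ K, f n x = 0) (hlim : ∀ x, Tendsto (fun n => f n x) atTop (𝓝 (g x))) :
    Tendsto (fun n => ∫ x, f n x) atTop (𝓝 (∫ x, g x)) := by
  refine tendsto_integral_of_dominated_convergence (K.indicator fun _ => C)
    (fun n => (hf n).aestronglyMeasurable) ?_ (fun n => Eventually.of_forall fun x => ?_)
    (Eventually.of_forall hlim)
  · exact (integrable_indicator_iff hK.measurableSet).mpr
      (continuousOn_const.integrableOn_compact hK)
  · by_cases hx : x ∈ K
    · rw [indicator_of_mem hx]; exact hb n x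
    · rw [indicator_of_notMem hx, h0 n x hx]; simp

/-- weak formulation with `C¹` compactly supported test functions -/
def WeakSol (p lam : ℝ) (Ω : Set E) (u : E → ℝ) : Prop :=
  ∀ φ : E → ℝ, ContDiff ℝ 1 φ → HasCompactSupport φ → tsupport φ ⊆ Ω →
    ∫ x, ⟪Fp p (gradient u x), gradient φ x⟫ = lam * ∫ x, (u x) ^ (p - 1) * φ x

lemma contDiff_top_one {φ : E → ℝ} (h : ContDiff ℝ (⊤ : ℕ∞) φ) : ContDiff ℝ 1 φ :=
  h.of_le (by exact_mod_cast le_top)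

lemma exists_bound_cs {F : Type*} [NormedAddCommGroup F] {f : E → F} (hf : Continuous f)
    {K : Set E} (hK : IsCompact K) : ∃ C, 0 ≤ C ∧ ∀ x ∈ K, ‖f x‖ ≤ C := by
  obtain ⟨C, hC⟩ := hK.exists_bound_of_continuousOn hf.continuousOn
  exact ⟨max C 0, le_max_right _ _, fun x hx => (hC x hx).trans (le_max_left _ _)⟩

lemma inv_nat_le_one (n : ℕ) : 1 / ((n : ℝ) + 1) ≤ 1 := by
  rw [div_le_one (by positivity)]; have : (0:ℝ) ≤ n := Nat.cast_nonneg n; linarith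

lemma weakSol_of_smooth {p lam : ℝ} (hp : 1 < p) {Ω : Set E} (hΩ : IsOpen Ω) {u : E → ℝ}
    (hu : ContDiff ℝ 1 u)
    (h : ∀ φ : E → ℝ, ContDiff ℝ (⊤ : ℕ∞) φ → HasCompactSupport φ → tsupport φ ⊆ Ω →
      ∫ x, ⟪Fp p (gradient u x), gradient φ x⟫ = lam * ∫ x, (u x) ^ (p - 1) * φ x) :
    WeakSol p lam Ω u := by
  intro φ h1 hc hs
  obtain ⟨K, hK, hKΩ, hφK, ψ, a, b, c, d⟩ := approx_seq h1 hc hΩ hs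
  have cF : Continuous fun x => Fp p (gradient u x) := (continuous_Fp hp).comp hu.continuous_grad
  have cu : Continuous fun x => (u x) ^ (p - 1) :=
    hu.continuous.rpow_const fun x => Or.inr (by linarith)
  obtain ⟨C1, hC1, hb1⟩ := exists_bound_cs cF hK
  obtain ⟨C2, hC2, hb2⟩ := exists_bound_cs cu hK
  obtain ⟨C3, hC3, hb3⟩ := exists_bound_cs h1.continuous_grad hK
  obtain ⟨C4, hC4, hb4⟩ := exists_bound_cs h1.continuous hK
  have cg : ∀ n, Continuous (gradient (ψ n)) := fun n => (contDiff_top_one (a n)).continuous_grad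
  have t1 : Tendsto (fun n => ∫ x, ⟪Fp p (gradient u x), gradient (ψ n) x⟫) atTop
      (𝓝 (∫ x, ⟪Fp p (gradient u x), gradient φ x⟫)) := by
    refine tendsto_integral_compact hK (fun n => cF.inner (cg n)) (C1 * (C3 + 1)) ?_ ?_ ?_
    · intro n x
      by_cases hx : x ∈ K
      · refine (abs_real_inner_le_norm _ _).trans ?_
        refine mul_le_mul (hb1 x hx) ?_ (norm_nonneg _) hC1
        have := norm_le_norm_add_norm_sub' (gradient (ψ n) x) (gradient φ x)
        have := d n x; have := inv_nat_le_one n; have := hb3 x hx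
        linarith
      · rw [gradient_eq_zero_of_notMem fun hh => hx (b n hh)]; simp; positivity
    · intro n x hx; rw [gradient_eq_zero_of_notMem fun hh => hx (b n hh)]; simp
    · intro x
      exact tendsto_const_nhds.inner (tendsto_of_le_inv fun n => by rw [dist_eq_norm]; exact d n x)
  have t2 : Tendsto (fun n => ∫ x, (u x) ^ (p - 1) * ψ n x) atTop
      (𝓝 (∫ x, (u x) ^ (p - 1) * φ x)) := by
    refine tendsto_integral_compact hK (fun n => cu.mul (a n).continuous) (C2 * (C4 + 1)) ?_ ?_ ?_
    · intro n x
      by_cases hx : x ∈ K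
      · rw [abs_mul]
        refine mul_le_mul (hb2 x hx) ?_ (abs_nonneg _) hC2
        have h5 := norm_le_norm_add_norm_sub' (ψ n x) (φ x)
        simp only [Real.norm_eq_abs] at h5
        have := c n x; have := inv_nat_le_one n; have h4 := hb4 x hx
        rw [Real.norm_eq_abs] at h4
        linarith
      · rw [image_eq_zero_of_notMem_tsupport fun hh => hx (b n hh)]; simp; positivity
    · intro n x hx; rw [image_eq_zero_of_notMem_tsupport fun hh => hx (b n hh)]; simp
    · intro x
      exact tendsto_const_nhds.mul (tendsto_of_le_inv fun n => by rw [Real.dist_eq]; exact c n x)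
  have hcψ : ∀ n, HasCompactSupport (ψ n) := fun n =>
    HasCompactSupport.intro hK fun x hx => image_eq_zero_of_notMem_tsupport fun hh => hx (b n hh)
  refine tendsto_nhds_unique t1 ?_
  simp_rw [fun n => h (ψ n) (a n) (hcψ n) ((b n).trans hKΩ)]
  exact t2.const_mul lam

lemma rayleigh_of_smooth {p lam : ℝ} (hp : 1 < p) {Ω : Set E} (hΩ : IsOpen Ω)
    (h : ∀ φ : E → ℝ, ContDiff ℝ (⊤ : ℕ∞) φ → HasCompactSupport φ → tsupport φ ⊆ Ω →
      lam * ∫ x, |φ x| ^ p ≤ ∫ x, ‖gradient φ x‖ ^ p) {φ : E → ℝ}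
    (h1 : ContDiff ℝ 1 φ) (hc : HasCompactSupport φ) (hs : tsupport φ ⊆ Ω) :
    lam * ∫ x, |φ x| ^ p ≤ ∫ x, ‖gradient φ x‖ ^ p := by
  obtain ⟨K, hK, hKΩ, hφK, ψ, a, b, c, d⟩ := approx_seq h1 hc hΩ hs
  have hp0 : 0 ≤ p := by linarith
  obtain ⟨C3, hC3, hb3⟩ := exists_bound_cs h1.continuous_grad hK
  obtain ⟨C4, hC4, hb4⟩ := exists_bound_cs h1.continuous hK
  have cg : ∀ n, Continuous (gradient (ψ n)) := fun n => (contDiff_top_one (a n)).continuous_grad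
  have t1 : Tendsto (fun n => ∫ x, ‖gradient (ψ n) x‖ ^ p) atTop
      (𝓝 (∫ x, ‖gradient φ x‖ ^ p)) := by
    refine tendsto_integral_compact hK (fun n => (cg n).norm.rpow_const fun x => Or.inr hp0)
      ((C3 + 1) ^ p) ?_ ?_ ?_
    · intro n x
      rw [abs_of_nonneg (Real.rpow_nonneg (norm_nonneg _) _)]
      by_cases hx : x ∈ K
      · refine Real.rpow_le_rpow (norm_nonneg _) ?_ hp0
        have := norm_le_norm_add_norm_sub' (gradient (ψ n) x) (gradient φ x)
        have := d n x; have := inv_nat_le_one n; have := hb3 x hx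
        linarith
      · rw [gradient_eq_zero_of_notMem fun hh => hx (b n hh)]
        rw [norm_zero, Real.zero_rpow (by linarith)]; positivity
    · intro n x hx; rw [gradient_eq_zero_of_notMem fun hh => hx (b n hh)]
      rw [norm_zero, Real.zero_rpow (by linarith)]
    · intro x
      exact (tendsto_of_le_inv fun n => by
        rw [dist_eq_norm]; exact d n x).norm.rpow_const (Or.inr hp0)
  have t2 : Tendsto (fun n => ∫ x, |ψ n x| ^ p) atTop (𝓝 (∫ x, |φ x| ^ p)) := by
    refine tendsto_integral_compact hK
      (fun n => (a n).continuous.abs.rpow_const fun x => Or.inr hp0) ((C4 + 1) ^ p) ?_ ?_ ?_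
    · intro n x
      rw [abs_of_nonneg (Real.rpow_nonneg (abs_nonneg _) _)]
      by_cases hx : x ∈ K
      · refine Real.rpow_le_rpow (abs_nonneg _) ?_ hp0
        have h5 := norm_le_norm_add_norm_sub' (ψ n x) (φ x)
        simp only [Real.norm_eq_abs] at h5
        have := c n x; have := inv_nat_le_one n; have h4 := hb4 x hx
        rw [Real.norm_eq_abs] at h4
        linarith
      · rw [image_eq_zero_of_notMem_tsupport fun hh => hx (b n hh)]
        rw [abs_zero, Real.zero_rpow (by linarith)]; positivity
    · intro n x hx; rw [image_eq_zero_of_notMem_tsupport fun hh => hx (b n hh)]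
      rw [abs_zero, Real.zero_rpow (by linarith)]
    · intro x
      exact (tendsto_of_le_inv fun n => by
        rw [Real.dist_eq]; exact c n x).abs.rpow_const (Or.inr hp0)
  have hcψ : ∀ n, HasCompactSupport (ψ n) := fun n =>
    HasCompactSupport.intro hK fun x hx => image_eq_zero_of_notMem_tsupport fun hh => hx (b n hh)
  exact le_of_tendsto_of_tendsto' (t2.const_mul lam) t1
    fun n => h (ψ n) (a n) (hcψ n) ((b n).trans hKΩ)

end Moll


section Glue
variable {E : Type*} [NormedAddCommGroup E] [InnerProductSpace ℝ E] [CompleteSpace E]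

lemma glue_grad {S Ω : Set E} (hS : IsClosed S) (hSΩ : S ⊆ Ω) (hΩ : IsOpen Ω) {f : E → ℝ}
    {G : E → E} (hf : ∀ x ∈ Ω, HasGradientAt f (G x) x) (hG : ContinuousOn G Ω)
    (f0 : ∀ x, x ∉ S → f x = 0) (G0 : ∀ x, x ∉ S → G x = 0) :
    (∀ x, HasGradientAt f (G x) x) ∧ Continuous G ∧ ContDiff ℝ 1 f ∧ tsupport f ⊆ S := by
  have h1 : ∀ x, HasGradientAt f (G x) x := by
    intro x
    by_cases hx : x ∈ Ω
    · exact hf x hx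
    · have hxS : x ∉ S := fun h => hx (hSΩ h)
      rw [G0 x hxS]
      have : f =ᶠ[𝓝 x] fun _ => 0 := by
        filter_upwards [hS.isOpen_compl.mem_nhds hxS] with y hy using f0 y hy
      exact (hasGradientAt_const x (0:ℝ)).congr' this
  have h2 : Continuous G := by
    rw [continuous_iff_continuousAt]
    intro x
    by_cases hx : x ∈ Ω
    · exact hG.continuousAt (hΩ.mem_nhds hx)
    · have hxS : x ∉ S := fun h => hx (hSΩ h)
      have : G =ᶠ[𝓝 x] fun _ => 0 := by
        filter_upwards [hS.isOpen_compl.mem_nhds hxS] with y hy using G0 y hy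
      exact continuousAt_const.congr this.symm
  refine ⟨h1, h2, contDiff_one_of_grad h1 h2, closure_minimal (fun x hx => ?_) hS⟩
  by_contra h; exact hx (f0 x h)

variable [FiniteDimensional ℝ E] [MeasurableSpace E] [BorelSpace E]

lemma hasCompactSupport_of_tsupport_subset {f : E → ℝ} {K : Set E} (hK : IsCompact K)
    (h : tsupport f ⊆ K) : HasCompactSupport f :=
  hK.of_isClosed_subset (isClosed_tsupport f) h

lemma trunc {Ω : Set E} (hΩ : IsOpen Ω) (hb : Bornology.IsBounded Ω) {v : E → ℝ} {g : E → E}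
    (hv : Continuous v) (h0 : ∀ x, x ∉ Ω → v x = 0) (hg : ∀ x ∈ Ω, HasGradientAt v (g x) x)
    (hgc : ContinuousOn g Ω) {δ : ℝ} (hδ : 0 < δ) :
    ContDiff ℝ 1 (fun x => bet δ (v x)) ∧ HasCompactSupport (fun x => bet δ (v x)) ∧
      tsupport (fun x => bet δ (v x)) ⊆ Ω ∧
      ∀ x, HasGradientAt (fun x => bet δ (v x)) (bet' δ (v x) • g x) x := by
  have hS : IsClosed {x | δ ≤ v x} := isClosed_le continuous_const hv
  have hSΩ : {x | δ ≤ v x} ⊆ Ω := by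
    intro x hx; by_contra h; have : δ ≤ v x := hx; rw [h0 x h] at this; linarith
  have hK : IsCompact {x | δ ≤ v x} := Metric.isCompact_of_isClosed_isBounded hS (hb.subset hSΩ)
  obtain ⟨a, b, c, d⟩ := glue_grad (f := fun x => bet δ (v x))
    (G := fun x => bet' δ (v x) • g x) hS hSΩ hΩ
    (fun x hx => HasGradientAt.real_comp (hasDerivAt_bet hδ _) (hg x hx))
    (((continuous_bet' hδ).comp hv).continuousOn.smul hgc)
    (fun x hx => bet_of_le (le_of_not_ge hx))
    (fun x hx => by
      have hx' : v x ≤ δ := le_of_not_ge hx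
      simp only [bet', if_pos hx', zero_smul])
  exact ⟨c, hasCompactSupport_of_tsupport_subset hK d, d.trans hSΩ, a⟩

lemma rayleigh_trunc {p lam : ℝ} (hp : 1 < p) {Ω : Set E} (hΩ : IsOpen Ω)
    (hb : Bornology.IsBounded Ω)
    (h : ∀ φ : E → ℝ, ContDiff ℝ 1 φ → HasCompactSupport φ → tsupport φ ⊆ Ω →
      lam * ∫ x, |φ x| ^ p ≤ ∫ x, ‖gradient φ x‖ ^ p) {v : E → ℝ} {g : E → E}
    (hv : Continuous v) (hv0 : ∀ x, 0 ≤ v x) (h0 : ∀ x, x ∉ Ω → v x = 0)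
    (hg : ∀ x ∈ Ω, HasGradientAt v (g x) x)
    (hgc : ContinuousOn g Ω) {C : ℝ} (hC : ∀ x ∈ Ω, ‖g x‖ ≤ C) :
    lam * ∫ x, (v x) ^ p ≤ ∫ x in Ω, ‖g x‖ ^ p := by
  have hp0 : 0 ≤ p := by linarith
  have hK : IsCompact (closure Ω) := hb.isCompact_closure
  obtain ⟨C4, hC4, hb4⟩ := exists_bound_cs hv hK
  have hvC : ∀ x, v x ≤ C4 := by
    intro x
    by_cases hx : x ∈ Ω
    · exact (le_abs_self _).trans (hb4 x (subset_closure hx))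
    · rw [h0 x hx]; exact hC4
  have t2 : Tendsto (fun n : ℕ => ∫ x, |bet (1 / ((n : ℝ) + 1)) (v x)| ^ p) atTop
      (𝓝 (∫ x, (v x) ^ p)) := by
    refine tendsto_integral_compact hK (fun n => ?_) (C4 ^ p) ?_ ?_ ?_
    · have := (contDiff_bet (δ := 1 / ((n : ℝ) + 1)) (by positivity)).continuous.comp hv
      exact this.abs.rpow_const fun x => Or.inr hp0
    · intro n x
      rw [abs_of_nonneg (Real.rpow_nonneg (abs_nonneg _) _)]
      refine Real.rpow_le_rpow (abs_nonneg _) ?_ hp0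
      rw [abs_of_nonneg (bet_nonneg (by positivity) _)]
      exact (bet_le (by positivity) (hv0 x)).trans (hvC x)
    · intro n x hx
      rw [h0 x fun hh => hx (subset_closure hh), bet_of_le (by positivity), abs_zero,
        Real.zero_rpow (by linarith)]
    · intro x
      have : Tendsto (fun n : ℕ => bet (1 / ((n : ℝ) + 1)) (v x)) atTop (𝓝 (v x)) := by
        have l1 : Tendsto (fun n : ℕ => v x - 2 * (1 / ((n : ℝ) + 1))) atTop (𝓝 (v x)) := by
          have := (tendsto_const_nhds (x := v x)).sub
            (tendsto_one_div_add_atTop_nhds_zero_nat (𝕜 := ℝ).const_mul 2)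
          simpa using this
        exact tendsto_of_tendsto_of_tendsto_of_le_of_le l1 tendsto_const_nhds
          (fun n => bet_ge (by positivity) (hv0 x)) (fun n => bet_le (by positivity) (hv0 x))
      have := this.abs.rpow_const (p := p) (Or.inr hp0)
      rwa [abs_of_nonneg (hv0 x)] at this
  refine le_of_tendsto (t2.const_mul lam) (Eventually.of_forall fun n => ?_)
  obtain ⟨a, b, c, d⟩ := trunc hΩ hb hv h0 hg hgc (δ := 1 / ((n : ℝ) + 1)) (by positivity)
  refine (h _ a b c).trans ?_
  rw [← setIntegral_eq_integral_of_forall_compl_eq_zero (s := Ω)]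
  · have hIntg : IntegrableOn (fun x => ‖g x‖ ^ p) Ω := by
      refine Integrable.mono' (g := fun _ => C ^ p)
        (integrableOn_const (hs := (hb.measure_lt_top).ne)) ?_ ?_
      · exact (hgc.norm.rpow_const fun x _ => Or.inr hp0).aestronglyMeasurable hΩ.measurableSet
      · refine (ae_restrict_mem hΩ.measurableSet).mono fun x hx => ?_
        rw [Real.norm_of_nonneg (Real.rpow_nonneg (norm_nonneg _) _)]
        exact Real.rpow_le_rpow (norm_nonneg _) (hC x hx) hp0
    refine integral_mono_of_nonneg (Eventually.of_forall fun x =>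
      Real.rpow_nonneg (norm_nonneg _) _) hIntg (Eventually.of_forall fun x => ?_)
    simp only
    rw [(d x).gradient, norm_smul, Real.norm_of_nonneg (bet'_nonneg (by positivity) _)]
    refine Real.rpow_le_rpow (by have := bet'_nonneg (δ := 1 / ((n : ℝ) + 1)) (by positivity) (v x); positivity) ?_ hp0
    exact mul_le_of_le_one_left (norm_nonneg _) (bet'_le_one _)
  · intro x hx
    rw [(d x).gradient, h0 x hx, bet', if_pos (by positivity), zero_smul, norm_zero,
      Real.zero_rpow (by linarith)]

lemma energy_le {p lam : ℝ} (hp : 1 < p) (hlam : 0 ≤ lam) {Ω : Set E} (hΩ : IsOpen Ω)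
    (hb : Bornology.IsBounded Ω) {u v : E → ℝ} (hu : ContDiff ℝ 1 u) (hw : WeakSol p lam Ω u)
    (hv : Continuous v) (hv0 : ∀ x ∈ Ω, 0 < v x) (h0 : ∀ x, x ∉ Ω → v x = 0)
    (huv : ∀ x ∈ Ω, u x = v x) :
    ∫ x in Ω, ‖gradient u x‖ ^ p ≤ lam * ∫ x, (v x) ^ p := by
  have hp0 : 0 ≤ p := by linarith
  have hK : IsCompact (closure Ω) := hb.isCompact_closure
  have hvn : ∀ x, 0 ≤ v x := fun x => by
    by_cases hx : x ∈ Ω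
    · exact (hv0 x hx).le
    · rw [h0 x hx]
  have hg : ∀ x ∈ Ω, HasGradientAt v (gradient u x) x := fun x hx =>
    (hu.hasGrad x).congr' (by
      filter_upwards [hΩ.mem_nhds hx] with y hy using (huv y hy).symm)
  obtain ⟨C3, hC3, hb3⟩ := exists_bound_cs hu.continuous_grad hK
  have cG : Continuous fun x => ‖gradient u x‖ ^ p :=
    hu.continuous_grad.norm.rpow_const fun x => Or.inr hp0
  have t1 : Tendsto (fun n : ℕ => ∫ x, bet' (1 / ((n : ℝ) + 1)) (v x) * ‖gradient u x‖ ^ p) atTop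
      (𝓝 (∫ x, Ω.indicator (fun x => ‖gradient u x‖ ^ p) x)) := by
    refine tendsto_integral_compact hK (fun n => ?_) (C3 ^ p) ?_ ?_ ?_
    · exact ((continuous_bet' (by positivity)).comp hv).mul cG
    · intro n x
      have h1 := bet'_nonneg (δ := 1 / ((n : ℝ) + 1)) (by positivity) (v x)
      rw [abs_of_nonneg (by positivity)]
      by_cases hx : x ∈ Ω
      · refine (mul_le_of_le_one_left (by positivity) (bet'_le_one _)).trans ?_
        exact Real.rpow_le_rpow (norm_nonneg _) (hb3 x (subset_closure hx)) hp0
      · rw [h0 x hx, bet', if_pos (by positivity), zero_mul]; positivity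
    · intro n x hx
      rw [h0 x fun hh => hx (subset_closure hh), bet', if_pos (by positivity), zero_mul]
    · intro x
      by_cases hx : x ∈ Ω
      · rw [indicator_of_mem hx]
        have h2 : Tendsto (fun n : ℕ => bet' (1 / ((n : ℝ) + 1)) (v x)) atTop (𝓝 1) := by
          have hev : ∀ᶠ n : ℕ in atTop, 1 / ((n : ℝ) + 1) < v x :=
            tendsto_one_div_add_atTop_nhds_zero_nat.eventually_lt_const (hv0 x hx)
          have h3 : Tendsto (fun n : ℕ => 1 - ((1 / ((n : ℝ) + 1)) / v x) ^ 2) atTop (𝓝 1) := by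
            have := (tendsto_const_nhds (x := (1:ℝ))).sub
              (((tendsto_one_div_add_atTop_nhds_zero_nat (𝕜 := ℝ)).div_const (v x)).pow 2)
            simpa using this
          refine h3.congr' ?_
          filter_upwards [hev] with n hn
          rw [bet', if_neg (not_le.mpr hn)]
        simpa using h2.mul_const (‖gradient u x‖ ^ p)
      · rw [indicator_of_notMem hx, h0 x hx]
        refine tendsto_const_nhds.congr fun n => ?_
        rw [bet', if_pos (by positivity), zero_mul]
  rw [integral_indicator hΩ.measurableSet] at t1
  refine le_of_tendsto t1 (Eventually.of_forall fun n => ?_)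
  obtain ⟨a, b, c, d⟩ := trunc hΩ hb hv h0 hg hu.continuous_grad.continuousOn
    (δ := 1 / ((n : ℝ) + 1)) (by positivity)
  have e := hw _ a b c
  have e1 : ∀ x, ⟪Fp p (gradient u x), gradient (fun x => bet (1 / ((n : ℝ) + 1)) (v x)) x⟫ =
      bet' (1 / ((n : ℝ) + 1)) (v x) * ‖gradient u x‖ ^ p := by
    intro x
    rw [(d x).gradient, real_inner_smul_right, inner_Fp_self hp]
  simp_rw [e1] at e
  rw [e]
  refine mul_le_mul_of_nonneg_left ?_ hlam
  have hvp : Continuous fun x => (v x) ^ p := hv.rpow_const fun x => Or.inr hp0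
  refine integral_mono_of_nonneg (Eventually.of_forall fun x => ?_) ?_
    (Eventually.of_forall fun x => ?_)
  · simp only [Pi.zero_apply]
    by_cases hx : x ∈ Ω
    · rw [huv x hx]
      exact mul_nonneg (Real.rpow_nonneg (hvn x) _) (bet_nonneg (by positivity) _)
    · rw [h0 x hx, bet_of_le (by positivity), mul_zero]
  · refine hvp.integrable_of_hasCompactSupport (HasCompactSupport.intro hK fun x hx => ?_)
    rw [h0 x fun hh => hx (subset_closure hh), Real.zero_rpow (by linarith)]
  · simp only
    by_cases hx : x ∈ Ω
    · rw [huv x hx, ← rpow_pm1_mul hp (hvn x)]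
      exact mul_le_mul_of_nonneg_left (bet_le (by positivity) (hvn x)) (Real.rpow_nonneg (hvn x) _)
    · rw [h0 x hx, bet_of_le (by positivity), mul_zero]; exact Real.rpow_nonneg le_rfl _

end Glue


section Picone
variable {E : Type*} [NormedAddCommGroup E] [InnerProductSpace ℝ E]

lemma picone_alg {p : ℝ} (hp : 1 < p) {U V : ℝ} (hU : 0 < U) (hV : 0 < V) (ξ ζ : E)
    {B B' δ ε : ℝ} (hε : 0 < ε) (hεU : ε ≤ U) (hB' : 0 ≤ B')
    (hd : 0 ≤ (V ^ p - U ^ p) * B' - B) (hd2 : (V ^ p - U ^ p) * B' - B ≤ 2 * δ)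
    (hUV : U ^ p ≤ V ^ p) :
    B' * p * U ^ p * ⟪Fp p (U⁻¹ • ξ) - Fp p (V⁻¹ • ζ), U⁻¹ • ξ - V⁻¹ • ζ⟫
      ≤ ⟪Fp p ζ, (B' * V ^ (1 - p)) • ((p * V ^ (p - 1)) • ζ - (p * U ^ (p - 1)) • ξ) +
          (B * ((1 - p) * V ^ (-p))) • ζ⟫
        - ⟪Fp p ξ, (B' * U ^ (1 - p)) • ((p * V ^ (p - 1)) • ζ - (p * U ^ (p - 1)) • ξ) +
          (B * ((1 - p) * U ^ (-p))) • ξ⟫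
        + (p - 1) * (2 * δ) * (‖ξ‖ ^ p / ε ^ p) := by
  set a := U⁻¹ • ξ with ha
  set b := V⁻¹ • ζ with hb
  have hξ : ξ = U • a := by rw [ha, smul_smul, mul_inv_cancel₀ hU.ne', one_smul]
  have hζ : ζ = V • b := by rw [hb, smul_smul, mul_inv_cancel₀ hV.ne', one_smul]
  have k1 : ∀ {W : ℝ}, 0 < W → W ^ (p - 1) * W ^ (1 - p) = 1 := fun h => by
    rw [← Real.rpow_add h]; simp
  have k2 : ∀ {W : ℝ}, 0 < W → W ^ (p - 1) * W = W ^ p := fun h => rpow_pm1_mul hp h.le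
  have k3 : ∀ {W : ℝ}, 0 < W → W ^ (-p) * W ^ p = 1 := fun h => by
    rw [← Real.rpow_add h]; simp
  have e1 : ⟪Fp p ξ, (B' * U ^ (1 - p)) • ((p * V ^ (p - 1)) • ζ - (p * U ^ (p - 1)) • ξ) +
      (B * ((1 - p) * U ^ (-p))) • ξ⟫ =
      B' * p * (V ^ p * ⟪Fp p a, b⟫ - U ^ p * ‖a‖ ^ p) + (1 - p) * B * ‖a‖ ^ p := by
    rw [hξ, Fp_smul hp hU.le, hζ]
    simp only [real_inner_smul_left, inner_add_right, real_inner_smul_right, inner_sub_right,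
      inner_Fp_self hp]
    have := k1 hU; have := k2 hU; have := k2 hV; have := k3 hU
    calc _ = (U ^ (p - 1) * U ^ (1 - p)) * B' * p * ((V ^ (p - 1) * V) * ⟪Fp p a, b⟫ -
        (U ^ (p - 1) * U) * ‖a‖ ^ p) + (1 - p) * B * ‖a‖ ^ p * (U ^ (-p) * (U ^ (p - 1) * U)) := by
          ring
      _ = _ := by rw [k1 hU, k2 hU, k2 hV, k3 hU]; ring
  have e2 : ⟪Fp p ζ, (B' * V ^ (1 - p)) • ((p * V ^ (p - 1)) • ζ - (p * U ^ (p - 1)) • ξ) +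
      (B * ((1 - p) * V ^ (-p))) • ζ⟫ =
      B' * p * (V ^ p * ‖b‖ ^ p - U ^ p * ⟪Fp p b, a⟫) + (1 - p) * B * ‖b‖ ^ p := by
    rw [hξ, hζ, Fp_smul hp hV.le]
    simp only [real_inner_smul_left, inner_add_right, real_inner_smul_right, inner_sub_right,
      inner_Fp_self hp]
    calc _ = (V ^ (p - 1) * V ^ (1 - p)) * B' * p * ((V ^ (p - 1) * V) * ‖b‖ ^ p -
        (U ^ (p - 1) * U) * ⟪Fp p b, a⟫) + (1 - p) * B * ‖b‖ ^ p * (V ^ (-p) * (V ^ (p - 1) * V)) := by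
          ring
      _ = _ := by rw [k1 hV, k2 hU, k2 hV, k3 hV]; ring
  rw [e1, e2]
  have h1 := young_Fp hp a b
  have h2 := young_Fp hp b a
  have h3 := young_sum hp a b
  have hna : ‖a‖ ^ p ≤ ‖ξ‖ ^ p / ε ^ p := by
    rw [ha, norm_smul, norm_inv, Real.norm_of_nonneg hU.le, inv_mul_eq_div,
      Real.div_rpow (norm_nonneg _) hU.le]
    gcongr
  set X := ‖b‖ ^ p + (p - 1) * ‖a‖ ^ p - p * ⟪Fp p a, b⟫ with hX
  set Y := ‖a‖ ^ p + (p - 1) * ‖b‖ ^ p - p * ⟪Fp p b, a⟫ with hY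
  set D := (V ^ p - U ^ p) * B' - B with hD
  have hnb : 0 ≤ ‖b‖ ^ p := by positivity
  have hna0 : 0 ≤ ‖a‖ ^ p := by positivity
  have key : B' * p * (V ^ p * ‖b‖ ^ p - U ^ p * ⟪Fp p b, a⟫) + (1 - p) * B * ‖b‖ ^ p -
      (B' * p * (V ^ p * ⟪Fp p a, b⟫ - U ^ p * ‖a‖ ^ p) + (1 - p) * B * ‖a‖ ^ p) =
      B' * (U ^ p * Y + V ^ p * X) - (p - 1) * D * (‖a‖ ^ p - ‖b‖ ^ p) := by
    rw [hX, hY, hD]; ring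
  have f1 : B' * p * U ^ p * ⟪Fp p a - Fp p b, a - b⟫ = B' * U ^ p * (X + Y) := by
    rw [h3]; ring
  rw [f1]
  have f2 : B' * (U ^ p * X) ≤ B' * (V ^ p * X) := by gcongr
  have f3 : (p - 1) * D * (‖a‖ ^ p - ‖b‖ ^ p) ≤ (p - 1) * (2 * δ) * (‖ξ‖ ^ p / ε ^ p) := by
    have hp1 : 0 ≤ p - 1 := by linarith
    calc (p - 1) * D * (‖a‖ ^ p - ‖b‖ ^ p) ≤ (p - 1) * D * ‖a‖ ^ p := by
          have := mul_nonneg hp1 hd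
          nlinarith [mul_nonneg this hnb]
      _ ≤ (p - 1) * (2 * δ) * (‖ξ‖ ^ p / ε ^ p) := by
          apply mul_le_mul (mul_le_mul_of_nonneg_left hd2 hp1) hna hna0
          have := hd.trans hd2
          positivity
  nlinarith
end Picone

section CompIsom
variable {E : Type*} [NormedAddCommGroup E] [InnerProductSpace ℝ E] [CompleteSpace E]

lemma Fp_isom {p : ℝ} (R : E ≃ₗᵢ[ℝ] E) (ξ : E) : Fp p (R ξ) = R (Fp p ξ) := by
  rw [Fp, Fp, R.norm_map, map_smul]

lemma gradient_comp_isom {u : E → ℝ} (hu : ContDiff ℝ 1 u) (R : E ≃ₗᵢ[ℝ] E) (x : E) :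
    gradient (fun y => u (R y)) x = R.symm (gradient u (R x)) :=
  (HasGradientAt.comp_isom R (hu.hasGrad (R x))).gradient

lemma contDiff_comp_isom {n : ℕ} {u : E → ℝ} (hu : ContDiff ℝ n u) (R : E ≃ₗᵢ[ℝ] E) :
    ContDiff ℝ n (fun y => u (R y)) := hu.comp R.toContinuousLinearEquiv.contDiff

variable [FiniteDimensional ℝ E] [MeasurableSpace E] [BorelSpace E]

lemma integral_comp_isom (R : E ≃ₗᵢ[ℝ] E) (f : E → ℝ) : ∫ x, f (R x) = ∫ x, f x :=
  (R.measurePreserving).integral_comp R.toHomeomorph.measurableEmbedding f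

lemma tsupport_comp_isom (φ : E → ℝ) (R : E ≃ₗᵢ[ℝ] E) :
    tsupport (fun y => φ (R y)) = R ⁻¹' tsupport φ :=
  tsupport_comp_eq_preimage φ R.toHomeomorph

lemma weakSol_comp {p lam : ℝ} {Ω : Set E} {u : E → ℝ} (hu : ContDiff ℝ 1 u)
    (hw : WeakSol p lam Ω u) (R : E ≃ₗᵢ[ℝ] E) :
    WeakSol p lam (R ⁻¹' Ω) (fun x => u (R x)) := by
  intro φ h1 hc hs
  have h1' := contDiff_comp_isom (n := 1) h1 R.symm
  have hc' : HasCompactSupport (fun y => φ (R.symm y)) := hc.comp_homeomorph R.symm.toHomeomorph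
  have hs' : tsupport (fun y => φ (R.symm y)) ⊆ Ω := by
    rw [tsupport_comp_isom]
    intro y hy
    have := hs hy
    simpa using this
  have := hw _ h1' hc' hs'
  rw [← integral_comp_isom R, ← integral_comp_isom R (fun x => u x ^ (p - 1) * _)] at this
  simp only [LinearIsometryEquiv.symm_apply_apply] at this
  rw [← this]
  congr 1
  ext x
  rw [gradient_comp_isom hu, gradient_comp_isom h1, Fp_isom, LinearIsometryEquiv.symm_symm,
    LinearIsometryEquiv.symm_apply_apply, ← R.inner_map_map]
  simp

end CompIsom


section Compare
variable {E : Type*} [NormedAddCommGroup E] [InnerProductSpace ℝ E] [CompleteSpace E]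
  [FiniteDimensional ℝ E] [MeasurableSpace E] [BorelSpace E]

/-- one step of the comparison argument: for fixed `ε, δ`. -/
lemma compare_step {p lam : ℝ} (hp : 1 < p) {Ω : Set E} (hΩ : IsOpen Ω)
    (hb : Bornology.IsBounded Ω) {u v : E → ℝ} (hu : ContDiff ℝ 1 u) (hw : WeakSol p lam Ω u)
    (hv : Continuous v) (hvn : ∀ x, 0 ≤ v x) (h0 : ∀ x, x ∉ Ω → v x = 0)
    (huv : ∀ x ∈ Ω, u x = v x) (σ : E ≃ₗᵢ[ℝ] E) {ℓ : E → ℝ} (hℓ : Continuous ℓ)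
    (hfix : ∀ x, ℓ x = 0 → σ x = x) (hpol : ∀ x, ℓ x < 0 → σ x ∈ Ω → x ∈ Ω)
    {D : Set E} (hD : D = {x | ℓ x < 0 ∧ v x < v (σ x)})
    {ε δ : ℝ} (hε : 0 < ε) (hδ : 0 < δ) {C : ℝ} (hC : ∀ x ∈ Ω, ‖gradient u x‖ ≤ C)
    {B : E → ℝ} (hB : B = D.indicator (fun x => bet δ ((v (σ x) + ε) ^ p - (v x + ε) ^ p)))
    {A : Set E} (hA : MeasurableSet A) (hAD : A ⊆ D) {c : ℝ}
    (hAc : ∀ x ∈ A, c ≤ bet' δ ((v (σ x) + ε) ^ p - (v x + ε) ^ p) * p * (v x + ε) ^ p *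
      ⟪Fp p ((v x + ε)⁻¹ • gradient u x) - Fp p ((v (σ x) + ε)⁻¹ • gradient (fun y => u (σ y)) x),
        (v x + ε)⁻¹ • gradient u x - (v (σ x) + ε)⁻¹ • gradient (fun y => u (σ y)) x⟫) :
    (Continuous fun x => u (σ x) ^ (p - 1) * (B x * (v (σ x) + ε) ^ (1 - p)) -
      u x ^ (p - 1) * (B x * (v x + ε) ^ (1 - p))) ∧
    volume.real A * c ≤ lam * (∫ x, (u (σ x) ^ (p - 1) * (B x * (v (σ x) + ε) ^ (1 - p)) -
      u x ^ (p - 1) * (B x * (v x + ε) ^ (1 - p)))) +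
      volume.real (closure Ω) * ((p - 1) * (2 * δ) * (C ^ p / ε ^ p)) := by
  have hσ : Continuous σ := σ.continuous
  have hUp : ∀ x, 0 < v x + ε := fun x => by have := hvn x; linarith
  have hVp : ∀ x, 0 < v (σ x) + ε := fun x => by have := hvn (σ x); linarith
  have hDo : IsOpen D := by
    rw [hD]; exact (isOpen_lt hℓ continuous_const).inter (isOpen_lt hv (hv.comp hσ))
  have hDσ : ∀ x ∈ D, σ x ∈ Ω := by
    intro x hx; rw [hD] at hx
    by_contra h
    have := hx.2; rw [h0 _ h] at this; linarith [hvn x]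
  have hDΩ : ∀ x ∈ D, x ∈ Ω := fun x hx => hpol x (by rw [hD] at hx; exact hx.1) (hDσ x hx)
  set ut : E → ℝ := fun y => u (σ y) with hut
  have hut1 : ContDiff ℝ 1 ut := contDiff_comp_isom (n := 1) hu σ
  have hwt : WeakSol p lam (σ ⁻¹' Ω) ut := weakSol_comp hu hw σ
  set t : E → ℝ := fun x => (v (σ x) + ε) ^ p - (v x + ε) ^ p with ht
  have hp0 : 0 ≤ p := by linarith
  have htc : Continuous t :=
    (((hv.comp hσ).add continuous_const).rpow_const fun _ => Or.inr hp0).sub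
      ((hv.add continuous_const).rpow_const fun _ => Or.inr hp0)
  set S : Set E := {x | ℓ x ≤ 0 ∧ δ ≤ t x} with hS
  have hSc : IsClosed S := (isClosed_le hℓ continuous_const).inter (isClosed_le continuous_const htc)
  have hSD : S ⊆ D := by
    rintro x ⟨h1, h2⟩
    have h3 : v x < v (σ x) := by
      by_contra h
      push Not at h
      have : (v (σ x) + ε) ^ p ≤ (v x + ε) ^ p := Real.rpow_le_rpow (hVp x).le (by linarith) hp0
      simp only [ht] at h2; linarith
    rw [hD]
    refine ⟨lt_of_le_of_ne h1 fun h => ?_, h3⟩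
    rw [hfix x h] at h3; exact lt_irrefl _ h3
  have hSK : IsCompact S := Metric.isCompact_of_isClosed_isBounded hSc
    (hb.subset fun x hx => hDΩ x (hSD hx))
  have hgv : ∀ x ∈ D, HasGradientAt (fun x => v x + ε) (gradient u x) x := fun x hx => by
    refine ((hu.hasGrad x).add_const' ε).congr' ?_
    filter_upwards [hΩ.mem_nhds (hDΩ x hx)] with y hy
    rw [huv y hy]
  have hgt : ∀ x ∈ D, HasGradientAt (fun x => v (σ x) + ε) (gradient ut x) x := fun x hx => by
    refine ((hut1.hasGrad x).add_const' ε).congr' ?_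
    filter_upwards [(hΩ.preimage hσ).mem_nhds (hDσ x hx)] with y hy
    simp only [hut]; rw [huv _ hy]
  -- powers
  have hpowU : ∀ (q : ℝ), ∀ x ∈ D, HasGradientAt (fun x => (v x + ε) ^ q)
      ((q * (v x + ε) ^ (q - 1)) • gradient u x) x := fun q x hx =>
    HasGradientAt.real_comp (h := fun t => t ^ q)
      (Real.hasDerivAt_rpow_const (Or.inl (hUp x).ne')) (hgv x hx)
  have hpowV : ∀ (q : ℝ), ∀ x ∈ D, HasGradientAt (fun x => (v (σ x) + ε) ^ q)
      ((q * (v (σ x) + ε) ^ (q - 1)) • gradient ut x) x := fun q x hx =>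
    HasGradientAt.real_comp (h := fun t => t ^ q)
      (Real.hasDerivAt_rpow_const (Or.inl (hVp x).ne')) (hgt x hx)
  set T : E → E := fun x => (p * (v (σ x) + ε) ^ (p - 1)) • gradient ut x -
    (p * (v x + ε) ^ (p - 1)) • gradient u x with hT
  have hgT : ∀ x ∈ D, HasGradientAt t (T x) x := fun x hx => (hpowV p x hx).sub' (hpowU p x hx)
  have cU : ∀ q : ℝ, Continuous fun x => (v x + ε) ^ q := fun q =>
    (hv.add continuous_const).rpow_const fun x => Or.inl (hUp x).ne'
  have cV : ∀ q : ℝ, Continuous fun x => (v (σ x) + ε) ^ q := fun q =>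
    ((hv.comp hσ).add continuous_const).rpow_const fun x => Or.inl (hVp x).ne'
  have cT : Continuous T := by
    exact ((continuous_const.mul (cV _)).smul hut1.continuous_grad).sub
      ((continuous_const.mul (cU _)).smul hu.continuous_grad)
  have gB : ∀ x ∈ D, HasGradientAt B (bet' δ (t x) • T x) x := fun x hx => by
    refine (HasGradientAt.real_comp (hasDerivAt_bet hδ _) (hgT x hx)).congr' ?_
    filter_upwards [hDo.mem_nhds hx] with y hy
    rw [hB, indicator_of_mem hy]
  have B0 : ∀ x, x ∉ S → B x = 0 := by
    intro x hx
    rw [hB]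
    by_cases hxD : x ∈ D
    · rw [indicator_of_mem hxD]
      refine bet_of_le (le_of_not_ge fun h => hx ⟨?_, h⟩)
      rw [hD] at hxD; exact hxD.1.le
    · rw [indicator_of_notMem hxD]
  set B' : E → ℝ := D.indicator fun x => bet' δ (t x) with hB'
  have B'0 : ∀ x, x ∉ S → B' x = 0 := by
    intro x hx
    rw [hB']
    by_cases hxD : x ∈ D
    · rw [indicator_of_mem hxD]
      have : t x ≤ δ := (le_of_not_ge fun h => hx ⟨by rw [hD] at hxD; exact hxD.1.le, h⟩)
      rw [bet', if_pos this]
    · rw [indicator_of_notMem hxD]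
  have cB' : ContinuousOn B' D := by
    refine ((continuous_bet' hδ).comp htc).continuousOn.congr fun x hx => ?_
    rw [hB', indicator_of_mem hx]; rfl
  have cB : ContinuousOn B D := by
    refine ((contDiff_bet hδ).continuous.comp htc).continuousOn.congr fun x hx => ?_
    rw [hB, indicator_of_mem hx]; rfl
  set G₁ : E → E := fun x => (B' x * (v x + ε) ^ (1 - p)) • T x +
    (B x * ((1 - p) * (v x + ε) ^ (-p))) • gradient u x with hG₁
  set G₂ : E → E := fun x => (B' x * (v (σ x) + ε) ^ (1 - p)) • T x +
    (B x * ((1 - p) * (v (σ x) + ε) ^ (-p))) • gradient ut x with hG₂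
  obtain ⟨a1, a2, a3, a4⟩ := glue_grad (f := fun x => B x * (v x + ε) ^ (1 - p)) (G := G₁)
    hSc hSD hDo
    (fun x hx => by
      have := (gB x hx).mul' (hpowU (1 - p) x hx)
      convert this using 1
      simp only [hG₁, hB', indicator_of_mem hx]
      rw [show (1 : ℝ) - p - 1 = -p by ring, smul_smul, smul_smul, add_comm]
      ring_nf)
    (((cB'.mul (cU _).continuousOn).smul cT.continuousOn).add
      ((cB.mul (continuous_const.mul (cU _)).continuousOn).smul hu.continuous_grad.continuousOn))
    (fun x hx => by simp [B0 x hx])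
    (fun x hx => by simp [hG₁, B0 x hx, B'0 x hx])
  obtain ⟨b1, b2, b3, b4⟩ := glue_grad (f := fun x => B x * (v (σ x) + ε) ^ (1 - p)) (G := G₂)
    hSc hSD hDo
    (fun x hx => by
      have := (gB x hx).mul' (hpowV (1 - p) x hx)
      convert this using 1
      simp only [hG₂, hB', indicator_of_mem hx]
      rw [show (1 : ℝ) - p - 1 = -p by ring, smul_smul, smul_smul, add_comm]
      ring_nf)
    (((cB'.mul (cV _).continuousOn).smul cT.continuousOn).add
      ((cB.mul (continuous_const.mul (cV _)).continuousOn).smul hut1.continuous_grad.continuousOn))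
    (fun x hx => by simp [B0 x hx])
    (fun x hx => by simp [hG₂, B0 x hx, B'0 x hx])
  have w1 := hw _ a3 (hasCompactSupport_of_tsupport_subset hSK a4)
    (a4.trans fun x hx => hDΩ x (hSD hx))
  have w2 := hwt _ b3 (hasCompactSupport_of_tsupport_subset hSK b4)
    (b4.trans fun x hx => hDσ x (hSD hx))
  have gg1 : gradient (fun x => B x * (v x + ε) ^ (1 - p)) = G₁ := funext fun x => (a1 x).gradient
  have gg2 : gradient (fun x => B x * (v (σ x) + ε) ^ (1 - p)) = G₂ :=
    funext fun x => (b1 x).gradient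
  rw [gg1] at w1
  rw [gg2] at w2
  have hp1 : 0 ≤ p - 1 := by linarith
  have c1 : Continuous fun x => u x ^ (p - 1) * (B x * (v x + ε) ^ (1 - p)) :=
    (hu.continuous.rpow_const fun _ => Or.inr hp1).mul a3.continuous
  have c2 : Continuous fun x => ut x ^ (p - 1) * (B x * (v (σ x) + ε) ^ (1 - p)) :=
    (hut1.continuous.rpow_const fun _ => Or.inr hp1).mul b3.continuous
  have G10 : ∀ x, x ∉ S → G₁ x = 0 := fun x hx => by simp [hG₁, B0 x hx, B'0 x hx]
  have G20 : ∀ x, x ∉ S → G₂ x = 0 := fun x hx => by simp [hG₂, B0 x hx, B'0 x hx]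
  have hcs : ∀ f : E → ℝ, Continuous f → (∀ x, x ∉ S → f x = 0) → Integrable f := fun f hf h =>
    hf.integrable_of_hasCompactSupport (HasCompactSupport.intro hSK fun x hx => h x hx)
  have i1 := hcs _ c1 (fun x hx => by simp [B0 x hx])
  have i2 := hcs _ c2 (fun x hx => by simp [B0 x hx])
  have i3 : Integrable fun x => ⟪Fp p (gradient u x), G₁ x⟫ :=
    hcs _ (((continuous_Fp hp).comp hu.continuous_grad).inner a2) (fun x hx => by simp [G10 x hx])
  have i4 : Integrable fun x => ⟪Fp p (gradient ut x), G₂ x⟫ :=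
    hcs _ (((continuous_Fp hp).comp hut1.continuous_grad).inner b2)
      (fun x hx => by simp [G20 x hx])
  refine ⟨c2.sub c1, ?_⟩
  rw [integral_sub i2 i1, mul_sub, ← w1, ← w2, ← integral_sub i4 i3]
  set e : ℝ := (p - 1) * (2 * δ) * (C ^ p / ε ^ p) with he
  have hK : IsCompact (closure Ω) := hb.isCompact_closure
  have i5 : Integrable ((closure Ω).indicator fun _ : E => e) := by
    rw [integrable_indicator_iff hK.measurableSet]
    exact integrableOn_const (hs := hK.measure_lt_top.ne)
  have e5 : ∫ x, (closure Ω).indicator (fun _ : E => e) x = volume.real (closure Ω) * e := by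
    rw [integral_indicator hK.measurableSet, setIntegral_const, smul_eq_mul]
  have e6 : ∫ x, A.indicator (fun _ : E => c) x = volume.real A * c := by
    rw [integral_indicator hA, setIntegral_const, smul_eq_mul]
  have hAfin : volume A < ⊤ :=
    (measure_mono (hAD.trans fun x hx => subset_closure (hDΩ x hx))).trans_lt hK.measure_lt_top
  have i43 : Integrable fun x => ⟪Fp p (gradient ut x), G₂ x⟫ - ⟪Fp p (gradient u x), G₁ x⟫ :=
    i4.sub i3
  rw [← e5, ← e6, ← integral_add i43 i5]
  refine integral_mono ?_ (i43.add i5) fun x => ?_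
  · rw [integrable_indicator_iff hA]; exact integrableOn_const (hs := hAfin.ne)
  have hC0 : ∀ x ∈ Ω, 0 ≤ C := fun x hx => (norm_nonneg _).trans (hC x hx)
  by_cases hxD : x ∈ D
  · have hxΩ := hDΩ x hxD
    have hxD' := hxD
    rw [hD] at hxD'
    have key := picone_alg hp (hUp x) (hVp x) (gradient u x) (gradient ut x)
      (B := B x) (B' := B' x) (δ := δ) hε (by linarith [hvn x])
      (by rw [hB', indicator_of_mem hxD]; exact bet'_nonneg hδ _)
      (by rw [hB', hB, indicator_of_mem hxD, indicator_of_mem hxD]; exact (bet_defect hδ _).1)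
      (by rw [hB', hB, indicator_of_mem hxD, indicator_of_mem hxD]; exact (bet_defect hδ _).2)
      (Real.rpow_le_rpow (hUp x).le (by linarith [hxD'.2]) hp0)
    have hx2 : (p - 1) * (2 * δ) * (‖gradient u x‖ ^ p / ε ^ p) ≤ e := by
      rw [he]
      have := hC x hxΩ
      gcongr
    simp only [indicator_of_mem (subset_closure hxΩ)]
    have hL : A.indicator (fun _ => c) x ≤ B' x * p * (v x + ε) ^ p *
      ⟪Fp p ((v x + ε)⁻¹ • gradient u x) - Fp p ((v (σ x) + ε)⁻¹ • gradient ut x),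
        (v x + ε)⁻¹ • gradient u x - (v (σ x) + ε)⁻¹ • gradient ut x⟫ := by
      rw [hB', indicator_of_mem hxD]
      by_cases hxA : x ∈ A
      · rw [indicator_of_mem hxA]; exact hAc x hxA
      · rw [indicator_of_notMem hxA]
        have h1 := bet'_nonneg hδ (t x)
        have h2 := (hUp x).le
        exact mul_nonneg (by positivity) (Fp_mono hp _ _)
    exact (hL.trans key).trans (by simp only [hG₁, hG₂, hT]; linarith)
  · have hxS : x ∉ S := fun h => hxD (hSD h)
    simp only [G10 x hxS, G20 x hxS, inner_zero_right, indicator_of_notMem fun h => hxD (hAD h)]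
    have : 0 ≤ (closure Ω).indicator (fun _ : E => e) x := by
      refine indicator_nonneg (fun y hy => ?_) x
      obtain ⟨z, hz⟩ : Ω.Nonempty := closure_nonempty_iff.1 ⟨y, hy⟩
      have := hC0 z hz
      rw [he]; positivity
    linarith
end Compare


section Compare2
variable {E : Type*} [NormedAddCommGroup E] [InnerProductSpace ℝ E] [CompleteSpace E]
  [FiniteDimensional ℝ E] [MeasurableSpace E] [BorelSpace E]

lemma compare_core {p lam : ℝ} (hp : 1 < p) {Ω : Set E} (hΩ : IsOpen Ω)
    (hb : Bornology.IsBounded Ω) {u v : E → ℝ} (hu : ContDiff ℝ 1 u) (hw : WeakSol p lam Ω u)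
    (hv : Continuous v) (hv0 : ∀ x ∈ Ω, 0 < v x) (h0 : ∀ x, x ∉ Ω → v x = 0)
    (huv : ∀ x ∈ Ω, u x = v x) (σ : E ≃ₗᵢ[ℝ] E) {ℓ : E → ℝ} (hℓ : Continuous ℓ)
    (hfix : ∀ x, ℓ x = 0 → σ x = x) (hpol : ∀ x, ℓ x < 0 → σ x ∈ Ω → x ∈ Ω)
    {D : Set E} (hD : D = {x | ℓ x < 0 ∧ v x < v (σ x)}) {x₀ : E} (hx₀ : x₀ ∈ D) :
    (v x₀)⁻¹ • gradient u x₀ = (v (σ x₀))⁻¹ • gradient (fun y => u (σ y)) x₀ := by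
  have hσ : Continuous σ := σ.continuous
  have hvn : ∀ x, 0 ≤ v x := fun x => by
    by_cases hx : x ∈ Ω
    · exact (hv0 x hx).le
    · rw [h0 x hx]
  have hDo : IsOpen D := by
    rw [hD]; exact (isOpen_lt hℓ continuous_const).inter (isOpen_lt hv (hv.comp hσ))
  have hDσ : ∀ x ∈ D, σ x ∈ Ω := by
    intro x hx; rw [hD] at hx
    by_contra h
    have := hx.2; rw [h0 _ h] at this; linarith [hvn x]
  have hDΩ : ∀ x ∈ D, x ∈ Ω := fun x hx => hpol x (by rw [hD] at hx; exact hx.1) (hDσ x hx)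
  have hDv : ∀ x ∈ D, v x < v (σ x) := fun x hx => by rw [hD] at hx; exact hx.2
  have hp0 : 0 ≤ p := by linarith
  have hp1 : 0 ≤ p - 1 := by linarith
  by_contra hne
  set ut : E → ℝ := fun y => u (σ y) with hut
  have hut1 : ContDiff ℝ 1 ut := contDiff_comp_isom (n := 1) hu σ
  have hK : IsCompact (closure Ω) := hb.isCompact_closure
  obtain ⟨C, hC0, hC⟩ := exists_bound_cs hu.continuous_grad hK
  obtain ⟨M, hM0, hM⟩ := exists_bound_cs hv hK
  have hvM : ∀ x, v x ≤ M := by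
    intro x
    by_cases hx : x ∈ Ω
    · exact (le_abs_self _).trans (hM x (subset_closure hx))
    · rw [h0 x hx]; exact hM0
  -- the lower bound near x₀
  set a : E × ℝ → E := fun z => (v z.1 + z.2)⁻¹ • gradient u z.1 with ha
  set b : E × ℝ → E := fun z => (v (σ z.1) + z.2)⁻¹ • gradient ut z.1 with hbb
  set Λ : E × ℝ → ℝ := fun z => p * (v z.1 + z.2) ^ p * ⟪Fp p (a z) - Fp p (b z), a z - b z⟫ with hΛ
  have hU0 : 0 < v x₀ := hv0 _ (hDΩ _ hx₀)
  have hV0 : 0 < v (σ x₀) := hv0 _ (hDσ _ hx₀)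
  have ca : ContinuousAt a (x₀, 0) := by
    refine ContinuousAt.smul (ContinuousAt.inv₀ ?_ (by simpa using hU0.ne')) ?_
    · exact ((hv.comp continuous_fst).add continuous_snd).continuousAt
    · exact (hu.continuous_grad.comp continuous_fst).continuousAt
  have cb : ContinuousAt b (x₀, 0) := by
    refine ContinuousAt.smul (ContinuousAt.inv₀ ?_ (by simpa using hV0.ne')) ?_
    · exact ((hv.comp (hσ.comp continuous_fst)).add continuous_snd).continuousAt
    · exact (hut1.continuous_grad.comp continuous_fst).continuousAt
  have cΛ : ContinuousAt Λ (x₀, 0) := by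
    refine ContinuousAt.mul ?_ (ContinuousAt.inner (𝕜 := ℝ) ?_ (ca.sub cb))
    · refine (continuous_const.mul ?_).continuousAt
      exact ((hv.comp continuous_fst).add continuous_snd).rpow_const fun _ => Or.inr hp0
    · exact ((continuous_Fp hp).continuousAt.comp ca).sub ((continuous_Fp hp).continuousAt.comp cb)
  have hΛ0 : 0 < Λ (x₀, 0) := by
    simp only [hΛ]
    refine mul_pos (by simp only [add_zero]; positivity) (Fp_mono_strict hp ?_)
    simpa only [ha, hbb, add_zero] using hne
  set c := Λ (x₀, 0) / 2 with hc
  have hc0 : 0 < c := by positivity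
  have ev1 : ∀ᶠ z in 𝓝 (x₀, (0:ℝ)), c < Λ z := cΛ.eventually_const_lt (by rw [hc]; linarith)
  set g : E × ℝ → ℝ := fun z => (v (σ z.1) + z.2) ^ p - (v z.1 + z.2) ^ p - 2 * z.2 ^ (p + 1)
    with hg
  have cg : Continuous g := by
    refine ((Continuous.rpow_const ?_ fun _ => Or.inr hp0).sub
      (Continuous.rpow_const ?_ fun _ => Or.inr hp0)).sub
      (continuous_const.mul (continuous_snd.rpow_const fun _ => Or.inr (by linarith)))
    · exact (hv.comp (hσ.comp continuous_fst)).add continuous_snd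
    · exact (hv.comp continuous_fst).add continuous_snd
  have ev2 : ∀ᶠ z in 𝓝 (x₀, (0:ℝ)), 0 < g z := by
    refine cg.continuousAt.eventually_const_lt ?_
    simp only [hg, add_zero]
    rw [Real.zero_rpow (by linarith)]
    have := Real.rpow_lt_rpow hU0.le (hDv _ hx₀) (by linarith : 0 < p)
    linarith
  have ev3 : ∀ᶠ z : E × ℝ in 𝓝 (x₀, (0:ℝ)), z.1 ∈ D :=
    continuous_fst.continuousAt.eventually (hDo.mem_nhds hx₀)
  obtain ⟨r, hr, hball⟩ := Metric.eventually_nhds_iff_ball.1 (ev1.and (ev2.and ev3))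
  set A := ball x₀ r with hA
  have hAz : ∀ x ∈ A, ∀ ε : ℝ, 0 < ε → ε < r → c < Λ (x, ε) ∧ 0 < g (x, ε) ∧ x ∈ D := by
    intro x hx ε h1 h2
    refine hball (x, ε) ?_
    rw [mem_ball, Prod.dist_eq]
    refine max_lt hx ?_
    rw [Real.dist_eq, sub_zero, abs_of_pos h1]; exact h2
  have hAD : A ⊆ D := fun x hx => (hAz x hx (r/2) (by linarith) (by linarith)).2.2
  -- the sequence
  set εn : ℕ → ℝ := fun n => 1 / ((n : ℝ) + 1) with hεn
  have hε0 : ∀ n, 0 < εn n := fun n => by simp only [hεn]; positivity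
  have hε1 : ∀ n, εn n ≤ 1 := fun n => inv_nat_le_one n
  have hεt : Tendsto εn atTop (𝓝 0) := tendsto_one_div_add_atTop_nhds_zero_nat (𝕜 := ℝ)
  have hδ0 : ∀ n, 0 < εn n ^ (p + 1) := fun n => Real.rpow_pos_of_pos (hε0 n) _
  set B : ℕ → E → ℝ := fun n => D.indicator (fun x => bet (εn n ^ (p + 1))
    ((v (σ x) + εn n) ^ p - (v x + εn n) ^ p)) with hB
  have step := fun n (hn : εn n < r) => compare_step hp hΩ hb hu hw hv hvn h0 huv σ hℓ hfix hpol hD (hε0 n) (hδ0 n)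
    (fun x hx => hC x (subset_closure hx)) (B := B n) rfl (A := A) measurableSet_ball hAD
    (c := c / 2) (fun x hx => by
      obtain ⟨h1, h2, h3⟩ := hAz x hx (εn n) (hε0 n) hn
      have h4 : 1 / 2 ≤ bet' (εn n ^ (p + 1)) ((v (σ x) + εn n) ^ p - (v x + εn n) ^ p) := by
        refine bet'_ge (hδ0 n) ?_
        simp only [hg] at h2; linarith
      calc c / 2 ≤ 1 / 2 * Λ (x, εn n) := by linarith
        _ ≤ bet' (εn n ^ (p + 1)) ((v (σ x) + εn n) ^ p - (v x + εn n) ^ p) * Λ (x, εn n) := by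
          gcongr; linarith
        _ = _ := by simp only [hΛ, ha, hbb]; ring)
  have stepc := fun n => (compare_step hp hΩ hb hu hw hv hvn h0 huv σ hℓ hfix hpol hD (hε0 n) (hδ0 n)
    (fun x hx => hC x (subset_closure hx)) (B := B n) rfl (A := ∅) MeasurableSet.empty
    (empty_subset _) (c := 0) (fun x hx => absurd hx (notMem_empty x))).1
  set J : ℕ → E → ℝ := fun n x => u (σ x) ^ (p - 1) * (B n x * (v (σ x) + εn n) ^ (1 - p)) -
      u x ^ (p - 1) * (B n x * (v x + εn n) ^ (1 - p)) with hJ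
  have hBn : ∀ n x, x ∈ D → 0 ≤ B n x ∧ B n x ≤ (M + 1) ^ p := by
    intro n x hx
    simp only [hB, indicator_of_mem hx]
    have h1 : (v x + εn n) ^ p ≤ (v (σ x) + εn n) ^ p :=
      Real.rpow_le_rpow (by linarith [hvn x, hε0 n]) (by linarith [hDv x hx]) hp0
    refine ⟨bet_nonneg (hδ0 n) _, (bet_le (hδ0 n) (by linarith)).trans ?_⟩
    have h2 : (v (σ x) + εn n) ^ p ≤ (M + 1) ^ p :=
      Real.rpow_le_rpow (by linarith [hvn (σ x), hε0 n]) (by linarith [hvM (σ x), hε1 n]) hp0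
    have h3 : 0 ≤ (v x + εn n) ^ p := Real.rpow_nonneg (by linarith [hvn x, hε0 n]) _
    linarith
  have frac : ∀ w ε : ℝ, 0 < w → 0 < ε → w ^ (p - 1) * (w + ε) ^ (1 - p) = (w / (w + ε)) ^ (p - 1) := by
    intro w ε h1 h2
    rw [Real.div_rpow h1.le (by linarith), div_eq_mul_inv, ← Real.rpow_neg (by linarith)]
    congr 2; ring
  have hJD : ∀ n x, x ∈ D → J n x = B n x * ((v (σ x) / (v (σ x) + εn n)) ^ (p - 1) -
      (v x / (v x + εn n)) ^ (p - 1)) := by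
    intro n x hx
    simp only [hJ]
    rw [huv _ (hDσ x hx), huv _ (hDΩ x hx), ← frac _ _ (hv0 _ (hDσ x hx)) (hε0 n),
      ← frac _ _ (hv0 _ (hDΩ x hx)) (hε0 n)]
    ring
  have hJ0 : ∀ n x, x ∉ D → J n x = 0 := by
    intro n x hx
    simp only [hJ, hB, indicator_of_notMem hx]; ring
  have frac1 : ∀ w ε : ℝ, 0 < w → 0 < ε → 0 ≤ (w / (w + ε)) ^ (p - 1) ∧ (w / (w + ε)) ^ (p - 1) ≤ 1 := by
    intro w ε h1 h2
    refine ⟨by positivity, Real.rpow_le_one (by positivity) ?_ hp1⟩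
    rw [div_le_one (by positivity)]; linarith
  have hJt : Tendsto (fun n => ∫ x, J n x) atTop (𝓝 (∫ x : E, (0:ℝ))) := by
    refine tendsto_integral_compact hK stepc ((M + 1) ^ p) ?_ ?_ ?_
    · intro n x
      by_cases hx : x ∈ D
      · rw [hJD n x hx, abs_mul]
        obtain ⟨h1, h2⟩ := hBn n x hx
        obtain ⟨h3, h4⟩ := frac1 _ _ (hv0 _ (hDσ x hx)) (hε0 n)
        obtain ⟨h5, h6⟩ := frac1 _ _ (hv0 _ (hDΩ x hx)) (hε0 n)
        rw [abs_of_nonneg h1]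
        calc _ ≤ (M + 1) ^ p * 1 := by
              refine mul_le_mul h2 ?_ (abs_nonneg _) (h1.trans h2)
              rw [abs_le]; constructor <;> linarith
          _ = _ := mul_one _
      · rw [hJ0 n x hx, abs_zero]; positivity
    · intro n x hx
      exact hJ0 n x fun h => hx (subset_closure (hDΩ x h))
    · intro x
      by_cases hx : x ∈ D
      · have tf : ∀ w : ℝ, 0 < w → Tendsto (fun n => (w / (w + εn n)) ^ (p - 1)) atTop (𝓝 1) := by
          intro w hw
          have h1 : Tendsto (fun n => w / (w + εn n)) atTop (𝓝 (w / (w + 0))) :=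
            tendsto_const_nhds.div (tendsto_const_nhds.add hεt) (by simpa using hw.ne')
          rw [add_zero, div_self hw.ne'] at h1
          simpa using h1.rpow_const (p := p - 1) (Or.inr hp1)
        have h2 := ((tf _ (hv0 _ (hDσ x hx))).sub (tf _ (hv0 _ (hDΩ x hx)))).abs.const_mul
          ((M + 1) ^ p)
        rw [sub_self, abs_zero, mul_zero] at h2
        refine squeeze_zero_norm (fun n => ?_) h2
        rw [hJD n x hx, Real.norm_eq_abs, abs_mul, abs_of_nonneg (hBn n x hx).1]
        exact mul_le_mul_of_nonneg_right (hBn n x hx).2 (abs_nonneg _)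
      · simp only [hJ0 _ x hx]; exact tendsto_const_nhds
  rw [integral_zero] at hJt
  have hA0 : 0 < volume.real A :=
    ENNReal.toReal_pos (measure_ball_pos volume x₀ hr).ne' measure_ball_lt_top.ne
  have lim : Tendsto (fun n => lam * (∫ x, J n x) +
      volume.real (closure Ω) * ((p - 1) * (2 * εn n ^ (p + 1)) * (C ^ p / εn n ^ p))) atTop
      (𝓝 0) := by
    have e1 : ∀ n, (p - 1) * (2 * εn n ^ (p + 1)) * (C ^ p / εn n ^ p) = (p - 1) * 2 * C ^ p * εn n := by
      intro n
      have : εn n ^ p ≠ 0 := (Real.rpow_pos_of_pos (hε0 n) _).ne'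
      rw [Real.rpow_add (hε0 n), Real.rpow_one]
      field_simp
    simp only [e1]
    have := (hJt.const_mul lam).add ((hεt.const_mul ((p - 1) * 2 * C ^ p)).const_mul
      (volume.real (closure Ω)))
    simpa using this
  have fin : ∀ᶠ n in atTop, volume.real A * (c / 2) ≤ lam * (∫ x, J n x) +
      volume.real (closure Ω) * ((p - 1) * (2 * εn n ^ (p + 1)) * (C ^ p / εn n ^ p)) := by
    filter_upwards [hεt.eventually_lt_const hr] with n hn
    exact (step n hn).2
  have := ge_of_tendsto lim fin
  have : 0 < volume.real A * (c / 2) := by positivity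
  linarith
end Compare2


section Compare3
variable {E : Type*} [NormedAddCommGroup E] [InnerProductSpace ℝ E] [CompleteSpace E]
  [FiniteDimensional ℝ E] [MeasurableSpace E] [BorelSpace E]

lemma compare_sphere {p lam : ℝ} (hp : 1 < p) (hrank : 1 < Module.rank ℝ E)
    {Ω : Set E} (hΩ : IsOpen Ω)
    (hb : Bornology.IsBounded Ω) {u v : E → ℝ} (hu : ContDiff ℝ 1 u) (hw : WeakSol p lam Ω u)
    (hv : Continuous v) (hv0 : ∀ x ∈ Ω, 0 < v x) (h0 : ∀ x, x ∉ Ω → v x = 0)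
    (huv : ∀ x ∈ Ω, u x = v x) (σ : E ≃ₗᵢ[ℝ] E) {ℓ : E → ℝ} (hℓ : Continuous ℓ)
    (hodd : ∀ x, ℓ (-x) = - ℓ x)
    (hfix : ∀ x, ℓ x = 0 → σ x = x) (hpol : ∀ x, ℓ x < 0 → σ x ∈ Ω → x ∈ Ω)
    {r : ℝ} (hr : sphere (0 : E) r ⊆ Ω) {x : E} (hx : x ∈ sphere (0 : E) r) (hxl : ℓ x ≤ 0) :
    v (σ x) ≤ v x := by
  by_contra hlt
  push Not at hlt
  have hσ : Continuous σ := σ.continuous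
  set D : Set E := {x | ℓ x < 0 ∧ v x < v (σ x)} with hD
  have hvn : ∀ x, 0 ≤ v x := fun x => by
    by_cases hx : x ∈ Ω
    · exact (hv0 x hx).le
    · rw [h0 x hx]
  have hDo : IsOpen D := (isOpen_lt hℓ continuous_const).inter (isOpen_lt hv (hv.comp hσ))
  have hDσ : ∀ x ∈ D, σ x ∈ Ω := by
    intro x hx
    by_contra h
    have := hx.2; rw [h0 _ h] at this; linarith [hvn x]
  have hDΩ : ∀ x ∈ D, x ∈ Ω := fun x hx => hpol x hx.1 (hDσ x hx)
  have mem_D : ∀ y, ℓ y ≤ 0 → v y < v (σ y) → y ∈ D := by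
    intro y h1 h2
    refine ⟨lt_of_le_of_ne h1 fun h => ?_, h2⟩
    rw [hfix y h] at h2; exact lt_irrefl _ h2
  have hxD : x ∈ D := mem_D x hxl hlt
  set κ := v (σ x) / v x with hκ
  have hvx : 0 < v x := hv0 x (hr hx)
  have hκ1 : 1 < κ := by rw [hκ, one_lt_div hvx]; exact hlt
  set U : Set E := {y | y ∈ D ∧ v (σ y) = κ * v y} with hU
  set W : Set E := {y | ¬ (ℓ y ≤ 0 ∧ v (σ y) = κ * v y)} with hW
  have hWo : IsOpen W := by
    have : IsClosed {y | ℓ y ≤ 0 ∧ v (σ y) = κ * v y} :=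
      (isClosed_le hℓ continuous_const).inter (isClosed_eq (hv.comp hσ) (continuous_const.mul hv))
    exact this.isOpen_compl
  have hut1 : ContDiff ℝ 1 (fun y => u (σ y)) := contDiff_comp_isom (n := 1) hu σ
  have hgrad : ∀ y ∈ D, HasGradientAt (fun y => v (σ y) * (v y)⁻¹) 0 y := by
    intro y hy
    have hvy := hv0 y (hDΩ y hy)
    have hvs := hv0 _ (hDσ y hy)
    have g1 : HasGradientAt v (gradient u y) y := (hu.hasGrad y).congr' (by
      filter_upwards [hΩ.mem_nhds (hDΩ y hy)] with z hz using (huv z hz).symm)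
    have g2 : HasGradientAt (fun y => v (σ y)) (gradient (fun y => u (σ y)) y) y :=
      (hut1.hasGrad y).congr' (by
        filter_upwards [(hΩ.preimage hσ).mem_nhds (hDσ y hy)] with z hz using (huv _ hz).symm)
    have g3 := g2.mul' (HasGradientAt.real_comp (hasDerivAt_inv hvy.ne') g1)
    have key := compare_core hp hΩ hb hu hw hv hv0 h0 huv σ hℓ hfix hpol hD hy
    convert g3 using 1
    have e1 : gradient (fun y => u (σ y)) y = v (σ y) • (v y)⁻¹ • gradient u y := by
      rw [key, smul_smul, mul_inv_cancel₀ hvs.ne', one_smul]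
    rw [e1, smul_smul, smul_smul, smul_smul, ← add_smul]
    convert (zero_smul ℝ (gradient u y)).symm using 2
    field_simp
    ring
  have hUo : IsOpen U := by
    rw [isOpen_iff_mem_nhds]
    rintro y ⟨hyD, hy⟩
    obtain ⟨ρ, hρ, hball⟩ := Metric.isOpen_iff.1 hDo y hyD
    refine mem_of_superset (ball_mem_nhds y hρ) fun z hz => ⟨hball hz, ?_⟩
    have := isOpen_ball.is_const_of_fderiv_eq_zero (𝕜 := ℝ) (convex_ball y ρ).isPreconnected
      (f := fun y => v (σ y) * (v y)⁻¹)
      (fun w hw => (hgrad w (hball hw)).hasFDerivAt.differentiableAt.differentiableWithinAt)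
      (fun w hw => by
        rw [(hgrad w (hball hw)).hasFDerivAt.fderiv]; simp) hz (mem_ball_self hρ)
    have hvy := hv0 y (hDΩ y hyD)
    have hvz := hv0 z (hDΩ z (hball hz))
    rw [hy, mul_assoc, mul_inv_cancel₀ hvy.ne', mul_one] at this
    rw [← this, mul_assoc, inv_mul_cancel₀ hvz.ne', mul_one]
  have hcov : sphere (0 : E) r ⊆ U ∪ W := by
    intro y hy
    by_cases h : y ∈ W
    · exact Or.inr h
    · left
      have h' : ℓ y ≤ 0 ∧ v (σ y) = κ * v y := by simpa only [hW, mem_ofPred_eq, not_not] using h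
      refine ⟨mem_D y h'.1 ?_, h'.2⟩
      have := hv0 y (hr hy)
      rw [h'.2]; nlinarith
  have hne := isPreconnected_sphere hrank (0 : E) r U W hUo hWo hcov
    ⟨x, hx, hxD, by rw [hκ]; field_simp⟩
    ⟨-x, by simpa using hx, fun h => by
      have h1 := h.1; rw [hodd] at h1; have h2 : ℓ x < 0 := hxD.1; linarith⟩
  obtain ⟨z, _, hz1, hz2⟩ := hne
  exact hz2 ⟨hz1.1.1.le, hz1.2⟩

lemma refl_apply (ν z : E) : (ℝ ∙ ν)ᗮ.reflection z = z - (2 * ⟪ν, z⟫ / ‖ν‖ ^ 2) • ν := by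
  rw [Submodule.reflection_orthogonal_apply, Submodule.reflection_singleton_apply]
  simp only [RCLike.ofReal_real_eq_id, id_eq, neg_sub]
  rw [two_smul, ← add_smul]
  congr 2; ring

lemma mono_sphere {p lam : ℝ} (hp : 1 < p) (hrank : 1 < Module.rank ℝ E) {e : E} (he : ‖e‖ = 1)
    {R₀ R₁ s : ℝ} (hs : 0 < s) (hR₀ : 0 < R₀)
    {Ω : Set E} (hΩe : Ω = ball 0 R₁ \ closedBall (s • e) R₀)
    {u v : E → ℝ} (hu : ContDiff ℝ 1 u) (hw : WeakSol p lam Ω u)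
    (hv : Continuous v) (hv0 : ∀ x ∈ Ω, 0 < v x) (h0 : ∀ x, x ∉ Ω → v x = 0)
    (huv : ∀ x ∈ Ω, u x = v x) {x y : E} (hxy : ‖x‖ = ‖y‖) (h1 : R₀ + s < ‖x‖) (h2 : ‖x‖ < R₁)
    (hle : ⟪e, x⟫ ≤ ⟪e, y⟫) : v y ≤ v x := by
  rcases eq_or_ne x y with rfl | hne
  · exact le_rfl
  have hΩ : IsOpen Ω := by rw [hΩe]; exact isOpen_ball.sdiff isClosed_closedBall
  have hb : Bornology.IsBounded Ω := by rw [hΩe]; exact isBounded_ball.subset sdiff_subset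
  set σ := (ℝ ∙ (x - y))ᗮ.reflection with hσ
  have hσx : σ x = y := Submodule.reflection_sub hxy
  have hν : 0 < ‖x - y‖ ^ 2 := by have := norm_pos_iff.2 (sub_ne_zero.2 hne); positivity
  have hσa : ∀ z, σ z = z - (2 * ⟪x - y, z⟫ / ‖x - y‖ ^ 2) • (x - y) := refl_apply _
  rw [← hσx]
  refine compare_sphere hp hrank hΩ hb hu hw hv hv0 h0 huv σ
    (ℓ := fun z => ⟪y - x, z⟫) (r := ‖x‖) (by fun_prop) (fun z => by simp) ?_ ?_ ?_ (by simp) ?_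
  · intro z hz
    have : ⟪x - y, z⟫ = 0 := by rw [← neg_sub y x, inner_neg_left, hz, neg_zero]
    rw [hσa, this]; simp
  · intro z hz hzΩ
    have hz' : 0 < ⟪x - y, z⟫ := by rw [← neg_sub y x, inner_neg_left]; linarith
    rw [hΩe] at hzΩ ⊢
    refine ⟨by have := hzΩ.1; simpa using this, fun h => hzΩ.2 ?_⟩
    rw [mem_closedBall, dist_eq_norm] at h ⊢
    refine le_trans ?_ h
    rw [← sq_le_sq₀ (norm_nonneg _) (norm_nonneg _), norm_sub_sq_real, norm_sub_sq_real,
      σ.norm_map]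
    have : ⟪z, s • e⟫ ≤ ⟪σ z, s • e⟫ := by
      rw [hσa, inner_sub_left, real_inner_smul_left, real_inner_smul_right, real_inner_smul_right,
        inner_sub_left x y e, real_inner_comm e x, real_inner_comm e y]
      have : (2 * ⟪x - y, z⟫ / ‖x - y‖ ^ 2) * (s * (⟪e, x⟫ - ⟪e, y⟫)) ≤ 0 :=
        mul_nonpos_of_nonneg_of_nonpos (by positivity)
          (mul_nonpos_of_nonneg_of_nonpos hs.le (by linarith))
      linarith
    linarith
  · intro z hz
    rw [hΩe]
    have hz' : ‖z‖ = ‖x‖ := by simpa using hz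
    refine ⟨by simpa [hz'] using h2, fun h => ?_⟩
    rw [mem_closedBall, dist_eq_norm] at h
    have h3 := norm_sub_norm_le z (s • e)
    rw [norm_smul, he, Real.norm_of_nonneg hs.le] at h3
    linarith
  · simp only [inner_sub_left]
    have := real_inner_le_norm y x
    rw [real_inner_self_eq_norm_sq, ← hxy] at *
    nlinarith
end Compare3


section Noether
variable {E : Type*} [NormedAddCommGroup E] [InnerProductSpace ℝ E] [CompleteSpace E]
  [FiniteDimensional ℝ E] [MeasurableSpace E] [BorelSpace E]

lemma psi_inj {e : E} (he : ‖e‖ = 1) {χ : E → ℝ} {g : E → E}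
    (hg : ∀ x, HasGradientAt χ (g x) x) {L : ℝ} (hL : ∀ x, ‖g x‖ ≤ L) {τ : ℝ}
    (hτ : |τ| * L < 1) : Function.Injective (fun x => x - (τ * χ x) • e) := by
  intro x y hxy
  simp only at hxy
  have hlip : ‖χ x - χ y‖ ≤ L * ‖x - y‖ := by
    refine convex_univ.norm_image_sub_le_of_norm_hasFDerivWithin_le (𝕜 := ℝ)
      (f' := fun x => innerSL ℝ (g x))
      (fun z _ => (hasGrad_iff.1 (hg z)).hasFDerivWithinAt) (fun z _ => ?_) (mem_univ y) (mem_univ x)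
    rw [innerSL_apply_norm]; exact hL z
  have h1 : x - y = (τ * (χ x - χ y)) • e := by
    rw [mul_sub, sub_smul]
    have : x - (τ * χ x) • e - (y - (τ * χ y) • e) = 0 := sub_eq_zero.2 hxy
    rw [← sub_eq_zero, ← this]; abel
  have h2 : ‖x - y‖ ≤ |τ| * L * ‖x - y‖ := by
    calc ‖x - y‖ = |τ| * ‖χ x - χ y‖ := by
          conv_lhs => rw [h1]
          rw [norm_smul, he, mul_one, norm_mul]; rfl
      _ ≤ |τ| * (L * ‖x - y‖) := by gcongr
      _ = _ := by ring
  by_contra hne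
  have : 0 < ‖x - y‖ := norm_pos_iff.2 (sub_ne_zero.2 hne)
  nlinarith

lemma psi_surj {e : E} {χ : E → ℝ} (hχ : Continuous χ) {M : ℝ} (hM : ∀ x, |χ x| ≤ M) (τ : ℝ) :
    Function.Surjective (fun x => x - (τ * χ x) • e) := by
  intro y
  set h : ℝ → ℝ := fun t => t - τ * χ (y + t • e) with hh
  have hc : Continuous h := by
    rw [hh]; exact continuous_id.sub (continuous_const.mul (hχ.comp (by fun_prop)))
  set T := |τ| * M with hT
  have hM0 : 0 ≤ M := (abs_nonneg _).trans (hM 0)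
  have hT0 : 0 ≤ T := by positivity
  have hb : ∀ t : ℝ, |τ * χ (y + t • e)| ≤ T := fun t => by
    rw [abs_mul]; exact mul_le_mul_of_nonneg_left (hM _) (abs_nonneg _)
  have := intermediate_value_Icc (a := -T) (b := T) (by linarith) hc.continuousOn
  obtain ⟨t, _, ht⟩ := this (show (0:ℝ) ∈ _ from
    ⟨by have := (abs_le.1 (hb (-T))).1; simp only [hh]; linarith,
     by have := (abs_le.1 (hb T)).2; simp only [hh]; linarith⟩)
  refine ⟨y + t • e, ?_⟩
  have : τ * χ (y + t • e) = t := by simp only [hh] at ht; linarith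
  simp only [this]; abel

lemma psi_cov {e : E} (he : ‖e‖ = 1) {χ : E → ℝ} {g : E → E}
    (hg : ∀ x, HasGradientAt χ (g x) x) {L : ℝ} (hL : ∀ x, ‖g x‖ ≤ L) {M : ℝ}
    (hM : ∀ x, |χ x| ≤ M) {τ : ℝ} (hτ : |τ| * L < 1) (f : E → ℝ) :
    ∫ x, f x = ∫ x, (1 - τ * ⟪g x, e⟫) * f (x - (τ * χ x) • e) := by
  have hχ : Continuous χ := continuous_iff_continuousAt.2 fun x => (hg x).continuousAt
  have hinj := psi_inj he hg hL hτ
  have hsurj := psi_surj (e := e) hχ hM τ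
  set f' : E → E →L[ℝ] E := fun x => ContinuousLinearMap.id ℝ E +
    ((-τ) • innerSL ℝ (g x)).smulRight e with hf'
  have hd : ∀ x ∈ (univ : Set E), HasFDerivWithinAt (fun x => x - (τ * χ x) • e) (f' x) univ x := by
    intro x _
    have h1 := ((hasGrad_iff.1 (hg x)).const_mul τ).smul_const e
    have h2 := (hasFDerivAt_id x).sub h1
    refine HasFDerivAt.hasFDerivWithinAt ?_
    have h3 : f' x = ContinuousLinearMap.id ℝ E - (τ • innerSL ℝ (g x)).smulRight e := by
      ext z
      simp [hf', sub_eq_add_neg]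
    rw [h3]; exact h2
  have key := integral_image_eq_integral_abs_det_fderiv_smul (volume : Measure E) MeasurableSet.univ
    hd hinj.injOn f
  rw [image_univ, hsurj.range_eq, setIntegral_univ, setIntegral_univ] at key
  rw [key]
  congr 1
  ext x
  have hdet : (f' x).det = 1 - τ * ⟪g x, e⟫ := by
    have : ((f' x : E →L[ℝ] E) : E →ₗ[ℝ] E) =
        LinearMap.transvection (((-τ) • innerSL ℝ (g x) : E →L[ℝ] ℝ) : E →ₗ[ℝ] ℝ) e := by
      ext z; simp [hf', LinearMap.transvection]
    rw [ContinuousLinearMap.det, this, LinearMap.transvection.det]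
    simp [sub_eq_add_neg]
  rw [hdet, smul_eq_mul, abs_of_nonneg]
  have h1 : |τ * ⟪g x, e⟫| ≤ |τ| * L := by
    rw [abs_mul]
    refine mul_le_mul_of_nonneg_left ?_ (abs_nonneg _)
    have := abs_real_inner_le_norm (g x) e
    rw [he, mul_one] at this
    exact this.trans (hL x)
  linarith [(abs_le.1 h1).2]

lemma noether_step {p : ℝ} (hp : 1 < p) {e : E} (he : ‖e‖ = 1) {R₀ R₁ s a b : ℝ}
    (hs : 0 < s) (hR₀ : 0 < R₀) (ha : R₀ + s < a) (hb : b < R₁)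
    {lam : ℝ → ℝ} {Ω : ℝ → Set E} (hΩe : ∀ t, Ω t = ball 0 R₁ \ closedBall (t • e) R₀)
    (hlam : 0 ≤ lam s)
    (hRay : ∀ t, ∀ φ : E → ℝ, ContDiff ℝ 1 φ → HasCompactSupport φ → tsupport φ ⊆ Ω t →
      lam t * ∫ x, |φ x| ^ p ≤ ∫ x, ‖gradient φ x‖ ^ p)
    {u v : E → ℝ} (hu : ContDiff ℝ 1 u) (hw : WeakSol p (lam s) (Ω s) u)
    (hv : Continuous v) (hv0 : ∀ x ∈ Ω s, 0 < v x) (h0 : ∀ x, x ∉ Ω s → v x = 0)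
    (huv : ∀ x ∈ Ω s, u x = v x) {Mv : ℝ} (hMv : ∀ x, v x ≤ Mv)
    {χ : E → ℝ} {g : E → E} (hg : ∀ x, HasGradientAt χ (g x) x) (hgc : Continuous g)
    {L : ℝ} (hL : ∀ x, ‖g x‖ ≤ L) {M : ℝ} (hM : ∀ x, |χ x| ≤ M) {k₀ : ℝ}
    (hχa : ∀ x, ‖x‖ ≤ a → χ x = k₀) (hχb : ∀ x, b ≤ ‖x‖ → χ x = 0)
    (hga : ∀ x, ‖x‖ < a → g x = 0) (hgb : ∀ x, b < ‖x‖ → g x = 0)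
    {τ : ℝ} (hτ : |τ| * L < 1) (hτ2 : |τ| * M < a - (R₀ + s)) :
    τ * ∫ x, (lam s * ((v (x - (τ * χ x) • e)) ^ p * ⟪g x, e⟫) -
      ‖gradient u (x - (τ * χ x) • e)‖ ^ p * ⟪g x, e⟫ +
      p * ⟪Fp p (gradient u (x - (τ * χ x) • e) -
          (τ * ⟪e, gradient u (x - (τ * χ x) • e)⟫) • g x),
        ⟪e, gradient u (x - (τ * χ x) • e)⟫ • g x⟫)
      ≤ |lam (s + τ * k₀) - lam s| * (Mv ^ p * volume.real (ball (0 : E) R₁)) := by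
  have hχ : Continuous χ := continuous_iff_continuousAt.2 fun x => (hg x).continuousAt
  have hp0 : 0 ≤ p := by linarith
  set Ψ : E → E := fun x => x - (τ * χ x) • e with hΨ
  have hΨc : Continuous Ψ := continuous_id.sub ((continuous_const.mul hχ).smul continuous_const)
  have hinj : Function.Injective Ψ := psi_inj he hg hL hτ
  have hcov := psi_cov he hg hL hM hτ
  have hM0 : 0 ≤ M := (abs_nonneg _).trans (hM 0)
  have hΩo : ∀ t, IsOpen (Ω t) := fun t => by
    rw [hΩe]; exact isOpen_ball.sdiff isClosed_closedBall
  have hΩb : ∀ t, Bornology.IsBounded (Ω t) := fun t => by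
    rw [hΩe]; exact isBounded_ball.subset sdiff_subset
  have hΨd : ∀ x, ‖x‖ ≤ ‖Ψ x‖ + |τ| * M := by
    intro x
    have h1 : x = Ψ x + (τ * χ x) • e := by simp [hΨ]
    calc ‖x‖ = ‖Ψ x + (τ * χ x) • e‖ := by rw [← h1]
      _ ≤ ‖Ψ x‖ + ‖(τ * χ x) • e‖ := norm_add_le _ _
      _ ≤ _ := by
        rw [norm_smul, he, mul_one, Real.norm_eq_abs, abs_mul]
        have := hM x
        gcongr
  have hk₀ : |k₀| ≤ M := by
    have := hχa 0 (by rw [norm_zero]; linarith)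
    rw [← this]; exact hM 0
  have hτk : |τ * k₀| ≤ |τ| * M := by rw [abs_mul]; gcongr
  have hse : ∀ t x, ‖x - t • e‖ ≤ R₀ → ‖x‖ ≤ R₀ + |t| := by
    intro t x h
    have := norm_sub_norm_le x (t • e)
    rw [norm_smul, he, mul_one, Real.norm_eq_abs] at this
    linarith
  -- domain correspondence
  have hdom : ∀ x, x ∈ Ω (s + τ * k₀) ↔ Ψ x ∈ Ω s := by
    intro x
    rw [hΩe, hΩe]
    have h1 : x ∈ ball (0 : E) R₁ ↔ Ψ x ∈ ball (0 : E) R₁ := by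
      have hfix : ∀ z : E, R₁ ≤ ‖z‖ → Ψ z = z := fun z hz => by
        simp [hΨ, hχb z (by linarith)]
      rw [mem_ball_zero_iff, mem_ball_zero_iff]
      constructor
      · intro h
        by_contra hc
        push Not at hc
        have := hinj (hfix _ hc)
        rw [this] at hc; linarith
      · intro h
        by_contra hc
        push Not at hc
        rw [hfix _ hc] at h; linarith
    have h2 : x ∈ closedBall ((s + τ * k₀) • e) R₀ ↔ Ψ x ∈ closedBall (s • e) R₀ := by
      rw [mem_closedBall, mem_closedBall, dist_eq_norm, dist_eq_norm]
      have h3 : ‖x‖ ≤ a → Ψ x - s • e = x - (s + τ * k₀) • e := fun h => by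
        simp only [hΨ, hχa x h]; rw [add_smul]; abel
      constructor
      · intro h
        rw [h3]
        · exact h
        · have := hse _ _ h
          have h4 : |s + τ * k₀| ≤ s + |τ| * M :=
            (abs_add_le _ _).trans (by rw [abs_of_pos hs]; linarith)
          linarith
      · intro h
        rw [← h3]
        · exact h
        · have := hse _ _ h
          rw [abs_of_pos hs] at this
          have := hΨd x
          linarith
    exact and_congr h1 (not_congr h2)
  set Ω' := Ω (s + τ * k₀) with hΩ'
  have hshell : ∀ x, g x ≠ 0 → x ∈ Ω' := by
    intro x hx
    have h1 : a ≤ ‖x‖ := by by_contra h; exact hx (hga x (not_le.1 h))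
    have h2 : ‖x‖ ≤ b := by by_contra h; exact hx (hgb x (not_le.1 h))
    rw [hΩ', hΩe]
    refine ⟨by rw [mem_ball_zero_iff]; linarith, fun h => ?_⟩
    rw [mem_closedBall, dist_eq_norm] at h
    have := hse _ _ h
    have h4 : |s + τ * k₀| ≤ s + |τ| * M :=
      (abs_add_le _ _).trans (by rw [abs_of_pos hs]; linarith)
    linarith
  -- the test function
  set gv : E → E := fun x => gradient u (Ψ x) - (τ * ⟪e, gradient u (Ψ x)⟫) • g x with hgv
  have cgu : Continuous fun x => gradient u (Ψ x) := hu.continuous_grad.comp hΨc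
  have cgv : Continuous gv := cgu.sub ((continuous_const.mul (continuous_const.inner cgu)).smul hgc)
  have hgvg : ∀ x ∈ Ω', HasGradientAt (fun x => v (Ψ x)) (gv x) x := by
    intro x hx
    have hx' := (hdom x).1 hx
    have g1 : HasGradientAt v (gradient u (Ψ x)) (Ψ x) := (hu.hasGrad _).congr' (by
      filter_upwards [(hΩo s).mem_nhds hx'] with z hz using (huv z hz).symm)
    have h1 := ((hasGrad_iff.1 (hg x)).const_mul τ).smul_const e
    have h2 : HasFDerivAt Ψ (ContinuousLinearMap.id ℝ E - (τ • innerSL ℝ (g x)).smulRight e) x :=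
      (hasFDerivAt_id x).sub h1
    have h3 := (hasGrad_iff.1 g1).comp x h2
    have h4 : innerSL ℝ (gv x) = (innerSL ℝ (gradient u (Ψ x))).comp
        (ContinuousLinearMap.id ℝ E - (τ • innerSL ℝ (g x)).smulRight e) := by
      ext z
      simp [hgv, inner_sub_left, real_inner_smul_left, inner_sub_right, real_inner_smul_right]
      ring
    rw [hasGrad_iff, h4]; exact h3
  have hv0' : ∀ x, 0 ≤ v x := fun x => by
    by_cases hx : x ∈ Ω s
    · exact (hv0 x hx).le
    · rw [h0 x hx]
  have hK : IsCompact (closedBall (0 : E) R₁) := isCompact_closedBall _ _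
  have hΩ'K : Ω' ⊆ closedBall 0 R₁ := by
    rw [hΩ', hΩe]; exact sdiff_subset.trans ball_subset_closedBall
  have hΩ'B : Ω' ⊆ ball 0 R₁ := by rw [hΩ', hΩe]; exact sdiff_subset
  obtain ⟨C, hC0, hC⟩ := exists_bound_cs cgv hK
  have hvΨ0 : ∀ x, x ∉ Ω' → v (Ψ x) = 0 := fun x hx => h0 _ fun h => hx ((hdom x).2 h)
  have ray := rayleigh_trunc hp (hΩo _) (hΩb _) (hRay (s + τ * k₀)) (v := fun x => v (Ψ x))
    (hv.comp hΨc) (fun x => hv0' _) hvΨ0 hgvg cgv.continuousOn (fun x hx => hC x (hΩ'K hx))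
  have en := energy_le hp hlam (hΩo s) (hΩb s) hu hw hv hv0 h0 huv
  -- integrability
  have hcs : ∀ f : E → ℝ, Continuous f → (∀ x, x ∉ closedBall (0 : E) R₁ → f x = 0) →
      Integrable f := fun f hf h =>
    hf.integrable_of_hasCompactSupport (HasCompactSupport.intro hK fun x hx => h x hx)
  have hg0 : ∀ x, x ∉ closedBall (0 : E) R₁ → g x = 0 := fun x hx => by
    refine hgb x ?_
    rw [mem_closedBall_zero_iff] at hx; linarith
  have cvp : Continuous fun x => v (Ψ x) ^ p := (hv.comp hΨc).rpow_const fun _ => Or.inr hp0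
  have cge : Continuous fun x => ⟪g x, e⟫ := hgc.inner continuous_const
  have iI : Integrable fun x => v (Ψ x) ^ p := hcs _ cvp fun x hx => by
    rw [hvΨ0 x fun h => hx (hΩ'K h), Real.zero_rpow (by linarith)]
  have iA : Integrable fun x => v (Ψ x) ^ p * ⟪g x, e⟫ := hcs _ (cvp.mul cge) fun x hx => by
    rw [hg0 x hx]; simp
  have cB : Continuous fun x => ‖gradient u (Ψ x)‖ ^ p := cgu.norm.rpow_const fun _ => Or.inr hp0
  set br : E → ℝ := fun x => τ * (‖gradient u (Ψ x)‖ ^ p * ⟪g x, e⟫ -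
    p * ⟪Fp p (gv x), ⟪e, gradient u (Ψ x)⟫ • g x⟫) with hbr
  have cbr : Continuous br := by
    refine continuous_const.mul ((cB.mul cge).sub (continuous_const.mul ?_))
    exact ((continuous_Fp hp).comp cgv).inner ((continuous_const.inner cgu).smul hgc)
  have br0 : ∀ x, g x = 0 → br x = 0 := fun x hx => by simp [hbr, hx]
  have ibr : Integrable br := hcs _ cbr fun x hx => br0 x (hg0 x hx)
  have vI : ∫ x, v x ^ p = (∫ x, v (Ψ x) ^ p) - τ * ∫ x, v (Ψ x) ^ p * ⟪g x, e⟫ := by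
    rw [hcov (fun x => v x ^ p), ← integral_const_mul, ← integral_sub iI (iA.const_mul τ)]
    congr 1; ext x; ring
  have gI : ∫ x in Ω s, ‖gradient u x‖ ^ p = ∫ x in Ω', (1 - τ * ⟪g x, e⟫) * ‖gradient u (Ψ x)‖ ^ p := by
    rw [← integral_indicator (hΩo s).measurableSet, hcov, ← integral_indicator (hΩo _).measurableSet]
    congr 1; ext x
    by_cases hx : x ∈ Ω'
    · rw [indicator_of_mem hx]
      have := (hdom x).1 hx
      simp only [hΨ] at this
      rw [indicator_of_mem this]
    · rw [indicator_of_notMem hx]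
      have : Ψ x ∉ Ω s := fun h => hx ((hdom x).2 h)
      simp only [hΨ] at this
      rw [indicator_of_notMem this, mul_zero]
  have iOn : ∀ f : E → ℝ, Continuous f → IntegrableOn f Ω' := fun f hf =>
    (hf.continuousOn.integrableOn_compact hK).mono_set hΩ'K
  have cJ : Continuous fun x => (1 - τ * ⟪g x, e⟫) * ‖gradient u (Ψ x)‖ ^ p :=
    (continuous_const.sub (continuous_const.mul cge)).mul cB
  have brI : ∫ x in Ω', br x = ∫ x, br x := by
    refine setIntegral_eq_integral_of_forall_compl_eq_zero fun x hx => br0 x ?_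
    by_contra h; exact hx (hshell x h)
  have gle : ∫ x in Ω', ‖gv x‖ ^ p ≤ (∫ x in Ω s, ‖gradient u x‖ ^ p) + ∫ x, br x := by
    rw [gI, ← brI, ← integral_add (iOn _ cJ) (iOn _ cbr)]
    refine integral_mono (iOn _ (cgv.norm.rpow_const fun _ => Or.inr hp0))
      ((iOn _ cJ).add (iOn _ cbr)) fun x => ?_
    have hy := young_Fp hp (gv x) (gradient u (Ψ x))
    have h1 : gradient u (Ψ x) = gv x + τ • (⟪e, gradient u (Ψ x)⟫ • g x) := by
      simp only [hgv, smul_smul]; abel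
    have h2 : ⟪Fp p (gv x), gradient u (Ψ x)⟫ = ‖gv x‖ ^ p +
        τ * ⟪Fp p (gv x), ⟪e, gradient u (Ψ x)⟫ • g x⟫ := by
      conv_lhs => rw [h1]
      rw [inner_add_right, inner_Fp_self hp, real_inner_smul_right]
    rw [h2] at hy
    simp only [hbr]
    linarith
  have hX : τ * ∫ x, (lam s * (v (Ψ x) ^ p * ⟪g x, e⟫) - ‖gradient u (Ψ x)‖ ^ p * ⟪g x, e⟫ +
      p * ⟪Fp p (gv x), ⟪e, gradient u (Ψ x)⟫ • g x⟫) =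
      lam s * (τ * ∫ x, v (Ψ x) ^ p * ⟪g x, e⟫) - ∫ x, br x := by
    rw [← integral_const_mul, ← integral_const_mul, ← integral_const_mul,
      ← integral_sub ((iA.const_mul τ).const_mul _) ibr]
    congr 1; ext x; simp only [hbr]; ring
  have hIb : ∫ x, v (Ψ x) ^ p ≤ Mv ^ p * volume.real (ball (0 : E) R₁) := by
    rw [mul_comm, ← smul_eq_mul, ← setIntegral_const,
      ← setIntegral_eq_integral_of_forall_compl_eq_zero (s := ball (0 : E) R₁)]
    · refine setIntegral_mono iI.integrableOn (integrableOn_const (hs := measure_ball_lt_top.ne))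
        fun x => ?_
      exact Real.rpow_le_rpow (hv0' _) (hMv _) hp0
    · intro x hx
      rw [hvΨ0 x fun h => hx (hΩ'B h), Real.zero_rpow (by linarith)]
  have hI0 : 0 ≤ ∫ x, v (Ψ x) ^ p := integral_nonneg fun x => Real.rpow_nonneg (hv0' _) _
  have fin : (lam (s + τ * k₀) - lam s) * (∫ x, v (Ψ x) ^ p) ≤
      - (lam s * (τ * ∫ x, v (Ψ x) ^ p * ⟪g x, e⟫) - ∫ x, br x) := by
    rw [vI] at en
    have := ray.trans (gle.trans (add_le_add_left en _))
    linarith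
  rw [hX]
  calc _ ≤ -((lam (s + τ * k₀) - lam s) * (∫ x, v (Ψ x) ^ p)) := by linarith
    _ ≤ |lam (s + τ * k₀) - lam s| * (∫ x, v (Ψ x) ^ p) := by
      rw [← neg_mul]; exact mul_le_mul_of_nonneg_right (neg_le_abs _) hI0
    _ ≤ _ := by gcongr
end Noether


section Noether2
variable {E : Type*} [NormedAddCommGroup E] [InnerProductSpace ℝ E] [CompleteSpace E]
  [FiniteDimensional ℝ E] [MeasurableSpace E] [BorelSpace E]

lemma noether_abs {p : ℝ} (hp : 1 < p) {e : E} (he : ‖e‖ = 1) {R₀ R₁ s a b : ℝ}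
    (hs : 0 < s) (hR₀ : 0 < R₀) (ha : R₀ + s < a) (hb : b < R₁)
    {lam : ℝ → ℝ} {Ω : ℝ → Set E} (hΩe : ∀ t, Ω t = ball 0 R₁ \ closedBall (t • e) R₀)
    (hlam : 0 ≤ lam s)
    (hRay : ∀ t, ∀ φ : E → ℝ, ContDiff ℝ 1 φ → HasCompactSupport φ → tsupport φ ⊆ Ω t →
      lam t * ∫ x, |φ x| ^ p ≤ ∫ x, ‖gradient φ x‖ ^ p)
    (hd : HasDerivAt lam 0 s)
    {u v : E → ℝ} (hu : ContDiff ℝ 1 u) (hw : WeakSol p (lam s) (Ω s) u)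
    (hv : Continuous v) (hv0 : ∀ x ∈ Ω s, 0 < v x) (h0 : ∀ x, x ∉ Ω s → v x = 0)
    (huv : ∀ x ∈ Ω s, u x = v x)
    {χ : E → ℝ} {g : E → E} (hg : ∀ x, HasGradientAt χ (g x) x) (hgc : Continuous g)
    {L : ℝ} (hL : ∀ x, ‖g x‖ ≤ L) {M : ℝ} (hM : ∀ x, |χ x| ≤ M) {k₀ : ℝ}
    (hχa : ∀ x, ‖x‖ ≤ a → χ x = k₀) (hχb : ∀ x, b ≤ ‖x‖ → χ x = 0)
    (hga : ∀ x, ‖x‖ < a → g x = 0) (hgb : ∀ x, b < ‖x‖ → g x = 0) :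
    ∫ x, (lam s * ((v x) ^ p * ⟪g x, e⟫) - ‖gradient u x‖ ^ p * ⟪g x, e⟫ +
      p * ⟪Fp p (gradient u x), ⟪e, gradient u x⟫ • g x⟫) = 0 := by
  have hχ : Continuous χ := continuous_iff_continuousAt.2 fun x => (hg x).continuousAt
  have hp0 : 0 ≤ p := by linarith
  have hK : IsCompact (closedBall (0 : E) R₁) := isCompact_closedBall _ _
  obtain ⟨Mv, hMv0, hMv1⟩ := exists_bound_cs hv hK
  have hMv : ∀ x, v x ≤ Mv := by
    intro x
    by_cases hx : x ∈ closedBall (0 : E) R₁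
    · exact (le_abs_self _).trans (hMv1 x hx)
    · rw [h0]
      · exact hMv0
      · rw [hΩe]; exact fun h => hx (ball_subset_closedBall h.1)
  have hg0 : ∀ x, x ∉ closedBall (0 : E) R₁ → g x = 0 := fun x hx => by
    refine hgb x ?_
    rw [mem_closedBall_zero_iff] at hx; linarith
  set T : ℝ → E → ℝ := fun τ x => lam s * ((v (x - (τ * χ x) • e)) ^ p * ⟪g x, e⟫) -
      ‖gradient u (x - (τ * χ x) • e)‖ ^ p * ⟪g x, e⟫ +
      p * ⟪Fp p (gradient u (x - (τ * χ x) • e) -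
          (τ * ⟪e, gradient u (x - (τ * χ x) • e)⟫) • g x),
        ⟪e, gradient u (x - (τ * χ x) • e)⟫ • g x⟫ with hT
  have hTc : Continuous (Function.uncurry T) := by
    have c1 : Continuous fun q : ℝ × E => q.2 - (q.1 * χ q.2) • e :=
      continuous_snd.sub ((continuous_fst.mul (hχ.comp continuous_snd)).smul continuous_const)
    have c2 : Continuous fun q : ℝ × E => gradient u (q.2 - (q.1 * χ q.2) • e) :=
      hu.continuous_grad.comp c1
    have c3 : Continuous fun q : ℝ × E => g q.2 := hgc.comp continuous_snd
    have c4 : Continuous fun q : ℝ × E => ⟪e, gradient u (q.2 - (q.1 * χ q.2) • e)⟫ :=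
      continuous_const.inner c2
    have c5 : Continuous fun q : ℝ × E => ⟪g q.2, e⟫ := c3.inner continuous_const
    refine ((continuous_const.mul (((hv.comp c1).rpow_const fun _ => Or.inr hp0).mul c5)).sub
      ((c2.norm.rpow_const fun _ => Or.inr hp0).mul c5)).add (continuous_const.mul ?_)
    exact ((continuous_Fp hp).comp (c2.sub ((continuous_fst.mul c4).smul c3))).inner (c4.smul c3)
  set X : ℝ → ℝ := fun τ => ∫ x in closedBall (0 : E) R₁, T τ x with hX
  have hXc : Continuous X := continuous_parametric_integral_of_continuous hTc hK
  have hXe : ∀ τ, X τ = ∫ x, T τ x := fun τ => by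
    refine setIntegral_eq_integral_of_forall_compl_eq_zero fun x hx => ?_
    simp [hT, hg0 x hx]
  set V := Mv ^ p * volume.real (ball (0 : E) R₁) with hV
  have hev : ∀ᶠ τ in 𝓝 (0 : ℝ), τ * X τ ≤ |lam (s + τ * k₀) - lam s| * V := by
    have e1 : ∀ᶠ τ in 𝓝 (0 : ℝ), |τ| * L < 1 := by
      have : Tendsto (fun τ : ℝ => |τ| * L) (𝓝 0) (𝓝 (|0| * L)) :=
        (continuous_abs.mul continuous_const).tendsto 0
      exact this.eventually (gt_mem_nhds (by simp))
    have e2 : ∀ᶠ τ in 𝓝 (0 : ℝ), |τ| * M < a - (R₀ + s) := by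
      have : Tendsto (fun τ : ℝ => |τ| * M) (𝓝 0) (𝓝 (|0| * M)) :=
        (continuous_abs.mul continuous_const).tendsto 0
      exact this.eventually (gt_mem_nhds (by simp; linarith))
    filter_upwards [e1, e2] with τ h1 h2
    rw [hXe]
    exact noether_step hp he hs hR₀ ha hb hΩe hlam hRay hu hw hv hv0 h0 huv hMv hg hgc hL hM hχa
      hχb hga hgb h1 h2
  have hdd : HasDerivAt (fun τ => lam (s + τ * k₀)) 0 0 := by
    have h1 : HasDerivAt (fun τ : ℝ => s + τ * k₀) k₀ 0 := by
      simpa using ((hasDerivAt_id (0:ℝ)).mul_const k₀).const_add s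
    have h2 : HasDerivAt lam 0 (s + 0 * k₀) := by simpa using hd
    have h3 := h2.comp (0 : ℝ) h1
    rw [zero_mul] at h3
    exact h3
  have hr := hdd.tendsto_slope_zero_right
  have hl := hdd.tendsto_slope_zero_left
  simp only [zero_add, zero_mul, add_zero, smul_eq_mul] at hr hl
  have hrV := (hr.abs).mul_const V
  have hlV := ((hl.abs).mul_const V).neg
  simp only [abs_zero, zero_mul, neg_zero] at hrV hlV
  have hXr : Tendsto X (𝓝[>] 0) (𝓝 (X 0)) := (hXc.tendsto 0).mono_left nhdsWithin_le_nhds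
  have hXl : Tendsto X (𝓝[<] 0) (𝓝 (X 0)) := (hXc.tendsto 0).mono_left nhdsWithin_le_nhds
  have hle : X 0 ≤ 0 := by
    refine le_of_tendsto_of_tendsto hXr hrV ?_
    filter_upwards [hev.filter_mono nhdsWithin_le_nhds, self_mem_nhdsWithin] with τ h1 h2
    have h2 : 0 < τ := h2
    rw [abs_mul, abs_of_pos (inv_pos.2 h2), mul_assoc, ← div_eq_inv_mul, le_div_iff₀ h2]
    linarith
  have hge : 0 ≤ X 0 := by
    refine le_of_tendsto_of_tendsto hlV hXl ?_
    filter_upwards [hev.filter_mono nhdsWithin_le_nhds, self_mem_nhdsWithin] with τ h1 h2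
    have h2 : τ < 0 := h2
    rw [abs_mul, abs_of_neg (inv_lt_zero.2 h2), neg_mul, neg_mul, neg_neg, mul_assoc,
      ← div_eq_inv_mul, div_le_iff_of_neg h2]
    linarith
  have := le_antisymm hle hge
  rw [hXe] at this
  simpa [hT] using this

/-- The Noether integrand. -/
noncomputable def Qf (p lam : ℝ) (e : E) (u : E → ℝ) (x : E) : ℝ :=
  ⟪‖x‖⁻¹ • x, e⟫ * (‖gradient u x‖ ^ p - lam * |u x| ^ p) -
    p * ⟪Fp p (gradient u x), ‖x‖⁻¹ • x⟫ * ⟪e, gradient u x⟫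

lemma noether_radial {p : ℝ} (hp : 1 < p) {e : E} (he : ‖e‖ = 1) {R₀ R₁ s a b : ℝ}
    (hs : 0 < s) (hR₀ : 0 < R₀) (ha : R₀ + s < a) (hb : b < R₁)
    {lam : ℝ → ℝ} {Ω : ℝ → Set E} (hΩe : ∀ t, Ω t = ball 0 R₁ \ closedBall (t • e) R₀)
    (hlam : 0 ≤ lam s)
    (hRay : ∀ t, ∀ φ : E → ℝ, ContDiff ℝ 1 φ → HasCompactSupport φ → tsupport φ ⊆ Ω t →
      lam t * ∫ x, |φ x| ^ p ≤ ∫ x, ‖gradient φ x‖ ^ p)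
    (hd : HasDerivAt lam 0 s)
    {u v : E → ℝ} (hu : ContDiff ℝ 1 u) (hw : WeakSol p (lam s) (Ω s) u)
    (hv : Continuous v) (hv0 : ∀ x ∈ Ω s, 0 < v x) (h0 : ∀ x, x ∉ Ω s → v x = 0)
    (huv : ∀ x ∈ Ω s, u x = v x) {κ : ℝ → ℝ} (hκ : Continuous κ)
    (hκa : ∀ r, r < a → κ r = 0) (hκb : ∀ r, b < r → κ r = 0) :
    ∫ x, κ ‖x‖ * Qf p (lam s) e u x = 0 := by
  have ha0 : 0 < a := by linarith
  set k : ℝ → ℝ := fun r => ∫ t in R₁..r, κ t with hk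
  have hkd : ∀ r, HasDerivAt k (κ r) r := fun r =>
    intervalIntegral.integral_hasDerivAt_right (hκ.intervalIntegrable _ _)
      (hκ.stronglyMeasurableAtFilter _ _) hκ.continuousAt
  have hka : ∀ r, r ≤ a → k r = k a := by
    intro r hr
    have h1 : ∫ t in r..a, κ t = 0 := by
      refine intervalIntegral.integral_zero_ae ?_
      have : ∀ᵐ x : ℝ, x ≠ a := by simp [ae_iff, measure_singleton]
      filter_upwards [this] with t ht ht2
      rw [uIoc_of_le hr] at ht2
      exact hκa t (lt_of_le_of_ne ht2.2 ht)
    have h2 := intervalIntegral.integral_add_adjacent_intervals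
      (hκ.intervalIntegrable R₁ r (μ := volume)) (hκ.intervalIntegrable r a)
    simp only [hk]; rw [← h2, h1, add_zero]
  have hkb : ∀ r, b ≤ r → k r = 0 := by
    intro r hr
    refine intervalIntegral.integral_zero_ae ?_
    have : ∀ᵐ x : ℝ, x ≠ b := by simp [ae_iff, measure_singleton]
    filter_upwards [this] with t ht ht2
    refine hκb t (lt_of_le_of_ne ?_ ht.symm)
    have := ht2.1
    have h3 : b ≤ min R₁ r := le_min hb.le hr
    linarith
  set g : E → E := fun x => (κ ‖x‖ * ‖x‖⁻¹) • x with hgdef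
  have hgc : Continuous g := by
    have h1 : Continuous fun r : ℝ => κ r * r⁻¹ := by
      rw [continuous_iff_continuousAt]
      intro r
      rcases lt_or_ge r a with h | h
      · have : (fun r : ℝ => κ r * r⁻¹) =ᶠ[𝓝 r] fun _ => 0 := by
          filter_upwards [gt_mem_nhds h] with t ht
          rw [hκa t ht, zero_mul]
        exact (continuousAt_congr this).2 continuousAt_const
      · exact hκ.continuousAt.mul (continuousAt_inv₀ (by linarith))
    exact (h1.comp continuous_norm).smul continuous_id
  have hg : ∀ x, HasGradientAt (fun x => k ‖x‖) (g x) x := by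
    intro x
    by_cases hx : x = 0
    · subst hx
      have h1 : g 0 = 0 := by simp [hgdef]
      rw [h1]
      have h2 : HasGradientAt (fun _ : E => k a) 0 0 := by
        rw [hasGrad_iff, map_zero]; exact hasFDerivAt_const _ _
      refine h2.congr' ?_
      filter_upwards [ball_mem_nhds (0 : E) ha0] with z hz
      rw [mem_ball_zero_iff] at hz
      exact hka _ hz.le
    · have := hasGrad_radial hx (hkd ‖x‖)
      rw [smul_smul] at this
      exact this
  have hχ : Continuous fun x : E => k ‖x‖ :=
    continuous_iff_continuousAt.2 fun x => (hg x).continuousAt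
  have hK : IsCompact (closedBall (0 : E) b) := isCompact_closedBall _ _
  obtain ⟨L, hL0, hL⟩ := exists_bound_cs hgc hK
  obtain ⟨M, hM0, hM⟩ := exists_bound_cs hχ hK
  have hgb : ∀ x : E, b < ‖x‖ → g x = 0 := fun x hx => by simp [hgdef, hκb _ hx]
  have hga : ∀ x : E, ‖x‖ < a → g x = 0 := fun x hx => by simp [hgdef, hκa _ hx]
  have key := noether_abs hp he hs hR₀ ha hb hΩe hlam hRay hd hu hw hv hv0 h0 huv hg hgc
    (L := L) (fun x => by
      by_cases hx : x ∈ closedBall (0 : E) b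
      · exact hL x hx
      · rw [hgb x (by rw [mem_closedBall_zero_iff] at hx; linarith), norm_zero]; exact hL0)
    (M := M) (fun x => by
      by_cases hx : x ∈ closedBall (0 : E) b
      · exact hM x hx
      · rw [hkb _ (by rw [mem_closedBall_zero_iff] at hx; linarith), abs_zero]; exact hM0)
    (fun x hx => hka _ hx) (fun x hx => hkb _ hx) hga hgb
  rw [← neg_eq_zero, ← integral_neg, ← key]
  congr 1
  ext x
  by_cases hx : κ ‖x‖ = 0
  · simp [hgdef, hx]
  have h1 : a ≤ ‖x‖ := by by_contra h; exact hx (hκa _ (not_le.1 h))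
  have h2 : ‖x‖ ≤ b := by by_contra h; exact hx (hκb _ (not_le.1 h))
  have hxΩ : x ∈ Ω s := by
    rw [hΩe]
    refine ⟨by rw [mem_ball_zero_iff]; linarith, fun h => ?_⟩
    rw [mem_closedBall, dist_eq_norm] at h
    have := norm_sub_norm_le x (s • e)
    rw [norm_smul, he, mul_one, Real.norm_eq_abs, abs_of_pos hs] at this
    linarith
  rw [Qf, huv x hxΩ, abs_of_pos (hv0 x hxΩ)]
  simp only [hgdef, real_inner_smul_left, real_inner_smul_right]
  ring
end Noether2


section Haar
variable {E : Type*} [NormedAddCommGroup E] [InnerProductSpace ℝ E] [CompleteSpace E]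
  [FiniteDimensional ℝ E] [MeasurableSpace E] [BorelSpace E]

/-- The orthogonal group. -/
noncomputable abbrev KE (E : Type*) [NormedAddCommGroup E] [InnerProductSpace ℝ E]
    [CompleteSpace E] :=
  unitary (E →L[ℝ] E)

instance compactKE : CompactSpace (KE E) := by
  refine (isCompact_iff_compactSpace
    (s := ((KE E : Submonoid (E →L[ℝ] E)) : Set (E →L[ℝ] E)))).1 ?_
  refine Metric.isCompact_of_isClosed_isBounded isClosed_unitary ?_
  refine (isBounded_closedBall (x := (0 : E →L[ℝ] E)) (r := 1)).subset fun R hR => ?_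
  rw [mem_closedBall_zero_iff]
  refine ContinuousLinearMap.opNorm_le_bound _ zero_le_one fun x => ?_
  rw [one_mul]
  exact (Unitary.norm_map (⟨R, hR⟩ : KE E) x).le

/-- Normalised Haar measure on the orthogonal group. -/
noncomputable def muK (E : Type*) [NormedAddCommGroup E] [InnerProductSpace ℝ E]
    [CompleteSpace E] [FiniteDimensional ℝ E] : Measure (KE E) :=
  Measure.haarMeasure ⊤

instance : Measure.IsHaarMeasure (muK E) := by unfold muK; infer_instance

instance : IsProbabilityMeasure (muK E) := ⟨by
  have := Measure.haarMeasure_self (K₀ := (⊤ : TopologicalSpace.PositiveCompacts (KE E)))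
  simpa [muK] using this⟩

instance : Measure.IsMulRightInvariant (muK E) := ⟨fun g => by
  have : IsProbabilityMeasure (Measure.map (fun x => x * g) (muK E)) :=
    Measure.isProbabilityMeasure_map (measurable_mul_const g).aemeasurable
  exact Measure.isHaarMeasure_eq_of_isProbabilityMeasure _ _⟩

/-- `R` as a linear isometry equivalence. -/
noncomputable def isoK (R : KE E) : E ≃ₗᵢ[ℝ] E := Unitary.linearIsometryEquiv R

lemma isoK_apply (R : KE E) (x : E) : isoK R x = R.1 x := rfl

lemma normK (R : KE E) (x : E) : ‖R.1 x‖ = ‖x‖ := Unitary.norm_map R x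

lemma innerK (R : KE E) (x y : E) : ⟪R.1 x, R.1 y⟫ = ⟪x, y⟫ := Unitary.inner_map_map R x y

lemma mulK (R S : KE E) (x : E) : (R * S).1 x = R.1 (S.1 x) := rfl

lemma exists_ofIso (S : E ≃ₗᵢ[ℝ] E) : ∃ R : KE E, ∀ x, R.1 x = S x :=
  ⟨Unitary.linearIsometryEquiv.symm S, fun x => rfl⟩

lemma transK {x y : E} (h : ‖x‖ = ‖y‖) : ∃ S : KE E, S.1 x = y := by
  obtain ⟨R, hR⟩ := exists_ofIso (((ℝ ∙ (x - y))ᗮ).reflection)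
  exact ⟨R, by rw [hR, Submodule.reflection_sub h]⟩

lemma continuous_actK : Continuous fun q : KE E × E => q.1.1 q.2 :=
  isBoundedBilinearMap_apply.continuous.comp
    ((continuous_subtype_val.comp continuous_fst).prodMk continuous_snd)

lemma continuous_actK' (x : E) : Continuous fun R : KE E => R.1 x :=
  continuous_actK.comp (continuous_id.prodMk continuous_const)

lemma integrableK {F : Type*} [NormedAddCommGroup F] {f : KE E → F} (hf : Continuous f) :
    Integrable f (muK E) := by
  rw [← integrableOn_univ]
  exact hf.continuousOn.integrableOn_compact isCompact_univ

/-- Spherical average. -/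
noncomputable def av (e : E) (f : E → ℝ) (r : ℝ) : ℝ := ∫ R : KE E, f (r • R.1 e) ∂(muK E)

lemma integral_act {e : E} (he : ‖e‖ = 1) (f : E → ℝ) (x : E) :
    ∫ R : KE E, f (R.1 x) ∂(muK E) = av e f ‖x‖ := by
  obtain ⟨S, hS⟩ := transK (x := ‖x‖ • e) (y := x) (by rw [norm_smul, he]; simp)
  have h := integral_mul_right_eq_self (μ := muK E) (fun R => f (R.1 (‖x‖ • e))) S
  simp only [mulK, hS] at h
  rw [h, av]
  simp only [map_smul]

lemma integral_eq_av {e : E} (he : ‖e‖ = 1) {f : E → ℝ} (hf : Continuous f)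
    (hc : HasCompactSupport f) : ∫ x, f x = ∫ x : E, av e f ‖x‖ := by
  have h1 : ∀ R : KE E, ∫ x, f (R.1 x) = ∫ x, f x := fun R => integral_comp_isom (isoK R) f
  calc ∫ x, f x = ∫ R : KE E, (∫ x, f (R.1 x)) ∂(muK E) := by simp [h1]
    _ = ∫ x, (∫ R : KE E, f (R.1 x) ∂(muK E)) := by
      obtain ⟨C, hC⟩ := hc.isCompact.isBounded.subset_closedBall (0 : E)
      refine integral_integral_swap_of_hasCompactSupport
        (f := fun (R : KE E) (x : E) => f (R.1 x)) (hf.comp continuous_actK) ?_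
      refine HasCompactSupport.intro (K := univ ×ˢ closedBall 0 C)
        (isCompact_univ.prod (isCompact_closedBall _ _)) fun q hq => ?_
      have : q.1.1 q.2 ∉ tsupport f := fun h => by
        have := hC h
        rw [mem_closedBall_zero_iff, normK] at this
        exact hq ⟨mem_univ _, mem_closedBall_zero_iff.2 this⟩
      exact image_eq_zero_of_notMem_tsupport (f := f) this
    _ = _ := by simp only [integral_act he]

lemma av_comp {e : E} (f : E → ℝ) (S : KE E) (r : ℝ) : av e (fun x => f (S.1 x)) r = av e f r := by
  have h := integral_mul_left_eq_self (μ := muK E) (fun R => f (r • R.1 e)) S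
  simp only [mulK] at h
  rw [av, av, ← h]
  simp only [map_smul]

lemma continuous_ray (e : E) : Continuous fun q : ℝ × KE E => q.1 • q.2.1 e :=
  continuous_fst.smul ((continuous_actK' e).comp continuous_snd)

lemma continuous_paramK {X : Type*} [TopologicalSpace X] [FirstCountableTopology X]
    [LocallyCompactSpace X] {f : X → KE E → ℝ}
    (hf : Continuous (Function.uncurry f)) : Continuous fun r => ∫ R, f r R ∂(muK E) := by
  have := continuous_parametric_integral_of_continuous (μ := muK E) hf isCompact_univ
  simpa using this

lemma continuous_av (e : E) {f : E → ℝ} (hf : Continuous f) : Continuous (av e f) :=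
  continuous_paramK (f := fun r R => f (r • R.1 e)) (hf.comp (continuous_ray e))

/-- The dimensional constant in polar coordinates. -/
noncomputable def cN (E : Type*) [NormedAddCommGroup E] [InnerProductSpace ℝ E]
    [FiniteDimensional ℝ E] [MeasurableSpace E] [BorelSpace E] : ℝ :=
  Module.finrank ℝ E * volume.real (ball (0 : E) 1)

lemma cN_pos [Nontrivial E] : 0 < cN E := by
  unfold cN
  have h1 : 0 < Module.finrank ℝ E := Module.finrank_pos
  have h2 : 0 < volume.real (ball (0 : E) 1) :=
    ENNReal.toReal_pos (measure_ball_pos _ _ one_pos).ne' measure_ball_lt_top.ne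
  positivity

lemma polar_radial [Nontrivial E] (f : ℝ → ℝ) :
    ∫ x : E, f ‖x‖ = cN E * ∫ r in Ioi (0 : ℝ), r ^ (Module.finrank ℝ E - 1) * f r := by
  rw [integral_fun_norm_addHaar]
  simp [cN, mul_assoc]

lemma polar [Nontrivial E] {e : E} (he : ‖e‖ = 1) {f : E → ℝ} (hf : Continuous f)
    (hc : HasCompactSupport f) :
    ∫ x, f x = cN E * ∫ r in Ioi (0 : ℝ), r ^ (Module.finrank ℝ E - 1) * av e f r := by
  rw [integral_eq_av he hf hc, polar_radial]

lemma hasDerivAt_ray {u : E → ℝ} (hu : ContDiff ℝ 1 u) (ω : E) (r : ℝ) :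
    HasDerivAt (fun r : ℝ => u (r • ω)) ⟪gradient u (r • ω), ω⟫ r := by
  have h1 : HasDerivAt (fun r : ℝ => r • ω) ω r := by simpa using (hasDerivAt_id r).smul_const ω
  exact (hasGrad_iff.1 (hu.hasGrad (r • ω))).comp_hasDerivAt r h1

lemma hasDerivAt_av {e : E} {u : E → ℝ} (hu : ContDiff ℝ 1 u) {c : KE E → ℝ}
    (hc : Continuous c) (r : ℝ) :
    HasDerivAt (fun r => ∫ R : KE E, u (r • R.1 e) * c R ∂(muK E))
      (∫ R : KE E, ⟪gradient u (r • R.1 e), R.1 e⟫ * c R ∂(muK E)) r := by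
  have cF : Continuous fun q : ℝ × KE E => ⟪gradient u (q.1 • q.2.1 e), q.2.1 e⟫ * c q.2 :=
    ((hu.continuous_grad.comp (continuous_ray e)).inner
      ((continuous_actK' e).comp continuous_snd)).mul (hc.comp continuous_snd)
  obtain ⟨B, hB⟩ := ((isCompact_closedBall r 1).prod (isCompact_univ (X := KE E))).exists_bound_of_continuousOn
    cF.continuousOn
  have cu : ∀ r : ℝ, Continuous fun R : KE E => u (r • R.1 e) * c R := fun r =>
    (hu.continuous.comp (continuous_const.smul (continuous_actK' e))).mul hc
  refine (hasDerivAt_integral_of_dominated_loc_of_deriv_le (s := closedBall r 1)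
    (F := fun r R => u (r • R.1 e) * c R)
    (F' := fun r R => ⟪gradient u (r • R.1 e), R.1 e⟫ * c R) (bound := fun _ => B) (closedBall_mem_nhds r one_pos) ?_ (integrableK (cu r)) ?_ ?_
    (integrable_const _) ?_).2
  · exact Eventually.of_forall fun r => (integrableK (cu r)).aestronglyMeasurable
  · exact (integrableK (cF.comp (continuous_const.prodMk continuous_id))).aestronglyMeasurable
  · exact Eventually.of_forall fun R t ht => hB (t, R) ⟨ht, mem_univ _⟩
  · exact Eventually.of_forall fun R t ht => (hasDerivAt_ray hu _ t).mul_const _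
end Haar


section AvQ
variable {E : Type*} [NormedAddCommGroup E] [InnerProductSpace ℝ E] [CompleteSpace E]
  [FiniteDimensional ℝ E] [MeasurableSpace E] [BorelSpace E]

/-- The Noether integrand multiplied by the norm. -/
noncomputable def Qx (p lam : ℝ) (e : E) (u : E → ℝ) (x : E) : ℝ :=
  ⟪x, e⟫ * (‖gradient u x‖ ^ p - lam * |u x| ^ p) -
    p * ⟪Fp p (gradient u x), x⟫ * ⟪e, gradient u x⟫

lemma Qx_eq (p lam : ℝ) (e : E) (u : E → ℝ) (x : E) : ‖x‖ * Qf p lam e u x = Qx p lam e u x := by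
  by_cases hx : x = 0
  · simp [hx, Qx]
  have : ‖x‖ ≠ 0 := norm_ne_zero_iff.2 hx
  rw [Qf, Qx]
  simp only [real_inner_smul_left, real_inner_smul_right]
  field_simp

lemma continuous_Qx {p : ℝ} (hp : 1 < p) (lam : ℝ) (e : E) {u : E → ℝ} (hu : ContDiff ℝ 1 u) :
    Continuous (Qx p lam e u) := by
  have hp0 : 0 ≤ p := by linarith
  have c1 := hu.continuous_grad
  have c2 := hu.continuous
  refine ((continuous_id.inner continuous_const).mul
    ((c1.norm.rpow_const fun _ => Or.inr hp0).sub
      (continuous_const.mul (c2.abs.rpow_const fun _ => Or.inr hp0)))).sub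
    ((continuous_const.mul (((continuous_Fp hp).comp c1).inner continuous_id)).mul
      (continuous_const.inner c1))

lemma av_nonpos_of_radial {e : E} (he : ‖e‖ = 1) {ρ R₁ : ℝ} (hρ : 0 < ρ) {q : E → ℝ}
    (hq : Continuous q)
    (h : ∀ (a b : ℝ) (κ : ℝ → ℝ), ρ < a → b < R₁ → ContDiff ℝ 1 κ → (∀ r, r < a → κ r = 0) →
      (∀ r, b < r → κ r = 0) → ∫ x, κ ‖x‖ * q x = 0) {r₀ : ℝ} (h1 : ρ < r₀) (h2 : r₀ < R₁) :
    av e q r₀ ≤ 0 := by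
  by_contra hA
  push Not at hA
  have hAc := continuous_av e hq
  obtain ⟨ε₁, hε₁, hA1⟩ := Metric.eventually_nhds_iff.1
    (hAc.continuousAt.eventually (lt_mem_nhds hA))
  obtain ⟨ε, hε, hεa, hεb, hεc⟩ : ∃ ε > 0, ε < r₀ - ρ ∧ ε < R₁ - r₀ ∧ ε < ε₁ := by
    refine ⟨min (min (r₀ - ρ) (R₁ - r₀)) ε₁ / 2, ?_, ?_, ?_, ?_⟩
    · have : 0 < min (min (r₀ - ρ) (R₁ - r₀)) ε₁ := by
        refine lt_min (lt_min ?_ ?_) hε₁ <;> linarith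
      linarith
    all_goals
      have h3 : 0 < min (min (r₀ - ρ) (R₁ - r₀)) ε₁ := by
        refine lt_min (lt_min ?_ ?_) hε₁ <;> linarith
      have h4 := min_le_left (min (r₀ - ρ) (R₁ - r₀)) ε₁
      have h5 := min_le_right (min (r₀ - ρ) (R₁ - r₀)) ε₁
      have h6 := min_le_left (r₀ - ρ) (R₁ - r₀)
      have h7 := min_le_right (r₀ - ρ) (R₁ - r₀)
      linarith
  set η : ℝ → ℝ := fun r => bet 1 (1 + (ε ^ 2 - (r - r₀) ^ 2)) with hη
  have hηs : ContDiff ℝ 1 η := (contDiff_bet one_pos).comp (by fun_prop)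
  have hηc : Continuous η := hηs.continuous
  have hη0 : ∀ r, ε ≤ |r - r₀| → η r = 0 := fun r hr => bet_of_le (by
    have := sq_abs (r - r₀)
    nlinarith)
  have key := h (r₀ - ε) (r₀ + ε) η (by linarith) (by linarith) hηs
    (fun r hr => hη0 r (by rw [abs_of_neg (by linarith)]; linarith))
    (fun r hr => hη0 r (by rw [abs_of_pos (by linarith)]; linarith))
  have cf : Continuous fun x : E => η ‖x‖ * q x := (hηc.comp continuous_norm).mul hq
  have hz : ∀ r, r₀ + ε < r → η r = 0 := fun r hr =>
    hη0 r (by rw [abs_of_pos (by linarith)]; linarith)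
  rw [integral_eq_av he cf] at key
  swap
  · refine HasCompactSupport.intro (isCompact_closedBall (0 : E) (r₀ + ε)) fun x hx => ?_
    rw [mem_closedBall_zero_iff, not_le] at hx
    rw [hz _ hx, zero_mul]
  have e1 : ∀ x : E, av e (fun x => η ‖x‖ * q x) ‖x‖ = η ‖x‖ * av e q ‖x‖ := fun x => by
    rw [av, av, ← integral_const_mul]
    congr 1; ext R
    rw [norm_smul, normK, he]; simp
  simp only [e1] at key
  have hpos : 0 < ∫ x : E, η ‖x‖ * av e q ‖x‖ := by
    refine Continuous.integral_pos_of_hasCompactSupport_nonneg_nonzero (x := r₀ • e)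
      ((hηc.comp continuous_norm).mul (hAc.comp continuous_norm)) ?_ ?_ ?_
    · refine HasCompactSupport.intro (isCompact_closedBall (0 : E) (r₀ + ε)) fun x hx => ?_
      rw [mem_closedBall_zero_iff, not_le] at hx
      rw [hz _ hx, zero_mul]
    · intro x
      show 0 ≤ η ‖x‖ * av e q ‖x‖
      by_cases hx : ε ≤ |‖x‖ - r₀|
      · rw [hη0 _ hx, zero_mul]
      · push Not at hx
        refine mul_nonneg (bet_nonneg one_pos _) (hA1 ?_).le
        rw [Real.dist_eq]; linarith
    · have : ‖r₀ • e‖ = r₀ := by rw [norm_smul, he, mul_one, Real.norm_of_nonneg (by linarith)]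
      rw [this]
      have : 0 < η r₀ := by
        have h9 : 1 < 1 + (ε ^ 2 - (r₀ - r₀) ^ 2) := by
          have : 0 < ε ^ 2 := by positivity
          rw [sub_self]; linarith
        simp only [hη]
        rw [bet_of_ge h9.le]
        have : 0 < 1 + (ε ^ 2 - (r₀ - r₀) ^ 2) - 1 := by linarith
        positivity
      exact (mul_pos this hA).ne'
  linarith

lemma av_zero_of_radial {e : E} (he : ‖e‖ = 1) {ρ R₁ : ℝ} (hρ : 0 < ρ) (hρR : ρ < R₁) {q : E → ℝ}
    (hq : Continuous q)
    (h : ∀ (a b : ℝ) (κ : ℝ → ℝ), ρ < a → b < R₁ → ContDiff ℝ 1 κ → (∀ r, r < a → κ r = 0) →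
      (∀ r, b < r → κ r = 0) → ∫ x, κ ‖x‖ * q x = 0) :
    ∀ r ∈ Ioc ρ R₁, av e q r = 0 := by
  have h1 : ∀ r ∈ Ioo ρ R₁, av e q r = 0 := by
    intro r hr
    refine le_antisymm (av_nonpos_of_radial he hρ hq h hr.1 hr.2) ?_
    have := av_nonpos_of_radial he hρ hq.neg (fun a b κ ha hb hκ h1 h2 => by
      have := h a b κ ha hb hκ h1 h2
      simpa [integral_neg] using this) hr.1 hr.2
    have h3 : av e (-q) r = - av e q r := by simp [av, integral_neg]
    linarith
  intro r hr
  have hcl : closure (Ioo ρ R₁) ⊆ {r | av e q r = 0} :=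
    closure_minimal h1 (isClosed_eq (continuous_av e hq) continuous_const)
  rw [closure_Ioo hρR.ne] at hcl
  exact hcl ⟨hr.1.le, hr.2⟩
end AvQ


section Cheb
variable {E : Type*} [NormedAddCommGroup E] [InnerProductSpace ℝ E] [CompleteSpace E]
  [FiniteDimensional ℝ E] [MeasurableSpace E] [BorelSpace E]

lemma contK_zero {f : KE E → ℝ} (hf : Continuous f) (h0 : ∀ R, 0 ≤ f R)
    (hi : ∫ R, f R ∂(muK E) = 0) (R : KE E) : f R = 0 := by
  have h1 := (integral_eq_zero_iff_of_nonneg h0 (integrableK hf)).1 hi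
  have h2 := (Continuous.ae_eq_iff_eq (muK E) hf continuous_zero).1 h1
  exact congrFun h2 R

lemma cheb_inner {f g : KE E → ℝ} (hf : Continuous f) (hg : Continuous g) (R : KE E) :
    ∫ S, (f R - f S) * (g R - g S) ∂(muK E) =
      f R * g R - f R * (∫ S, g S ∂(muK E)) - g R * (∫ S, f S ∂(muK E)) +
        ∫ S, f S * g S ∂(muK E) := by
  have i1 := integrableK hf
  have i2 := integrableK hg
  have i3 : Integrable (fun S => f S * g S) (muK E) := integrableK (hf.mul hg)
  have e1 : ∀ S, (f R - f S) * (g R - g S) = f R * g R - f R * g S - g R * f S + f S * g S :=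
    fun S => by ring
  simp only [e1]
  have j1 : Integrable (fun S => f R * g S) (muK E) := i2.const_mul _
  have j2 : Integrable (fun S => g R * f S) (muK E) := i1.const_mul _
  have j0 : Integrable (fun S : KE E => f R * g R) (muK E) := integrable_const _
  have j3 : Integrable (fun S => f R * g R - f R * g S) (muK E) := j0.sub j1
  have j4 : Integrable (fun S => f R * g R - f R * g S - g R * f S) (muK E) := j3.sub j2
  rw [integral_add j4 i3, integral_sub j3 j2, integral_sub j0 j1, integral_const_mul,
    integral_const_mul (g R)]
  simp [integral_const_mul]

lemma cheb_outer {f g : KE E → ℝ} (hf : Continuous f) (hg : Continuous g) :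
    ∫ R, (f R * g R - f R * (∫ S, g S ∂(muK E)) - g R * (∫ S, f S ∂(muK E)) +
        ∫ S, f S * g S ∂(muK E)) ∂(muK E) =
      2 * (∫ S, f S * g S ∂(muK E) - (∫ S, f S ∂(muK E)) * ∫ S, g S ∂(muK E)) := by
  have i1 := integrableK hf
  have i2 := integrableK hg
  have i3 : Integrable (fun S => f S * g S) (muK E) := integrableK (hf.mul hg)
  set a := ∫ S, g S ∂(muK E) with ha
  set b := ∫ S, f S ∂(muK E) with hb
  set c := ∫ S, f S * g S ∂(muK E) with hc
  have j1 : Integrable (fun S => f S * a) (muK E) := i1.mul_const _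
  have j2 : Integrable (fun S => g S * b) (muK E) := i2.mul_const _
  have j3 : Integrable (fun S => f S * g S - f S * a) (muK E) := i3.sub j1
  have j4 : Integrable (fun S => f S * g S - f S * a - g S * b) (muK E) := j3.sub j2
  rw [integral_add j4 (integrable_const _), integral_sub j3 j2, integral_sub i3 j1,
    integral_mul_const, integral_mul_const, ← ha, ← hb, ← hc]
  simp
  ring

/-- Chebyshev's inequality for similarly ordered functions. -/
lemma cheb_le {f g : KE E → ℝ} (hf : Continuous f) (hg : Continuous g)
    (h : ∀ R S, 0 ≤ (f R - f S) * (g R - g S)) :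
    (∫ S, f S ∂(muK E)) * (∫ S, g S ∂(muK E)) ≤ ∫ S, f S * g S ∂(muK E) := by
  have h1 := cheb_outer hf hg
  have h2 : 0 ≤ ∫ R, (f R * g R - f R * (∫ S, g S ∂(muK E)) - g R * (∫ S, f S ∂(muK E)) +
        ∫ S, f S * g S ∂(muK E)) ∂(muK E) := by
    refine integral_nonneg fun R => ?_
    show 0 ≤ f R * g R - f R * (∫ S, g S ∂(muK E)) - g R * (∫ S, f S ∂(muK E)) +
        ∫ S, f S * g S ∂(muK E)
    rw [← cheb_inner hf hg R]
    exact integral_nonneg fun S => h R S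
  linarith

lemma cheb_eq {f g : KE E → ℝ} (hf : Continuous f) (hg : Continuous g)
    (h : ∀ R S, 0 ≤ (f R - f S) * (g R - g S))
    (he : ∫ S, f S * g S ∂(muK E) = (∫ S, f S ∂(muK E)) * (∫ S, g S ∂(muK E))) (R S : KE E) :
    (f R - f S) * (g R - g S) = 0 := by
  have h1 := cheb_outer hf hg
  have h2 : ∫ S, (f R - f S) * (g R - g S) ∂(muK E) = 0 := by
    rw [cheb_inner hf hg R]
    refine contK_zero (f := fun R => f R * g R - f R * (∫ S, g S ∂(muK E)) -
      g R * (∫ S, f S ∂(muK E)) + ∫ S, f S * g S ∂(muK E)) ?_ ?_ ?_ R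
    · exact (((hf.mul hg).sub (hf.mul continuous_const)).sub (hg.mul continuous_const)).add
        continuous_const
    · intro R
      show 0 ≤ f R * g R - f R * (∫ S, g S ∂(muK E)) - g R * (∫ S, f S ∂(muK E)) +
        ∫ S, f S * g S ∂(muK E)
      rw [← cheb_inner hf hg R]
      exact integral_nonneg fun S => h R S
    · rw [h1, he]; ring
  exact contK_zero (f := fun S => (f R - f S) * (g R - g S))
    ((continuous_const.sub hf).mul (continuous_const.sub hg)) (fun S => h R S) h2 S

lemma exists_negK : ∃ S : KE E, ∀ x, S.1 x = -x := by
  obtain ⟨S, hS⟩ := exists_ofIso (LinearIsometryEquiv.neg ℝ (E := E))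
  exact ⟨S, fun x => by rw [hS]; rfl⟩

/-- odd functions integrate to zero -/
lemma integralK_neg (e : E) (f : E → ℝ) :
    ∫ R : KE E, f (- R.1 e) ∂(muK E) = ∫ R : KE E, f (R.1 e) ∂(muK E) := by
  obtain ⟨S, hS⟩ := exists_negK (E := E)
  have h := integral_mul_left_eq_self (μ := muK E) (fun R => f (R.1 e)) S
  simp only [mulK, hS] at h
  exact h

lemma integralK_n1 (e : E) : ∫ R : KE E, ⟪R.1 e, e⟫ ∂(muK E) = 0 := by
  have h := integralK_neg e (fun x => ⟪x, e⟫)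
  simp only [inner_neg_left, integral_neg] at h
  linarith
end Cheb

section ShellE
variable {E : Type*} [NormedAddCommGroup E] [InnerProductSpace ℝ E] [CompleteSpace E]
  [FiniteDimensional ℝ E] [MeasurableSpace E] [BorelSpace E]

/-- The data on the outer shell. -/
structure Shell (p lam : ℝ) (e : E) (ρ R₁ : ℝ) (u : E → ℝ) : Prop where
  hp : 1 < p
  he : ‖e‖ = 1
  hρ : 0 < ρ
  hρR : ρ < R₁
  lam0 : 0 ≤ lam
  hu : ContDiff ℝ 1 u
  pos : ∀ x, ρ < ‖x‖ → ‖x‖ < R₁ → 0 < u x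
  bd : ∀ x, ‖x‖ = R₁ → u x = 0
  weak : WeakSol p lam {x | ρ < ‖x‖ ∧ ‖x‖ < R₁} u
  mono : ∀ x y, ‖x‖ = ‖y‖ → ρ < ‖x‖ → ‖x‖ < R₁ → ⟪e, x⟫ ≤ ⟪e, y⟫ → u y ≤ u x
  avQ : ∀ r ∈ Ioc ρ R₁, av e (Qx p lam e u) r = 0

lemma deriv_nonpos_of_left {f : ℝ → ℝ} {f' a b : ℝ} (hab : a < b) (hf : HasDerivAt f f' b)
    (h0 : f b = 0) (h : ∀ t ∈ Ioo a b, 0 ≤ f t) : f' ≤ 0 := by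
  have h1 := hf.tendsto_slope
  have h2 : Tendsto (slope f b) (𝓝[<] b) (𝓝 f') := h1.mono_left
    (nhdsWithin_mono _ fun x hx => ne_of_lt hx)
  refine le_of_tendsto h2 ?_
  filter_upwards [Ioo_mem_nhdsLT hab] with t ht
  rw [slope_def_field, h0, sub_zero]
  exact div_nonpos_of_nonneg_of_nonpos (h t ht) (by linarith [ht.2])

variable {p lam ρ R₁ : ℝ} {e : E} {u : E → ℝ}

lemma Shell.nontriv (H : Shell p lam e ρ R₁ u) : Nontrivial E :=
  ⟨⟨e, 0, fun h => by have := H.he; rw [h] at this; simp at this⟩⟩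

lemma Shell.hR (H : Shell p lam e ρ R₁ u) : 0 < R₁ := H.hρ.trans H.hρR

/-- boundary gradient is radial -/
lemma Shell.grad_bd (H : Shell p lam e ρ R₁ u) {ω : E} (hω : ‖ω‖ = 1) :
    gradient u (R₁ • ω) = ⟪gradient u (R₁ • ω), ω⟫ • ω := by
  set g := gradient u (R₁ • ω) with hg
  set τ := g - ⟪g, ω⟫ • ω with hτ
  have hτω : ⟪ω, τ⟫ = 0 := by
    rw [hτ, inner_sub_right, real_inner_smul_right, real_inner_self_eq_norm_sq, hω,
      real_inner_comm]; ring
  set γ : ℝ → E := fun t => Real.cos (‖τ‖ * t) • (‖τ‖ • R₁ • ω) + Real.sin (‖τ‖ * t) • (R₁ • τ) with hγ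
  by_cases hτ0 : τ = 0
  · rw [hτ] at hτ0; exact sub_eq_zero.1 hτ0
  have hn : 0 < ‖τ‖ := norm_pos_iff.2 hτ0
  exfalso
  set γ : ℝ → E := fun t => R₁ • (Real.cos t • ω + Real.sin t • (‖τ‖⁻¹ • τ)) with hγ
  have hγd : HasDerivAt γ (R₁ • (‖τ‖⁻¹ • τ)) 0 := by
    have h1 := ((Real.hasDerivAt_cos 0).smul_const ω).add
      ((Real.hasDerivAt_sin 0).smul_const (‖τ‖⁻¹ • τ))
    have h2 := h1.const_smul R₁
    simp only [Real.sin_zero, neg_zero, zero_smul, Real.cos_zero, one_smul, zero_add] at h2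
    exact h2
  have hγ0 : γ 0 = R₁ • ω := by simp [hγ]
  have hγn : ∀ t, ‖γ t‖ = R₁ := by
    intro t
    have h1 : ‖Real.cos t • ω + Real.sin t • (‖τ‖⁻¹ • τ)‖ ^ 2 = 1 := by
      rw [norm_add_sq_real, norm_smul, norm_smul, norm_smul, hω, inner_smul_left, inner_smul_right,
        inner_smul_right, hτω, norm_inv, norm_norm, inv_mul_cancel₀ hn.ne']
      simp
    have h2 : ‖Real.cos t • ω + Real.sin t • (‖τ‖⁻¹ • τ)‖ = 1 := by
      have := norm_nonneg (Real.cos t • ω + Real.sin t • (‖τ‖⁻¹ • τ))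
      nlinarith
    rw [hγ]; simp only; rw [norm_smul, h2, mul_one, Real.norm_of_nonneg H.hR.le]
  have h3 : HasDerivAt (fun t => u (γ t)) ⟪g, R₁ • (‖τ‖⁻¹ • τ)⟫ 0 := by
    have h4 : HasGradientAt u g (γ 0) := by rw [hγ0]; exact H.hu.hasGrad _
    exact (hasGrad_iff.1 h4).comp_hasDerivAt 0 hγd
  have h5 : (fun t => u (γ t)) = fun _ => 0 := funext fun t => H.bd _ (hγn t)
  rw [h5] at h3
  have h6 := h3.unique (hasDerivAt_const 0 0)
  rw [real_inner_smul_right, real_inner_smul_right] at h6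
  have h7 : ⟪g, τ⟫ = ‖τ‖ ^ 2 := by
    have : g = τ + ⟪g, ω⟫ • ω := by rw [hτ]; abel
    conv_lhs => rw [this]
    rw [inner_add_left, real_inner_smul_left, hτω, real_inner_self_eq_norm_sq]; ring
  rw [h7] at h6
  have := H.hR
  have : 0 < R₁ * (‖τ‖⁻¹ * ‖τ‖ ^ 2) := by positivity
  linarith

lemma norm_ray {ω : E} (hω : ‖ω‖ = 1) {t : ℝ} (ht : 0 ≤ t) : ‖t • ω‖ = t := by
  rw [norm_smul, hω, mul_one, Real.norm_of_nonneg ht]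

lemma Shell.ur_nonpos (H : Shell p lam e ρ R₁ u) {ω : E} (hω : ‖ω‖ = 1) :
    ⟪gradient u (R₁ • ω), ω⟫ ≤ 0 := by
  refine deriv_nonpos_of_left H.hρR (hasDerivAt_ray H.hu ω R₁)
    (H.bd _ (norm_ray hω H.hR.le)) fun t ht => ?_
  have hn := norm_ray hω (t := t) (by linarith [ht.1, H.hρ])
  exact (H.pos _ (by rw [hn]; exact ht.1) (by rw [hn]; exact ht.2)).le

lemma Shell.ur_mono (H : Shell p lam e ρ R₁ u) {ω ω' : E} (hω : ‖ω‖ = 1) (hω' : ‖ω'‖ = 1)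
    (hle : ⟪ω, e⟫ ≤ ⟪ω', e⟫) :
    ⟪gradient u (R₁ • ω), ω⟫ ≤ ⟪gradient u (R₁ • ω'), ω'⟫ := by
  have h := deriv_nonpos_of_left H.hρR
    ((hasDerivAt_ray H.hu ω R₁).sub (hasDerivAt_ray H.hu ω' R₁)) ?_ fun t ht => ?_
  · linarith
  · simp [H.bd _ (norm_ray hω H.hR.le), H.bd _ (norm_ray hω' H.hR.le)]
  · have ht0 : 0 ≤ t := by linarith [ht.1, H.hρ]
    have hn := norm_ray hω ht0
    have hn' := norm_ray hω' ht0
    simp only [Pi.sub_apply, sub_nonneg]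
    refine H.mono _ _ (by rw [hn, hn']) (by rw [hn]; exact ht.1) (by rw [hn]; exact ht.2) ?_
    rw [real_inner_smul_right, real_inner_smul_right, real_inner_comm, real_inner_comm ω' e]
    exact mul_le_mul_of_nonneg_left hle ht0

/-- The normal derivative is constant on the outer sphere. -/
lemma Shell.exists_c (H : Shell p lam e ρ R₁ u) :
    ∃ c : ℝ, 0 ≤ c ∧ ∀ ω : E, ‖ω‖ = 1 → gradient u (R₁ • ω) = (-c) • ω := by
  have hp := H.hp
  have hR := H.hR
  set q : E → ℝ := fun ω => - ⟪gradient u (R₁ • ω), ω⟫ with hq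
  have hq0 : ∀ ω : E, ‖ω‖ = 1 → 0 ≤ q ω := fun ω hω => by
    have := H.ur_nonpos hω; simp only [hq]; linarith
  have hg : ∀ ω : E, ‖ω‖ = 1 → gradient u (R₁ • ω) = - q ω • ω := fun ω hω => by
    have := H.grad_bd hω
    simp only [hq, neg_neg]; exact this
  have nK : ∀ R : KE E, ‖R.1 e‖ = 1 := fun R => by rw [normK, H.he]
  have cq : Continuous fun R : KE E => q (R.1 e) := by
    have c1 := continuous_actK' e
    exact ((H.hu.continuous_grad.comp (continuous_const.smul c1)).inner c1).neg
  have cqp : Continuous fun R : KE E => - q (R.1 e) ^ p :=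
    (cq.rpow_const fun _ => Or.inr (by linarith)).neg
  have cn : Continuous fun R : KE E => ⟪R.1 e, e⟫ := (continuous_actK' e).inner continuous_const
  have hQ : ∀ R : KE E, Qx p lam e u (R₁ • R.1 e) =
      (R₁ * (p - 1)) * (⟪R.1 e, e⟫ * - q (R.1 e) ^ p) := by
    intro R
    set ω := R.1 e with hω
    have h1 := nK R
    rw [← hω] at h1
    have hq1 := hq0 ω h1
    have h2 : Fp p (-ω) = -ω := by simp [Fp, h1]
    have h3 : (-q ω) • ω = q ω • (-ω) := by rw [smul_neg, neg_smul]
    have h4 : ‖q ω • (-ω)‖ = q ω := by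
      rw [norm_smul, norm_neg ω, h1, mul_one, Real.norm_of_nonneg hq1]
    rw [Qx, hg ω h1, H.bd _ (norm_ray h1 hR.le), h3, h4, Fp_smul hp hq1, h2, abs_zero, Real.zero_rpow (by linarith)]
    simp only [real_inner_smul_left, real_inner_smul_right, inner_neg_left, inner_neg_right,
      real_inner_self_eq_norm_sq, h1, mul_one]
    rw [real_inner_comm ω e]
    have := rpow_pm1_mul hp hq1
    rw [← this]
    ring
  have h1 : ∫ R : KE E, ⟪R.1 e, e⟫ * - q (R.1 e) ^ p ∂(muK E) = 0 := by
    have := H.avQ R₁ ⟨H.hρR, le_rfl⟩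
    rw [av] at this
    simp only [hQ] at this
    rw [integral_const_mul] at this
    have h2 : R₁ * (p - 1) ≠ 0 := by
      have : 0 < p - 1 := by linarith
      positivity
    exact (mul_eq_zero.1 this).resolve_left h2
  have key := cheb_eq cn cqp ?_ ?_
  rotate_left
  · intro R S
    have hm : ∀ R S : KE E, ⟪R.1 e, e⟫ ≤ ⟪S.1 e, e⟫ → - q (R.1 e) ^ p ≤ - q (S.1 e) ^ p := by
      intro R S h
      have := H.ur_mono (nK R) (nK S) h
      refine neg_le_neg (Real.rpow_le_rpow (hq0 _ (nK S)) ?_ (by linarith))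
      simp only [hq]; linarith
    rcases le_total ⟪R.1 e, e⟫ ⟪S.1 e, e⟫ with h | h
    · exact mul_nonneg_of_nonpos_of_nonpos (by linarith) (by linarith [hm R S h])
    · exact mul_nonneg (by linarith) (by linarith [hm S R h])
  · rw [h1, integralK_n1, zero_mul]
  have hne : ∀ ω ω' : E, ‖ω‖ = 1 → ‖ω'‖ = 1 → ⟪ω, e⟫ ≠ ⟪ω', e⟫ → q ω = q ω' := by
    intro ω ω' h h' hn
    obtain ⟨R, hR⟩ := transK (x := e) (y := ω) (by rw [h, H.he])
    obtain ⟨S, hS⟩ := transK (x := e) (y := ω') (by rw [h', H.he])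
    have := key R S
    simp only [hR, hS] at this
    have h3 := (mul_eq_zero.1 this).resolve_left (sub_ne_zero.2 hn)
    have h4 : q ω ^ p = q ω' ^ p := by linarith
    exact (Real.rpow_left_inj (hq0 _ h) (hq0 _ h') (by linarith)).1 h4
  have hee : ⟪e, e⟫ = (1 : ℝ) := by rw [real_inner_self_eq_norm_sq, H.he]; norm_num
  have hne' : ‖-e‖ = 1 := by rw [norm_neg, H.he]
  have h5 : q (-e) = q e := hne _ _ hne' H.he (by rw [inner_neg_left, hee]; norm_num)
  refine ⟨q e, hq0 _ H.he, fun ω hω => ?_⟩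
  have : q ω = q e := by
    by_cases h : ⟪ω, e⟫ = ⟪e, e⟫
    · rw [← h5]
      refine hne _ _ hω hne' ?_
      rw [h, inner_neg_left, hee]; norm_num
    · exact hne _ _ hω H.he h
  rw [hg ω hω, this]
end ShellE


section Hopf
variable {E : Type*} [NormedAddCommGroup E] [InnerProductSpace ℝ E] [CompleteSpace E]
  [FiniteDimensional ℝ E] [MeasurableSpace E] [BorelSpace E]

lemma continuous_inv_normpow {f : E → ℝ} (hf : Continuous f) {a : ℝ} (ha : 0 < a)
    (h0 : ∀ x, ‖x‖ < a → f x = 0) (k : ℕ) : Continuous fun x => (‖x‖ ^ k)⁻¹ * f x := by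
  have h1 : (fun x => (‖x‖ ^ k)⁻¹ * f x) = fun x => (max a ‖x‖ ^ k)⁻¹ * f x := by
    funext x
    rcases lt_or_ge ‖x‖ a with h | h
    · rw [h0 x h]; simp
    · rw [max_eq_right h]
  rw [h1]
  refine Continuous.mul (Continuous.inv₀ ((continuous_const.max continuous_norm).pow k) fun x => ?_) hf
  have : 0 < max a ‖x‖ := lt_max_of_lt_left ha
  positivity

lemma radial_divfree [Nontrivial E] {e : E} (he : ‖e‖ = 1) {φ : E → ℝ} (hφ : ContDiff ℝ 1 φ)
    (hc : HasCompactSupport φ) {a : ℝ} (ha : 0 < a)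
    (h0 : ∀ x, ‖x‖ < a → gradient φ x = 0) (h00 : φ 0 = 0) :
    ∫ x, (‖x‖ ^ (Module.finrank ℝ E))⁻¹ * ⟪x, gradient φ x⟫ = 0 := by
  have hN : 0 < Module.finrank ℝ E := Module.finrank_pos
  have hcont : Continuous fun x => (‖x‖ ^ (Module.finrank ℝ E))⁻¹ * ⟪x, gradient φ x⟫ :=
    continuous_inv_normpow (continuous_id.inner hφ.continuous_grad) ha
      (fun x hx => by simp [h0 x hx]) _
  obtain ⟨B, hB⟩ := hc.isCompact.isBounded.subset_closedBall (0 : E)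
  have hz : ∀ x, B < ‖x‖ → φ x = 0 := fun x hx => by
    refine image_eq_zero_of_notMem_tsupport fun h => ?_
    have := mem_closedBall_zero_iff.1 (hB h); linarith
  have hgz : ∀ x, x ∉ tsupport φ → gradient φ x = 0 := fun x hx => gradient_eq_zero_of_notMem hx
  rw [polar he hcont (HasCompactSupport.intro hc.isCompact fun x hx => by simp [hgz x hx])]
  have hd := fun r => hasDerivAt_av (e := e) hφ (c := fun _ => 1) continuous_const r
  simp only [mul_one] at hd
  set A := fun r : ℝ => ∫ R : KE E, φ (r • R.1 e) ∂(muK E) with hA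
  set A' := fun r : ℝ => ∫ R : KE E, ⟪gradient φ (r • R.1 e), R.1 e⟫ ∂(muK E) with hA'
  have h1 : ∀ r ∈ Ioi (0 : ℝ), r ^ (Module.finrank ℝ E - 1) *
      av e (fun x => (‖x‖ ^ (Module.finrank ℝ E))⁻¹ * ⟪x, gradient φ x⟫) r = A' r := by
    intro r hr
    have hr : 0 < r := hr
    have h2 : ∀ R : KE E, ‖r • R.1 e‖ = r := fun R => by
      rw [norm_smul, normK, he, Real.norm_of_nonneg hr.le, mul_one]
    rw [av, ← integral_const_mul]
    refine integral_congr_ae (Eventually.of_forall fun R => ?_)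
    simp only [h2, real_inner_smul_left]
    rw [real_inner_comm]
    have : r ^ Module.finrank ℝ E = r ^ (Module.finrank ℝ E - 1) * r := by
      rw [← pow_succ]; congr 1; omega
    rw [this]; field_simp
  rw [setIntegral_congr_fun measurableSet_Ioi h1]
  have hgb : ∀ x, B < ‖x‖ → gradient φ x = 0 := fun x hx => hgz x fun h => by
    have := mem_closedBall_zero_iff.1 (hB h); linarith
  have nrm : ∀ r, 0 < r → ∀ R : KE E, ‖r • R.1 e‖ = r := fun r hr R => by
    rw [norm_smul, normK, he, Real.norm_of_nonneg hr.le, mul_one]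
  have hA'c : Continuous A' := continuous_paramK
    (f := fun r R => ⟪gradient φ (r • R.1 e), R.1 e⟫)
    ((hφ.continuous_grad.comp (continuous_ray e)).inner ((continuous_actK' e).comp continuous_snd))
  have hA'z : ∀ r, 0 < r → B < r → A' r = 0 := fun r hr hr' => by
    simp only [hA']
    rw [integral_congr_ae (g := fun _ => 0) (Eventually.of_forall fun R => ?_)]
    · simp
    · simp [hgb _ (by rw [nrm r hr R]; exact hr')]
  have hIntg : IntegrableOn A' (Ioi 0) := by
    have h3 : IntegrableOn A' (Icc 0 (max B 0)) := hA'c.continuousOn.integrableOn_Icc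
    have h4 : IntegrableOn A' (Ioi (max B 0)) := by
      refine (integrableOn_zero (ε' := ℝ)).congr_fun (fun r hr => ?_) measurableSet_Ioi
      have := max_lt_iff.1 (mem_Ioi.1 hr)
      exact (hA'z r this.2 this.1).symm
    refine (h3.union h4).mono_set fun r hr => ?_
    rcases le_or_gt r (max B 0) with h | h
    · exact Or.inl ⟨le_of_lt hr, h⟩
    · exact Or.inr h
  have := integral_Ioi_of_hasDerivAt_of_tendsto (a := 0) (f := A) (f' := A') (m := 0)
    (hd 0).continuousAt.continuousWithinAt (fun r _ => hd r) hIntg ?_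
  · rw [this]; simp [hA, h00]
  · refine tendsto_const_nhds.congr' ?_
    filter_upwards [eventually_gt_atTop (max B 0)] with r hr
    have := max_lt_iff.1 hr
    simp only [hA]
    rw [integral_congr_ae (g := fun _ => 0) (Eventually.of_forall fun R => ?_)]
    · simp
    · simp [hz _ (by rw [nrm r this.2 R]; exact this.1)]

/-- barrier profile -/
lemma exists_barrier (α : ℝ) {R₁ : ℝ} (hR : 0 < R₁) : ∃ v : ℝ → ℝ, v R₁ = 0 ∧
    (∀ r, 0 < r → HasDerivAt v (-(r ^ (-α))) r) ∧ (∀ r, 0 < r → r ≤ R₁ → 0 ≤ v r) := by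
  have hc : ContinuousOn (fun t : ℝ => t ^ (-α)) (Ioi 0) := fun t ht =>
    (Real.continuousAt_rpow_const t _ (Or.inl (ne_of_gt ht))).continuousWithinAt
  have hi : ∀ r, 0 < r → IntervalIntegrable (fun t : ℝ => t ^ (-α)) volume R₁ r := fun r hr =>
    (hc.mono fun t ht => lt_of_lt_of_le (lt_min hR hr) ht.1).intervalIntegrable
  refine ⟨fun r => -∫ t in R₁..r, t ^ (-α), by simp, fun r hr => ?_, fun r hr hr' => ?_⟩
  · refine (intervalIntegral.integral_hasDerivAt_right (hi r hr) ?_ ?_).neg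
    · exact hc.stronglyMeasurableAtFilter isOpen_Ioi _ hr
    · exact Real.continuousAt_rpow_const r _ (Or.inl (ne_of_gt hr))
  · simp only
    rw [intervalIntegral.integral_symm, neg_neg]
    refine intervalIntegral.integral_nonneg hr' fun t ht => ?_
    exact Real.rpow_nonneg (hr.le.trans ht.1) _

variable {p lam ρ R₁ : ℝ} {e : E} {u : E → ℝ}

lemma Shell.hopf_le (H : Shell p lam e ρ R₁ u) {ρ' κ : ℝ} (h1 : ρ < ρ') (h2 : ρ' < R₁) (hκ : 0 < κ)
    {v : ℝ → ℝ} (v0 : v R₁ = 0)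
    (vd : ∀ r, 0 < r → HasDerivAt v (-(r ^ (-(((Module.finrank ℝ E - 1 : ℕ) : ℝ) / (p - 1))))) r)
    (hv : ∀ x, ‖x‖ = ρ' → κ * v ρ' < u x) {ε : ℝ} (hε : 0 < ε) (x : E) (hx : ρ' < ‖x‖) (hx' : ‖x‖ < R₁) :
    κ * v ‖x‖ - u x ≤ 2 * ε := by
  have := H.nontriv
  have hp := H.hp
  have hN : 0 < Module.finrank ℝ E := Module.finrank_pos
  have hρ' : 0 < ρ' := H.hρ.trans h1
  set α : ℝ := ((Module.finrank ℝ E - 1 : ℕ) : ℝ) / (p - 1) with hα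
  set A : Set E := {x | ρ' < ‖x‖ ∧ ‖x‖ < R₁} with hA
  have oA : IsOpen A := (isOpen_lt continuous_const continuous_norm).inter
    (isOpen_lt continuous_norm continuous_const)
  set gv : E → E := fun x => (-(κ * ‖x‖ ^ (-α))) • (‖x‖⁻¹ • x) with hgv
  have gvd : ∀ x : E, x ≠ 0 → HasGradientAt (fun y : E => κ * v ‖y‖) (gv x) x := by
    intro x hx
    have h3 := hasGrad_radial hx ((vd ‖x‖ (norm_pos_iff.2 hx)).const_mul κ)
    rw [mul_neg] at h3; exact h3
  have gvc : ContinuousOn gv A := by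
    intro x hx
    have hx0 : ‖x‖ ≠ 0 := (hρ'.trans hx.1).ne'
    refine ContinuousAt.continuousWithinAt ?_
    refine ContinuousAt.smul (ContinuousAt.neg (continuousAt_const.mul
      (continuous_norm.continuousAt.rpow_const (Or.inl hx0)))) ?_
    exact (continuous_norm.continuousAt.inv₀ hx0).smul continuousAt_id
  have Fgv : ∀ x : E, x ≠ 0 → Fp p (gv x) = (-(κ ^ (p - 1))) • ((‖x‖ ^ Module.finrank ℝ E)⁻¹ • x) := by
    intro x hx
    have hx0 : 0 < ‖x‖ := norm_pos_iff.2 hx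
    have e1 : gv x = (κ * ‖x‖ ^ (-α)) • (-(‖x‖⁻¹ • x)) := by simp only [hgv]; rw [smul_neg, neg_smul]
    have e2 : Fp p (-(‖x‖⁻¹ • x)) = -(‖x‖⁻¹ • x) := by
      have : ‖-(‖x‖⁻¹ • x)‖ = 1 := by
        rw [norm_neg, norm_smul, norm_inv, norm_norm, inv_mul_cancel₀ hx0.ne']
      rw [Fp, this]; simp
    have hκx : 0 ≤ κ * ‖x‖ ^ (-α) := by positivity
    rw [e1, Fp_smul hp hκx, e2, smul_neg, smul_smul, neg_smul, smul_smul]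
    congr 2
    rw [Real.mul_rpow hκ.le (by positivity), ← Real.rpow_mul hx0.le]
    have e3 : -α * (p - 1) = -((Module.finrank ℝ E - 1 : ℕ) : ℝ) := by
      rw [hα]; field_simp [show p - 1 ≠ 0 by linarith]
    rw [e3, Real.rpow_neg hx0.le, Real.rpow_natCast, mul_assoc, ← mul_inv, ← pow_succ]
    congr 4; omega
  set f : E → ℝ := fun x => if ρ' ≤ ‖x‖ ∧ ‖x‖ ≤ R₁ then bet ε (κ * v ‖x‖ - u x) else 0 with hf
  set G : E → E := fun x => if ρ' ≤ ‖x‖ ∧ ‖x‖ ≤ R₁ then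
    bet' ε (κ * v ‖x‖ - u x) • (gv x - gradient u x) else 0 with hG
  set S : Set E := {x | (ρ' ≤ ‖x‖ ∧ ‖x‖ ≤ R₁) ∧ ε ≤ κ * v ‖x‖ - u x} with hS
  have vc : ContinuousOn (fun x : E => κ * v ‖x‖ - u x) {x | ρ' ≤ ‖x‖ ∧ ‖x‖ ≤ R₁} := by
    intro x hx
    have hx0 : x ≠ 0 := norm_pos_iff.1 (hρ'.trans_le hx.1)
    exact ((gvd x hx0).continuousAt.sub H.hu.continuous.continuousAt).continuousWithinAt
  have clo : IsClosed {x : E | ρ' ≤ ‖x‖ ∧ ‖x‖ ≤ R₁} :=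
    (isClosed_le continuous_const continuous_norm).inter (isClosed_le continuous_norm continuous_const)
  have hScl : IsClosed S := vc.preimage_isClosed_of_isClosed clo isClosed_Ici
  have hSA : S ⊆ A := by
    rintro y ⟨⟨hy1, hy2⟩, hy3⟩
    refine ⟨lt_of_le_of_ne hy1 fun h => ?_, lt_of_le_of_ne hy2 fun h => ?_⟩
    · have := hv y h.symm; rw [← h] at hy3; linarith
    · rw [h, v0, H.bd y h] at hy3; linarith
  have kk : (∀ x, HasGradientAt f (G x) x) ∧ Continuous G ∧ ContDiff ℝ 1 f ∧ tsupport f ⊆ S := by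
   refine glue_grad (f := f) (G := G) hScl hSA oA ?_ ?_ ?_ ?_
   · intro y hy
     have hy0 : y ≠ 0 := norm_pos_iff.1 (hρ'.trans hy.1)
     have h3 := HasGradientAt.real_comp (hasDerivAt_bet hε _) ((gvd y hy0).sub' (H.hu.hasGrad y))
     have e1 : G y = bet' ε (κ * v ‖y‖ - u y) • (gv y - gradient u y) := by
       simp only [hG]; rw [if_pos ⟨hy.1.le, hy.2.le⟩]
     rw [e1]
     refine h3.congr' ?_
     filter_upwards [oA.mem_nhds hy] with z hz
     simp only [hf]; rw [if_pos ⟨hz.1.le, hz.2.le⟩]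
   · have : ContinuousOn (fun x => bet' ε (κ * v ‖x‖ - u x) • (gv x - gradient u x)) A :=
       ((continuous_bet' hε).comp_continuousOn (vc.mono fun y hy => ⟨hy.1.le, hy.2.le⟩)).smul
         (gvc.sub H.hu.continuous_grad.continuousOn)
     refine this.congr fun y hy => ?_
     simp only [hG]; rw [if_pos ⟨hy.1.le, hy.2.le⟩]
   · intro y hy
     simp only [hf]
     split_ifs with h
     · exact bet_of_le (by by_contra h'; push Not at h'; exact hy ⟨h, h'.le⟩)
     · rfl
   · intro y hy
     simp only [hG]
     split_ifs with h
     · rw [bet', if_pos (by by_contra h'; push Not at h'; exact hy ⟨h, h'.le⟩), zero_smul]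
     · rfl
  obtain ⟨k1, k2, k3, k4⟩ := kk
  have hcpt : HasCompactSupport f := hasCompactSupport_of_tsupport_subset
    (isCompact_closedBall (0:E) R₁) (k4.trans fun y hy => mem_closedBall_zero_iff.2 (hSA hy).2.le)
  have gf : ∀ x, gradient f x = G x := fun x => (k1 x).gradient
  have hGA : ∀ x, x ∉ A → G x = 0 := fun x hx => by
    rw [← gf]; exact gradient_eq_zero_of_notMem fun h => hx (hSA (k4 h))
  have f0A : ∀ x, x ∉ A → f x = 0 := fun x hx =>
    image_eq_zero_of_notMem_tsupport fun h => hx (hSA (k4 h))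
  have w1 := H.weak f k3 hcpt (k4.trans fun y hy => ⟨h1.trans (hSA hy).1, (hSA hy).2⟩)
  have f_nonneg : ∀ x, 0 ≤ f x := fun x => by
    simp only [hf]; split_ifs
    · exact bet_nonneg hε _
    · exact le_rfl
  have w2 : 0 ≤ lam * ∫ x, (u x) ^ (p - 1) * f x := by
    refine mul_nonneg H.lam0 (integral_nonneg fun x => ?_)
    by_cases hx : x ∈ A
    · exact mul_nonneg (Real.rpow_nonneg (H.pos x (h1.trans hx.1) hx.2).le _) (f_nonneg x)
    · simp [f0A x hx]
  have w3 := radial_divfree H.he k3 hcpt hρ'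
    (fun x hx => by rw [gf]; exact hGA x fun h => by linarith [h.1])
    (f0A 0 fun h => by have := h.1; simp at this; linarith)
  simp only [gf] at w1 w3
  have c1 : Continuous fun x => ⟪Fp p (gradient u x), G x⟫ :=
    ((continuous_Fp hp).comp H.hu.continuous_grad).inner k2
  have c2 : Continuous fun x => (‖x‖ ^ (Module.finrank ℝ E))⁻¹ * ⟪x, G x⟫ :=
    continuous_inv_normpow (continuous_id.inner k2) hρ' (fun x hx => by
      have : G x = 0 := hGA x fun h => by linarith [h.1]
      simp [this]) _
  have hGK : ∀ x, x ∉ closedBall (0:E) R₁ → G x = 0 := fun x hx =>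
    hGA x fun h => hx (mem_closedBall_zero_iff.2 h.2.le)
  have s1 : HasCompactSupport fun x => ⟪Fp p (gradient u x), G x⟫ :=
    HasCompactSupport.intro (isCompact_closedBall (0:E) R₁) fun x hx => by simp [hGK x hx]
  have s2 : HasCompactSupport fun x => (‖x‖ ^ (Module.finrank ℝ E))⁻¹ * ⟪x, G x⟫ :=
    HasCompactSupport.intro (isCompact_closedBall (0:E) R₁) fun x hx => by simp [hGK x hx]
  set D : E → ℝ := fun x => (-(κ ^ (p - 1))) * ((‖x‖ ^ (Module.finrank ℝ E))⁻¹ * ⟪x, G x⟫) -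
    ⟪Fp p (gradient u x), G x⟫ with hD
  have cD : Continuous D := (continuous_const.mul c2).sub c1
  have i1 := c1.integrable_of_hasCompactSupport (μ := volume) s1
  have i2 := (c2.integrable_of_hasCompactSupport (μ := volume) s2).const_mul (-(κ ^ (p - 1)))
  have hDi : ∫ x, D x ≤ 0 := by
    simp only [hD]
    rw [integral_sub i2 i1, integral_const_mul, w3, w1]; linarith
  have hDA : ∀ x ∈ A, D x = bet' ε (κ * v ‖x‖ - u x) *
      ⟪Fp p (gv x) - Fp p (gradient u x), gv x - gradient u x⟫ := by
    intro x hx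
    have hx0 : x ≠ 0 := norm_pos_iff.1 (hρ'.trans hx.1)
    have e1 : G x = bet' ε (κ * v ‖x‖ - u x) • (gv x - gradient u x) := by
      simp only [hG]; rw [if_pos ⟨hx.1.le, hx.2.le⟩]
    have e2 : (-(κ ^ (p - 1))) * ((‖x‖ ^ (Module.finrank ℝ E))⁻¹ * ⟪x, G x⟫) = ⟪Fp p (gv x), G x⟫ := by
      rw [Fgv x hx0, real_inner_smul_left, real_inner_smul_left]
    simp only [hD]
    rw [e2, ← inner_sub_left, e1, real_inner_smul_right]
  have hD0 : ∀ x, 0 ≤ D x := by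
    intro x
    by_cases hx : x ∈ A
    · rw [hDA x hx]
      exact mul_nonneg (bet'_nonneg hε _) (Fp_mono hp _ _)
    · simp [hD, hGA x hx]
  have hDz : ∀ x, D x = 0 := by
    have h3 : ∫ x, D x = 0 := le_antisymm hDi (integral_nonneg hD0)
    have h4 := (integral_eq_zero_iff_of_nonneg hD0 (i2.sub i1)).1 h3
    have h5 := (Continuous.ae_eq_iff_eq volume cD continuous_zero).1 h4
    exact fun x => congrFun h5 x
  have hG0 : ∀ x, G x = 0 := by
    intro x
    by_cases hx : x ∈ A
    · have h3 := hDz x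
      rw [hDA x hx] at h3
      have e1 : G x = bet' ε (κ * v ‖x‖ - u x) • (gv x - gradient u x) := by
        simp only [hG]; rw [if_pos ⟨hx.1.le, hx.2.le⟩]
      rw [e1]
      rcases mul_eq_zero.1 h3 with h | h
      · rw [h, zero_smul]
      · by_cases hne : gv x = gradient u x
        · rw [hne, sub_self, smul_zero]
        · exact absurd h (Fp_mono_strict hp hne).ne'
    · exact hGA x hx
  have hfc : ∀ x, f x = 0 := by
    intro x
    have h3 : ∀ x, fderiv ℝ f x = 0 := fun x => by
      rw [(hasGrad_iff.1 (k1 x)).fderiv, hG0 x, map_zero]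
    rw [is_const_of_fderiv_eq_zero (k3.differentiable (by norm_num)) h3 x 0]
    exact f0A 0 fun h => by have := h.1; simp at this; linarith
  have h3 := hfc x
  simp only [hf] at h3
  rw [if_pos ⟨hx.le, hx'.le⟩] at h3
  rcases le_or_gt (κ * v ‖x‖ - u x) 0 with h | h
  · linarith
  · have := bet_ge hε h.le
    linarith

/-- Hopf: the normal derivative is positive -/
lemma Shell.exists_c_pos (H : Shell p lam e ρ R₁ u) :
    ∃ c : ℝ, 0 < c ∧ ∀ ω : E, ‖ω‖ = 1 → gradient u (R₁ • ω) = (-c) • ω := by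
  have := H.nontriv
  obtain ⟨c, hc0, hc⟩ := H.exists_c
  refine ⟨c, ?_, hc⟩
  obtain ⟨v, v0, vd, vn⟩ := exists_barrier
    (((Module.finrank ℝ E - 1 : ℕ) : ℝ) / (p - 1)) H.hR
  set ρ' := (ρ + R₁) / 2 with hρ'
  have h1 : ρ < ρ' := by have := H.hρR; rw [hρ']; linarith
  have h2 : ρ' < R₁ := by have := H.hρR; rw [hρ']; linarith
  have hρ0 : 0 < ρ' := H.hρ.trans h1
  obtain ⟨x₀, hx₀, hmin⟩ := (isCompact_sphere (0:E) ρ').exists_isMinOn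
    ⟨ρ' • e, by simp [norm_smul, H.he, abs_of_pos hρ0]⟩ H.hu.continuous.continuousOn
  have hx₀ : ‖x₀‖ = ρ' := by simpa using hx₀
  have hm : 0 < u x₀ := H.pos x₀ (by rw [hx₀]; exact h1) (by rw [hx₀]; exact h2)
  have hv0 := vn ρ' hρ0 h2.le
  set κ := u x₀ / (v ρ' + 1) with hκ
  have hκ0 : 0 < κ := by positivity
  have key : ∀ x : E, ρ' < ‖x‖ → ‖x‖ < R₁ → κ * v ‖x‖ ≤ u x := by
    intro x hx hx'
    refine le_of_forall_pos_le_add fun ε hε => ?_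
    have := H.hopf_le h1 h2 hκ0 v0 vd (fun y hy => ?_) (ε := ε / 2) (by positivity) x hx hx'
    · linarith
    · have h3 : u x₀ ≤ u y := hmin (by simpa using hy)
      refine lt_of_lt_of_le ?_ h3
      rw [hκ, div_mul_eq_mul_div, div_lt_iff₀ (by positivity)]
      nlinarith
  have hd := (hasDerivAt_ray H.hu e R₁).sub ((vd R₁ H.hR).const_mul κ)
  have h4 := deriv_nonpos_of_left h2 hd ?_ ?_
  · rw [hc e H.he, real_inner_smul_left, real_inner_self_eq_norm_sq, H.he] at h4
    have := Real.rpow_pos_of_pos H.hR (-(((Module.finrank ℝ E - 1 : ℕ) : ℝ) / (p - 1)))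
    have := mul_pos hκ0 this
    linarith
  · simp [v0, H.bd _ (norm_ray H.he H.hR.le)]
  · intro t ht
    have ht0 : 0 ≤ t := hρ0.le.trans ht.1.le
    have hn := norm_ray H.he ht0
    have := key (t • e) (by rw [hn]; exact ht.1) (by rw [hn]; exact ht.2)
    rw [hn] at this
    simp only [Pi.sub_apply]; linarith
end Hopf


section Radial
variable {E : Type*} [NormedAddCommGroup E] [InnerProductSpace ℝ E] [CompleteSpace E]
  [FiniteDimensional ℝ E] [MeasurableSpace E] [BorelSpace E]

/-- radial functions vanishing near the origin are `C¹` -/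
lemma radial_C1 {K : ℝ → ℝ} (hK : ContDiff ℝ 1 K) {a : ℝ} (ha : 0 < a)
    (h0 : ∀ r, r < a → K r = 0) :
    ContDiff ℝ 1 (fun x : E => K ‖x‖) ∧
      ∀ x : E, gradient (fun x : E => K ‖x‖) x = deriv K ‖x‖ • (‖x‖⁻¹ • x) := by
  have hd0 : ∀ r, r < a → deriv K r = 0 := fun r hr => by
    have : K =ᶠ[𝓝 r] fun _ => 0 := by
      filter_upwards [Iio_mem_nhds hr] with t ht using h0 t ht
    rw [this.deriv_eq]; simp
  have hdK : ∀ r, HasDerivAt K (deriv K r) r := fun r =>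
    (hK.differentiable (by norm_num)).differentiableAt.hasDerivAt
  have kk := glue_grad (S := {x : E | a ≤ ‖x‖}) (Ω := {x : E | 0 < ‖x‖}) (f := fun x : E => K ‖x‖)
    (G := fun x => deriv K ‖x‖ • (‖x‖⁻¹ • x)) (isClosed_le continuous_const continuous_norm)
    (fun x hx => ha.trans_le hx) (isOpen_lt continuous_const continuous_norm)
    (fun x hx => hasGrad_radial (norm_pos_iff.1 hx) (hdK _))
    (fun x hx => by
      have hx : 0 < ‖x‖ := hx
      refine ContinuousAt.continuousWithinAt ?_
      exact (((hK.continuous_deriv (by norm_num)).comp continuous_norm).continuousAt).smul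
        ((continuous_norm.continuousAt.inv₀ hx.ne').smul continuousAt_id))
    (fun x hx => h0 _ (not_le.1 hx)) (fun x hx => by rw [hd0 _ (not_le.1 hx), zero_smul])
  exact ⟨kk.2.2.1, fun x => (kk.1 x).gradient⟩

lemma fderiv_eq_inner {f : E → ℝ} (hf : ContDiff ℝ 1 f) (x v : E) :
    fderiv ℝ f x v = ⟪gradient f x, v⟫ := by
  rw [(hasGrad_iff.1 (hf.hasGrad x)).fderiv]; rfl

lemma ibp_dir {f g : E → ℝ} (hf : ContDiff ℝ 1 f) (hg : ContDiff ℝ 1 g) (hc : HasCompactSupport g)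
    (v : E) : ∫ x, g x * ⟪gradient f x, v⟫ = - ∫ x, f x * ⟪gradient g x, v⟫ := by
  have z : ∀ x, x ∉ tsupport g → g x = 0 := fun x hx => image_eq_zero_of_notMem_tsupport hx
  have z' : ∀ x, x ∉ tsupport g → gradient g x = 0 := fun x hx => gradient_eq_zero_of_notMem hx
  have i1 : Integrable fun x => ⟪gradient g x, v⟫ * f x :=
    ((hg.continuous_grad.inner continuous_const).mul hf.continuous).integrable_of_hasCompactSupport
      (HasCompactSupport.intro hc.isCompact fun x hx => by
        simp only [Pi.mul_apply]; rw [z' x hx, inner_zero_left, zero_mul])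
  have i2 : Integrable fun x => g x * ⟪gradient f x, v⟫ :=
    (hg.continuous.mul (hf.continuous_grad.inner continuous_const)).integrable_of_hasCompactSupport
      (HasCompactSupport.intro hc.isCompact fun x hx => by simp [z x hx])
  have i3 : Integrable fun x => g x * f x :=
    (hg.continuous.mul hf.continuous).integrable_of_hasCompactSupport
      (HasCompactSupport.intro hc.isCompact fun x hx => by simp [z x hx])
  have h := integral_mul_fderiv_eq_neg_fderiv_mul_of_integrable (μ := volume) (f := g) (g := f) (v := v)
    (by simpa only [fderiv_eq_inner hg] using i1) (by simpa only [fderiv_eq_inner hf] using i2) i3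
    (fun x _ => (hg.differentiable (by norm_num)).differentiableAt)
    (fun x _ => (hf.differentiable (by norm_num)).differentiableAt)
  simp only [fderiv_eq_inner hf, fderiv_eq_inner hg] at h
  rw [h]
  congr 2; funext x; ring

/-- spherical divergence identity, tested with radial functions -/
lemma sph_div_test [Nontrivial E] {e : E} (he : ‖e‖ = 1) {u : E → ℝ} (hu : ContDiff ℝ 1 u)
    {a b : ℝ} (ha : 0 < a) {κ : ℝ → ℝ} (hκ : ContDiff ℝ 1 κ) (h0 : ∀ r, r < a → κ r = 0)
    (h1 : ∀ r, b < r → κ r = 0) :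
    ∫ x, κ ‖x‖ * (‖x‖ ^ 2 * ⟪gradient u x, e⟫ - ((Module.finrank ℝ E : ℝ) - 1) * (u x * ⟪x, e⟫) -
      ⟪gradient u x, x⟫ * ⟪x, e⟫) = 0 := by
  set N := Module.finrank ℝ E with hN
  have hN0 : 0 < N := Module.finrank_pos
  have hdκ : ∀ r, HasDerivAt κ (deriv κ r) r := fun r =>
    (hκ.differentiable (by norm_num)).differentiableAt.hasDerivAt
  -- first function
  set K1 : ℝ → ℝ := fun r => κ r * r ^ 2 with hK1
  have cK1 : ContDiff ℝ 1 K1 := hκ.mul (contDiff_id.pow 2)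
  have dK1 : ∀ r, deriv K1 r = deriv κ r * r ^ 2 + κ r * (2 * r) := fun r => by
    have h2 := (hdκ r).mul (hasDerivAt_pow 2 r)
    have h3 : deriv K1 r = _ := h2.deriv
    rw [h3]; simp
  obtain ⟨f1c, f1g⟩ := radial_C1 (E := E) cK1 ha (fun r hr => by simp [hK1, h0 r hr])
  set K2 : ℝ → ℝ := fun r => κ r * r ^ N with hK2
  have cK2 : ContDiff ℝ 1 K2 := hκ.mul (contDiff_id.pow N)
  have dK2 : ∀ r, deriv K2 r = deriv κ r * r ^ N + κ r * (N * r ^ (N - 1)) := fun r => by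
    have h2 := (hdκ r).mul (hasDerivAt_pow N r)
    exact h2.deriv
  obtain ⟨f2c, f2g⟩ := radial_C1 (E := E) cK2 ha (fun r hr => by simp [hK2, h0 r hr])
  have hcs : ∀ K : ℝ → ℝ, (∀ r, b < r → K r = 0) → HasCompactSupport (fun x : E => K ‖x‖) :=
    fun K hK => HasCompactSupport.intro (isCompact_closedBall (0 : E) b) fun x hx => by
      rw [mem_closedBall_zero_iff, not_le] at hx; exact hK _ hx
  have c1 := hcs K1 fun r hr => by simp [hK1, h1 r hr]
  have c2 := hcs K2 fun r hr => by simp [hK2, h1 r hr]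
  have A := ibp_dir hu f1c c1 e
  set φ : E → ℝ := fun x => K2 ‖x‖ * (u x * ⟪e, x⟫) with hφ
  have φg : ∀ x, HasGradientAt φ (K2 ‖x‖ • (u x • e + ⟪e, x⟫ • gradient u x) +
      (u x * ⟪e, x⟫) • (deriv K2 ‖x‖ • (‖x‖⁻¹ • x))) x := fun x => by
    have h2 := f2c.hasGrad x
    rw [f2g x] at h2
    exact h2.mul' ((hu.hasGrad x).mul' (hasGrad_inner e x))
  have φc : ContDiff ℝ 1 φ := f2c.mul (hu.mul (contDiff_const.inner ℝ contDiff_id))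
  have φs : HasCompactSupport φ := c2.mul_right
  have B := radial_divfree he φc φs ha (fun x hx => by
    rw [(φg x).gradient, dK2]
    simp only [hK2, h0 _ hx]
    have : deriv κ ‖x‖ = 0 := by
      have : κ =ᶠ[𝓝 ‖x‖] fun _ => 0 := by
        filter_upwards [Iio_mem_nhds hx] with t ht using h0 t ht
      rw [this.deriv_eq]; simp
    rw [this]; simp) (by simp [hφ])
  have hpt : ∀ x, κ ‖x‖ * (‖x‖ ^ 2 * ⟪gradient u x, e⟫ - ((N : ℝ) - 1) * (u x * ⟪x, e⟫) -
      ⟪gradient u x, x⟫ * ⟪x, e⟫) = (K1 ‖x‖ * ⟪gradient u x, e⟫ +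
        u x * ⟪gradient (fun x : E => K1 ‖x‖) x, e⟫) -
        (‖x‖ ^ N)⁻¹ * ⟪x, gradient φ x⟫ := by
    intro x
    by_cases hx : x = 0
    · rw [f1g x]; subst hx; simp [hK1, h0 0 ha]
    have hx0 : ‖x‖ ≠ 0 := norm_ne_zero_iff.2 hx
    rw [(φg x).gradient, f1g, dK2, dK1]
    simp only [inner_add_right, real_inner_smul_right, real_inner_smul_left, real_inner_self_eq_norm_sq,
      hK1, hK2]
    rw [real_inner_comm x e, real_inner_comm x (gradient u x)]
    have hp1 : ‖x‖ ^ N = ‖x‖ ^ (N - 1) * ‖x‖ := by rw [← pow_succ]; congr 1; omega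
    rw [hp1]
    field_simp
    ring
  simp only [hpt]
  have z1 : ∀ x, x ∉ closedBall (0:E) b → gradient (fun x : E => K1 ‖x‖) x = 0 := fun x hx => by
    refine gradient_eq_zero_of_notMem fun h => hx ?_
    refine closure_minimal ?_ isClosed_closedBall h
    intro y hy
    by_contra hy'
    rw [mem_closedBall_zero_iff, not_le] at hy'
    exact hy (by simp [hK1, h1 _ hy'])
  have z2 : ∀ x, x ∉ closedBall (0:E) b → K1 ‖x‖ = 0 := fun x hx => by
    rw [mem_closedBall_zero_iff, not_le] at hx
    simp [hK1, h1 _ hx]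
  have i1 : Integrable fun x => K1 ‖x‖ * ⟪gradient u x, e⟫ :=
    ((cK1.continuous.comp continuous_norm).mul (hu.continuous_grad.inner
      continuous_const)).integrable_of_hasCompactSupport
      (HasCompactSupport.intro (isCompact_closedBall (0:E) b) fun x hx => by simp [z2 x hx])
  have i2 : Integrable fun x => u x * ⟪gradient (fun x : E => K1 ‖x‖) x, e⟫ :=
    (hu.continuous.mul (f1c.continuous_grad.inner continuous_const)).integrable_of_hasCompactSupport
      (HasCompactSupport.intro (isCompact_closedBall (0:E) b) fun x hx => by
        simp only [Pi.mul_apply]; rw [z1 x hx, inner_zero_left, mul_zero])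
  have z3 : ∀ x : E, ‖x‖ < a → gradient φ x = 0 := fun x hx => by
    rw [(φg x).gradient, dK2]
    simp only [hK2, h0 _ hx]
    have : deriv κ ‖x‖ = 0 := by
      have : κ =ᶠ[𝓝 ‖x‖] fun _ => 0 := by
        filter_upwards [Iio_mem_nhds hx] with t ht using h0 t ht
      rw [this.deriv_eq]; simp
    rw [this]; simp
  have i3 : Integrable fun x => (‖x‖ ^ N)⁻¹ * ⟪x, gradient φ x⟫ :=
    (continuous_inv_normpow (continuous_id.inner φc.continuous_grad) ha
      (fun x hx => by simp [z3 x hx]) N).integrable_of_hasCompactSupport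
      (HasCompactSupport.intro φs.isCompact fun x hx => by
        simp [gradient_eq_zero_of_notMem hx])
  have i12 : Integrable fun x => K1 ‖x‖ * ⟪gradient u x, e⟫ +
      u x * ⟪gradient (fun x : E => K1 ‖x‖) x, e⟫ := i1.add i2
  rw [integral_sub i12 i3, integral_add i1 i2, B, A]; ring

/-- averaged directional derivative -/
lemma av_dir [Nontrivial E] {e : E} (he : ‖e‖ = 1) {u : E → ℝ} (hu : ContDiff ℝ 1 u) {r : ℝ}
    (hr : 0 < r) :
    ∫ R : KE E, ⟪gradient u (r • R.1 e), e⟫ ∂(muK E) =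
      (∫ R : KE E, ⟪gradient u (r • R.1 e), R.1 e⟫ * ⟪R.1 e, e⟫ ∂(muK E)) +
      ((Module.finrank ℝ E : ℝ) - 1) / r * ∫ R : KE E, u (r • R.1 e) * ⟪R.1 e, e⟫ ∂(muK E) := by
  have cg := hu.continuous_grad
  have h := av_zero_of_radial (e := e) he (ρ := r / 2) (R₁ := r) (by positivity) (by linarith)
    (q := fun x => ‖x‖ ^ 2 * ⟪gradient u x, e⟫ - ((Module.finrank ℝ E : ℝ) - 1) * (u x * ⟪x, e⟫) -
      ⟪gradient u x, x⟫ * ⟪x, e⟫)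
    ((((continuous_norm.pow 2).mul (cg.inner continuous_const)).sub (continuous_const.mul
      (hu.continuous.mul (continuous_id.inner continuous_const)))).sub
      ((cg.inner continuous_id).mul (continuous_id.inner continuous_const)))
    (fun a b κ ha hb hκ h0 h1 => sph_div_test he hu (by linarith) hκ h0 h1) r ⟨by linarith, le_rfl⟩
  have cr : Continuous fun R : KE E => r • R.1 e := continuous_const.smul (continuous_actK' e)
  have ci1 : Continuous fun R : KE E => ⟪gradient u (r • R.1 e), e⟫ :=
    (cg.comp cr).inner continuous_const
  have i1 := integrableK ci1
  have cn : Continuous fun R : KE E => ⟪R.1 e, e⟫ := (continuous_actK' e).inner continuous_const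
  have i2 : Integrable (fun R : KE E => u (r • R.1 e) * ⟪R.1 e, e⟫) (muK E) :=
    integrableK ((hu.continuous.comp cr).mul cn)
  have i3 : Integrable (fun R : KE E => ⟪gradient u (r • R.1 e), R.1 e⟫ * ⟪R.1 e, e⟫) (muK E) :=
    integrableK (((cg.comp cr).inner (continuous_actK' e)).mul cn)
  rw [av] at h
  have e1 : ∀ R : KE E, ‖r • R.1 e‖ ^ 2 * ⟪gradient u (r • R.1 e), e⟫ -
      ((Module.finrank ℝ E : ℝ) - 1) * (u (r • R.1 e) * ⟪r • R.1 e, e⟫) -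
      ⟪gradient u (r • R.1 e), r • R.1 e⟫ * ⟪r • R.1 e, e⟫ =
      r ^ 2 * ⟪gradient u (r • R.1 e), e⟫ -
      (((Module.finrank ℝ E : ℝ) - 1) * r) * (u (r • R.1 e) * ⟪R.1 e, e⟫) -
      r ^ 2 * (⟪gradient u (r • R.1 e), R.1 e⟫ * ⟪R.1 e, e⟫) := fun R => by
    rw [norm_smul, normK, he, Real.norm_of_nonneg hr.le, real_inner_smul_left, real_inner_smul_right]
    ring
  simp only [e1] at h
  have j1 : Integrable (fun R : KE E => r ^ 2 * ⟪gradient u (r • R.1 e), e⟫) (muK E) := i1.const_mul _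
  have j2 : Integrable (fun R : KE E => (((Module.finrank ℝ E : ℝ) - 1) * r) *
    (u (r • R.1 e) * ⟪R.1 e, e⟫)) (muK E) := i2.const_mul _
  have j3 : Integrable (fun R : KE E => r ^ 2 * (⟪gradient u (r • R.1 e), R.1 e⟫ * ⟪R.1 e, e⟫))
    (muK E) := i3.const_mul _
  have j12 : Integrable (fun R : KE E => r ^ 2 * ⟪gradient u (r • R.1 e), e⟫ -
    (((Module.finrank ℝ E : ℝ) - 1) * r) * (u (r • R.1 e) * ⟪R.1 e, e⟫)) (muK E) := j1.sub j2
  rw [integral_sub j12 j3, integral_sub j1 j2, integral_const_mul, integral_const_mul,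
    integral_const_mul] at h
  set X := ∫ R : KE E, ⟪gradient u (r • R.1 e), e⟫ ∂(muK E)
  set Y := ∫ R : KE E, ⟪gradient u (r • R.1 e), R.1 e⟫ * ⟪R.1 e, e⟫ ∂(muK E)
  set Z := ∫ R : KE E, u (r • R.1 e) * ⟪R.1 e, e⟫ ∂(muK E)
  field_simp
  have : r * (r * X - (r * Y + ((Module.finrank ℝ E : ℝ) - 1) * Z)) = 0 := by linarith
  have := (mul_eq_zero.1 this).resolve_left hr.ne'
  linarith

/-- swapping with a bounded measurable weight of bounded support -/
lemma swapK {k : E → ℝ} (hk : Measurable k) {M B : ℝ} (hM : ∀ x, |k x| ≤ M)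
    (hB : ∀ x, B < ‖x‖ → k x = 0) {F : KE E → E → ℝ} (hF : Continuous (Function.uncurry F)) :
    ∫ x, k x * (∫ R, F R x ∂(muK E)) = ∫ R, (∫ x, k x * F R x) ∂(muK E) := by
  simp only [← integral_const_mul]
  refine integral_integral_swap (f := fun x R => k x * F R x) ?_
  have hFs : Continuous fun z : E × KE E => F z.2 z.1 := hF.comp continuous_swap
  have hm : Measurable fun z : E × KE E => k z.1 * F z.2 z.1 :=
    (hk.comp measurable_fst).mul hFs.measurable
  have hKc : IsCompact (closedBall (0:E) B ×ˢ (univ : Set (KE E))) :=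
    (isCompact_closedBall _ _).prod isCompact_univ
  obtain ⟨C, hC⟩ := hKc.exists_bound_of_continuousOn hFs.continuousOn
  have h1 : Function.support (fun z : E × KE E => k z.1 * F z.2 z.1) ⊆
      closedBall (0:E) B ×ˢ (univ : Set (KE E)) := by
    intro z hz
    refine ⟨?_, mem_univ _⟩
    by_contra h
    rw [mem_closedBall_zero_iff, not_le] at h
    exact hz (by simp [hB _ h])
  show Integrable (fun z : E × KE E => k z.1 * F z.2 z.1) (volume.prod (muK E))
  rw [← integrableOn_iff_integrable_of_support_subset h1]
  refine Measure.integrableOn_of_bounded (M := M * C) ?_ hm.aestronglyMeasurable ?_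
  · exact hKc.measure_lt_top.ne
  · rw [ae_restrict_iff' hKc.measurableSet]
    refine Eventually.of_forall fun z hz => ?_
    rw [norm_mul]
    exact mul_le_mul (hM _) (hC z hz) (norm_nonneg _) ((abs_nonneg _).trans (hM z.1))

lemma integral_radial_mul {e : E} (he : ‖e‖ = 1) {k : ℝ → ℝ} (hk : Measurable k) {M B : ℝ}
    (hM : ∀ r, |k r| ≤ M) (hB : ∀ r, B < r → k r = 0) {g : E → ℝ} (hg : Continuous g) :
    ∫ x, k ‖x‖ * g x = ∫ x : E, k ‖x‖ * av e g ‖x‖ := by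
  have h1 := swapK (E := E) (k := fun x => k ‖x‖) (hk.comp measurable_norm) (M := M) (B := B)
    (fun x => hM _) (fun x hx => hB _ hx) (F := fun R x => g (R.1 x)) (hg.comp continuous_actK)
  simp only [integral_act he] at h1
  rw [h1]
  have h2 : ∀ R : KE E, ∫ x, k ‖x‖ * g (R.1 x) = ∫ x, k ‖x‖ * g x := fun R => by
    rw [← integral_comp_isom (isoK R) (fun x => k ‖x‖ * g x)]
    simp only [isoK_apply, normK]
  simp only [h2]; simp
end Radial


section Scalar

lemma rpow_bounds {α β : ℝ} (hα : 0 < α) (q : ℝ) : ∃ m M : ℝ, 0 < m ∧ m ≤ M ∧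
    ∀ t, α ≤ t → t ≤ β → m ≤ t ^ q ∧ t ^ q ≤ M := by
  by_cases hαβ : α ≤ β
  · have hβ : 0 < β := hα.trans_le hαβ
    refine ⟨min (α ^ q) (β ^ q), max (α ^ q) (β ^ q), ?_, min_le_max, fun t h1 h2 => ?_⟩
    · exact lt_min (Real.rpow_pos_of_pos hα _) (Real.rpow_pos_of_pos hβ _)
    · have ht : 0 < t := hα.trans_le h1
      rcases le_total 0 q with hq | hq
      · exact ⟨(min_le_left _ _).trans (Real.rpow_le_rpow hα.le h1 hq),
          (Real.rpow_le_rpow ht.le h2 hq).trans (le_max_right _ _)⟩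
      · exact ⟨(min_le_right _ _).trans (Real.rpow_le_rpow_of_nonpos ht h2 hq),
          (Real.rpow_le_rpow_of_nonpos hα h1 hq).trans (le_max_left _ _)⟩
  · exact ⟨1, 1, one_pos, le_rfl, fun t h1 h2 => absurd (h1.trans h2) hαβ⟩

lemma rpow_mvt {α β s t : ℝ} (hα : 0 < α) (q : ℝ) (hs : α ≤ s) (hs' : s ≤ β) (ht : α ≤ t)
    (ht' : t ≤ β) : ∃ ξ, α ≤ ξ ∧ ξ ≤ β ∧ s ^ q - t ^ q = (q * ξ ^ (q - 1)) * (s - t) := by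
  have key : ∀ s t : ℝ, α ≤ s → s ≤ β → α ≤ t → t ≤ β → t < s → ∃ ξ, α ≤ ξ ∧ ξ ≤ β ∧
      s ^ q - t ^ q = (q * ξ ^ (q - 1)) * (s - t) := by
    intro s t hs hs' ht ht' hts
    obtain ⟨ξ, hξ, h⟩ := exists_hasDerivAt_eq_slope (fun x : ℝ => x ^ q) (fun x => q * x ^ (q - 1)) hts
      (fun x hx => (Real.continuousAt_rpow_const x q
        (Or.inl (hα.trans_le (ht.trans hx.1)).ne')).continuousWithinAt)
      (fun x hx => Real.hasDerivAt_rpow_const (Or.inl (hα.trans_le (ht.trans hx.1.le)).ne'))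
    refine ⟨ξ, ht.trans hξ.1.le, hξ.2.le.trans hs', ?_⟩
    have : s - t ≠ 0 := by linarith
    rw [h]; field_simp
  rcases lt_trichotomy t s with h | h | h
  · exact key s t hs hs' ht ht' h
  · exact ⟨s, hs, hs', by rw [h]; ring⟩
  · obtain ⟨ξ, h1, h2, h3⟩ := key t s ht ht' hs hs' h
    exact ⟨ξ, h1, h2, by linarith⟩

lemma rpow_lip {α β : ℝ} (hα : 0 < α) (q : ℝ) : ∃ L : ℝ, 0 ≤ L ∧
    ∀ s t, α ≤ s → s ≤ β → α ≤ t → t ≤ β → |s ^ q - t ^ q| ≤ L * |s - t| := by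
  obtain ⟨m, M, hm, hmM, h⟩ := rpow_bounds (β := β) hα (q - 1)
  refine ⟨|q| * M, mul_nonneg (abs_nonneg _) (hm.le.trans hmM), fun s t h1 h2 h3 h4 => ?_⟩
  obtain ⟨ξ, h5, h6, h7⟩ := rpow_mvt hα q h1 h2 h3 h4
  rw [h7, abs_mul, abs_mul]
  refine mul_le_mul_of_nonneg_right (mul_le_mul_of_nonneg_left ?_ (abs_nonneg _)) (abs_nonneg _)
  rw [abs_of_pos (hm.trans_le (h ξ h5 h6).1)]
  exact (h ξ h5 h6).2

lemma rpow_coer {α β : ℝ} (hα : 0 < α) {q : ℝ} (hq : 0 < q) : ∃ k : ℝ, 0 < k ∧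
    ∀ s t, α ≤ s → s ≤ β → α ≤ t → t ≤ β → k * (s - t) ^ 2 ≤ (s ^ q - t ^ q) * (s - t) := by
  obtain ⟨m, M, hm, hmM, h⟩ := rpow_bounds (β := β) hα (q - 1)
  refine ⟨q * m, by positivity, fun s t h1 h2 h3 h4 => ?_⟩
  obtain ⟨ξ, h5, h6, h7⟩ := rpow_mvt hα q h1 h2 h3 h4
  rw [h7, mul_assoc, mul_assoc, ← sq, mul_assoc]
  have := (h ξ h5 h6).1
  gcongr

/-- second order Taylor estimate for powers -/
lemma rpow_taylor {α β : ℝ} (hα : 0 < α) (q : ℝ) : ∃ L : ℝ, 0 ≤ L ∧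
    ∀ s t, α ≤ s → s ≤ β → α ≤ t → t ≤ β →
      |s ^ q - t ^ q - (q * t ^ (q - 1)) * (s - t)| ≤ L * (s - t) ^ 2 := by
  obtain ⟨L, hL, h⟩ := rpow_lip (β := β) hα (q - 1)
  refine ⟨|q| * L, mul_nonneg (abs_nonneg _) hL, fun s t h1 h2 h3 h4 => ?_⟩
  have key : ∃ ξ, α ≤ ξ ∧ ξ ≤ β ∧ |ξ - t| ≤ |s - t| ∧
      s ^ q - t ^ q = (q * ξ ^ (q - 1)) * (s - t) := by
    obtain ⟨ξ, h5, h6, h7⟩ := rpow_mvt (α := min s t) (β := max s t)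
      (lt_min (hα.trans_le h1) (hα.trans_le h3)) q (min_le_left _ _) (le_max_left _ _)
      (min_le_right _ _) (le_max_right _ _)
    refine ⟨ξ, (le_min h1 h3).trans h5, h6.trans (max_le h2 h4), ?_, h7⟩
    rcases le_total s t with hst | hst
    · rw [min_eq_left hst] at h5; rw [max_eq_right hst] at h6
      rw [abs_of_nonpos (by linarith), abs_of_nonpos (by linarith)]; linarith
    · rw [min_eq_right hst] at h5; rw [max_eq_left hst] at h6
      rw [abs_of_nonneg (by linarith), abs_of_nonneg (by linarith)]; linarith
  obtain ⟨ξ, h5, h6, h7, h8⟩ := key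
  have e1 : s ^ q - t ^ q - (q * t ^ (q - 1)) * (s - t) =
      q * (ξ ^ (q - 1) - t ^ (q - 1)) * (s - t) := by rw [h8]; ring
  rw [e1, abs_mul, abs_mul, ← sq_abs (s - t)]
  have h9 := h ξ t h5 h6 h3 h4
  calc |q| * |ξ ^ (q - 1) - t ^ (q - 1)| * |s - t| ≤ |q| * (L * |ξ - t|) * |s - t| := by gcongr
    _ ≤ |q| * (L * |s - t|) * |s - t| := by gcongr
    _ = _ := by ring
end Scalar

section NearSec
variable {E : Type*} [NormedAddCommGroup E] [InnerProductSpace ℝ E] [CompleteSpace E]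

lemma Fp_coer {α β p : ℝ} (hp : 1 < p) (hα : 0 < α) : ∃ k : ℝ, 0 < k ∧
    ∀ a b : E, α ≤ ‖a‖ → ‖a‖ ≤ β → α ≤ ‖b‖ → ‖b‖ ≤ β →
      k * ‖a - b‖ ^ 2 ≤ ⟪Fp p a - Fp p b, a - b⟫ := by
  obtain ⟨m, M, hm, hmM, h⟩ := rpow_bounds (β := β) hα (p - 2)
  obtain ⟨k, hk, h'⟩ := rpow_coer (β := β) hα (q := p - 1) (by linarith)
  refine ⟨min m k, lt_min hm hk, fun a b h1 h2 h3 h4 => ?_⟩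
  rw [Fp_mono_identity hp]
  have h5 := (h _ h1 h2).1
  have h6 := (h _ h3 h4).1
  have h7 := h' _ _ h1 h2 h3 h4
  have h8 : 0 ≤ ‖a‖ * ‖b‖ - ⟪a, b⟫ := by linarith [real_inner_le_norm a b]
  have h9 : ‖a - b‖ ^ 2 = (‖a‖ - ‖b‖) ^ 2 + 2 * (‖a‖ * ‖b‖ - ⟪a, b⟫) := by
    rw [norm_sub_sq_real]; ring
  rw [h9]
  have h10 : min m k * (‖a‖ - ‖b‖) ^ 2 ≤ k * (‖a‖ - ‖b‖) ^ 2 := by gcongr; exact min_le_right _ _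
  have h11 : min m k * (2 * (‖a‖ * ‖b‖ - ⟪a, b⟫)) ≤
      (‖a‖ ^ (p - 2) + ‖b‖ ^ (p - 2)) * (‖a‖ * ‖b‖ - ⟪a, b⟫) := by
    have : min m k ≤ m := min_le_left _ _
    nlinarith
  linarith

lemma Fp_lip {α β p : ℝ} (hα : 0 < α) (hαβ : α ≤ β) : ∃ L : ℝ, 0 < L ∧
    ∀ a b : E, α ≤ ‖a‖ → ‖a‖ ≤ β → α ≤ ‖b‖ → ‖b‖ ≤ β → ‖Fp p a - Fp p b‖ ≤ L * ‖a - b‖ := by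
  obtain ⟨m, M, hm, hmM, h⟩ := rpow_bounds (β := β) hα (p - 2)
  obtain ⟨L, hL, h'⟩ := rpow_lip (β := β) hα (p - 2)
  refine ⟨M + L * β, by have := hα.trans_le hαβ; have := hm.trans_le hmM; positivity,
    fun a b h1 h2 h3 h4 => ?_⟩
  have e1 : Fp p a - Fp p b = ‖a‖ ^ (p - 2) • (a - b) + (‖a‖ ^ (p - 2) - ‖b‖ ^ (p - 2)) • b := by
    simp only [Fp, smul_sub, sub_smul]; abel
  rw [e1]
  refine (norm_add_le _ _).trans ?_
  rw [norm_smul, norm_smul, Real.norm_eq_abs, Real.norm_eq_abs]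
  have h5 := (h _ h1 h2)
  rw [abs_of_pos (hm.trans_le h5.1)]
  have h6 := h' _ _ h1 h2 h3 h4
  have h7 := abs_norm_sub_norm_le a b
  calc _ ≤ M * ‖a - b‖ + (L * ‖a - b‖) * β := by
        gcongr
        · exact h5.2
        · exact h6.trans (by gcongr)
    _ = _ := by ring

variable [FiniteDimensional ℝ E] [MeasurableSpace E] [BorelSpace E]

/-- the data close to the outer sphere -/
structure Near (p lam : ℝ) (e : E) (ρ R₁ : ℝ) (u : E → ℝ) (c δ₁ : ℝ) : Prop extends
    Shell p lam e ρ R₁ u where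
  hc : 0 < c
  hδ : 0 < δ₁
  hδ1 : δ₁ ≤ 1
  hδρ : ρ < R₁ - δ₁
  near : ∀ x, R₁ - δ₁ ≤ ‖x‖ → ‖x‖ ≤ R₁ → ‖gradient u x + c • (‖x‖⁻¹ • x)‖ ≤ c / 4
  eps : ∀ ε, 0 < ε → ∃ δ, 0 < δ ∧ δ ≤ δ₁ ∧
    ∀ x, R₁ - δ ≤ ‖x‖ → ‖x‖ ≤ R₁ → ‖gradient u x + c • (‖x‖⁻¹ • x)‖ ≤ ε

variable {p lam ρ R₁ c δ₁ : ℝ} {e : E} {u : E → ℝ}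

lemma Shell.exists_near (H : Shell p lam e ρ R₁ u) : ∃ c δ₁, Near p lam e ρ R₁ u c δ₁ := by
  obtain ⟨c, hc, hg⟩ := H.exists_c_pos
  have key : ∀ ε, 0 < ε → ∃ δ, 0 < δ ∧ δ < R₁ ∧
    ∀ x, R₁ - δ ≤ ‖x‖ → ‖x‖ ≤ R₁ → ‖gradient u x + c • (‖x‖⁻¹ • x)‖ ≤ ε := by
    intro ε hε
    have h1 := (isCompact_closedBall (0:E) R₁).uniformContinuousOn_of_continuous
      H.hu.continuous_grad.continuousOn
    obtain ⟨δ, hδ, h2⟩ := Metric.uniformContinuousOn_iff.1 h1 ε hε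
    have hR := H.hR
    refine ⟨min (δ / 2) (R₁ / 2), by positivity, ?_, fun x h3 h4 => ?_⟩
    · exact (min_le_right _ _).trans_lt (by linarith)
    have h5 : min (δ / 2) (R₁ / 2) ≤ R₁ / 2 := min_le_right _ _
    have h6 : min (δ / 2) (R₁ / 2) ≤ δ / 2 := min_le_left _ _
    have hx : 0 < ‖x‖ := by linarith
    have hn : ‖‖x‖⁻¹ • x‖ = 1 := by rw [norm_smul, norm_inv, norm_norm, inv_mul_cancel₀ hx.ne']
    have h7 := hg _ hn
    have hy := norm_ray hn hR.le
    have h8 : dist x (R₁ • (‖x‖⁻¹ • x)) < δ := by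
      rw [dist_eq_norm]
      have : x - R₁ • (‖x‖⁻¹ • x) = (‖x‖ - R₁) • (‖x‖⁻¹ • x) := by
        rw [sub_smul, smul_smul ‖x‖, mul_inv_cancel₀ hx.ne', one_smul]
      rw [this, norm_smul, hn, Real.norm_eq_abs, abs_of_nonpos (by linarith)]
      linarith
    have h9 := h2 x (mem_closedBall_zero_iff.2 h4) _ (mem_closedBall_zero_iff.2 hy.le) h8
    rw [h7, dist_eq_norm, neg_smul, sub_neg_eq_add] at h9
    exact h9.le
  obtain ⟨δ, hδ, hδR, h⟩ := key (c / 4) (by positivity)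
  have hρR := H.hρR
  have hm : 0 < min δ (min 1 ((R₁ - ρ) / 2)) := by
    refine lt_min hδ (lt_min one_pos ?_); linarith
  have m1 := min_le_left δ (min 1 ((R₁ - ρ) / 2))
  have m2 := (min_le_right δ (min 1 ((R₁ - ρ) / 2))).trans (min_le_left _ _)
  have m3 := (min_le_right δ (min 1 ((R₁ - ρ) / 2))).trans (min_le_right _ _)
  refine ⟨c, min δ (min 1 ((R₁ - ρ) / 2)), ⟨H, hc, hm, m2, by linarith, fun x h1 h2 =>
    h x (by linarith) h2, fun ε hε => ?_⟩⟩
  obtain ⟨δ', hδ', hδR', h'⟩ := key ε hε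
  refine ⟨min δ' (min δ (min 1 ((R₁ - ρ) / 2))), lt_min hδ' hm, min_le_right _ _, fun x h1 h2 =>
    h' x ?_ h2⟩
  have := min_le_left δ' (min δ (min 1 ((R₁ - ρ) / 2)))
  linarith

/-- growth of `u` away from the sphere -/
lemma Shell.growth (H : Shell p lam e ρ R₁ u) {δ ε : ℝ} (hδ : δ < R₁)
    (h : ∀ x, R₁ - δ ≤ ‖x‖ → ‖x‖ ≤ R₁ → ‖gradient u x + c • (‖x‖⁻¹ • x)‖ ≤ ε) {x : E}
    (h1 : R₁ - δ ≤ ‖x‖) (h2 : ‖x‖ ≤ R₁) : |u x - c * (R₁ - ‖x‖)| ≤ ε * (R₁ - ‖x‖) := by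
  have hx : 0 < ‖x‖ := by linarith
  set ω := ‖x‖⁻¹ • x with hω
  have hn : ‖ω‖ = 1 := by rw [hω, norm_smul, norm_inv, norm_norm, inv_mul_cancel₀ hx.ne']
  have hxω : x = ‖x‖ • ω := by rw [hω, smul_smul, mul_inv_cancel₀ hx.ne', one_smul]
  have hd : ∀ t, HasDerivAt (fun t : ℝ => u (t • ω) + c * t) (⟪gradient u (t • ω), ω⟫ + c * 1) t :=
    fun t => (hasDerivAt_ray H.hu ω t).add ((hasDerivAt_id t).const_mul c)
  have hb : ∀ t ∈ Icc ‖x‖ R₁, ‖⟪gradient u (t • ω), ω⟫ + c * 1‖ ≤ ε := by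
    intro t ht
    have ht0 : 0 < t := hx.trans_le ht.1
    have h3 := norm_ray hn ht0.le
    have h4 := h (t • ω) (by rw [h3]; linarith [ht.1]) (by rw [h3]; exact ht.2)
    rw [h3, smul_smul t⁻¹, inv_mul_cancel₀ ht0.ne', one_smul] at h4
    have h5 : ⟪gradient u (t • ω), ω⟫ + c * 1 = ⟪gradient u (t • ω) + c • ω, ω⟫ := by
      rw [inner_add_left, real_inner_smul_left, real_inner_self_eq_norm_sq, hn]; ring
    rw [h5]
    have := norm_inner_le_norm (𝕜 := ℝ) (gradient u (t • ω) + c • ω) ω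
    rw [hn, mul_one] at this
    exact this.trans h4
  have h6 := (convex_Icc ‖x‖ R₁).norm_image_sub_le_of_norm_hasDerivWithin_le
    (fun t ht => (hd t).hasDerivWithinAt) hb ⟨h2, le_rfl⟩ ⟨le_rfl, h2⟩
  rw [← hxω, H.bd _ (norm_ray hn H.hR.le), Real.norm_eq_abs, Real.norm_eq_abs,
    abs_of_nonpos (show ‖x‖ - R₁ ≤ 0 by linarith)] at h6
  have e1 : u x + c * ‖x‖ - (0 + c * R₁) = u x - c * (R₁ - ‖x‖) := by ring
  rw [e1] at h6
  linarith

lemma Near.δR (H : Near p lam e ρ R₁ u c δ₁) : δ₁ < R₁ := by linarith [H.hδρ, H.hρ]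

lemma Near.u_bounds (H : Near p lam e ρ R₁ u c δ₁) {x : E} (h1 : R₁ - δ₁ ≤ ‖x‖) (h2 : ‖x‖ ≤ R₁) :
    3 / 4 * c * (R₁ - ‖x‖) ≤ u x ∧ u x ≤ 5 / 4 * c * (R₁ - ‖x‖) := by
  have := abs_le.1 (H.growth H.δR H.near h1 h2)
  constructor <;> linarith [this.1, this.2]

lemma Near.grad_bounds (H : Near p lam e ρ R₁ u c δ₁) {x : E} (h1 : R₁ - δ₁ ≤ ‖x‖) (h2 : ‖x‖ ≤ R₁) :
    3 / 4 * c ≤ ‖gradient u x‖ ∧ ‖gradient u x‖ ≤ 5 / 4 * c := by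
  have hx : 0 < ‖x‖ := by linarith [H.δR]
  have h3 := H.near x h1 h2
  have hn : ‖c • (‖x‖⁻¹ • x)‖ = c := by
    rw [norm_smul, norm_smul, norm_inv, norm_norm, inv_mul_cancel₀ hx.ne', mul_one,
      Real.norm_of_nonneg H.hc.le]
  constructor
  · have := norm_sub_le (gradient u x + c • (‖x‖⁻¹ • x)) (gradient u x)
    rw [add_sub_cancel_left, hn] at this; linarith
  · have := norm_sub_le (gradient u x + c • (‖x‖⁻¹ • x)) (c • (‖x‖⁻¹ • x))
    rw [add_sub_cancel_right, hn] at this; linarith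

/-- the zeroth order term -/
lemma Near.pow_diff (H : Near p lam e ρ R₁ u c δ₁) : ∃ C, 0 ≤ C ∧ ∀ x y, ‖x‖ = ‖y‖ →
    R₁ - δ₁ ≤ ‖x‖ → ‖x‖ < R₁ →
    |u x ^ (p - 1) - u y ^ (p - 1)| ≤ C * (R₁ - ‖x‖)⁻¹ * |u x - u y| := by
  have hc := H.hc
  obtain ⟨m, M, hm, hmM, hb⟩ := rpow_bounds (α := 3 / 4 * c) (β := 5 / 4 * c) (by positivity) (p - 2)
  have hp := H.hp
  have hM : 0 ≤ M := hm.le.trans hmM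
  have hp1 : 0 ≤ p - 1 := by linarith
  refine ⟨(p - 1) * M, mul_nonneg hp1 hM, fun x y hxy h1 h2 => ?_⟩
  set d := R₁ - ‖x‖ with hd
  have hd0 : 0 < d := by rw [hd]; linarith
  have hd1 : d ≤ 1 := by rw [hd]; linarith [H.hδ1]
  have b1 := H.u_bounds h1 h2.le
  have b2 := H.u_bounds (x := y) (by rw [← hxy]; exact h1) (by rw [← hxy]; exact h2.le)
  rw [← hxy] at b2
  rw [← hd] at b1 b2
  obtain ⟨ξ, h5, h6, h7⟩ := rpow_mvt (α := 3 / 4 * c * d) (β := 5 / 4 * c * d) (by positivity) (p - 1)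
    b1.1 b1.2 b2.1 b2.2
  rw [h7, abs_mul]
  refine mul_le_mul_of_nonneg_right ?_ (abs_nonneg _)
  have hξ : 0 < ξ := lt_of_lt_of_le (by positivity) h5
  rw [abs_of_nonneg (by positivity), mul_assoc]
  refine mul_le_mul_of_nonneg_left ?_ hp1
  have e1 : p - 1 - 1 = p - 2 := by ring
  have e2 : ξ ^ (p - 2) = (ξ / d) ^ (p - 2) * d ^ (p - 2) := by
    rw [← Real.mul_rpow (by positivity) hd0.le]; congr 1; field_simp
  rw [e1, e2]
  refine mul_le_mul (hb _ ?_ ?_).2 ?_ (by positivity) hM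
  · rw [le_div_iff₀ hd0]; linarith
  · rw [div_le_iff₀ hd0]; linarith
  · rw [← Real.rpow_neg_one]
    exact Real.rpow_le_rpow_of_exponent_ge hd0 hd1 (by linarith)
end NearSec


section Cacc
variable {E : Type*} [NormedAddCommGroup E] [InnerProductSpace ℝ E] [CompleteSpace E]

lemma st_deriv_zero {t : ℝ} (h : t < 0 ∨ 1 < t) : deriv Real.smoothTransition t = 0 := by
  rcases h with h | h
  · have : Real.smoothTransition =ᶠ[𝓝 t] fun _ => (0:ℝ) := by
      filter_upwards [Iio_mem_nhds h] with y hy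
      exact Real.smoothTransition.zero_of_nonpos (le_of_lt hy)
    rw [this.deriv_eq, deriv_const]
  · have : Real.smoothTransition =ᶠ[𝓝 t] fun _ => (1:ℝ) := by
      filter_upwards [Ioi_mem_nhds h] with y hy
      exact Real.smoothTransition.one_of_one_le (le_of_lt hy)
    rw [this.deriv_eq, deriv_const]

lemma st_contDiff : ContDiff ℝ 1 Real.smoothTransition := Real.smoothTransition.contDiff

lemma st_bd : ∃ C : ℝ, 0 ≤ C ∧ ∀ t, |deriv Real.smoothTransition t| ≤ C := by
  have hc : Continuous (deriv Real.smoothTransition) := st_contDiff.continuous_deriv le_rfl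
  obtain ⟨C, hC⟩ := (isCompact_Icc (a := (0:ℝ)) (b := 1)).exists_bound_of_continuousOn hc.continuousOn
  refine ⟨max C 0, le_max_right _ _, fun t => ?_⟩
  by_cases h : t ∈ Icc (0:ℝ) 1
  · exact (hC t h).trans (le_max_left _ _)
  · have h' : t < 0 ∨ 1 < t := by
      by_contra hh; push Not at hh; exact h ⟨hh.1, hh.2⟩
    rw [st_deriv_zero h', abs_zero]; exact le_max_right _ _

/-- cutoffs depending on the squared norm -/
noncomputable def cutS (a b : ℝ) (x : E) : ℝ := Real.smoothTransition (a * ‖x‖ ^ 2 + b)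

lemma contDiff_cutS (a b : ℝ) : ContDiff ℝ 1 (cutS a b : E → ℝ) :=
  st_contDiff.comp ((contDiff_const.mul (contDiff_norm_sq ℝ)).add contDiff_const)

lemma hasGrad_cutS (a b : ℝ) (x : E) : HasGradientAt (cutS a b)
    ((deriv Real.smoothTransition (a * ‖x‖ ^ 2 + b) * (2 * a)) • x) x := by
  have h1 : HasGradientAt (fun y : E => ‖y‖ ^ 2) ((2:ℝ) • x) x := by
    rw [hasGrad_iff]
    have := (hasStrictFDerivAt_norm_sq x).hasFDerivAt
    have e1 : innerSL ℝ ((2:ℝ) • x) = 2 • (innerSL ℝ x) := by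
      ext y; simp [inner_smul_left]; 
    rw [e1]; exact this
  have h2 : HasDerivAt (fun t : ℝ => Real.smoothTransition (a * t + b))
      (deriv Real.smoothTransition (a * ‖x‖ ^ 2 + b) * (a * 1)) (‖x‖ ^ 2) := by
    have h3 : HasDerivAt (fun t : ℝ => a * t + b) (a * 1) (‖x‖ ^ 2) :=
      ((hasDerivAt_id _).const_mul a).add_const b
    have h4 := (st_contDiff.differentiable one_ne_zero (a * ‖x‖ ^ 2 + b)).hasDerivAt
    exact h4.comp (‖x‖ ^ 2) h3
  have h5 := HasGradientAt.real_comp (f := fun y : E => ‖y‖ ^ 2) h2 h1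
  have e2 : (deriv Real.smoothTransition (a * ‖x‖ ^ 2 + b) * (2 * a)) • x =
      (deriv Real.smoothTransition (a * ‖x‖ ^ 2 + b) * (a * 1)) • ((2:ℝ) • x) := by
    rw [smul_smul]; congr 1; ring
  rw [e2]; exact h5

lemma bd_dist {φ : E → ℝ} [FiniteDimensional ℝ E] [MeasurableSpace E] [BorelSpace E] (hφ : ContDiff ℝ 1 φ) {R₁ : ℝ} (hR : 0 < R₁)
    (h0 : ∀ x, ‖x‖ = R₁ → φ x = 0) (h00 : φ 0 = 0) :
    ∃ L, 0 ≤ L ∧ ∀ x, ‖x‖ ≤ R₁ → |φ x| ≤ L * (R₁ - ‖x‖) := by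
  have hc : Continuous (fderiv ℝ φ) := hφ.continuous_fderiv one_ne_zero
  obtain ⟨L, hL, hb⟩ := exists_bound_cs hc (isCompact_closedBall (0:E) R₁)
  refine ⟨L, hL, fun x hx => ?_⟩
  by_cases hx0 : x = 0
  · rw [hx0, h00]; simp; positivity
  have hn : 0 < ‖x‖ := norm_pos_iff.2 hx0
  have h1 : ‖(R₁ * ‖x‖⁻¹) • x‖ = R₁ := by
    rw [norm_smul, Real.norm_of_nonneg (by positivity)]; field_simp
  have h2 := (convex_closedBall (0:E) R₁).norm_image_sub_le_of_norm_fderiv_le (𝕜 := ℝ) (f := φ) (C := L)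
    (fun y _ => hφ.differentiable one_ne_zero y) hb (mem_closedBall_zero_iff.2 h1.le)
    (mem_closedBall_zero_iff.2 hx)
  rw [h0 _ h1, sub_zero, Real.norm_eq_abs] at h2
  have h3 : x - (R₁ * ‖x‖⁻¹) • x = (-(R₁ - ‖x‖) * ‖x‖⁻¹) • x := by
    rw [show -(R₁ - ‖x‖) * ‖x‖⁻¹ = 1 - R₁ * ‖x‖⁻¹ by field_simp; ring, sub_smul, one_smul]
  rw [h3, norm_smul, norm_mul, norm_neg, Real.norm_of_nonneg (by linarith : 0 ≤ R₁ - ‖x‖), norm_inv,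
    norm_norm, mul_assoc, inv_mul_cancel₀ hn.ne', mul_one] at h2
  exact h2

variable [FiniteDimensional ℝ E] [MeasurableSpace E] [BorelSpace E]

lemma weak_ext {p lam ρ ρ' R₁ : ℝ} {v φ : E → ℝ} (hp : 1 < p) (hρ : 0 < ρ) (hρ' : ρ < ρ')
    (hR : ρ' < R₁) (hv : ContDiff ℝ 1 v) (hw : WeakSol p lam {x | ρ < ‖x‖ ∧ ‖x‖ < R₁} v)
    (hφ : ContDiff ℝ 1 φ) (h0 : ∀ x, ‖x‖ = R₁ → φ x = 0) (hi : ∀ x, ‖x‖ ≤ ρ' → φ x = 0) :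
    ∫ x in ball 0 R₁, ⟪Fp p (gradient v x), gradient φ x⟫ =
      lam * ∫ x in ball 0 R₁, (v x) ^ (p - 1) * φ x := by
  have hR0 : 0 < R₁ := by linarith
  obtain ⟨L, hL, hLb⟩ := bd_dist hφ hR0 h0 (hi 0 (by simp; linarith))
  obtain ⟨CT, hCT, hT⟩ := st_bd
  set K := closedBall (0:E) R₁ with hKdef
  have hK : IsCompact K := isCompact_closedBall _ _
  have cF : Continuous fun x => Fp p (gradient v x) := (continuous_Fp hp).comp hv.continuous_grad
  have cv : Continuous fun x => (v x) ^ (p - 1) :=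
    hv.continuous.rpow_const fun x => Or.inr (by linarith)
  obtain ⟨C1, hC1, hb1⟩ := exists_bound_cs cF hK
  obtain ⟨C2, hC2, hb2⟩ := exists_bound_cs cv hK
  obtain ⟨C3, hC3, hb3⟩ := exists_bound_cs hφ.continuous_grad hK
  obtain ⟨C4, hC4, hb4⟩ := exists_bound_cs hφ.continuous hK
  let θ : ℕ → E → ℝ := fun n => cutS (-((n:ℝ) + 1)) (((n:ℝ) + 1) * R₁ ^ 2 - 1)
  have θ1 : ∀ n, ContDiff ℝ 1 (θ n) := fun n => contDiff_cutS _ _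
  have θarg : ∀ (n : ℕ) (x : E), -((n:ℝ) + 1) * ‖x‖ ^ 2 + (((n:ℝ) + 1) * R₁ ^ 2 - 1) =
      ((n:ℝ) + 1) * (R₁ ^ 2 - ‖x‖ ^ 2) - 1 := fun n x => by ring
  have θg : ∀ n x, gradient (θ n) x = (deriv Real.smoothTransition
      (((n:ℝ) + 1) * (R₁ ^ 2 - ‖x‖ ^ 2) - 1) * (2 * -((n:ℝ) + 1))) • x := by
    intro n x; rw [← θarg]; exact (hasGrad_cutS _ _ x).gradient
  have θ0 : ∀ (n : ℕ) (x : E), ((n:ℝ) + 1) * (R₁ ^ 2 - ‖x‖ ^ 2) ≤ 1 → θ n x = 0 := by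
    intro n x h
    refine Real.smoothTransition.zero_of_nonpos ?_
    rw [θarg]; linarith
  have θe : ∀ (n : ℕ) (x : E), 2 ≤ ((n:ℝ) + 1) * (R₁ ^ 2 - ‖x‖ ^ 2) → θ n x = 1 := by
    intro n x h
    refine Real.smoothTransition.one_of_one_le ?_
    rw [θarg]; linarith
  have θb : ∀ n x, |θ n x| ≤ 1 := fun n x => by
    show |Real.smoothTransition _| ≤ 1
    rw [abs_of_nonneg (Real.smoothTransition.nonneg _)]; exact Real.smoothTransition.le_one _
  let φn : ℕ → E → ℝ := fun n x => φ x * θ n x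
  have φ1 : ∀ n, ContDiff ℝ 1 (φn n) := fun n => hφ.mul (θ1 n)
  have φg : ∀ n x, gradient (φn n) x = φ x • gradient (θ n) x + θ n x • gradient φ x :=
    fun n x => (HasGradientAt.mul' (hφ.hasGrad x) ((θ1 n).hasGrad x)).gradient
  have hout : ∀ n, ∀ x, x ∉ K → θ n x = 0 := by
    intro n x hx
    have hx' : R₁ < ‖x‖ := by simpa [hKdef] using hx
    refine θ0 n x ?_
    have : R₁ ^ 2 - ‖x‖ ^ 2 ≤ 0 := by nlinarith
    have h5 : (0:ℝ) ≤ (n:ℝ) + 1 := by positivity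
    nlinarith
  have hgK : ∀ n, ∀ x, x ∉ K → gradient (θ n) x = 0 := by
    intro n x hx
    have hx' : R₁ < ‖x‖ := by simpa [hKdef] using hx
    have : R₁ ^ 2 - ‖x‖ ^ 2 ≤ 0 := by nlinarith
    have h5 : (0:ℝ) ≤ (n:ℝ) + 1 := by positivity
    rw [θg, st_deriv_zero (Or.inl (by nlinarith)), zero_mul, zero_smul]
  have hgb : ∀ n x, ‖φ x • gradient (θ n) x‖ ≤ 4 * (L * CT) := by
    intro n x
    by_cases hx : x ∈ K
    swap
    · rw [hgK n x hx, smul_zero, norm_zero]; positivity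
    have hx' : ‖x‖ ≤ R₁ := by simpa [hKdef] using hx
    have h5 : (0:ℝ) < (n:ℝ) + 1 := by positivity
    rw [θg]
    by_cases h6 : ((n:ℝ) + 1) * (R₁ ^ 2 - ‖x‖ ^ 2) ≤ 2
    swap
    · rw [st_deriv_zero (Or.inr (by linarith)), zero_mul, zero_smul, smul_zero, norm_zero]; positivity
    rw [norm_smul, norm_smul, norm_mul, norm_mul, norm_neg, Real.norm_of_nonneg h5.le]
    simp only [Real.norm_eq_abs]
    have h7 := hLb x hx'
    have h8 : R₁ * (R₁ - ‖x‖) ≤ R₁ ^ 2 - ‖x‖ ^ 2 := by nlinarith [norm_nonneg x]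
    have h9 : ((n:ℝ) + 1) * (R₁ * (R₁ - ‖x‖)) ≤ 2 := (mul_le_mul_of_nonneg_left h8 h5.le).trans h6
    calc _ ≤ (L * (R₁ - ‖x‖)) * (CT * (|2| * ((n:ℝ) + 1)) * R₁) := by
          gcongr
          exact hT _
      _ = 2 * (L * CT) * (((n:ℝ) + 1) * (R₁ * (R₁ - ‖x‖))) := by rw [abs_two]; ring
      _ ≤ 2 * (L * CT) * 2 := by gcongr
      _ = _ := by ring
  have hev : ∀ x ∈ ball (0:E) R₁, ∀ᶠ n : ℕ in atTop, 3 ≤ ((n:ℝ) + 1) * (R₁ ^ 2 - ‖x‖ ^ 2) := by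
    intro x hx
    rw [mem_ball_zero_iff] at hx
    have h6 : 0 < R₁ ^ 2 - ‖x‖ ^ 2 := by nlinarith [norm_nonneg x]
    have h7 : Tendsto (fun n : ℕ => ((n:ℝ) + 1) * (R₁ ^ 2 - ‖x‖ ^ 2)) atTop atTop :=
      (tendsto_atTop_add_const_right _ _ tendsto_natCast_atTop_atTop).atTop_mul_const h6
    exact h7.eventually_ge_atTop 3
  have hnb : ∀ n, ∀ x ∉ ball (0:E) R₁, θ n x = 0 ∧ φ x • gradient (θ n) x = 0 := by
    intro n x hx
    rw [mem_ball_zero_iff, not_lt] at hx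
    have : R₁ ^ 2 - ‖x‖ ^ 2 ≤ 0 := by nlinarith
    have h5 : (0:ℝ) ≤ (n:ℝ) + 1 := by positivity
    refine ⟨θ0 n x (by nlinarith), ?_⟩
    rw [θg, st_deriv_zero (Or.inl (by nlinarith)), zero_mul, zero_smul, smul_zero]
  have hweak : ∀ n, ∫ x, ⟪Fp p (gradient v x), gradient (φn n) x⟫ =
      lam * ∫ x, (v x) ^ (p - 1) * φn n x := by
    intro n
    have h5 : (0:ℝ) < (n:ℝ) + 1 := by positivity
    have hcl : IsClosed {x : E | ρ' ≤ ‖x‖ ∧ 1 ≤ ((n:ℝ) + 1) * (R₁ ^ 2 - ‖x‖ ^ 2)} :=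
      (isClosed_le continuous_const continuous_norm).inter
        (isClosed_le continuous_const (continuous_const.mul (continuous_const.sub (continuous_norm.pow 2))))
    have hts : tsupport (φn n) ⊆ {x : E | ρ' ≤ ‖x‖ ∧ 1 ≤ ((n:ℝ) + 1) * (R₁ ^ 2 - ‖x‖ ^ 2)} := by
      refine closure_minimal (fun x hx => ?_) hcl
      by_contra hh
      refine hx ?_
      show φ x * θ n x = 0
      by_cases h6 : ρ' ≤ ‖x‖
      · have h7 : ¬ 1 ≤ ((n:ℝ) + 1) * (R₁ ^ 2 - ‖x‖ ^ 2) := fun h => hh ⟨h6, h⟩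
        rw [θ0 n x (by linarith), mul_zero]
      · rw [hi x (by linarith), zero_mul]
    have hS : {x : E | ρ' ≤ ‖x‖ ∧ 1 ≤ ((n:ℝ) + 1) * (R₁ ^ 2 - ‖x‖ ^ 2)} ⊆
        {x | ρ < ‖x‖ ∧ ‖x‖ < R₁} := by
      rintro x ⟨h6, h7⟩
      refine ⟨by linarith, ?_⟩
      by_contra h8
      push Not at h8
      have : R₁ ^ 2 - ‖x‖ ^ 2 ≤ 0 := by nlinarith
      nlinarith
    refine hw _ (φ1 n) (hasCompactSupport_of_tsupport_subset hK ?_) (hts.trans hS)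
    refine (hts.trans hS).trans fun x hx => ?_
    rw [hKdef, mem_closedBall_zero_iff]; exact hx.2.le
  have t1 : Tendsto (fun n => ∫ x, ⟪Fp p (gradient v x), gradient (φn n) x⟫) atTop
      (𝓝 (∫ x, (ball (0:E) R₁).indicator (fun x => ⟪Fp p (gradient v x), gradient φ x⟫) x)) := by
    refine tendsto_integral_compact hK (fun n => cF.inner (φ1 n).continuous_grad)
      (C1 * (4 * (L * CT) + 1 * C3)) ?_ ?_ ?_
    · intro n x
      by_cases hx : x ∈ K
      · refine (abs_real_inner_le_norm _ _).trans ?_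
        refine mul_le_mul (hb1 x hx) ?_ (norm_nonneg _) hC1
        rw [φg]
        refine (norm_add_le _ _).trans (add_le_add (hgb n x) ?_)
        rw [norm_smul]
        exact mul_le_mul (θb n x) (hb3 x hx) (norm_nonneg _) zero_le_one
      · rw [φg, hout n x hx, hgK n x hx]; simp; positivity
    · intro n x hx
      rw [φg, hout n x hx, hgK n x hx]; simp
    · intro x
      by_cases hx : x ∈ ball (0:E) R₁
      · rw [indicator_of_mem hx]
        refine tendsto_const_nhds.congr' ?_
        filter_upwards [hev x hx] with n hn
        rw [φg, θe n x (by linarith), θg, st_deriv_zero (Or.inr (by linarith))]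
        simp
      · rw [indicator_of_notMem hx]
        refine tendsto_const_nhds.congr fun n => ?_
        rw [φg, (hnb n x hx).1, (hnb n x hx).2]; simp
  have t2 : Tendsto (fun n => ∫ x, (v x) ^ (p - 1) * φn n x) atTop
      (𝓝 (∫ x, (ball (0:E) R₁).indicator (fun x => (v x) ^ (p - 1) * φ x) x)) := by
    refine tendsto_integral_compact hK (fun n => cv.mul (φ1 n).continuous) (C2 * (C4 * 1)) ?_ ?_ ?_
    · intro n x
      by_cases hx : x ∈ K
      · rw [abs_mul]
        refine mul_le_mul (hb2 x hx) ?_ (abs_nonneg _) hC2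
        show |φ x * θ n x| ≤ _
        rw [abs_mul]
        exact mul_le_mul (hb4 x hx) (θb n x) (abs_nonneg _) hC4
      · show |_ * (φ x * θ n x)| ≤ _
        rw [hout n x hx]; simp; positivity
    · intro n x hx
      show _ * (φ x * θ n x) = _
      rw [hout n x hx]; simp
    · intro x
      by_cases hx : x ∈ ball (0:E) R₁
      · rw [indicator_of_mem hx]
        refine tendsto_const_nhds.congr' ?_
        filter_upwards [hev x hx] with n hn
        show _ = _ * (φ x * θ n x)
        rw [θe n x (by linarith), mul_one]
      · rw [indicator_of_notMem hx]
        refine tendsto_const_nhds.congr fun n => ?_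
        show _ = _ * (φ x * θ n x)
        rw [(hnb n x hx).1]; simp
  rw [integral_indicator measurableSet_ball] at t1 t2
  simp only [hweak] at t1
  exact tendsto_nhds_unique t1 (t2.const_mul lam)
end Cacc


section Cacc2
/-- indicator of an interval -/
noncomputable def ch (a b r : ℝ) : ℝ := (Ioo a b).indicator (fun _ => 1) r

lemma ch_of_mem {a b r : ℝ} (h1 : a < r) (h2 : r < b) : ch a b r = 1 :=
  indicator_of_mem (show r ∈ Ioo a b from ⟨h1, h2⟩) _
lemma ch_of_le {a b r : ℝ} (h1 : r ≤ a) : ch a b r = 0 :=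
  indicator_of_notMem (fun h => absurd h.1 (not_lt.2 h1)) _
lemma ch_of_ge {a b r : ℝ} (h1 : b ≤ r) : ch a b r = 0 :=
  indicator_of_notMem (fun h => absurd h.2 (not_lt.2 h1)) _
lemma ch_nonneg (a b r : ℝ) : 0 ≤ ch a b r := indicator_nonneg (fun _ _ => zero_le_one) _
lemma ch_le_one (a b r : ℝ) : ch a b r ≤ 1 := by
  by_cases h1 : a < r
  · by_cases h2 : r < b
    · rw [ch_of_mem h1 h2]
    · rw [ch_of_ge (not_lt.1 h2)]; exact zero_le_one
  · rw [ch_of_le (not_lt.1 h1)]; exact zero_le_one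
lemma ch_abs (a b r : ℝ) : |ch a b r| ≤ 1 := by
  rw [abs_of_nonneg (ch_nonneg _ _ _)]; exact ch_le_one _ _ _
lemma measurable_ch (a b : ℝ) : Measurable (ch a b) := measurable_const.indicator measurableSet_Ioo

lemma cacc_scalar {k Z D P L G h' w Y lam Q C0 d' Φ : ℝ} (hk : 0 < k) (hL : 0 < L) (hG0 : 0 ≤ G)
    (hh : 0 < h') (hlam : 0 ≤ lam) (hC0 : 0 ≤ C0) (hd : 0 < d') (hD0 : 0 ≤ D) (hz0 : 0 ≤ Z) (hz1 : Z ≤ 1)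
    (X1 : k * D ^ 2 ≤ P) (Y1 : |Y| ≤ (L * D) * (G * h')) (X3 : |Q| ≤ C0 * d' * |w|)
    (X5 : (h' ^ 2 + d') * |w| ≤ Φ) :
    k / 2 * (Z ^ 2 * D ^ 2) ≤ Z ^ 2 * P + 2 * Z * w * Y - lam * (Q * (Z ^ 2 * w)) +
      (2 / k * L ^ 2 * G ^ 2 + lam * C0) * Φ * |w| := by
  set C' := 2 / k * L ^ 2 * G ^ 2 + lam * C0 with hC'
  have hC'0 : 0 ≤ C' := by positivity
  have B1 : k * (Z ^ 2 * D ^ 2) ≤ Z ^ 2 * P := by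
    calc k * (Z ^ 2 * D ^ 2) = Z ^ 2 * (k * D ^ 2) := by ring
      _ ≤ _ := by gcongr
  have B2 : -(k / 2 * (Z ^ 2 * D ^ 2) + 2 / k * L ^ 2 * G ^ 2 * (h' ^ 2 * w ^ 2)) ≤ 2 * Z * w * Y := by
    have t1 : |2 * Z * w * Y| ≤ 2 * Z * |w| * (L * D * (G * h')) := by
      rw [abs_mul, abs_mul, abs_mul, abs_two, abs_of_nonneg hz0]; gcongr
    have t2 : 2 * Z * |w| * (L * D * (G * h')) ≤
        k / 2 * (Z ^ 2 * D ^ 2) + 2 / k * L ^ 2 * G ^ 2 * (h' ^ 2 * w ^ 2) := by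
      have t3 : k / 2 * (Z ^ 2 * D ^ 2) + 2 / k * L ^ 2 * G ^ 2 * (h' ^ 2 * w ^ 2) -
          2 * Z * |w| * (L * D * (G * h')) =
          k / 2 * (Z * D - 2 / k * (L * G * h' * |w|)) ^ 2 := by
        rw [← sq_abs w]; field_simp; ring
      have t4 : 0 ≤ k / 2 * (Z * D - 2 / k * (L * G * h' * |w|)) ^ 2 := by positivity
      linarith
    have := neg_abs_le (2 * Z * w * Y)
    linarith
  have B3 : lam * (Q * (Z ^ 2 * w)) ≤ lam * C0 * (d' * w ^ 2) := by
    have : Q * (Z ^ 2 * w) ≤ C0 * (d' * w ^ 2) := by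
      calc Q * (Z ^ 2 * w) ≤ |Q * (Z ^ 2 * w)| := le_abs_self _
        _ = |Q| * (Z ^ 2 * |w|) := by rw [abs_mul, abs_mul, abs_of_nonneg (sq_nonneg Z)]
        _ ≤ (C0 * d' * |w|) * (1 * |w|) := by gcongr; exact pow_le_one₀ hz0 hz1
        _ = C0 * (d' * w ^ 2) := by rw [← sq_abs w]; ring
    rw [mul_assoc]; gcongr
  have B4 : C' * ((h' ^ 2 + d') * w ^ 2) ≤ C' * Φ * |w| := by
    rw [mul_assoc, ← sq_abs w, sq |w|, ← mul_assoc (h' ^ 2 + d')]; gcongr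
  have B5 : 2 / k * L ^ 2 * G ^ 2 * (h' ^ 2 * w ^ 2) + lam * C0 * (d' * w ^ 2) ≤
      C' * ((h' ^ 2 + d') * w ^ 2) := by
    have p1 : 0 ≤ 2 / k * L ^ 2 * G ^ 2 * (d' * w ^ 2) := by positivity
    have p2 : 0 ≤ lam * C0 * (h' ^ 2 * w ^ 2) := by positivity
    rw [hC']; linarith
  linarith

variable {E : Type*} [NormedAddCommGroup E] [InnerProductSpace ℝ E] [CompleteSpace E]
variable [FiniteDimensional ℝ E] [MeasurableSpace E] [BorelSpace E]

lemma integrableOn_ball_cont {g : E → ℝ} (hg : Continuous g) (R₁ : ℝ) :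
    IntegrableOn g (ball 0 R₁) volume :=
  (hg.continuousOn.integrableOn_compact (isCompact_closedBall (0:E) R₁)).mono_set ball_subset_closedBall

lemma integrable_ch {g : E → ℝ} (hg : Continuous g) (a b : ℝ) :
    Integrable (fun x => ch a b ‖x‖ * g x) volume := by
  have hm : MeasurableSet {x : E | a < ‖x‖ ∧ ‖x‖ < b} :=
    ((isOpen_lt continuous_const continuous_norm).inter
      (isOpen_lt continuous_norm continuous_const)).measurableSet
  have h1 : (fun x => ch a b ‖x‖ * g x) = {x : E | a < ‖x‖ ∧ ‖x‖ < b}.indicator g := by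
    funext x
    by_cases h : a < ‖x‖ ∧ ‖x‖ < b
    · rw [indicator_of_mem (show x ∈ {x : E | a < ‖x‖ ∧ ‖x‖ < b} from h), ch_of_mem h.1 h.2, one_mul]
    · rw [indicator_of_notMem (show x ∉ {x : E | a < ‖x‖ ∧ ‖x‖ < b} from h)]
      by_cases h1 : a < ‖x‖
      · rw [ch_of_ge (not_lt.1 fun h2 => h ⟨h1, h2⟩), zero_mul]
      · rw [ch_of_le (not_lt.1 h1), zero_mul]
  rw [h1, integrable_indicator_iff hm]
  exact (integrableOn_ball_cont hg b).mono_set fun x hx => mem_ball_zero_iff.2 hx.2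

lemma setIntegral_ch (g : E → ℝ) (a b : ℝ) :
    ∫ x in ball 0 b, ch a b ‖x‖ * g x = ∫ x, ch a b ‖x‖ * g x := by
  refine setIntegral_eq_integral_of_forall_compl_eq_zero fun x hx => ?_
  rw [mem_ball_zero_iff, not_lt] at hx
  rw [ch_of_ge hx, zero_mul]

variable {p lam ρ R₁ c δ₁ : ℝ} {e : E} {u : E → ℝ}

set_option maxHeartbeats 1000000 in
lemma Near.cacc (H : Near p lam e ρ R₁ u c δ₁) : ∃ C, 0 ≤ C ∧ ∀ δ h Φ, 0 < δ → 0 < h → δ + h ≤ δ₁ →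
    0 ≤ Φ → ∀ R : E ≃ₗᵢ[ℝ] E, (∀ x, R₁ - δ - h < ‖x‖ → ‖x‖ < R₁ →
      ((h⁻¹) ^ 2 + (R₁ - ‖x‖)⁻¹) * |u x - u (R x)| ≤ Φ) →
    ∫ x, ch (R₁ - δ) R₁ ‖x‖ * ‖gradient u x - R.symm (gradient u (R x))‖ ^ 2 ≤
      C * Φ * ∫ x, ch (R₁ - δ - h) R₁ ‖x‖ * |u x - u (R x)| := by
  obtain ⟨C0, hC0, hpow⟩ := H.pow_diff
  have hc := H.hc
  obtain ⟨k, hk, hcoer⟩ := Fp_coer (E := E) (α := 3 / 4 * c) (β := 5 / 4 * c) H.hp (by positivity)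
  obtain ⟨L, hL, hlip⟩ := Fp_lip (E := E) (α := 3 / 4 * c) (β := 5 / 4 * c) (p := p) (by positivity)
    (by linarith)
  obtain ⟨CT, hCT, hT⟩ := st_bd
  have hR := H.hR
  have hρ := H.hρ
  have hlam := H.lam0
  set G := CT * R₁ / ρ with hG
  have hG0 : 0 ≤ G := by positivity
  set C' := 2 / k * L ^ 2 * G ^ 2 + lam * C0 with hC'
  have hC'0 : 0 ≤ C' := by positivity
  refine ⟨2 / k * C', by positivity, fun δ h Φ hδ hh hδh hΦ R hΦb => ?_⟩
  have hδρ := H.hδρ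
  set α := R₁ - δ - h with hα
  set β := R₁ - δ with hβ
  have hαρ : ρ < α := by rw [hα]; linarith
  have hαβ : α < β := by rw [hα, hβ]; linarith
  have hβR : β < R₁ := by rw [hβ]; linarith
  have hD : 0 < β ^ 2 - α ^ 2 := by nlinarith
  have hDh : h * (2 * ρ) ≤ β ^ 2 - α ^ 2 := by
    have : β ^ 2 - α ^ 2 = h * (α + β) := by rw [hα, hβ]; ring
    rw [this]; gcongr; linarith
  set a := (β ^ 2 - α ^ 2)⁻¹ with ha
  have ha0 : 0 < a := by positivity
  let ζ : E → ℝ := cutS a (-(a * α ^ 2))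
  have ζarg : ∀ x : E, a * ‖x‖ ^ 2 + -(a * α ^ 2) = a * (‖x‖ ^ 2 - α ^ 2) := fun x => by ring
  have ζ1 : ContDiff ℝ 1 ζ := contDiff_cutS _ _
  have ζ0 : ∀ x, ‖x‖ ≤ α → ζ x = 0 := by
    intro x hx
    refine Real.smoothTransition.zero_of_nonpos ?_
    rw [ζarg]
    have : ‖x‖ ^ 2 - α ^ 2 ≤ 0 := by nlinarith [norm_nonneg x]
    nlinarith
  have ζe : ∀ x, β ≤ ‖x‖ → ζ x = 1 := by
    intro x hx
    refine Real.smoothTransition.one_of_one_le ?_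
    rw [ζarg]
    have : β ^ 2 - α ^ 2 ≤ ‖x‖ ^ 2 - α ^ 2 := by nlinarith
    calc (1:ℝ) = a * (β ^ 2 - α ^ 2) := by rw [ha, inv_mul_cancel₀ hD.ne']
      _ ≤ _ := by gcongr
  have ζn : ∀ x, 0 ≤ ζ x := fun x => Real.smoothTransition.nonneg _
  have ζl : ∀ x, ζ x ≤ 1 := fun x => Real.smoothTransition.le_one _
  have ζg : ∀ x, ‖x‖ ≤ R₁ → ‖gradient ζ x‖ ≤ G * h⁻¹ := by
    intro x hx
    rw [(hasGrad_cutS _ _ x).gradient, norm_smul, norm_mul, norm_mul]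
    simp only [Real.norm_eq_abs, abs_two, abs_of_pos ha0]
    calc _ ≤ CT * (2 * a) * R₁ := by gcongr; exact hT _
      _ ≤ CT * (2 * (h * (2 * ρ))⁻¹) * R₁ := by
          rw [ha]; gcongr
      _ = _ := by rw [hG]; field_simp
  let v : E → ℝ := fun x => u (R x)
  have hv : ContDiff ℝ 1 v := contDiff_comp_isom (n := 1) H.hu R
  have hgv : ∀ x, gradient v x = R.symm (gradient u (R x)) := gradient_comp_isom H.hu R
  have hwv : WeakSol p lam {x | ρ < ‖x‖ ∧ ‖x‖ < R₁} v := by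
    have := weakSol_comp H.hu H.weak R
    have e1 : (R ⁻¹' {x | ρ < ‖x‖ ∧ ‖x‖ < R₁}) = {x | ρ < ‖x‖ ∧ ‖x‖ < R₁} := by
      ext x; show (ρ < ‖R x‖ ∧ ‖R x‖ < R₁) ↔ (ρ < ‖x‖ ∧ ‖x‖ < R₁); rw [R.norm_map]
    rw [e1] at this; exact this
  let φ : E → ℝ := fun x => (ζ x * ζ x) * (u x - v x)
  have hw1 : ContDiff ℝ 1 fun x => u x - v x := H.hu.sub hv
  have hφ : ContDiff ℝ 1 φ := (ζ1.mul ζ1).mul hw1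
  have hgφ : ∀ x, gradient φ x = (ζ x * ζ x) • (gradient u x - gradient v x) +
      (u x - v x) • (ζ x • gradient ζ x + ζ x • gradient ζ x) := fun x =>
    (HasGradientAt.mul' (HasGradientAt.mul' (ζ1.hasGrad x) (ζ1.hasGrad x))
      (HasGradientAt.sub' (H.hu.hasGrad x) (hv.hasGrad x))).gradient
  have φ0 : ∀ x, ‖x‖ = R₁ → φ x = 0 := by
    intro x hx
    show _ * (u x - u (R x)) = 0
    rw [H.bd x hx, H.bd (R x) (by rw [R.norm_map, hx])]; simp
  have φi : ∀ x, ‖x‖ ≤ α → φ x = 0 := by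
    intro x hx
    show (ζ x * ζ x) * _ = 0
    rw [ζ0 x hx]; simp
  have w1 := weak_ext H.hp hρ hαρ (hαβ.trans hβR) H.hu H.weak hφ φ0 φi
  have w2 := weak_ext H.hp hρ hαρ (hαβ.trans hβR) hv hwv hφ φ0 φi
  have hp := H.hp
  have cFu : Continuous fun x => Fp p (gradient u x) := (continuous_Fp hp).comp H.hu.continuous_grad
  have cFv : Continuous fun x => Fp p (gradient v x) := (continuous_Fp hp).comp hv.continuous_grad
  have cu : Continuous fun x => (u x) ^ (p - 1) :=
    H.hu.continuous.rpow_const fun x => Or.inr (by linarith)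
  have cv : Continuous fun x => (v x) ^ (p - 1) :=
    hv.continuous.rpow_const fun x => Or.inr (by linarith)
  let A : E → ℝ := fun x => ⟪Fp p (gradient u x) - Fp p (gradient v x), gradient φ x⟫ -
    lam * ((u x ^ (p - 1) - v x ^ (p - 1)) * φ x)
  have cA : Continuous A := ((cFu.sub cFv).inner hφ.continuous_grad).sub
    (continuous_const.mul ((cu.sub cv).mul hφ.continuous))
  have hA : ∫ x in ball 0 R₁, A x = 0 := by
    have i1 : Integrable (fun x => ⟪Fp p (gradient u x), gradient φ x⟫) (volume.restrict (ball (0:E) R₁)) :=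
      integrableOn_ball_cont (E := E) (cFu.inner hφ.continuous_grad) R₁
    have i2 : Integrable (fun x => ⟪Fp p (gradient v x), gradient φ x⟫) (volume.restrict (ball (0:E) R₁)) :=
      integrableOn_ball_cont (E := E) (cFv.inner hφ.continuous_grad) R₁
    have i3 : Integrable (fun x => lam * (u x ^ (p - 1) * φ x)) (volume.restrict (ball (0:E) R₁)) :=
      integrableOn_ball_cont (E := E) (continuous_const.mul (cu.mul hφ.continuous)) R₁
    have i4 : Integrable (fun x => lam * (v x ^ (p - 1) * φ x)) (volume.restrict (ball (0:E) R₁)) :=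
      integrableOn_ball_cont (E := E) (continuous_const.mul (cv.mul hφ.continuous)) R₁
    have e1 : ∀ x, A x = (⟪Fp p (gradient u x), gradient φ x⟫ - lam * (u x ^ (p - 1) * φ x)) -
        (⟪Fp p (gradient v x), gradient φ x⟫ - lam * (v x ^ (p - 1) * φ x)) := by
      intro x
      show ⟪Fp p (gradient u x) - Fp p (gradient v x), gradient φ x⟫ - lam * ((u x ^ (p - 1) - v x ^ (p - 1)) * φ x) = _
      rw [inner_sub_left]; ring
    have e2 : ∫ x in ball 0 R₁, (⟪Fp p (gradient u x), gradient φ x⟫ - lam * (u x ^ (p - 1) * φ x)) = 0 := by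
      rw [integral_sub i1 i3, integral_const_mul, w1, sub_self]
    have e3 : ∫ x in ball 0 R₁, (⟪Fp p (gradient v x), gradient φ x⟫ - lam * (v x ^ (p - 1) * φ x)) = 0 := by
      rw [integral_sub i2 i4, integral_const_mul, w2, sub_self]
    simp only [e1]
    have i13 : Integrable (fun x => ⟪Fp p (gradient u x), gradient φ x⟫ - lam * (u x ^ (p - 1) * φ x))
      (volume.restrict (ball (0:E) R₁)) := i1.sub i3
    have i24 : Integrable (fun x => ⟪Fp p (gradient v x), gradient φ x⟫ - lam * (v x ^ (p - 1) * φ x))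
      (volume.restrict (ball (0:E) R₁)) := i2.sub i4
    rw [integral_sub i13 i24, e2, e3, sub_self]
  have cw : Continuous fun x => |u x - u (R x)| := hw1.continuous.abs
  have cg : Continuous fun x => ‖gradient u x - R.symm (gradient u (R x))‖ ^ 2 := by
    have : Continuous fun x => ‖gradient u x - gradient v x‖ ^ 2 :=
      ((H.hu.continuous_grad.sub hv.continuous_grad).norm.pow 2)
    simp only [hgv] at this; exact this
  have hpt : ∀ x ∈ ball (0:E) R₁, k / 2 * (ch β R₁ ‖x‖ * ‖gradient u x - R.symm (gradient u (R x))‖ ^ 2) ≤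
      A x + C' * Φ * (ch α R₁ ‖x‖ * |u x - u (R x)|) := by
    intro x hx
    rw [mem_ball_zero_iff] at hx
    by_cases hxα : ‖x‖ ≤ α
    · have e1 : A x = 0 := by
        show ⟪_, gradient φ x⟫ - lam * (_ * φ x) = 0
        rw [hgφ, φi x hxα, ζ0 x hxα]; simp
      rw [e1, ch_of_le hxα, ch_of_le (hxα.trans hαβ.le)]; simp
    push Not at hxα
    have hxR : ‖R x‖ = ‖x‖ := R.norm_map x
    have hxδ : R₁ - δ₁ ≤ ‖x‖ := by linarith
    have g1 := H.grad_bounds hxδ hx.le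
    have g2 := H.grad_bounds (x := R x) (by rw [hxR]; exact hxδ) (by rw [hxR]; exact hx.le)
    have nv : ‖gradient v x‖ = ‖gradient u (R x)‖ := by rw [hgv, LinearIsometryEquiv.norm_map]
    rw [← nv] at g2
    have X1 := hcoer _ _ g1.1 g1.2 g2.1 g2.2
    have X2 := hlip _ _ g1.1 g1.2 g2.1 g2.2
    have X3 := hpow x (R x) hxR.symm hxδ hx
    have X4 := ζg x hx.le
    have X5 := hΦb x hxα hx
    have hd : 0 < (R₁ - ‖x‖)⁻¹ := by rw [inv_pos]; linarith
    rw [ch_of_mem hxα hx, one_mul, ← hgv]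
    have eA : A x = ζ x ^ 2 * ⟪Fp p (gradient u x) - Fp p (gradient v x), gradient u x - gradient v x⟫ +
        2 * ζ x * (u x - v x) * ⟪Fp p (gradient u x) - Fp p (gradient v x), gradient ζ x⟫ -
        lam * ((u x ^ (p - 1) - v x ^ (p - 1)) * (ζ x ^ 2 * (u x - v x))) := by
      show ⟪_, gradient φ x⟫ - lam * (_ * ((ζ x * ζ x) * (u x - v x))) = _
      rw [hgφ]
      simp only [inner_add_right, inner_smul_right]
      ring
    set P := ⟪Fp p (gradient u x) - Fp p (gradient v x), gradient u x - gradient v x⟫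
    have Y1 : |⟪Fp p (gradient u x) - Fp p (gradient v x), gradient ζ x⟫| ≤
        (L * ‖gradient u x - gradient v x‖) * (G * h⁻¹) :=
      (abs_real_inner_le_norm _ _).trans (mul_le_mul X2 X4 (norm_nonneg _) (by positivity))
    set Y := ⟪Fp p (gradient u x) - Fp p (gradient v x), gradient ζ x⟫
    set D := ‖gradient u x - gradient v x‖ with hDdef
    have hD0 : 0 ≤ D := norm_nonneg _
    have hz0 := ζn x
    have hz1 := ζl x
    have ew : u (R x) = v x := rfl
    rw [ew] at X3 X5 ⊢
    set w := u x - v x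
    set Q := u x ^ (p - 1) - v x ^ (p - 1)
    set Z := ζ x
    set d' := (R₁ - ‖x‖)⁻¹
    have B6 : k / 2 * (Z ^ 2 * D ^ 2) ≤ A x + C' * Φ * |w| := by
      rw [eA]
      exact cacc_scalar hk hL hG0 (inv_pos.2 hh) hlam hC0 hd hD0 hz0 hz1 X1 Y1 X3 X5
    refine le_trans ?_ B6
    by_cases hb : β < ‖x‖
    · have : Z = 1 := ζe x hb.le
      rw [this, ch_of_mem hb hx]; simp
    · rw [ch_of_le (not_lt.1 hb)]; simp; positivity
  have I1 := (integrable_ch cg β R₁).integrableOn (s := ball (0:E) R₁)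
  have I2 := (integrable_ch cw α R₁).integrableOn (s := ball (0:E) R₁)
  have I3 := integrableOn_ball_cont cA R₁
  have fin := setIntegral_mono_on (I1.const_mul (k / 2)) (I3.add (I2.const_mul (C' * Φ))) measurableSet_ball hpt
  have e4 : ∫ x in ball 0 R₁, (A x + C' * Φ * (ch α R₁ ‖x‖ * |u x - u (R x)|)) =
      C' * Φ * ∫ x, ch α R₁ ‖x‖ * |u x - u (R x)| := by
    rw [integral_add I3 (I2.const_mul (C' * Φ)), hA, zero_add, integral_const_mul, setIntegral_ch]
  have e5 : ∫ x in ball 0 R₁, k / 2 * (ch β R₁ ‖x‖ * ‖gradient u x - R.symm (gradient u (R x))‖ ^ 2) =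
      k / 2 * ∫ x, ch β R₁ ‖x‖ * ‖gradient u x - R.symm (gradient u (R x))‖ ^ 2 := by
    rw [integral_const_mul, setIntegral_ch]
  have fin2 := e5 ▸ (fin.trans_eq e4)
  have : 2 / k * (k / 2 * ∫ x, ch β R₁ ‖x‖ * ‖gradient u x - R.symm (gradient u (R x))‖ ^ 2) ≤
      2 / k * (C' * Φ * ∫ x, ch α R₁ ‖x‖ * |u x - u (R x)|) := by gcongr
  calc _ = 2 / k * (k / 2 * ∫ x, ch β R₁ ‖x‖ * ‖gradient u x - R.symm (gradient u (R x))‖ ^ 2) := by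
        field_simp
    _ ≤ _ := this
    _ = _ := by ring
end Cacc2


section Mono
variable {E : Type*} [NormedAddCommGroup E] [InnerProductSpace ℝ E] [CompleteSpace E]
variable [FiniteDimensional ℝ E] [MeasurableSpace E] [BorelSpace E]

/-- antipodal difference -/
def Hd (u : E → ℝ) (x : E) : ℝ := |u x - u (-x)|
/-- maximal oscillation on the sphere -/
def mx (e : E) (u : E → ℝ) (r : ℝ) : ℝ := u (r • (-e)) - u (r • e)
/-- first moment -/
noncomputable def W1 (e : E) (u : E → ℝ) (r : ℝ) : ℝ := ∫ R : KE E, u (r • R.1 e) * ⟪R.1 e, e⟫ ∂(muK E)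

lemma Hd_nonneg (u : E → ℝ) (x : E) : 0 ≤ Hd u x := abs_nonneg _
lemma continuous_Hd {u : E → ℝ} (hu : Continuous u) : Continuous (Hd u) :=
  (hu.sub (hu.comp continuous_neg)).abs

lemma rpow_lip0 {p M s t : ℝ} (hp : 1 < p) (hs : 0 ≤ s) (hs' : s ≤ M) (ht : 0 ≤ t) (ht' : t ≤ M) :
    |s ^ p - t ^ p| ≤ p * M ^ (p - 1) * |s - t| := by
  have h := (convex_Icc (0:ℝ) M).norm_image_sub_le_of_norm_hasDerivWithin_le (f := fun x : ℝ => x ^ p)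
    (f' := fun x => p * x ^ (p - 1)) (C := p * M ^ (p - 1))
    (fun x _ => (Real.hasDerivAt_rpow_const (Or.inr hp.le)).hasDerivWithinAt)
    (fun x hx => ?_) (⟨ht, ht'⟩ : t ∈ Icc 0 M) (⟨hs, hs'⟩ : s ∈ Icc 0 M)
  · exact h
  · have := hx.1
    rw [Real.norm_of_nonneg (by positivity)]
    gcongr
    exact hx.2

variable {p lam ρ R₁ c δ₁ : ℝ} {e : E} {u : E → ℝ}

lemma Shell.range (H : Shell p lam e ρ R₁ u) {x : E} (h1 : ρ < ‖x‖) (h2 : ‖x‖ < R₁) :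
    u (‖x‖ • e) ≤ u x ∧ u x ≤ u (‖x‖ • (-e)) := by
  have he := H.he
  have n1 : ‖‖x‖ • e‖ = ‖x‖ := by rw [norm_smul, he]; simp
  have n2 : ‖‖x‖ • (-e)‖ = ‖x‖ := by rw [norm_smul, norm_neg, he]; simp
  have h3 := abs_le.1 (abs_real_inner_le_norm e x)
  rw [he, one_mul] at h3
  constructor
  · refine H.mono x (‖x‖ • e) n1.symm h1 h2 ?_
    rw [real_inner_smul_right, real_inner_self_eq_norm_sq, he]; linarith [h3.2]
  · refine H.mono (‖x‖ • (-e)) x n2 (by rw [n2]; exact h1) (by rw [n2]; exact h2) ?_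
    rw [real_inner_smul_right, inner_neg_right, real_inner_self_eq_norm_sq, he]; linarith [h3.1]

lemma Shell.diff_le_mx (H : Shell p lam e ρ R₁ u) {x y : E} (hxy : ‖x‖ = ‖y‖) (h1 : ρ < ‖x‖)
    (h2 : ‖x‖ < R₁) : |u x - u y| ≤ mx e u ‖x‖ := by
  have a1 := H.range h1 h2
  have a2 := H.range (x := y) (by rw [← hxy]; exact h1) (by rw [← hxy]; exact h2)
  rw [← hxy] at a2
  rw [abs_le, mx]; constructor <;> linarith [a1.1, a1.2, a2.1, a2.2]

lemma Shell.mx_nonneg (H : Shell p lam e ρ R₁ u) {r : ℝ} (h1 : ρ < r) (h2 : r < R₁) :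
    0 ≤ mx e u r := by
  have n1 : ‖r • e‖ = r := norm_ray H.he (by linarith [H.hρ])
  have := H.diff_le_mx (x := r • e) (y := r • e) rfl (by rw [n1]; exact h1) (by rw [n1]; exact h2)
  rw [n1] at this
  exact (abs_nonneg _).trans this

lemma Shell.Hd_mono (H : Shell p lam e ρ R₁ u) {x y : E} (hxy : ‖x‖ = ‖y‖) (h1 : ρ < ‖x‖)
    (h2 : ‖x‖ < R₁) (h : |⟪e, y⟫| ≤ |⟪e, x⟫|) : Hd u y ≤ Hd u x ∧ |u x - u y| ≤ Hd u x := by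
  have key : ∀ x y : E, ‖x‖ = ‖y‖ → ρ < ‖x‖ → ‖x‖ < R₁ → |⟪e, y⟫| ≤ |⟪e, x⟫| → 0 ≤ ⟪e, x⟫ →
      Hd u y ≤ u (-x) - u x ∧ u x ≤ u y ∧ u y ≤ u (-x) := by
    intro x y hxy h1 h2 h h0
    rw [abs_of_nonneg h0, abs_le] at h
    have m1 : ∀ y, ‖x‖ = ‖y‖ → -⟪e, x⟫ ≤ ⟪e, y⟫ → ⟪e, y⟫ ≤ ⟪e, x⟫ → u x ≤ u y ∧ u y ≤ u (-x) := by
      intro y hxy a b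
      refine ⟨H.mono y x hxy.symm (by rw [← hxy]; exact h1) (by rw [← hxy]; exact h2) b,
        H.mono (-x) y (by rw [norm_neg, hxy]) (by rw [norm_neg]; exact h1) (by rw [norm_neg]; exact h2) ?_⟩
      rw [inner_neg_right]; exact a
    have a1 := m1 y hxy h.1 h.2
    have a2 := m1 (-y) (by rw [norm_neg, hxy]) (by rw [inner_neg_right]; linarith [h.2])
      (by rw [inner_neg_right]; linarith [h.1])
    refine ⟨?_, a1⟩
    rw [Hd, abs_le]; constructor <;> linarith [a1.1, a1.2, a2.1, a2.2]
  by_cases h0 : 0 ≤ ⟪e, x⟫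
  · have a := key x y hxy h1 h2 h h0
    have b : u (-x) - u x ≤ Hd u x := by rw [Hd, abs_sub_comm]; exact le_abs_self _
    refine ⟨a.1.trans b, ?_⟩
    rw [abs_le]; constructor <;> linarith [a.2.1, a.2.2]
  · have a := key (-x) y (by rw [norm_neg, hxy]) (by rw [norm_neg]; exact h1) (by rw [norm_neg]; exact h2)
      (by rw [inner_neg_right, abs_neg]; exact h) (by rw [inner_neg_right]; linarith)
    rw [neg_neg] at a
    have b : u x - u (-x) ≤ Hd u x := le_abs_self _
    refine ⟨a.1.trans b, ?_⟩
    rw [abs_le]; constructor <;> linarith [a.2.1, a.2.2]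

lemma Shell.diff_le_Hd (H : Shell p lam e ρ R₁ u) {x y : E} (hxy : ‖x‖ = ‖y‖) (h1 : ρ < ‖x‖)
    (h2 : ‖x‖ < R₁) : |u x - u y| ≤ Hd u x + Hd u y := by
  rcases le_total |⟪e, y⟫| |⟪e, x⟫| with h | h
  · have := (H.Hd_mono hxy h1 h2 h).2
    have := Hd_nonneg u y; linarith
  · have := (H.Hd_mono hxy.symm (by rw [← hxy]; exact h1) (by rw [← hxy]; exact h2) h).2
    rw [abs_sub_comm] at this
    have := Hd_nonneg u x; linarith

lemma continuous_rayK (e : E) (r : ℝ) : Continuous fun R : KE E => r • R.1 e :=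
  (continuous_actK' e).const_smul r

lemma norm_rayK (he : ‖e‖ = 1) {r : ℝ} (hr : 0 ≤ r) (R : KE E) : ‖r • R.1 e‖ = r :=
  norm_ray (by rw [normK, he]) hr

lemma Shell.Hd_n1 (H : Shell p lam e ρ R₁ u) {r : ℝ} (h1 : ρ < r) (h2 : r < R₁) :
    ∫ R : KE E, Hd u (r • R.1 e) * |⟪R.1 e, e⟫| ∂(muK E) = -2 * W1 e u r := by
  have hr : 0 < r := H.hρ.trans h1
  have cu := H.hu.continuous
  have pt : ∀ R : KE E, Hd u (r • R.1 e) * |⟪R.1 e, e⟫| =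
      u (r • (-(R.1 e))) * ⟪R.1 e, e⟫ - u (r • R.1 e) * ⟪R.1 e, e⟫ := by
    intro R
    have n1 := norm_rayK H.he hr.le R
    have en : r • (-(R.1 e)) = -(r • R.1 e) := smul_neg _ _
    have ei : ⟪e, r • R.1 e⟫ = r * ⟪R.1 e, e⟫ := by rw [real_inner_smul_right, real_inner_comm]
    rw [en, Hd]
    rcases le_total 0 ⟪R.1 e, e⟫ with h | h
    · have := H.mono (-(r • R.1 e)) (r • R.1 e) (norm_neg _) (by rw [norm_neg, n1]; exact h1)
        (by rw [norm_neg, n1]; exact h2) (by rw [inner_neg_right, ei]; nlinarith)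
      rw [abs_of_nonneg h, abs_of_nonpos (by linarith)]; ring
    · have := H.mono (r • R.1 e) (-(r • R.1 e)) (norm_neg _).symm (by rw [n1]; exact h1)
        (by rw [n1]; exact h2) (by rw [inner_neg_right, ei]; nlinarith)
      rw [abs_of_nonpos h, abs_of_nonneg (by linarith)]; ring
  have c1 : Continuous fun R : KE E => ⟪R.1 e, e⟫ := (continuous_actK' e).inner continuous_const
  have i1 : Integrable (fun R : KE E => u (r • R.1 e) * ⟪R.1 e, e⟫) (muK E) :=
    integrableK ((cu.comp (continuous_rayK e r)).mul c1)
  have i2 : Integrable (fun R : KE E => u (r • (-(R.1 e))) * ⟪R.1 e, e⟫) (muK E) :=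
    integrableK ((cu.comp ((continuous_actK' e).neg.const_smul r)).mul c1)
  have h3 := integralK_neg e (fun x => u (r • x) * ⟪x, e⟫)
  have h4 : ∫ R : KE E, u (r • (-(R.1 e))) * ⟪R.1 e, e⟫ ∂(muK E) = - W1 e u r := by
    rw [W1, ← h3, ← integral_neg]
    congr 1; funext R; rw [inner_neg_left]; ring
  simp only [pt]
  rw [integral_sub i2 i1, h4]
  show _ - W1 e u r = _
  ring

lemma Shell.W_nonpos (H : Shell p lam e ρ R₁ u) {r : ℝ} (h1 : ρ < r) (h2 : r < R₁) : W1 e u r ≤ 0 := by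
  have h := H.Hd_n1 h1 h2
  have : 0 ≤ ∫ R : KE E, Hd u (r • R.1 e) * |⟪R.1 e, e⟫| ∂(muK E) :=
    integral_nonneg fun R => mul_nonneg (Hd_nonneg _ _) (abs_nonneg _)
  linarith

/-- a positive constant -/
noncomputable def a1K (e : E) : ℝ := ∫ R : KE E, |⟪R.1 e, e⟫| ∂(muK E)

lemma a1K_pos (he : ‖e‖ = 1) : 0 < a1K e := by
  have c1 : Continuous fun R : KE E => |⟪R.1 e, e⟫| := ((continuous_actK' e).inner continuous_const).abs
  refine lt_of_le_of_ne (integral_nonneg fun R => abs_nonneg _) fun h => ?_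
  have := contK_zero c1 (fun R => abs_nonneg _) h.symm 1
  have e1 : (1 : KE E).1 e = e := rfl
  rw [e1, real_inner_self_eq_norm_sq, he] at this
  norm_num at this

lemma Shell.avH_le (H : Shell p lam e ρ R₁ u) {r : ℝ} (h1 : ρ < r) (h2 : r < R₁) :
    av e (Hd u) r * a1K e ≤ -2 * W1 e u r := by
  have hr : 0 < r := H.hρ.trans h1
  rw [← H.Hd_n1 h1 h2]
  have c1 : Continuous fun R : KE E => |⟪R.1 e, e⟫| := ((continuous_actK' e).inner continuous_const).abs
  have c2 : Continuous fun R : KE E => Hd u (r • R.1 e) :=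
    (continuous_Hd H.hu.continuous).comp (continuous_rayK e r)
  refine cheb_le c2 c1 fun R S => ?_
  have n1 := norm_rayK H.he hr.le R
  have n2 := norm_rayK H.he hr.le S
  have ei : ∀ R : KE E, |⟪e, r • R.1 e⟫| = r * |⟪R.1 e, e⟫| := fun R => by
    rw [real_inner_smul_right, real_inner_comm, abs_mul, abs_of_pos hr]
  rcases le_total |⟪R.1 e, e⟫| |⟪S.1 e, e⟫| with h | h
  · have := (H.Hd_mono (x := r • S.1 e) (y := r • R.1 e) (by rw [n1, n2]) (by rw [n2]; exact h1)
      (by rw [n2]; exact h2) (by rw [ei, ei]; gcongr)).1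
    exact mul_nonneg_of_nonpos_of_nonpos (by linarith) (by linarith)
  · have := (H.Hd_mono (x := r • R.1 e) (y := r • S.1 e) (by rw [n1, n2]) (by rw [n1]; exact h1)
      (by rw [n1]; exact h2) (by rw [ei, ei]; gcongr)).1
    exact mul_nonneg (by linarith) (by linarith)

lemma Shell.av_pow (H : Shell p lam e ρ R₁ u) : ∃ C, 0 ≤ C ∧ ∀ r, ρ < r → r < R₁ →
    |∫ R : KE E, ⟪R.1 e, e⟫ * |u (r • R.1 e)| ^ p ∂(muK E)| ≤ C * |W1 e u r| := by
  obtain ⟨M, hM, hb⟩ := exists_bound_cs H.hu.continuous (isCompact_closedBall (0:E) R₁)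
  have hp := H.hp
  refine ⟨p * M ^ (p - 1), by positivity, fun r h1 h2 => ?_⟩
  have hr : 0 < r := H.hρ.trans h1
  have cu := H.hu.continuous
  have c1 : Continuous fun R : KE E => ⟪R.1 e, e⟫ := (continuous_actK' e).inner continuous_const
  have cq : Continuous fun x => |u x| ^ p := cu.abs.rpow_const fun x => Or.inr (by linarith)
  have i1 : Integrable (fun R : KE E => ⟪R.1 e, e⟫ * |u (r • R.1 e)| ^ p) (muK E) :=
    integrableK (c1.mul (cq.comp (continuous_rayK e r)))
  have i2 : Integrable (fun R : KE E => ⟪R.1 e, e⟫ * |u (r • (-(R.1 e)))| ^ p) (muK E) :=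
    integrableK (c1.mul (cq.comp ((continuous_actK' e).neg.const_smul r)))
  have h3 := integralK_neg e (fun x => ⟪x, e⟫ * |u (r • x)| ^ p)
  have h4 : ∫ R : KE E, ⟪R.1 e, e⟫ * |u (r • (-(R.1 e)))| ^ p ∂(muK E) =
      - ∫ R : KE E, ⟪R.1 e, e⟫ * |u (r • R.1 e)| ^ p ∂(muK E) := by
    rw [← h3, ← integral_neg]
    congr 1; funext R; rw [inner_neg_left]; ring
  have h5 : ∫ R : KE E, (⟪R.1 e, e⟫ * |u (r • R.1 e)| ^ p - ⟪R.1 e, e⟫ * |u (r • (-(R.1 e)))| ^ p) ∂(muK E) =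
      2 * ∫ R : KE E, ⟪R.1 e, e⟫ * |u (r • R.1 e)| ^ p ∂(muK E) := by
    rw [integral_sub i1 i2, h4]; ring
  have c2 : Continuous fun R : KE E => p * M ^ (p - 1) * (Hd u (r • R.1 e) * |⟪R.1 e, e⟫|) :=
    continuous_const.mul (((continuous_Hd H.hu.continuous).comp (continuous_rayK e r)).mul c1.abs)
  have h6 : |∫ R : KE E, (⟪R.1 e, e⟫ * |u (r • R.1 e)| ^ p - ⟪R.1 e, e⟫ * |u (r • (-(R.1 e)))| ^ p) ∂(muK E)| ≤
      ∫ R : KE E, p * M ^ (p - 1) * (Hd u (r • R.1 e) * |⟪R.1 e, e⟫|) ∂(muK E) := by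
    have := norm_integral_le_of_norm_le (μ := muK E)
      (f := fun R : KE E => ⟪R.1 e, e⟫ * |u (r • R.1 e)| ^ p - ⟪R.1 e, e⟫ * |u (r • (-(R.1 e)))| ^ p)
      (integrableK c2) (Eventually.of_forall fun R => ?_)
    · exact this
    have n1 := norm_rayK H.he hr.le R
    have en : r • (-(R.1 e)) = -(r • R.1 e) := smul_neg _ _
    rw [en, ← mul_sub, Real.norm_eq_abs, abs_mul]
    have p1 := H.pos (r • R.1 e) (by rw [n1]; exact h1) (by rw [n1]; exact h2)
    have p2 := H.pos (-(r • R.1 e)) (by rw [norm_neg, n1]; exact h1) (by rw [norm_neg, n1]; exact h2)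
    have q1 := hb (r • R.1 e) (mem_closedBall_zero_iff.2 (by rw [n1]; exact h2.le))
    have q2 := hb (-(r • R.1 e)) (mem_closedBall_zero_iff.2 (by rw [norm_neg, n1]; exact h2.le))
    rw [Real.norm_of_nonneg p1.le] at q1
    rw [Real.norm_of_nonneg p2.le] at q2
    have := rpow_lip0 hp p1.le q1 p2.le q2
    rw [abs_of_pos p1, abs_of_pos p2]
    calc _ ≤ |⟪R.1 e, e⟫| * (p * M ^ (p - 1) * |u (r • R.1 e) - u (-(r • R.1 e))|) := by gcongr
      _ = _ := by rw [Hd]; ring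
  rw [h5, integral_const_mul, H.Hd_n1 h1 h2, abs_mul, abs_two] at h6
  have := H.W_nonpos h1 h2
  rw [abs_of_nonpos this]
  linarith

/-- interpolation: the oscillation is controlled by the mean -/
lemma Shell.mx_pow (H : Shell p lam e ρ R₁ u) : ∃ C, 0 ≤ C ∧ ∀ r, ρ < r → r < R₁ →
    mx e u r ^ (Module.finrank ℝ E + 1) ≤ C * av e (Hd u) r := by
  have := H.nontriv
  have he := H.he
  have hR := H.hR
  have hcf : Continuous (fderiv ℝ u) := H.hu.continuous_fderiv one_ne_zero
  obtain ⟨L0, hL0, hb⟩ := exists_bound_cs hcf (isCompact_closedBall (0:E) R₁)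
  set L := L0 + 1 with hL
  have hLp : 0 < L := by linarith
  have lip : ∀ x y : E, ‖x‖ ≤ R₁ → ‖y‖ ≤ R₁ → |u x - u y| ≤ L * ‖x - y‖ := by
    intro x y hx hy
    exact (convex_closedBall (0:E) R₁).norm_image_sub_le_of_norm_fderiv_le (𝕜 := ℝ) (f := u) (C := L)
      (fun y _ => H.hu.differentiable one_ne_zero y) (fun z hz => (hb z hz).trans (by linarith))
      (mem_closedBall_zero_iff.2 hy) (mem_closedBall_zero_iff.2 hx)
  set N := Module.finrank ℝ E
  set V1 := volume.real (ball (0:E) 1) with hV1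
  set V2 := volume.real (closedBall (0:E) 2) with hV2
  have hV1p : 0 < V1 := by
    rw [hV1, Measure.real, ENNReal.toReal_pos_iff]
    exact ⟨measure_ball_pos _ _ one_pos, measure_ball_lt_top⟩
  have hV2p : 0 ≤ V2 := measureReal_nonneg
  refine ⟨4 * V2 * (16 * R₁ * L) ^ N / V1, by positivity, fun r h1 h2 => ?_⟩
  have hr : 0 < r := H.hρ.trans h1
  have hm0 := H.mx_nonneg h1 h2
  have hav0 : 0 ≤ av e (Hd u) r := integral_nonneg fun R => Hd_nonneg _ _
  rcases hm0.eq_or_lt with hm | hm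
  · rw [← hm, zero_pow (Nat.succ_ne_zero _)]; positivity
  set m := mx e u r with hmdef
  set τ := m / (8 * R₁ * L) with hτ
  have hτp : 0 < τ := by positivity
  have n0 : ‖r • e‖ = r := norm_ray he hr.le
  have n0' : ‖r • (-e)‖ = r := norm_ray (by rw [norm_neg, he]) hr.le
  have hτ1 : τ ≤ 1 := by
    rw [hτ, div_le_one (by positivity)]
    have a := lip (r • (-e)) (r • e) (by rw [n0']; exact h2.le) (by rw [n0]; exact h2.le)
    have b : ‖r • (-e) - r • e‖ ≤ r + r := (norm_sub_le _ _).trans (by rw [n0, n0'])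
    have : m ≤ L * (r + r) := (le_abs_self _).trans (a.trans (by gcongr))
    nlinarith
  let f : E → ℝ := fun x => max 0 (1 - ‖x - e‖ / τ)
  have cf : Continuous f := continuous_const.max
    (continuous_const.sub ((continuous_id.sub continuous_const).norm.div_const τ))
  have f0 : ∀ x, 0 ≤ f x := fun x => le_max_left _ _
  have f1 : ∀ x, f x ≤ 1 := fun x => max_le zero_le_one (by
    have : 0 ≤ ‖x - e‖ / τ := by positivity
    linarith)
  have fz : ∀ x, τ ≤ ‖x - e‖ → f x = 0 := fun x hx => max_eq_left (by
    have : 1 ≤ ‖x - e‖ / τ := by rw [one_le_div hτp]; exact hx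
    linarith)
  have fbig : ∀ x, 2 < ‖x‖ → f x = 0 := fun x hx => fz x (by
    have := norm_sub_norm_le x e
    rw [he] at this; linarith)
  have hfc : HasCompactSupport f := by
    refine HasCompactSupport.of_support_subset_isCompact (isCompact_closedBall (0:E) 2) fun x hx => ?_
    rw [mem_closedBall_zero_iff]
    by_contra hh; push Not at hh
    exact hx (fbig x hh)
  -- the key pointwise comparison
  have key : ∀ t : ℝ, 0 ≤ t → ∀ R : KE E, f (t • R.1 e) ≤ 2 / m * Hd u (r • R.1 e) := by
    intro t ht R
    have hH := Hd_nonneg u (r • R.1 e)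
    by_cases hc : τ ≤ ‖t • R.1 e - e‖
    · rw [fz _ hc]; positivity
    push Not at hc
    refine (f1 _).trans ?_
    have hRe : ‖R.1 e‖ = 1 := by rw [normK, he]
    have nt : ‖t • R.1 e‖ = t := norm_ray hRe ht
    have d1 : |t - 1| < τ := by
      have := abs_norm_sub_norm_le (t • R.1 e) e
      rw [nt, he] at this; linarith
    have d2 : ‖R.1 e - e‖ ≤ 2 * τ := by
      have : R.1 e - e = (t • R.1 e - e) - (t - 1) • R.1 e := by rw [sub_smul, one_smul]; abel
      rw [this]
      refine (norm_sub_le _ _).trans ?_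
      rw [norm_smul, hRe, mul_one, Real.norm_eq_abs]; linarith
    have d3 : ‖r • R.1 e - r • e‖ ≤ R₁ * (2 * τ) := by
      rw [← smul_sub, norm_smul, Real.norm_of_nonneg hr.le]; gcongr
    have n1 := norm_rayK he hr.le R
    have l1 := lip (r • R.1 e) (r • e) (by rw [n1]; exact h2.le) (by rw [n0]; exact h2.le)
    have l2 := lip (-(r • R.1 e)) (r • (-e)) (by rw [norm_neg, n1]; exact h2.le) (by rw [n0']; exact h2.le)
    have e1 : ‖-(r • R.1 e) - r • (-e)‖ = ‖r • R.1 e - r • e‖ := by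
      rw [← norm_neg]; congr 1; rw [smul_neg]; abel
    rw [e1] at l2
    have e2 : L * (R₁ * (2 * τ)) = m / 4 := by rw [hτ]; field_simp; norm_num
    have l3 : L * ‖r • R.1 e - r • e‖ ≤ m / 4 := by rw [← e2]; gcongr
    have l1' := (abs_le.1 (l1.trans l3)).2
    have l2' := (abs_le.1 (l2.trans l3)).1
    have : m / 2 ≤ Hd u (r • R.1 e) := by
      rw [Hd, abs_sub_comm]
      refine le_trans ?_ (le_abs_self _)
      have : m = u (r • (-e)) - u (r • e) := rfl
      linarith
    calc (1:ℝ) = 2 / m * (m / 2) := by field_simp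
      _ ≤ _ := by gcongr
  have cHd : Continuous fun R : KE E => 2 / m * Hd u (r • R.1 e) :=
    continuous_const.mul ((continuous_Hd H.hu.continuous).comp (continuous_rayK e r))
  have avf : ∀ t, 0 ≤ t → av e f t ≤ 2 / m * av e (Hd u) r := by
    intro t ht
    rw [av, av, ← integral_const_mul]
    exact integral_mono (integrableK (cf.comp (continuous_rayK e t))) (integrableK cHd) (key t ht)
  have avf2 : ∀ t, 2 < t → av e f t = 0 := by
    intro t ht
    rw [av]
    have : ∀ R : KE E, f (t • R.1 e) = 0 := fun R => fbig _ (by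
      rw [norm_rayK he (by linarith)]; exact ht)
    simp [this]
  have up : ∫ x, f x ≤ V2 * (2 / m * av e (Hd u) r) := by
    rw [integral_eq_av he cf hfc]
    have hV : ∫ x, (closedBall (0:E) 2).indicator (fun _ => 2 / m * av e (Hd u) r) x =
        V2 * (2 / m * av e (Hd u) r) := by
      rw [integral_indicator measurableSet_closedBall, setIntegral_const, smul_eq_mul]
    rw [← hV]
    refine integral_mono_of_nonneg (Eventually.of_forall fun x => integral_nonneg fun R => f0 _) ?_
      (Eventually.of_forall fun x => ?_)
    · rw [integrable_indicator_iff measurableSet_closedBall]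
      exact continuousOn_const.integrableOn_compact (isCompact_closedBall _ _)
    · by_cases hx : x ∈ closedBall (0:E) 2
      · rw [indicator_of_mem hx]; exact avf _ (norm_nonneg _)
      · rw [indicator_of_notMem hx]
        exact (avf2 _ (by rw [mem_closedBall_zero_iff] at hx; linarith)).le
  have low : 1 / 2 * ((τ / 2) ^ N * V1) ≤ ∫ x, f x := by
    have hV : ∫ x, (ball e (τ / 2)).indicator (fun _ => (1:ℝ) / 2) x = 1 / 2 * ((τ / 2) ^ N * V1) := by
      rw [integral_indicator measurableSet_ball, setIntegral_const, smul_eq_mul, Measure.real,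
        Measure.addHaar_ball _ _ (by positivity : 0 ≤ τ / 2), ENNReal.toReal_mul,
        ENNReal.toReal_ofReal (by positivity), hV1, Measure.real]
      ring
    rw [← hV]
    refine integral_mono_of_nonneg (Eventually.of_forall fun x => indicator_nonneg (fun _ _ => by norm_num) _)
      (cf.integrable_of_hasCompactSupport hfc) (Eventually.of_forall fun x => ?_)
    by_cases hx : x ∈ ball e (τ / 2)
    · rw [indicator_of_mem hx]
      rw [mem_ball, dist_eq_norm] at hx
      refine le_trans ?_ (le_max_right _ _)
      have : ‖x - e‖ / τ ≤ 1 / 2 := by rw [div_le_iff₀ hτp]; linarith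
      linarith
    · rw [indicator_of_notMem hx]; exact f0 x
  have tot := low.trans up
  have e3 : τ / 2 = m / (16 * R₁ * L) := by rw [hτ]; field_simp; norm_num
  rw [e3, div_pow] at tot
  have e4 : m ^ (N + 1) = (2 * m * (16 * R₁ * L) ^ N / V1) *
      (1 / 2 * (m ^ N / (16 * R₁ * L) ^ N * V1)) := by
    field_simp; ring
  have e5 : 4 * V2 * (16 * R₁ * L) ^ N / V1 * av e (Hd u) r = (2 * m * (16 * R₁ * L) ^ N / V1) *
      (V2 * (2 / m * av e (Hd u) r)) := by
    field_simp; ring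
  rw [e4, e5]
  gcongr
end Mono


section Energy
variable {E : Type*} [NormedAddCommGroup E] [InnerProductSpace ℝ E] [CompleteSpace E]
variable [FiniteDimensional ℝ E] [MeasurableSpace E] [BorelSpace E]

/-- mean radial derivative -/
noncomputable def bb (e : E) (u : E → ℝ) (r : ℝ) : ℝ :=
  ∫ R : KE E, ⟪gradient u (r • R.1 e), R.1 e⟫ ∂(muK E)

/-- mean squared deviation of the gradient -/
noncomputable def eE (e : E) (u : E → ℝ) (r : ℝ) : ℝ :=
  ∫ R : KE E, ‖gradient u (r • R.1 e) - bb e u r • R.1 e‖ ^ 2 ∂(muK E)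

variable {p lam ρ R₁ c δ₁ : ℝ} {e : E} {u : E → ℝ}

lemma continuous_bb (hu : ContDiff ℝ 1 u) : Continuous (bb e u) := by
  refine continuous_paramK (f := fun r R => ⟪gradient u (r • R.1 e), R.1 e⟫) ?_
  exact (hu.continuous_grad.comp (continuous_ray e)).inner ((continuous_actK' e).comp continuous_snd)

lemma continuous_eE (hu : ContDiff ℝ 1 u) : Continuous (eE e u) := by
  refine continuous_paramK (f := fun r R => ‖gradient u (r • R.1 e) - bb e u r • R.1 e‖ ^ 2) ?_
  exact ((hu.continuous_grad.comp (continuous_ray e)).sub (((continuous_bb hu).comp continuous_fst).smul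
    ((continuous_actK' e).comp continuous_snd))).norm.pow 2

lemma eE_nonneg (r : ℝ) : 0 ≤ eE e u r := integral_nonneg fun R => by positivity

lemma continuous_W1 (hu : Continuous u) : Continuous (W1 e u) := by
  refine continuous_paramK (f := fun r R => u (r • R.1 e) * ⟪R.1 e, e⟫) ?_
  exact (hu.comp (continuous_ray e)).mul
    (((continuous_actK' e).comp continuous_snd).inner continuous_const)

lemma isoK_symm_inner (R : KE E) (x y : E) : ⟪(isoK R).symm x, y⟫ = ⟪x, R.1 y⟫ := by
  have := (isoK R).inner_map_map ((isoK R).symm x) y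
  rw [LinearIsometryEquiv.apply_symm_apply] at this
  exact this.symm

lemma isoK_symm_norm (R : KE E) (x y : E) : ‖x - (isoK R).symm y‖ = ‖R.1 x - y‖ := by
  rw [← (isoK R).norm_map, map_sub, LinearIsometryEquiv.apply_symm_apply]; rfl

lemma mean_eta (he : ‖e‖ = 1) (hu : ContDiff ℝ 1 u) {x : E} (hx : x ≠ 0) (y : E) :
    ∫ R : KE E, ⟪gradient u (R.1 x), R.1 y⟫ ∂(muK E) = ⟪‖x‖⁻¹ • x, y⟫ * bb e u ‖x‖ := by
  have hn : 0 < ‖x‖ := norm_pos_iff.2 hx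
  set n := ‖x‖⁻¹ • x with hndef
  have hnn : ‖n‖ = 1 := by rw [hndef, norm_smul, norm_inv, norm_norm, inv_mul_cancel₀ hn.ne']
  have hxn : x = ‖x‖ • n := by rw [hndef, smul_smul, mul_inv_cancel₀ hn.ne', one_smul]
  obtain ⟨S, hS⟩ := exists_ofIso (Submodule.reflection (ℝ ∙ n))
  have hS' : ∀ z, S.1 z = (2 * ⟪n, z⟫) • n - z := by
    intro z
    rw [hS, Submodule.reflection_singleton_apply, hnn]
    simp [smul_smul, two_smul, two_mul, add_smul]
  have hSx : S.1 x = x := by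
    rw [hS']
    nth_rw 1 [hxn]
    rw [real_inner_smul_right, real_inner_self_eq_norm_sq, hnn, hndef, smul_smul]
    have : 2 * (‖x‖ * 1 ^ 2) * ‖x‖⁻¹ = 2 := by field_simp
    rw [this, two_smul]; abel
  have h1 := integral_mul_right_eq_self (μ := muK E) (fun R => ⟪gradient u (R.1 x), R.1 y⟫) S
  simp only [mulK, hSx] at h1
  have cg : ∀ z : E, Continuous fun R : KE E => ⟪gradient u (R.1 x), R.1 z⟫ := fun z =>
    (hu.continuous_grad.comp (continuous_actK' x)).inner (continuous_actK' z)
  have h2 : ∫ R : KE E, ⟪gradient u (R.1 x), R.1 (S.1 y)⟫ ∂(muK E) =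
      2 * ⟪n, y⟫ * (∫ R : KE E, ⟪gradient u (R.1 x), R.1 n⟫ ∂(muK E)) -
        ∫ R : KE E, ⟪gradient u (R.1 x), R.1 y⟫ ∂(muK E) := by
    rw [← integral_const_mul, ← integral_sub ((integrableK (cg n)).const_mul _) (integrableK (cg y))]
    congr 1; funext R
    rw [hS', map_sub, map_smul, inner_sub_right, real_inner_smul_right]
  have h3 : ∫ R : KE E, ⟪gradient u (R.1 x), R.1 n⟫ ∂(muK E) = bb e u ‖x‖ := by
    have := integral_act he (fun z => ⟪gradient u z, ‖x‖⁻¹ • z⟫) x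
    rw [bb]
    rw [av] at this
    simp only [smul_smul, inv_mul_cancel₀ hn.ne', one_smul] at this
    rw [← this]
    congr 1; funext R
    rw [hndef, map_smul]
  rw [h3] at h2
  linarith

lemma jensen (he : ‖e‖ = 1) (hu : ContDiff ℝ 1 u) {x : E} (hx : x ≠ 0) :
    ‖gradient u x - bb e u ‖x‖ • (‖x‖⁻¹ • x)‖ ^ 2 ≤
      ∫ R : KE E, ‖R.1 (gradient u x) - gradient u (R.1 x)‖ ^ 2 ∂(muK E) := by
  set ξ := gradient u x with hξ
  set b := bb e u ‖x‖ with hb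
  set n := ‖x‖⁻¹ • x with hn
  set z := ξ - b • n with hz
  have cg : Continuous fun R : KE E => gradient u (R.1 x) := hu.continuous_grad.comp (continuous_actK' x)
  have c1 : Continuous fun R : KE E => ‖R.1 ξ - gradient u (R.1 x)‖ ^ 2 :=
    ((continuous_actK' ξ).sub cg).norm.pow 2
  have c2 : Continuous fun R : KE E => ⟪gradient u (R.1 x), R.1 z⟫ := cg.inner (continuous_actK' z)
  have pt : ∀ R : KE E, (2 * ⟪ξ, z⟫ - ‖z‖ ^ 2) - 2 * ⟪gradient u (R.1 x), R.1 z⟫ ≤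
      ‖R.1 ξ - gradient u (R.1 x)‖ ^ 2 := by
    intro R
    have h1 : 0 ≤ ‖(R.1 ξ - gradient u (R.1 x)) - R.1 z‖ ^ 2 := by positivity
    rw [norm_sub_sq_real, inner_sub_left, innerK, normK] at h1
    linarith
  have h2 := integral_mono ((integrable_const (2 * ⟪ξ, z⟫ - ‖z‖ ^ 2)).sub ((integrableK c2).const_mul 2))
    (integrableK c1) pt
  refine le_trans (le_of_eq ?_) h2
  have h3 : ∫ R : KE E, ((2 * ⟪ξ, z⟫ - ‖z‖ ^ 2) - 2 * ⟪gradient u (R.1 x), R.1 z⟫) ∂(muK E) =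
      (2 * ⟪ξ, z⟫ - ‖z‖ ^ 2) - 2 * (⟪n, z⟫ * b) := by
    rw [integral_sub (integrable_const _) ((integrableK c2).const_mul 2), integral_const_mul,
      mean_eta he hu hx z]
    simp only [integral_const, probReal_univ, one_smul]
    rfl
  refine Eq.trans ?_ h3.symm
  have h4 : ⟪z, z⟫ = ⟪ξ, z⟫ - b * ⟪n, z⟫ := by
    nth_rw 1 [hz]; rw [inner_sub_left, real_inner_smul_left]
  rw [real_inner_self_eq_norm_sq] at h4
  linarith

lemma ch_mul_eq (a b : ℝ) (g : ℝ → ℝ) (r : ℝ) : ch a b r * g r = (Ioo a b).indicator g r := by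
  rw [ch]
  by_cases h : r ∈ Ioo a b
  · rw [indicator_of_mem h, indicator_of_mem h, one_mul]
  · rw [indicator_of_notMem h, indicator_of_notMem h, zero_mul]

lemma integral_ch_Ioi {a b : ℝ} (ha : 0 ≤ a) (g : ℝ → ℝ) :
    ∫ r in Ioi (0:ℝ), ch a b r * g r = ∫ r in Ioo a b, g r := by
  simp only [ch_mul_eq]
  rw [setIntegral_indicator measurableSet_Ioo]
  congr 2
  ext r; simp only [mem_inter_iff, mem_Ioi, mem_Ioo]
  constructor
  · exact fun h => h.2
  · exact fun h => ⟨by linarith [h.1], h⟩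

lemma intOn_Ioo {g : ℝ → ℝ} (hg : Continuous g) (a b : ℝ) : IntegrableOn g (Ioo a b) volume :=
  (hg.continuousOn.integrableOn_compact (isCompact_Icc (a := a) (b := b))).mono_set Ioo_subset_Icc_self

lemma Near.energy (H : Near p lam e ρ R₁ u c δ₁) : ∃ C, 0 ≤ C ∧ ∀ δ h Φ, 0 < δ → 0 < h → δ + h ≤ δ₁ →
    0 ≤ Φ → (∀ r, R₁ - δ - h < r → r < R₁ → ((h⁻¹) ^ 2 + (R₁ - r)⁻¹) * mx e u r ≤ Φ) →
    ∫ r in Ioo (R₁ - δ) R₁, eE e u r ≤ C * Φ * ∫ r in Ioo (R₁ - δ - h) R₁, |W1 e u r| := by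
  obtain ⟨C0, hC0, hcacc⟩ := H.cacc
  have hnt := H.nontriv
  have he := H.he
  have hρ := H.hρ
  have hR := H.hR
  have hcN := cN_pos (E := E)
  have ha1 := a1K_pos (E := E) he
  set N := Module.finrank ℝ E
  set A := cN E * ρ ^ (N - 1 + 2) with hA
  have hA0 : 0 < A := by positivity
  set B := cN E * (R₁ ^ (N - 1) * (2 / a1K e)) with hB
  have hB0 : 0 < B := by positivity
  refine ⟨A⁻¹ * (R₁ ^ 2 * (C0 * (2 * B))), by positivity, fun δ h Φ hδ hh hδh hΦ hΦb => ?_⟩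
  have hδρ := H.hδρ
  set α := R₁ - δ - h with hα
  set β := R₁ - δ with hβ
  have hαρ : ρ < α := by rw [hα]; linarith
  have hαβ : α < β := by rw [hα, hβ]; linarith
  have hβR : β < R₁ := by rw [hβ]; linarith
  -- the continuous integrand
  let g : E → ℝ := fun x => ‖‖x‖ • gradient u x - bb e u ‖x‖ • x‖ ^ 2
  have cg : Continuous g := ((continuous_norm.smul H.hu.continuous_grad).sub
    (((continuous_bb H.hu).comp continuous_norm).smul continuous_id)).norm.pow 2
  let F : KE E → E → ℝ := fun R x => ‖R.1 (gradient u x) - gradient u (R.1 x)‖ ^ 2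
  have cF : Continuous (Function.uncurry F) := by
    have q1 : Continuous fun q : KE E × E => q.1.1 (gradient u q.2) :=
      continuous_actK.comp (continuous_fst.prodMk (H.hu.continuous_grad.comp continuous_snd))
    exact (q1.sub (H.hu.continuous_grad.comp continuous_actK)).norm.pow 2
  have cF' : Continuous fun x : E => ∫ R, F R x ∂(muK E) :=
    continuous_paramK (f := fun x R => F R x) (cF.comp continuous_swap)
  have F0 : ∀ R x, 0 ≤ F R x := fun R x => by positivity
  have cHd := continuous_Hd H.hu.continuous
  set J := ∫ x, ch α R₁ ‖x‖ * Hd u x with hJ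
  have hJ0 : 0 ≤ J := integral_nonneg fun x => mul_nonneg (ch_nonneg _ _ _) (Hd_nonneg _ _)
  -- step 1
  have s1 : ∫ x, ch β R₁ ‖x‖ * g x ≤ R₁ ^ 2 * ∫ x, ch β R₁ ‖x‖ * (∫ R, F R x ∂(muK E)) := by
    rw [← integral_const_mul]
    refine integral_mono (integrable_ch cg β R₁) ((integrable_ch cF' β R₁).const_mul _) fun x => ?_
    show ch β R₁ ‖x‖ * g x ≤ R₁ ^ 2 * (ch β R₁ ‖x‖ * (∫ R, F R x ∂(muK E)))
    by_cases h1 : β < ‖x‖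
    swap
    · rw [ch_of_le (not_lt.1 h1)]; simp
    by_cases h2 : ‖x‖ < R₁
    swap
    · rw [ch_of_ge (not_lt.1 h2)]; simp
    rw [ch_of_mem h1 h2, one_mul, one_mul]
    have hx : 0 < ‖x‖ := by linarith
    have j := jensen he H.hu (norm_pos_iff.1 hx)
    have e1 : g x = ‖x‖ ^ 2 * ‖gradient u x - bb e u ‖x‖ • (‖x‖⁻¹ • x)‖ ^ 2 := by
      show ‖‖x‖ • gradient u x - bb e u ‖x‖ • x‖ ^ 2 = _
      have : ‖x‖ • gradient u x - bb e u ‖x‖ • x =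
          ‖x‖ • (gradient u x - bb e u ‖x‖ • (‖x‖⁻¹ • x)) := by
        rw [smul_sub, smul_smul, smul_smul]
        congr 2; field_simp
      rw [this, norm_smul, norm_norm, mul_pow]
    rw [e1]
    have j0 : 0 ≤ ∫ R, F R x ∂(muK E) := integral_nonneg fun R => F0 R x
    gcongr
  -- step 2
  have s2 : ∫ x, ch β R₁ ‖x‖ * (∫ R, F R x ∂(muK E)) = ∫ R, (∫ x, ch β R₁ ‖x‖ * F R x) ∂(muK E) :=
    swapK (k := fun x : E => ch β R₁ ‖x‖) ((measurable_ch β R₁).comp measurable_norm) (M := 1) (B := R₁)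
      (fun x => ch_abs _ _ _) (fun x hx => ch_of_ge hx.le) cF
  -- step 3
  have s3 : ∀ R : KE E, ∫ x, ch β R₁ ‖x‖ * F R x ≤ C0 * Φ * (2 * J) := by
    intro R
    have h1 := hcacc δ h Φ hδ hh hδh hΦ (isoK R) (fun x h1 h2 => by
      have h3 := H.diff_le_mx (x := x) (y := isoK R x) ((isoK R).norm_map x).symm (by linarith) h2
      have h4 : 0 ≤ (R₁ - ‖x‖)⁻¹ := by rw [inv_nonneg]; linarith
      exact (mul_le_mul_of_nonneg_left h3 (by positivity)).trans (hΦb _ h1 h2))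
    have e1 : ∀ x, ‖gradient u x - (isoK R).symm (gradient u (isoK R x))‖ ^ 2 = F R x := fun x => by
      rw [isoK_symm_norm]; rfl
    simp only [e1] at h1
    refine h1.trans ?_
    refine mul_le_mul_of_nonneg_left ?_ (by positivity)
    have cHR : Continuous fun x => Hd u (isoK R x) := cHd.comp (isoK R).continuous
    have cd : Continuous fun x => |u x - u (isoK R x)| :=
      (H.hu.continuous.sub (H.hu.continuous.comp (isoK R).continuous)).abs
    have e2 : ∫ x, ch α R₁ ‖x‖ * Hd u (isoK R x) = J := by
      rw [hJ, ← integral_comp_isom (isoK R) (fun x => ch α R₁ ‖x‖ * Hd u x)]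
      simp only [LinearIsometryEquiv.norm_map]
    have e3 : 2 * J = ∫ x, (ch α R₁ ‖x‖ * Hd u x + ch α R₁ ‖x‖ * Hd u (isoK R x)) := by
      rw [integral_add (integrable_ch cHd α R₁) (integrable_ch cHR α R₁), e2]; ring
    rw [e3]
    refine integral_mono (integrable_ch cd α R₁)
      ((integrable_ch cHd α R₁).add (integrable_ch cHR α R₁)) fun x => ?_
    show ch α R₁ ‖x‖ * |u x - u (isoK R x)| ≤ ch α R₁ ‖x‖ * Hd u x + ch α R₁ ‖x‖ * Hd u (isoK R x)
    by_cases h1 : α < ‖x‖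
    swap
    · rw [ch_of_le (not_lt.1 h1)]; simp
    by_cases h2 : ‖x‖ < R₁
    swap
    · rw [ch_of_ge (not_lt.1 h2)]; simp
    rw [ch_of_mem h1 h2, one_mul, one_mul, one_mul]
    exact H.diff_le_Hd ((isoK R).norm_map x).symm (by linarith) h2
  have s4 : ∫ R, (∫ x, ch β R₁ ‖x‖ * F R x) ∂(muK E) ≤ C0 * Φ * (2 * J) := by
    have := integral_mono_of_nonneg (μ := muK E) (f := fun R => ∫ x, ch β R₁ ‖x‖ * F R x)
      (g := fun _ => C0 * Φ * (2 * J))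
      (Eventually.of_forall fun R => integral_nonneg fun x => mul_nonneg (ch_nonneg _ _ _) (F0 R x))
      (integrable_const _) (Eventually.of_forall s3)
    simpa using this
  -- step 5 : J in one dimension
  have s5 : J ≤ B * ∫ r in Ioo α R₁, |W1 e u r| := by
    rw [hJ, integral_radial_mul he (measurable_ch α R₁) (M := 1) (B := R₁) (ch_abs _ _)
      (fun r hr => ch_of_ge hr.le) cHd, polar_radial (fun r => ch α R₁ r * av e (Hd u) r), hB, mul_assoc]
    refine mul_le_mul_of_nonneg_left ?_ hcN.le
    have e1 : ∀ r, r ^ (N - 1) * (ch α R₁ r * av e (Hd u) r) = ch α R₁ r * (r ^ (N - 1) * av e (Hd u) r) :=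
      fun r => by ring
    rw [show (∫ r in Ioi (0:ℝ), r ^ (N - 1) * (ch α R₁ r * av e (Hd u) r)) =
      ∫ r in Ioi (0:ℝ), ch α R₁ r * (r ^ (N - 1) * av e (Hd u) r) from congrArg _ (funext e1)]
    rw [integral_ch_Ioi (by linarith) (fun r => r ^ (N - 1) * av e (Hd u) r), ← integral_const_mul]
    have cav := continuous_av e cHd
    refine setIntegral_mono_on (intOn_Ioo ((continuous_pow _).mul cav) _ _)
      ((intOn_Ioo (continuous_W1 H.hu.continuous).abs _ _).const_mul _) measurableSet_Ioo fun r hr => ?_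
    have h1 := H.avH_le (r := r) (by linarith [hr.1]) hr.2
    have h2 := H.W_nonpos (r := r) (by linarith [hr.1]) hr.2
    have hav0 : 0 ≤ av e (Hd u) r := integral_nonneg fun R => Hd_nonneg _ _
    have hr0 : 0 < r := by linarith [hr.1]
    have h3 : av e (Hd u) r ≤ 2 / a1K e * |W1 e u r| := by
      rw [abs_of_nonpos h2, div_mul_eq_mul_div, le_div_iff₀ ha1]; linarith
    rw [mul_assoc]
    refine mul_le_mul ?_ h3 hav0 (by positivity)
    exact pow_le_pow_left₀ hr0.le hr.2.le _
  -- step 6 : lower bound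
  have s6 : A * ∫ r in Ioo β R₁, eE e u r ≤ ∫ x, ch β R₁ ‖x‖ * g x := by
    rw [integral_radial_mul he (measurable_ch β R₁) (M := 1) (B := R₁) (ch_abs _ _)
      (fun r hr => ch_of_ge hr.le) cg, polar_radial (fun r => ch β R₁ r * av e g r), hA, mul_assoc]
    refine mul_le_mul_of_nonneg_left ?_ hcN.le
    have e1 : ∀ r, r ^ (N - 1) * (ch β R₁ r * av e g r) = ch β R₁ r * (r ^ (N - 1) * av e g r) :=
      fun r => by ring
    rw [show (∫ r in Ioi (0:ℝ), r ^ (N - 1) * (ch β R₁ r * av e g r)) =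
      ∫ r in Ioi (0:ℝ), ch β R₁ r * (r ^ (N - 1) * av e g r) from congrArg _ (funext e1)]
    rw [integral_ch_Ioi (by linarith) (fun r => r ^ (N - 1) * av e g r), ← integral_const_mul]
    refine setIntegral_mono_on ((intOn_Ioo (continuous_eE H.hu) _ _).const_mul _)
      (intOn_Ioo ((continuous_pow _).mul (continuous_av e cg)) _ _) measurableSet_Ioo fun r hr => ?_
    have hr0 : 0 < r := by linarith [hr.1]
    have e2 : av e g r = r ^ 2 * eE e u r := by
      rw [av, eE, ← integral_const_mul]
      congr 1; funext R
      show ‖‖r • R.1 e‖ • gradient u (r • R.1 e) - bb e u ‖r • R.1 e‖ • (r • R.1 e)‖ ^ 2 = _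
      rw [norm_rayK he hr0.le R]
      have : r • gradient u (r • R.1 e) - bb e u r • (r • R.1 e) =
          r • (gradient u (r • R.1 e) - bb e u r • R.1 e) := by
        rw [smul_sub, smul_smul, smul_smul, mul_comm]
      rw [this, norm_smul, mul_pow, Real.norm_of_nonneg hr0.le]
    rw [e2, ← mul_assoc, ← pow_add]
    refine mul_le_mul_of_nonneg_right ?_ (eE_nonneg r)
    exact pow_le_pow_left₀ hρ.le (by linarith [hr.1]) _
  set I := ∫ r in Ioo α R₁, |W1 e u r|
  have s7 : A * ∫ r in Ioo β R₁, eE e u r ≤ R₁ ^ 2 * (C0 * Φ * (2 * (B * I))) := by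
    refine s6.trans (s1.trans ?_)
    rw [s2]
    refine mul_le_mul_of_nonneg_left (s4.trans ?_) (by positivity)
    gcongr
  calc ∫ r in Ioo β R₁, eE e u r = A⁻¹ * (A * ∫ r in Ioo β R₁, eE e u r) := by
        rw [← mul_assoc, inv_mul_cancel₀ hA0.ne', one_mul]
    _ ≤ A⁻¹ * (R₁ ^ 2 * (C0 * Φ * (2 * (B * I)))) := by gcongr
    _ = _ := by ring
end Energy


section Taylor
lemma abs_mul_le' {a b A B : ℝ} (h1 : |a| ≤ A) (h2 : |b| ≤ B) : |a * b| ≤ A * B := by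
  rw [abs_mul]; exact mul_le_mul h1 h2 (abs_nonneg _) ((abs_nonneg _).trans h1)

/-- scalar form of the second order expansion -/
lemma taylor_scalar {p b n₁ ηn η₁ t M K g0 g1 rem : ℝ} (hp : 1 < p) (hb : |b| ≤ M) (hn : |n₁| ≤ 1)
    (h1 : |ηn| ≤ t) (h2 : |η₁| ≤ t) (htM : t ≤ M) (hg0 : |g0| ≤ K) (hg1 : |g1| ≤ K)
    (hg : g1 * b ^ 2 = (p - 2) / 2 * g0) (hrem : |rem| ≤ K * (2 * b * ηn + t ^ 2) ^ 2) :
    |(g0 + g1 * (2 * b * ηn + t ^ 2) + rem) *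
        (n₁ * (b ^ 2 + 2 * b * ηn + t ^ 2) - p * (b + ηn) * (b * n₁ + η₁)) -
      (g0 * (n₁ * b ^ 2 * (1 - p)) + g0 * b * p * ((2 - p) * n₁ * ηn - η₁))| ≤
      K * (1 + p) * (1 + 6 * M ^ 2 + 4 * M ^ 2 * (1 + 9 * M ^ 2)) * t ^ 2 := by
  have ht : 0 ≤ t := (abs_nonneg _).trans h1
  have hM : 0 ≤ M := ht.trans htM
  have hK : 0 ≤ K := (abs_nonneg _).trans hg0
  set B0 := n₁ * b ^ 2 * (1 - p) with hB0
  set B1 := (2 - p) * b * n₁ * ηn - p * b * η₁ with hB1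
  set B2 := n₁ * t ^ 2 - p * ηn * η₁ with hB2
  have key : (g0 + g1 * (2 * b * ηn + t ^ 2) + rem) *
        (n₁ * (b ^ 2 + 2 * b * ηn + t ^ 2) - p * (b + ηn) * (b * n₁ + η₁)) -
      (g0 * B0 + g0 * b * p * ((2 - p) * n₁ * ηn - η₁)) =
      g0 * B2 + 2 * b * ηn * g1 * (B1 + B2) + (g1 * t ^ 2 + rem) * (B0 + B1 + B2) := by
    rw [hB0, hB1, hB2]
    linear_combination (2 * b * ηn * n₁ * (1 - p)) * hg
  rw [key]
  have hp1 : |p| ≤ p := by rw [abs_of_pos (by linarith)]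
  have hp2 : |2 - p| ≤ 2 + p := by rw [abs_le]; constructor <;> linarith
  have hp3 : |1 - p| ≤ 1 + p := by rw [abs_le]; constructor <;> linarith
  have ht2 : |t ^ 2| ≤ t ^ 2 := by rw [abs_of_nonneg (by positivity)]
  have hb2 : |b ^ 2| ≤ M ^ 2 := by rw [abs_pow]; exact pow_le_pow_left₀ (abs_nonneg _) hb 2
  have hMt : t ^ 2 ≤ M * t := by nlinarith
  have hMM : M * t ≤ M ^ 2 := by nlinarith
  have e0 : |B0| ≤ (1 + p) * M ^ 2 := by
    have := abs_mul_le' (abs_mul_le' hn hb2) hp3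
    rw [hB0]; linarith
  have e1 : |B1| ≤ 2 * (1 + p) * (M * t) := by
    have q1 := abs_mul_le' (abs_mul_le' (abs_mul_le' hp2 hb) hn) h1
    have q2 := abs_mul_le' (abs_mul_le' hp1 hb) h2
    have q3 := abs_sub ((2 - p) * b * n₁ * ηn) (p * b * η₁)
    rw [hB1]; linarith
  have e2 : |B2| ≤ (1 + p) * t ^ 2 := by
    have q1 := abs_mul_le' hn ht2
    have q2 := abs_mul_le' (abs_mul_le' hp1 h1) h2
    have q3 := abs_sub (n₁ * t ^ 2) (p * ηn * η₁)
    rw [hB2]; linarith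
  have e12 : |B1 + B2| ≤ 3 * (1 + p) * (M * t) := by
    have := abs_add_le B1 B2
    linarith [mul_le_mul_of_nonneg_left hMt (by linarith : 0 ≤ 1 + p)]
  have e012 : |B0 + B1 + B2| ≤ 4 * (1 + p) * M ^ 2 := by
    have := abs_add_le B0 (B1 + B2)
    rw [← add_assoc] at this
    linarith [mul_le_mul_of_nonneg_left hMM (by linarith : 0 ≤ 1 + p)]
  have eT : |2 * b * ηn + t ^ 2| ≤ 3 * (M * t) := by
    have q1 := abs_mul_le' (abs_mul_le' (le_of_eq (abs_two (α := ℝ))) hb) h1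
    have q2 := abs_add_le (2 * b * ηn) (t ^ 2)
    linarith
  have er : |rem| ≤ K * (9 * M ^ 2 * t ^ 2) := by
    refine hrem.trans (mul_le_mul_of_nonneg_left ?_ hK)
    have := pow_le_pow_left₀ (abs_nonneg _) eT 2
    rw [sq_abs] at this
    linarith
  have f1 : |g0 * B2| ≤ K * ((1 + p) * t ^ 2) := abs_mul_le' hg0 e2
  have f2 : |2 * b * ηn * g1 * (B1 + B2)| ≤ 2 * M * t * K * (3 * (1 + p) * (M * t)) :=
    abs_mul_le' (abs_mul_le' (abs_mul_le' (abs_mul_le' (le_of_eq (abs_two (α := ℝ))) hb) h1) hg1) e12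
  have f3 : |g1 * t ^ 2 + rem| ≤ K * t ^ 2 + K * (9 * M ^ 2 * t ^ 2) :=
    (abs_add_le _ _).trans (add_le_add (abs_mul_le' hg1 ht2) er)
  have f4 := abs_mul_le' f3 e012
  refine (abs_add_three _ _ _).trans ((add_le_add (add_le_add f1 f2) f4).trans (le_of_eq ?_))
  ring

variable {E : Type*} [NormedAddCommGroup E] [InnerProductSpace ℝ E] [CompleteSpace E]

lemma taylor_vec {p c : ℝ} (hp : 1 < p) (hc : 0 < c) : ∃ C m0 K0 : ℝ, 0 ≤ C ∧ 0 < m0 ∧ 0 ≤ K0 ∧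
    ∀ (b : ℝ), |b + c| ≤ c / 4 → ∃ g0 : ℝ, m0 ≤ |g0 * b| ∧ |g0 * b| ≤ K0 ∧
    ∀ (e n a : E), ‖e‖ = 1 → ‖n‖ = 1 → 3 / 4 * c ≤ ‖a‖ → ‖a‖ ≤ 5 / 4 * c →
    |(⟪n, e⟫ * ‖a‖ ^ p - p * ⟪Fp p a, n⟫ * ⟪e, a⟫) -
      (g0 * (⟪n, e⟫ * b ^ 2 * (1 - p)) +
        g0 * b * p * ((2 - p) * ⟪n, e⟫ * ⟪a - b • n, n⟫ - ⟪a - b • n, e⟫))| ≤ C * ‖a - b • n‖ ^ 2 := by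
  set α := (3 / 4 * c) ^ 2 with hα
  set β := (5 / 4 * c) ^ 2 with hβ
  have hα0 : 0 < α := by positivity
  obtain ⟨L, hL, hT⟩ := rpow_taylor (β := β) hα0 ((p - 2) / 2)
  obtain ⟨m, M0, hm, hmM, hb0⟩ := rpow_bounds (β := β) hα0 ((p - 2) / 2)
  obtain ⟨m', M1, hm', hmM', hb1⟩ := rpow_bounds (β := β) hα0 ((p - 2) / 2 - 1)
  have hM1 : 0 ≤ M1 := hm'.le.trans hmM'
  have hM0 : 0 ≤ M0 := hm.le.trans hmM
  set K := M0 + |(p - 2) / 2| * M1 + L with hK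
  have hK0 : 0 ≤ K := by positivity
  set M := 5 / 2 * c with hM
  refine ⟨K * (1 + p) * (1 + 6 * M ^ 2 + 4 * M ^ 2 * (1 + 9 * M ^ 2)), m * (3 / 4 * c), M0 * (5 / 4 * c),
    by positivity, by positivity, by positivity, fun b hb => ?_⟩
  obtain ⟨hb1', hb2'⟩ := abs_le.1 hb
  have hbl : 3 / 4 * c ≤ |b| := by rw [abs_of_neg (by linarith)]; linarith
  have hbu : |b| ≤ 5 / 4 * c := by rw [abs_of_neg (by linarith)]; linarith
  have hbα : α ≤ b ^ 2 := by rw [← sq_abs b]; exact pow_le_pow_left₀ (by positivity) hbl 2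
  have hbβ : b ^ 2 ≤ β := by rw [← sq_abs b]; exact pow_le_pow_left₀ (abs_nonneg _) hbu 2
  obtain ⟨g0l, g0u⟩ := hb0 _ hbα hbβ
  obtain ⟨g1l, g1u⟩ := hb1 _ hbα hbβ
  set g0 := (b ^ 2) ^ ((p - 2) / 2) with hg0
  have hg0a : |g0| = g0 := abs_of_pos (hm.trans_le g0l)
  refine ⟨g0, ?_, ?_, fun e n a he hn ha1 ha2 => ?_⟩
  · rw [abs_mul, hg0a]; exact mul_le_mul g0l hbl (by positivity) (by linarith)
  · rw [abs_mul, hg0a]; exact mul_le_mul g0u hbu (abs_nonneg _) hM0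
  have haα : α ≤ ‖a‖ ^ 2 := pow_le_pow_left₀ (by positivity) ha1 2
  have haβ : ‖a‖ ^ 2 ≤ β := pow_le_pow_left₀ (norm_nonneg _) ha2 2
  have tay := hT _ _ haα haβ hbα hbβ
  set η := a - b • n with hη
  have ha : a = b • n + η := by rw [hη]; abel
  have hnn : ⟪n, n⟫ = 1 := by rw [real_inner_self_eq_norm_sq, hn]; norm_num
  have hsq : ‖a‖ ^ 2 = b ^ 2 + 2 * b * ⟪η, n⟫ + ‖η‖ ^ 2 := by
    rw [ha, norm_add_sq_real, norm_smul, hn, Real.norm_eq_abs, mul_one, sq_abs, real_inner_smul_left,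
      real_inner_comm]; ring
  have hgp : ‖a‖ ^ (p - 2) = (‖a‖ ^ 2) ^ ((p - 2) / 2) := by
    rw [← Real.rpow_natCast, ← Real.rpow_mul (norm_nonneg _)]; congr 1; push_cast; ring
  have ia : ⟪a, n⟫ = b + ⟪η, n⟫ := by rw [ha, inner_add_left, real_inner_smul_left, hnn, mul_one]
  have ie : ⟪e, a⟫ = b * ⟪n, e⟫ + ⟪η, e⟫ := by
    rw [real_inner_comm, ha, inner_add_left, real_inner_smul_left]
  set g1 := (p - 2) / 2 * (b ^ 2) ^ ((p - 2) / 2 - 1) with hg1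
  set rem := (‖a‖ ^ 2) ^ ((p - 2) / 2) - g0 - g1 * (‖a‖ ^ 2 - b ^ 2) with hrem
  have hG : ⟪n, e⟫ * ‖a‖ ^ p - p * ⟪Fp p a, n⟫ * ⟪e, a⟫ =
      (g0 + g1 * (2 * b * ⟪η, n⟫ + ‖η‖ ^ 2) + rem) *
        (⟪n, e⟫ * (b ^ 2 + 2 * b * ⟪η, n⟫ + ‖η‖ ^ 2) - p * (b + ⟪η, n⟫) * (b * ⟪n, e⟫ + ⟪η, e⟫)) := by
    have q : g0 + g1 * (2 * b * ⟪η, n⟫ + ‖η‖ ^ 2) + rem = ‖a‖ ^ (p - 2) := by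
      rw [hgp, hrem, hsq]; ring
    rw [q, ← hsq, ← ia, ← ie, Fp, real_inner_smul_left, ← rpow_pm2_mul_sq hp (norm_nonneg a)]
    ring
  rw [hG]
  have hbne : b ^ 2 ≠ 0 := (hα0.trans_le hbα).ne'
  refine taylor_scalar hp (by linarith) ?_ ?_ ?_ ?_ ?_ ?_ ?_ ?_
  · have := abs_real_inner_le_norm n e; rwa [hn, he, mul_one] at this
  · have := abs_real_inner_le_norm η n; rwa [hn, mul_one] at this
  · have := abs_real_inner_le_norm η e; rwa [he, mul_one] at this
  · have := norm_sub_le a (b • n)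
    rw [norm_smul, hn, Real.norm_eq_abs, mul_one] at this
    rw [hM]; linarith
  · rw [hg0a, hK]; linarith [mul_nonneg (abs_nonneg ((p - 2) / 2)) hM1]
  · rw [hg1, abs_mul, abs_of_pos (hm'.trans_le g1l), hK]
    linarith [mul_le_mul_of_nonneg_left g1u (abs_nonneg ((p - 2) / 2))]
  · rw [hg1, hg0, Real.rpow_sub_one hbne]; field_simp [show b ≠ 0 from fun h => hbne (by rw [h]; ring)]
  · have q : 2 * b * ⟪η, n⟫ + ‖η‖ ^ 2 = ‖a‖ ^ 2 - b ^ 2 := by rw [hsq]; ring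
    rw [q]
    refine tay.trans (mul_le_mul_of_nonneg_right ?_ (sq_nonneg _))
    rw [hK]; linarith [mul_nonneg (abs_nonneg ((p - 2) / 2)) hM1]

variable [FiniteDimensional ℝ E] [MeasurableSpace E] [BorelSpace E]
variable {p lam ρ R₁ c δ₁ : ℝ} {e : E} {u : E → ℝ}

/-- derivative of `W1` -/
noncomputable def W1' (e : E) (u : E → ℝ) (r : ℝ) : ℝ :=
  ∫ R : KE E, ⟪gradient u (r • R.1 e), R.1 e⟫ * ⟪R.1 e, e⟫ ∂(muK E)

lemma hasDerivAt_W1 (hu : ContDiff ℝ 1 u) (r : ℝ) : HasDerivAt (W1 e u) (W1' e u r) r :=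
  hasDerivAt_av hu ((continuous_actK' e).inner continuous_const) r

lemma continuous_W1' (hu : ContDiff ℝ 1 u) : Continuous (W1' e u) := by
  refine continuous_paramK (f := fun r R => ⟪gradient u (r • R.1 e), R.1 e⟫ * ⟪R.1 e, e⟫) ?_
  have q := (continuous_actK' e).comp (continuous_snd (X := ℝ) (Y := KE E))
  exact ((hu.continuous_grad.comp (continuous_ray e)).inner q).mul (q.inner continuous_const)

set_option maxHeartbeats 1000000 in
lemma Near.W1'_le (H : Near p lam e ρ R₁ u c δ₁) : ∃ C, 0 ≤ C ∧ ∀ r, R₁ - δ₁ < r → r < R₁ →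
    |W1' e u r| ≤ C * (|W1 e u r| + eE e u r) := by
  have hp := H.hp
  have he := H.he
  have hρ := H.hρ
  have hnt := H.nontriv
  obtain ⟨C, m0, K0, hC, hm0, hK0, hT⟩ := taylor_vec (E := E) hp H.hc
  obtain ⟨Ca, hCa, hav⟩ := H.av_pow
  set N1 := ((Module.finrank ℝ E : ℝ) - 1) with hN1
  set D := m0 * (p * (p - 1)) with hD
  have hD0 : 0 < D := by
    have : 0 < p - 1 := by linarith
    positivity
  refine ⟨D⁻¹ * (C + lam * Ca + K0 * p * (|N1| / ρ)), ?_, fun r h1 h2 => ?_⟩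
  · have := H.lam0
    positivity
  have hρr : ρ < r := by linarith [H.hδρ]
  have hr : 0 < r := by linarith
  set b := bb e u r with hb
  have hn : ∀ R : KE E, ‖R.1 e‖ = 1 := fun R => by rw [normK, he]
  have cr : Continuous fun R : KE E => r • R.1 e := continuous_rayK e r
  have cn : Continuous fun R : KE E => R.1 e := continuous_actK' e
  have cg : Continuous fun R : KE E => gradient u (r • R.1 e) := H.hu.continuous_grad.comp cr
  have c1 : Continuous fun R : KE E => ⟪R.1 e, e⟫ := cn.inner continuous_const
  have cgn : Continuous fun R : KE E => ⟪gradient u (r • R.1 e), R.1 e⟫ := cg.inner cn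
  have cge : Continuous fun R : KE E => ⟪gradient u (r • R.1 e), e⟫ := cg.inner continuous_const
  have nearR : ∀ R : KE E, ‖gradient u (r • R.1 e) + c • R.1 e‖ ≤ c / 4 := by
    intro R
    have h := H.near (r • R.1 e) (by rw [norm_rayK he hr.le]; exact h1.le)
      (by rw [norm_rayK he hr.le]; exact h2.le)
    rwa [norm_rayK he hr.le, smul_smul r⁻¹, inv_mul_cancel₀ hr.ne', one_smul] at h
  have hbc : |b + c| ≤ c / 4 := by
    have e1 : b + c = ∫ R : KE E, (⟪gradient u (r • R.1 e), R.1 e⟫ + c) ∂(muK E) := by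
      rw [integral_add (integrableK cgn) (integrable_const _), hb, bb]
      simp
    rw [e1, ← Real.norm_eq_abs]
    have q := norm_integral_le_of_norm_le (μ := muK E)
      (f := fun R : KE E => ⟪gradient u (r • R.1 e), R.1 e⟫ + c) (integrable_const (c / 4))
      (Eventually.of_forall fun R => by
        have e2 : ⟪gradient u (r • R.1 e), R.1 e⟫ + c = ⟪gradient u (r • R.1 e) + c • R.1 e, R.1 e⟫ := by
          rw [inner_add_left, real_inner_smul_left, real_inner_self_eq_norm_sq, hn]; ring
        show ‖⟪gradient u (r • R.1 e), R.1 e⟫ + c‖ ≤ c / 4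
        rw [e2]
        refine (norm_inner_le_norm _ _).trans ?_
        rw [hn, mul_one]; exact nearR R)
    simpa using q
  obtain ⟨g0, hg1, hg2, hG⟩ := hT b hbc
  -- the two functions
  let G : KE E → ℝ := fun R => ⟪R.1 e, e⟫ * ‖gradient u (r • R.1 e)‖ ^ p -
    p * ⟪Fp p (gradient u (r • R.1 e)), R.1 e⟫ * ⟪e, gradient u (r • R.1 e)⟫
  let L : KE E → ℝ := fun R => (g0 * (b ^ 2 * (1 - p)) - g0 * b * p * ((2 - p) * b) + g0 * b * p * b) * ⟪R.1 e, e⟫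
    + g0 * b * p * (2 - p) * (⟪gradient u (r • R.1 e), R.1 e⟫ * ⟪R.1 e, e⟫)
    - g0 * b * p * ⟪gradient u (r • R.1 e), e⟫
  have cG : Continuous G := (c1.mul (cg.norm.rpow_const fun _ => Or.inr (by linarith))).sub
    ((continuous_const.mul (((continuous_Fp hp).comp cg).inner cn)).mul (continuous_const.inner cg))
  have cL : Continuous L := ((continuous_const.mul c1).add (continuous_const.mul (cgn.mul c1))).sub
    (continuous_const.mul cge)
  have pt : ∀ R, |G R - L R| ≤ C * ‖gradient u (r • R.1 e) - b • R.1 e‖ ^ 2 := by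
    intro R
    have gb := H.grad_bounds (x := r • R.1 e) (by rw [norm_rayK he hr.le]; exact h1.le)
      (by rw [norm_rayK he hr.le]; exact h2.le)
    have h := hG e (R.1 e) (gradient u (r • R.1 e)) he (hn R) gb.1 gb.2
    refine le_trans (le_of_eq ?_) h
    congr 2
    show (g0 * (b ^ 2 * (1 - p)) - g0 * b * p * ((2 - p) * b) + g0 * b * p * b) * ⟪R.1 e, e⟫
      + g0 * b * p * (2 - p) * (⟪gradient u (r • R.1 e), R.1 e⟫ * ⟪R.1 e, e⟫)
      - g0 * b * p * ⟪gradient u (r • R.1 e), e⟫ = _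
    rw [inner_sub_left, inner_sub_left, real_inner_smul_left, real_inner_smul_left,
      real_inner_self_eq_norm_sq, hn]
    ring
  have ceta : Continuous fun R : KE E => ‖gradient u (r • R.1 e) - b • R.1 e‖ ^ 2 :=
    (cg.sub (cn.const_smul b)).norm.pow 2
  have hGL : |(∫ R, G R ∂(muK E)) - ∫ R, L R ∂(muK E)| ≤ C * eE e u r := by
    rw [← integral_sub (integrableK cG) (integrableK cL), eE, ← integral_const_mul, ← Real.norm_eq_abs]
    exact norm_integral_le_of_norm_le ((integrableK ceta).const_mul C) (Eventually.of_forall pt)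
  have iL : ∫ R, L R ∂(muK E) = g0 * b * p * ((1 - p) * W1' e u r - N1 / r * W1 e u r) := by
    have i1 : Integrable (fun R : KE E => (g0 * (b ^ 2 * (1 - p)) - g0 * b * p * ((2 - p) * b) + g0 * b * p * b) * ⟪R.1 e, e⟫) (muK E) :=
      (integrableK c1).const_mul _
    have i2 : Integrable (fun R : KE E => g0 * b * p * (2 - p) * (⟪gradient u (r • R.1 e), R.1 e⟫ * ⟪R.1 e, e⟫)) (muK E) :=
      (integrableK (cgn.mul c1)).const_mul _
    have i3 : Integrable (fun R : KE E => g0 * b * p * ⟪gradient u (r • R.1 e), e⟫) (muK E) :=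
      (integrableK cge).const_mul _
    have i12 : Integrable (fun R : KE E => (g0 * (b ^ 2 * (1 - p)) - g0 * b * p * ((2 - p) * b) + g0 * b * p * b) * ⟪R.1 e, e⟫ + g0 * b * p * (2 - p) * (⟪gradient u (r • R.1 e), R.1 e⟫ * ⟪R.1 e, e⟫)) (muK E) := i1.add i2
    show ∫ R : KE E, ((g0 * (b ^ 2 * (1 - p)) - g0 * b * p * ((2 - p) * b) + g0 * b * p * b) * ⟪R.1 e, e⟫
      + g0 * b * p * (2 - p) * (⟪gradient u (r • R.1 e), R.1 e⟫ * ⟪R.1 e, e⟫)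
      - g0 * b * p * ⟪gradient u (r • R.1 e), e⟫) ∂(muK E) = _
    rw [integral_sub i12 i3, integral_add i1 i2, integral_const_mul, integral_const_mul, integral_const_mul,
      integralK_n1, av_dir he H.hu hr, W1', W1]
    ring
  have iG : ∫ R, G R ∂(muK E) = lam * ∫ R : KE E, ⟪R.1 e, e⟫ * |u (r • R.1 e)| ^ p ∂(muK E) := by
    have h := H.avQ r ⟨hρr, h2.le⟩
    have cu : Continuous fun R : KE E => ⟪R.1 e, e⟫ * |u (r • R.1 e)| ^ p :=
      c1.mul ((H.hu.continuous.comp cr).abs.rpow_const fun _ => Or.inr (by linarith))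
    have j1 : Integrable (fun R : KE E => G R) (muK E) := integrableK cG
    have j2 : Integrable (fun R : KE E => lam * (⟪R.1 e, e⟫ * |u (r • R.1 e)| ^ p)) (muK E) :=
      (integrableK cu).const_mul _
    have e1 : av e (Qx p lam e u) r = r * ((∫ R, G R ∂(muK E)) - lam * ∫ R : KE E, ⟪R.1 e, e⟫ * |u (r • R.1 e)| ^ p ∂(muK E)) := by
      rw [← integral_const_mul, ← integral_sub j1 j2, ← integral_const_mul, av]
      congr 1; funext R
      show Qx p lam e u (r • R.1 e) = r * ((⟪R.1 e, e⟫ * ‖gradient u (r • R.1 e)‖ ^ p -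
        p * ⟪Fp p (gradient u (r • R.1 e)), R.1 e⟫ * ⟪e, gradient u (r • R.1 e)⟫) -
        lam * (⟪R.1 e, e⟫ * |u (r • R.1 e)| ^ p))
      rw [Qx, real_inner_smul_left, real_inner_smul_right]
      ring
    rw [e1] at h
    rcases mul_eq_zero.1 h with h | h
    · exact absurd h hr.ne'
    · linarith
  rw [iG, iL] at hGL
  have ha := hav r hρr h2
  set w := W1 e u r
  set w' := W1' e u r
  set A := ∫ R : KE E, ⟪R.1 e, e⟫ * |u (r • R.1 e)| ^ p ∂(muK E)
  have hE0 := eE_nonneg (e := e) (u := u) r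
  set ee := eE e u r
  have k1 : g0 * b * p * (p - 1) * w' = (lam * A - g0 * b * p * ((1 - p) * w' - N1 / r * w)) - lam * A
      - g0 * b * p * (N1 / r) * w := by ring
  have k2 : |g0 * b * p * (N1 / r) * w| ≤ K0 * p * (|N1| / ρ) * |w| := by
    refine abs_mul_le' (abs_mul_le' (abs_mul_le' hg2 (le_of_eq (abs_of_pos (by linarith)))) ?_) le_rfl
    rw [abs_div, abs_of_pos hr]
    exact div_le_div_of_nonneg_left (abs_nonneg _) hρ hρr.le
  have k3 : |lam * A| ≤ lam * (Ca * |w|) := abs_mul_le' (le_of_eq (abs_of_nonneg H.lam0)) ha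
  have k4 : D * |w'| ≤ |g0 * b * p * (p - 1) * w'| := by
    rw [abs_mul]
    refine mul_le_mul_of_nonneg_right ?_ (abs_nonneg _)
    rw [mul_assoc, abs_mul, abs_of_pos (a := p * (p - 1)) (by
      have : 0 < p - 1 := by linarith
      positivity), hD]
    refine mul_le_mul_of_nonneg_right hg1 ?_
    have : 0 < p - 1 := by linarith
    positivity
  have k5 : D * |w'| ≤ (C + lam * Ca + K0 * p * (|N1| / ρ)) * (|w| + ee) := by
    refine k4.trans ?_
    rw [k1]
    have q1 := abs_sub ((lam * A - g0 * b * p * ((1 - p) * w' - N1 / r * w)) - lam * A) (g0 * b * p * (N1 / r) * w)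
    have q2 := abs_sub (lam * A - g0 * b * p * ((1 - p) * w' - N1 / r * w)) (lam * A)
    have z1 : 0 ≤ C * |w| := mul_nonneg hC (abs_nonneg _)
    have z2 : 0 ≤ lam * Ca * ee := mul_nonneg (mul_nonneg H.lam0 hCa) hE0
    have z3 : 0 ≤ K0 * p * (|N1| / ρ) * ee := by positivity
    linarith
  calc |w'| = D⁻¹ * (D * |w'|) := by rw [← mul_assoc, inv_mul_cancel₀ hD0.ne', one_mul]
    _ ≤ D⁻¹ * ((C + lam * Ca + K0 * p * (|N1| / ρ)) * (|w| + ee)) := by gcongr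
    _ = _ := by ring
end Taylor


section Iter
lemma decay_aux {f : ℝ → ℝ} {D : ℝ} (hD : 0 < D) (mono : ∀ a b, 0 < a → a ≤ b → b ≤ D → f a ≤ f b)
    (f0 : 0 ≤ f D) (k : ℕ) (h : ∀ δ, 0 < δ → 2 * δ ≤ D → f δ ≤ (1 / 2) ^ k * f (2 * δ)) :
    ∃ A, 0 ≤ A ∧ ∀ δ, 0 < δ → δ ≤ D → f δ ≤ A * δ ^ k := by
  set A := f D * (2 / D) ^ k with hA
  have hA0 : 0 ≤ A := by positivity
  refine ⟨A, hA0, ?_⟩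
  have base : ∀ δ, D / 2 < δ → δ ≤ D → f δ ≤ A * δ ^ k := by
    intro δ h1 h2
    refine (mono δ D (by linarith) h2 le_rfl).trans ?_
    have e1 : f D = A * (D / 2) ^ k := by
      rw [hA, mul_assoc, ← mul_pow]
      have : 2 / D * (D / 2) = 1 := by field_simp
      rw [this, one_pow, mul_one]
    rw [e1]
    exact mul_le_mul_of_nonneg_left (pow_le_pow_left₀ (by linarith) h1.le _) hA0
  have ind : ∀ n : ℕ, ∀ δ, D / 2 ^ (n + 1) < δ → δ ≤ D → f δ ≤ A * δ ^ k := by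
    intro n
    induction n with
    | zero => intro δ h1 h2; exact base δ (by simpa using h1) h2
    | succ n ih =>
      intro δ h1 h2
      have hδ : 0 < δ := lt_of_le_of_lt (by positivity) h1
      by_cases h3 : D / 2 < δ
      · exact base δ h3 h2
      have h4 : 2 * δ ≤ D := by linarith
      have h5 := ih (2 * δ) (by
        have : D / 2 ^ (n + 1) = 2 * (D / 2 ^ (n + 1 + 1)) := by field_simp; ring
        rw [this]; linarith) h4
      refine (h δ hδ h4).trans ((mul_le_mul_of_nonneg_left h5 (by positivity)).trans (le_of_eq ?_))
      rw [mul_pow]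
      have : ((1:ℝ) / 2) ^ k * 2 ^ k = 1 := by rw [← mul_pow]; norm_num
      linear_combination (A * δ ^ k) * this
  intro δ hδ hδD
  obtain ⟨n, hn⟩ := exists_pow_lt_of_lt_one (div_pos hδ hD) (by norm_num : (1:ℝ) / 2 < 1)
  refine ind n δ ?_ hδD
  rw [lt_div_iff₀ hD] at hn
  have : D / 2 ^ (n + 1) = (1 / 2) ^ n * D / 2 := by
    rw [one_div, inv_pow, pow_succ]; field_simp
  rw [this]
  have : 0 < (1 / 2 : ℝ) ^ n * D := by positivity
  linarith

lemma deGiorgi {f : ℝ → ℝ} {D C A κ : ℝ} (hD : 0 < D) (hC : 0 ≤ C) (hA : 0 ≤ A) (hκ : 0 < κ)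
    (f0 : ∀ δ, 0 ≤ f δ) (mono : ∀ a b, 0 < a → a ≤ b → b ≤ D → f a ≤ f b)
    (hdec : ∀ δ, 0 < δ → δ ≤ D → f δ ^ κ ≤ A * δ ^ 3)
    (h : ∀ δ h, 0 < δ → 0 < h → δ + h ≤ D → f δ ≤ C * (h⁻¹) ^ 2 * (f (δ + h) * f (δ + h) ^ κ)) :
    ∃ δ, 0 < δ ∧ δ ≤ D ∧ f δ = 0 := by
  set θ : ℝ := (1 / 4) ^ (1 / κ) with hθ
  have hθ0 : 0 < θ := by positivity
  have hθ1 : θ < 1 := Real.rpow_lt_one (by norm_num) (by norm_num) (by positivity)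
  set δ := min D (θ / (16 * C * A + 1)) with hδ
  have hδ0 : 0 < δ := lt_min hD (by positivity)
  have hδD : δ ≤ D := min_le_left _ _
  have hsmall : 16 * C * A * δ ≤ θ := by
    have h1 : δ ≤ θ / (16 * C * A + 1) := min_le_right _ _
    rw [le_div_iff₀ (by positivity)] at h1
    linarith
  have hfin : ∀ j : ℕ, f (δ * (1 / 2 + (1 / 2) ^ (j + 1))) ≤ f δ * θ ^ j := by
    intro j
    induction j with
    | zero => norm_num
    | succ j ih =>
      set a := δ * (1 / 2 + (1 / 2) ^ (j + 1)) with ha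
      set η := δ * (1 / 2) ^ (j + 2) with hη
      have hη0 : 0 < η := by positivity
      have hae : δ * (1 / 2 + (1 / 2) ^ (j + 1 + 1)) + η = a := by
        rw [ha, hη]; ring
      have haD : a ≤ D := by
        refine le_trans ?_ hδD
        rw [ha]
        have : (1 / 2 : ℝ) ^ (j + 1) ≤ 1 / 2 := by
          rw [pow_succ]
          have := pow_le_one₀ (n := j) (by norm_num : (0:ℝ) ≤ 1 / 2) (by norm_num)
          linarith
        nlinarith
      have h1 := h (δ * (1 / 2 + (1 / 2) ^ (j + 1 + 1))) η (by positivity) hη0 (by rw [hae]; exact haD)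
      rw [hae] at h1
      have h2 : f a ^ κ ≤ A * δ ^ 3 * (1 / 4) ^ j := by
        have q1 := Real.rpow_le_rpow (f0 a) ih hκ.le
        rw [Real.mul_rpow (f0 _) (by positivity)] at q1
        have q2 : (θ ^ j) ^ κ = (1 / 4) ^ j := by
          rw [hθ, ← Real.rpow_natCast, ← Real.rpow_natCast, ← Real.rpow_mul (by positivity),
            ← Real.rpow_mul (by positivity)]
          congr 1; field_simp
        rw [q2] at q1
        exact q1.trans (mul_le_mul_of_nonneg_right (hdec δ hδ0 hδD) (by positivity))
      have h3 : (η⁻¹) ^ 2 = 16 * 4 ^ j / δ ^ 2 := by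
        have q : ((1:ℝ) / 2) ^ (j + 2) * (2 ^ j * 4) = 1 := by
          rw [pow_add]
          have : ((1:ℝ) / 2) ^ j * 2 ^ j = 1 := by rw [← mul_pow]; norm_num
          linear_combination this
        have q4 : (4:ℝ) ^ j = 2 ^ j * 2 ^ j := by rw [← mul_pow]; norm_num
        have q5 : η⁻¹ = 2 ^ j * 4 / δ := by
          rw [inv_eq_one_div, div_eq_div_iff hη0.ne' hδ0.ne', hη]
          linear_combination (-δ) * q
        rw [q5, q4]; field_simp; ring
      have h4 : (4:ℝ) ^ j * (1 / 4) ^ j = 1 := by rw [← mul_pow]; norm_num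
      calc f (δ * (1 / 2 + (1 / 2) ^ (j + 1 + 1))) ≤ C * (η⁻¹) ^ 2 * (f a * f a ^ κ) := h1
        _ ≤ C * (η⁻¹) ^ 2 * (f a * (A * δ ^ 3 * (1 / 4) ^ j)) := by
          have := f0 a
          gcongr
        _ = 16 * C * A * δ * f a * (4 ^ j * (1 / 4) ^ j) := by rw [h3]; field_simp
        _ = 16 * C * A * δ * f a := by rw [h4, mul_one]
        _ ≤ θ * (f δ * θ ^ j) := mul_le_mul hsmall ih (f0 _) hθ0.le
        _ = f δ * θ ^ (j + 1) := by ring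
  refine ⟨δ / 2, by positivity, by linarith, le_antisymm ?_ (f0 _)⟩
  have hle : ∀ j : ℕ, f (δ / 2) ≤ f δ * θ ^ j := fun j => by
    refine (mono _ _ (by positivity) ?_ ?_).trans (hfin j)
    · have : (0:ℝ) < (1 / 2) ^ (j + 1) := by positivity
      nlinarith
    · refine le_trans ?_ hδD
      have : (1 / 2 : ℝ) ^ (j + 1) ≤ 1 / 2 := by
        rw [pow_succ]
        have := pow_le_one₀ (n := j) (by norm_num : (0:ℝ) ≤ 1 / 2) (by norm_num)
        linarith
      nlinarith
  have ht : Tendsto (fun j : ℕ => f δ * θ ^ j) atTop (𝓝 0) := by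
    have := (tendsto_pow_atTop_nhds_zero_of_lt_one hθ0.le hθ1).const_mul (f δ)
    rwa [mul_zero] at this
  exact ge_of_tendsto' ht hle

variable {E : Type*} [NormedAddCommGroup E] [InnerProductSpace ℝ E] [CompleteSpace E]
variable [FiniteDimensional ℝ E] [MeasurableSpace E] [BorelSpace E]
variable {p lam ρ R₁ c δ₁ : ℝ} {e : E} {u : E → ℝ}

/-- total variation of `W1` near the outer sphere -/
noncomputable def YY (e : E) (u : E → ℝ) (R₁ δ : ℝ) : ℝ := ∫ r in Ioo (R₁ - δ) R₁, |W1' e u r|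

lemma YY_nonneg (δ : ℝ) : 0 ≤ YY e u R₁ δ := integral_nonneg fun _ => abs_nonneg _

lemma YY_mono (hu : ContDiff ℝ 1 u) {a b : ℝ} (h : a ≤ b) : YY e u R₁ a ≤ YY e u R₁ b :=
  setIntegral_mono_set (intOn_Ioo (continuous_W1' hu).abs _ _) (Eventually.of_forall fun _ => abs_nonneg _)
    (Eventually.of_forall (Ioo_subset_Ioo_left (by linarith)))

lemma Shell.W1_bd (H : Shell p lam e ρ R₁ u) : W1 e u R₁ = 0 := by
  rw [W1]
  have : ∀ R : KE E, u (R₁ • R.1 e) * ⟪R.1 e, e⟫ = 0 := fun R => by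
    rw [H.bd _ (norm_rayK H.he H.hR.le R), zero_mul]
  simp [this]

lemma Shell.W1_le (H : Shell p lam e ρ R₁ u) {r : ℝ} (hr : r < R₁) : |W1 e u r| ≤ YY e u R₁ (R₁ - r) := by
  have h1 : ∫ t in r..R₁, W1' e u t = W1 e u R₁ - W1 e u r :=
    intervalIntegral.integral_eq_sub_of_hasDerivAt (fun t _ => hasDerivAt_W1 H.hu t)
      ((continuous_W1' H.hu).intervalIntegrable _ _)
  rw [H.W1_bd, zero_sub] at h1
  rw [← abs_neg, ← h1, YY, sub_sub_cancel, ← integral_Ioc_eq_integral_Ioo,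
    ← intervalIntegral.integral_of_le hr.le]
  exact intervalIntegral.abs_integral_le_integral_abs hr.le

lemma Shell.intW1_le (H : Shell p lam e ρ R₁ u) {δ : ℝ} (hδ : 0 < δ) :
    ∫ r in Ioo (R₁ - δ) R₁, |W1 e u r| ≤ δ * YY e u R₁ δ := by
  have h1 : ∫ r in Ioo (R₁ - δ) R₁, |W1 e u r| ≤ ∫ r in Ioo (R₁ - δ) R₁, YY e u R₁ δ :=
    setIntegral_mono_on (intOn_Ioo (continuous_W1 H.hu.continuous).abs _ _)
      (intOn_Ioo continuous_const _ _) measurableSet_Ioo fun r hr =>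
        (H.W1_le hr.2).trans (YY_mono H.hu (by linarith [hr.1]))
  refine h1.trans (le_of_eq ?_)
  rw [setIntegral_const, Measure.real, Real.volume_Ioo, sub_sub_cancel, ENNReal.toReal_ofReal hδ.le, smul_eq_mul]

lemma Near.key (H : Near p lam e ρ R₁ u c δ₁) : ∃ C D, 0 ≤ C ∧ 0 < D ∧ D ≤ δ₁ ∧
    ∀ δ h Φ, 0 < δ → 0 < h → δ + h ≤ D → 0 ≤ Φ →
    (∀ r, R₁ - δ - h < r → r < R₁ → ((h⁻¹) ^ 2 + (R₁ - r)⁻¹) * mx e u r ≤ Φ) →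
    YY e u R₁ δ ≤ C * Φ * ((δ + h) * YY e u R₁ (δ + h)) := by
  obtain ⟨C1, hC1, h1⟩ := H.W1'_le
  obtain ⟨C2, hC2, h2⟩ := H.energy
  have hδ1 := H.hδ
  refine ⟨2 * C1 * C2, min δ₁ (1 / (2 * (C1 + 1))), by positivity, lt_min hδ1 (by positivity),
    min_le_left _ _, fun δ h Φ hδ hh hδh hΦ hΦb => ?_⟩
  have hD1 : δ + h ≤ δ₁ := hδh.trans (min_le_left _ _)
  have hD2 : C1 * δ ≤ 1 / 2 := by
    have q := hδh.trans (min_le_right _ _)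
    rw [le_div_iff₀ (by positivity)] at q
    nlinarith
  have q1 := h2 δ h Φ hδ hh hD1 hΦ hΦb
  have q2 := H.intW1_le hδ
  have q3 := H.intW1_le (δ := δ + h) (by linarith)
  rw [← sub_sub] at q3
  have iW := intOn_Ioo (continuous_W1 H.hu.continuous (e := e)).abs (R₁ - δ) R₁
  have iE := intOn_Ioo (continuous_eE H.hu (e := e)) (R₁ - δ) R₁
  have q4 : YY e u R₁ δ ≤ C1 * ((∫ r in Ioo (R₁ - δ) R₁, |W1 e u r|) + ∫ r in Ioo (R₁ - δ) R₁, eE e u r) := by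
    have iW' : Integrable (fun r => |W1 e u r|) (volume.restrict (Ioo (R₁ - δ) R₁)) := iW
    have iE' : Integrable (fun r => eE e u r) (volume.restrict (Ioo (R₁ - δ) R₁)) := iE
    rw [← integral_add iW' iE', ← integral_const_mul, YY]
    refine setIntegral_mono_on (intOn_Ioo (continuous_W1' H.hu).abs _ _)
      ((iW'.add iE').const_mul C1) measurableSet_Ioo fun r hr => ?_
    exact h1 r (by linarith [hr.1]) hr.2
  have Y0 := YY_nonneg (e := e) (u := u) (R₁ := R₁) δ
  have q5 : C1 * (∫ r in Ioo (R₁ - δ) R₁, |W1 e u r|) ≤ 1 / 2 * YY e u R₁ δ := by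
    calc _ ≤ C1 * (δ * YY e u R₁ δ) := mul_le_mul_of_nonneg_left q2 hC1
      _ = C1 * δ * YY e u R₁ δ := by ring
      _ ≤ _ := mul_le_mul_of_nonneg_right hD2 Y0
  have q6 : C1 * (∫ r in Ioo (R₁ - δ) R₁, eE e u r) ≤ C1 * (C2 * Φ * ((δ + h) * YY e u R₁ (δ + h))) :=
    mul_le_mul_of_nonneg_left (q1.trans (mul_le_mul_of_nonneg_left q3 (by positivity))) hC1
  linarith

lemma Near.mx_eps (H : Near p lam e ρ R₁ u c δ₁) {ε : ℝ} (hε : 0 < ε) : ∃ δ, 0 < δ ∧ δ ≤ δ₁ ∧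
    ∀ r, R₁ - δ < r → r < R₁ → mx e u r ≤ 2 * ε * (R₁ - r) := by
  obtain ⟨δ, h1, h2, h3⟩ := H.eps ε hε
  refine ⟨δ, h1, h2, fun r h4 h5 => ?_⟩
  have hδR : δ < R₁ := h2.trans_lt H.δR
  have hr : 0 < r := by linarith
  have n1 : ‖r • e‖ = r := by rw [norm_smul, H.he, Real.norm_of_nonneg hr.le, mul_one]
  have n2 : ‖r • (-e)‖ = r := by rw [smul_neg, norm_neg, n1]
  have g1 := H.growth hδR h3 (x := r • e) (by rw [n1]; exact h4.le) (by rw [n1]; exact h5.le)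
  have g2 := H.growth hδR h3 (x := r • (-e)) (by rw [n2]; exact h4.le) (by rw [n2]; exact h5.le)
  rw [n1] at g1; rw [n2] at g2
  rw [mx]
  linarith [(abs_le.1 g1).1, (abs_le.1 g2).2]

lemma Near.decay (H : Near p lam e ρ R₁ u c δ₁) (k : ℕ) : ∃ A D, 0 ≤ A ∧ 0 < D ∧ D ≤ δ₁ ∧
    ∀ δ, 0 < δ → δ ≤ D → YY e u R₁ δ ≤ A * δ ^ k := by
  obtain ⟨C, D, hC, hD, hDδ, hkey⟩ := H.key
  set ε := (1 / 2 : ℝ) ^ k / (12 * C + 1) with hε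
  have hε0 : 0 < ε := by positivity
  obtain ⟨δ2, h1, h2, h3⟩ := H.mx_eps hε0
  have hδ1 := H.hδ1
  obtain ⟨A, hA, hdec⟩ := decay_aux (f := YY e u R₁) (D := min D δ2) (lt_min hD h1)
    (fun a b _ hab _ => YY_mono H.hu hab) (YY_nonneg _) k (fun δ hδ hδD => by
      have hd1 : 2 * δ ≤ D := hδD.trans (min_le_left _ _)
      have hd2 : 2 * δ ≤ δ2 := hδD.trans (min_le_right _ _)
      have hδ11 : δ ≤ 1 := by linarith
      have hk := hkey δ δ (6 * ε / δ) hδ hδ (by linarith) (by positivity) (fun r hr1 hr2 => by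
        have hm := h3 r (by linarith) hr2
        have hd : 0 < R₁ - r := by linarith
        have hd' : R₁ - r ≤ 2 * δ := by linarith
        calc ((δ⁻¹) ^ 2 + (R₁ - r)⁻¹) * mx e u r ≤ ((δ⁻¹) ^ 2 + (R₁ - r)⁻¹) * (2 * ε * (R₁ - r)) := by gcongr
          _ = 2 * ε * ((δ⁻¹) ^ 2 * (R₁ - r) + 1) := by field_simp
          _ ≤ 2 * ε * ((δ⁻¹) ^ 2 * (2 * δ) + δ⁻¹) := by
            have : 1 ≤ δ⁻¹ := (one_le_inv₀ hδ).2 hδ11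
            gcongr
          _ = 6 * ε / δ := by field_simp; ring)
      rw [← two_mul] at hk
      refine hk.trans ?_
      have e1 : C * (6 * ε / δ) * (2 * δ * YY e u R₁ (2 * δ)) = 12 * C * ε * YY e u R₁ (2 * δ) := by
        field_simp; ring
      rw [e1]
      refine mul_le_mul_of_nonneg_right ?_ (YY_nonneg _)
      rw [hε, mul_div_assoc', div_le_iff₀ (by positivity)]
      have : (0:ℝ) < (1 / 2) ^ k := by positivity
      nlinarith)
  exact ⟨A, min D δ2, hA, lt_min hD h1, (min_le_left _ _).trans hDδ, hdec⟩

lemma Near.mx_YY (H : Near p lam e ρ R₁ u c δ₁) : ∃ C, 0 ≤ C ∧ ∀ r, ρ < r → r < R₁ →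
    mx e u r ^ (Module.finrank ℝ E + 1) ≤ C * |W1 e u r| := by
  obtain ⟨C, hC, h⟩ := H.mx_pow
  have hnt := H.nontriv
  have ha := a1K_pos (E := E) H.he
  refine ⟨C * (2 / a1K e), by positivity, fun r h1 h2 => (h r h1 h2).trans ?_⟩
  rw [mul_assoc]
  refine mul_le_mul_of_nonneg_left ?_ hC
  have q1 := H.avH_le h1 h2
  rw [abs_of_nonpos (H.W_nonpos h1 h2), div_mul_eq_mul_div, le_div_iff₀ ha]
  linarith

lemma Near.YY_zero (H : Near p lam e ρ R₁ u c δ₁) : ∃ δ, 0 < δ ∧ δ ≤ δ₁ ∧ YY e u R₁ δ = 0 := by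
  obtain ⟨C2, hC2, hmx⟩ := H.mx_YY
  set n := Module.finrank ℝ E + 1 with hn
  have hn0 : 0 < (n : ℝ) := by rw [hn]; positivity
  obtain ⟨A, D1, hA, hD1, hD1δ, hdec⟩ := H.decay (6 * n)
  obtain ⟨C, D, hC, hD, hDδ, hkey⟩ := H.key
  have hδ1 := H.hδ1
  set D' := min D D1 with hD'
  have hD'0 : 0 < D' := lt_min hD hD1
  have hD'D : D' ≤ D := min_le_left _ _
  have hD'1 : D' ≤ D1 := min_le_right _ _
  set κ : ℝ := 1 / (2 * n) with hκ
  have hκ0 : 0 < κ := by positivity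
  set B := (C2 ^ 2 * A) ^ κ with hB
  have hB0 : 0 ≤ B := by positivity
  obtain ⟨δ, h1, h2, h3⟩ := deGiorgi (f := YY e u R₁) (D := D') (C := C * (2 * B)) (A := A ^ κ) (κ := κ) hD'0
    (by positivity) (by positivity) hκ0 (fun _ => YY_nonneg _) (fun a b _ hab _ => YY_mono H.hu hab)
    (fun δ hδ hδD => by
      have q := Real.rpow_le_rpow (YY_nonneg _) (hdec δ hδ (hδD.trans hD'1)) hκ0.le
      refine q.trans (le_of_eq ?_)
      rw [Real.mul_rpow hA (by positivity)]
      congr 1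
      rw [← Real.rpow_natCast, ← Real.rpow_natCast, ← Real.rpow_mul hδ.le]
      congr 1
      rw [hκ]; push_cast; field_simp; norm_num)
    (fun δ h hδ hh hδh => by
      have hδhD1 : δ + h ≤ D1 := hδh.trans hD'1
      have hYp : 0 ≤ YY e u R₁ (δ + h) ^ κ := Real.rpow_nonneg (YY_nonneg _) _
      have h1' : 1 ≤ (h⁻¹) ^ 2 := one_le_pow₀ ((one_le_inv₀ hh).2 (by linarith))
      have hk := hkey δ h ((h⁻¹) ^ 2 * (2 * B * YY e u R₁ (δ + h) ^ κ)) hδ hh (hδh.trans hD'D)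
        (by positivity) (fun r hr1 hr2 => by
          have hρr : ρ < r := by linarith [H.hδρ]
          have hd : 0 < R₁ - r := by linarith
          have hd1 : R₁ - r ≤ D1 := by linarith
          have hd11 : R₁ - r ≤ 1 := by linarith
          have m0 : 0 ≤ mx e u r := H.mx_nonneg hρr hr2
          have m1 := (hmx r hρr hr2).trans (mul_le_mul_of_nonneg_left (H.W1_le hr2) hC2)
          have y0 := YY_nonneg (e := e) (u := u) (R₁ := R₁) (R₁ - r)
          have y1 := hdec (R₁ - r) hd hd1
          have y2 : YY e u R₁ (R₁ - r) ≤ YY e u R₁ (δ + h) := YY_mono H.hu (by linarith)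
          set d := R₁ - r with hdd
          set y := YY e u R₁ d
          have m2 : mx e u r ^ (2 * n) ≤ (C2 ^ 2 * A) * YY e u R₁ (δ + h) * d ^ (2 * n) := by
            have z1 : mx e u r ^ (2 * n) = (mx e u r ^ n) ^ 2 := by rw [← pow_mul, mul_comm]
            have z2 : d ^ (6 * n) ≤ d ^ (2 * n) := pow_le_pow_of_le_one hd.le hd11 (by omega)
            calc mx e u r ^ (2 * n) ≤ (C2 * y) ^ 2 := by
                  rw [z1]; exact pow_le_pow_left₀ (by positivity) m1 2
              _ = C2 ^ 2 * (y * y) := by ring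
              _ ≤ C2 ^ 2 * ((A * d ^ (2 * n)) * YY e u R₁ (δ + h)) := by
                  refine mul_le_mul_of_nonneg_left ?_ (by positivity)
                  refine mul_le_mul (y1.trans (mul_le_mul_of_nonneg_left z2 hA)) y2 y0 (by positivity)
              _ = _ := by ring
          have m3 : mx e u r ≤ B * YY e u R₁ (δ + h) ^ κ * d := by
            have z := Real.rpow_le_rpow (by positivity) m2 hκ0.le
            rw [Real.mul_rpow (mul_nonneg (by positivity) (YY_nonneg _)) (by positivity),
              Real.mul_rpow (by positivity) (YY_nonneg _)] at z
            have cast : ∀ t : ℝ, 0 ≤ t → (t ^ (2 * n)) ^ κ = t := fun t ht => by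
              rw [← Real.rpow_natCast, ← Real.rpow_mul ht]
              have : ((2 * n : ℕ) : ℝ) * κ = 1 := by rw [hκ]; push_cast; field_simp
              rw [this, Real.rpow_one]
            rwa [cast _ m0, cast _ hd.le] at z
          have hBY : 0 ≤ B * YY e u R₁ (δ + h) ^ κ := mul_nonneg hB0 hYp
          calc ((h⁻¹) ^ 2 + d⁻¹) * mx e u r ≤ ((h⁻¹) ^ 2 + d⁻¹) * (B * YY e u R₁ (δ + h) ^ κ * d) := by gcongr
            _ = B * YY e u R₁ (δ + h) ^ κ * ((h⁻¹) ^ 2 * d + 1) := by field_simp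
            _ ≤ B * YY e u R₁ (δ + h) ^ κ * ((h⁻¹) ^ 2 * 1 + (h⁻¹) ^ 2) := by gcongr
            _ = _ := by ring)
      refine hk.trans ?_
      have hle : (δ + h) * YY e u R₁ (δ + h) ≤ YY e u R₁ (δ + h) := by
        have := YY_nonneg (e := e) (u := u) (R₁ := R₁) (δ + h)
        nlinarith
      refine (mul_le_mul_of_nonneg_left hle (by positivity)).trans (le_of_eq ?_)
      ring)
  exact ⟨δ, h1, h2.trans (hD'D.trans hDδ), h3⟩

theorem Shell.radial (H : Shell p lam e ρ R₁ u) : ∃ r₁, ρ < r₁ ∧ r₁ < R₁ ∧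
    ∀ x y, ‖x‖ = ‖y‖ → r₁ < ‖x‖ → ‖x‖ < R₁ → u x = u y := by
  obtain ⟨c, δ₁, H'⟩ := H.exists_near
  obtain ⟨δ, h1, h2, h3⟩ := H'.YY_zero
  obtain ⟨C, hC, hmx⟩ := H'.mx_YY
  refine ⟨R₁ - δ, by linarith [H'.hδρ], by linarith, fun x y hxy hx1 hx2 => ?_⟩
  have hρ : ρ < ‖x‖ := by linarith [H'.hδρ]
  have hW : |W1 e u ‖x‖| = 0 := by
    refine le_antisymm ?_ (abs_nonneg _)
    rw [← h3]
    exact (H.W1_le hx2).trans (YY_mono H.hu (by linarith))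
  have hm := hmx ‖x‖ hρ hx2
  rw [hW, mul_zero] at hm
  have hm0 : mx e u ‖x‖ = 0 := by
    by_contra hne
    have : 0 < mx e u ‖x‖ := lt_of_le_of_ne (H.mx_nonneg hρ hx2) (Ne.symm hne)
    exact absurd hm (not_le.2 (by positivity))
  have hd := H.diff_le_mx hxy hρ hx2
  rw [hm0] at hd
  exact sub_eq_zero.1 (abs_eq_zero.1 (le_antisymm hd (abs_nonneg _)))
end Iter


section Final
variable {N : ℕ}

lemma e1_eq (h : 0 < N) : e1 N = EuclideanSpace.single (⟨0, h⟩ : Fin N) (1 : ℝ) := by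
  ext i
  simp only [e1, PiLp.single_apply, Fin.ext_iff]
  rfl

lemma norm_e1 (h : 0 < N) : ‖e1 N‖ = 1 := by
  rw [e1_eq h]; simp

lemma inner_e1 (h : 0 < N) (x : EuclideanSpace ℝ (Fin N)) : ⟪x, e1 N⟫ = x ⟨0, h⟩ := by
  rw [e1_eq h, EuclideanSpace.inner_single_right]; simp

lemma lam1_nonneg (p : ℝ) (Ω : Set (EuclideanSpace ℝ (Fin N))) : 0 ≤ lam1 p Ω := by
  refine Real.sInf_nonneg ?_
  rintro r ⟨φ, -, -, -, -, rfl⟩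
  exact div_nonneg (integral_nonneg fun x => by positivity) (integral_nonneg fun x => by positivity)

lemma setInt_of_tsupport {φ : EuclideanSpace ℝ (Fin N) → ℝ} {Ω : Set (EuclideanSpace ℝ (Fin N))}
    (hs : tsupport φ ⊆ Ω) {g : EuclideanSpace ℝ (Fin N) → ℝ} (hg : ∀ x, x ∉ tsupport φ → g x = 0) :
    ∫ x in Ω, g x = ∫ x, g x :=
  setIntegral_eq_integral_of_forall_compl_eq_zero fun x hx => hg x fun h => hx (hs h)

lemma lam1_rayleigh {p : ℝ} (hp : 1 < p) {Ω : Set (EuclideanSpace ℝ (Fin N))}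
    (φ : EuclideanSpace ℝ (Fin N) → ℝ) (h1 : ContDiff ℝ (⊤ : ℕ∞) φ) (hc : HasCompactSupport φ)
    (hs : tsupport φ ⊆ Ω) : lam1 p Ω * ∫ x, |φ x| ^ p ≤ ∫ x, ‖gradient φ x‖ ^ p := by
  have hp0 : p ≠ 0 := by linarith
  have g0 : 0 ≤ ∫ x, ‖gradient φ x‖ ^ p := integral_nonneg fun x => by positivity
  have f0 : 0 ≤ ∫ x, |φ x| ^ p := integral_nonneg fun x => by positivity
  rcases f0.eq_or_lt with h | h
  · rw [← h, mul_zero]; exact g0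
  have hne : φ ≠ 0 := by
    rintro rfl
    simp [Real.zero_rpow hp0] at h
  have key : lam1 p Ω ≤ (∫ x in Ω, ‖gradient φ x‖ ^ p) / (∫ x in Ω, |φ x| ^ p) := by
    refine csInf_le ⟨0, ?_⟩ ⟨φ, h1, hne, hc, hs, rfl⟩
    rintro r ⟨ψ, -, -, -, -, rfl⟩
    exact div_nonneg (integral_nonneg fun x => by positivity) (integral_nonneg fun x => by positivity)
  rw [setInt_of_tsupport hs (g := fun x => ‖gradient φ x‖ ^ p) (fun x hx => by
      rw [gradient_eq_zero_of_notMem hx, norm_zero, Real.zero_rpow hp0]),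
    setInt_of_tsupport hs (g := fun x => |φ x| ^ p) (fun x hx => by
      rw [image_eq_zero_of_notMem_tsupport hx, abs_zero, Real.zero_rpow hp0]), le_div_iff₀ h] at key
  exact key

/-- extension of a `C¹` function near a compact set to a global one -/
lemma exists_ext {E : Type*} [NormedAddCommGroup E] [InnerProductSpace ℝ E] [FiniteDimensional ℝ E]
    {K V : Set E} (hK : IsCompact K) (hV : IsOpen V) (hKV : K ⊆ V) {u : E → ℝ}
    (hu : ContDiffOn ℝ 1 u V) : ∃ w : E → ℝ, ContDiff ℝ 1 w ∧ ∀ x ∈ K, w x = u x := by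
  obtain ⟨L, hL, hKL, hLV⟩ := exists_compact_between hK hV hKV
  obtain ⟨χ, h1, h2, -⟩ := exists_contMDiffMap_one_nhds_of_subset_interior (n := 1) (modelWithCornersSelf ℝ E)
    hK.isClosed hKL
  have hχ : ContDiff ℝ 1 (fun x => χ x) := χ.contMDiff.contDiff
  refine ⟨fun x => χ x * u x, ?_, fun x hx => ?_⟩
  · rw [contDiff_iff_contDiffAt]
    intro x
    by_cases hx : x ∈ V
    · exact hχ.contDiffAt.mul (hu.contDiffAt (hV.mem_nhds hx))
    · have hxL : Lᶜ ∈ 𝓝 x := hL.isClosed.isOpen_compl.mem_nhds fun h => hx (hLV h)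
      refine contDiffAt_const (c := (0:ℝ)) |>.congr_of_eventuallyEq ?_
      filter_upwards [hxL] with y hy
      rw [h2 y hy, zero_mul]
  · have := h1.self_of_nhdsSet x hx
    show χ x * u x = u x
    rw [this, one_mul]

lemma Om_eq (R₀ R₁ t : ℝ) (hR₀ : 0 < R₀) :
    Om N R₀ R₁ t = ball 0 R₁ \ closedBall (t • e1 N) R₀ := by
  rw [Om, closure_ball _ hR₀.ne']

end Final

theorem stmt11 (N : ℕ) (hN : 2 ≤ N) (R₀ R₁ : ℝ) (hR₀ : 0 < R₀) (hR : R₀ < R₁)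
    (p : ℝ) (hp : 1 < p) (s : ℝ) (hs : 0 < s) (hs' : s < R₁ - R₀)
    (u : EuclideanSpace ℝ (Fin N) → ℝ)
    (hu : IsFirstEigenfunction p (Om N R₀ R₁ s) (lam1 p (Om N R₀ R₁ s)) u)
    (hd : HasDerivAt (fun t : ℝ => lam1 p (Om N R₀ R₁ t)) 0 s) :
    ∃ r₁ ∈ Set.Ioo (R₀ + s) R₁, ∀ x : EuclideanSpace ℝ (Fin N),
      r₁ < ‖x‖ → ‖x‖ < R₁ → u x = u (x - (2 * x ⟨0, by omega⟩) • e1 N) := by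
  have hN0 : 0 < N := by omega
  obtain ⟨⟨V, hV, hΩV, huV⟩, hpos, hbd, hweak⟩ := hu
  have hΩe : ∀ t, Om N R₀ R₁ t = ball 0 R₁ \ closedBall (t • e1 N) R₀ := fun t => Om_eq R₀ R₁ t hR₀
  have hop : ∀ t, IsOpen (Om N R₀ R₁ t) := fun t => by
    rw [hΩe]; exact isOpen_ball.sdiff isClosed_closedBall
  have he := norm_e1 hN0
  set lam : ℝ → ℝ := fun t => lam1 p (Om N R₀ R₁ t) with hlam
  set Ω := Om N R₀ R₁ s with hΩ
  have hΩo : IsOpen Ω := hop s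
  have hΩb : IsCompact (closure Ω) := by
    refine (isCompact_closedBall (0 : EuclideanSpace ℝ (Fin N)) R₁).of_isClosed_subset isClosed_closure ?_
    refine closure_minimal ?_ isClosed_closedBall
    rw [hΩ, hΩe]
    exact sdiff_subset.trans ball_subset_closedBall
  obtain ⟨w, hw, hwu⟩ := exists_ext hΩb hV hΩV huV
  have hwΩ : ∀ x ∈ Ω, w x = u x := fun x hx => hwu x (subset_closure hx)
  have hgr : ∀ x ∈ Ω, gradient w x = gradient u x := fun x hx => by
    have : w =ᶠ[𝓝 x] u := by
      filter_upwards [hΩo.mem_nhds hx] with y hy using hwΩ y hy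
    rw [gradient, gradient, this.fderiv_eq]
  -- the weak formulation
  have hwk : WeakSol p (lam s) Ω w := by
    refine weakSol_of_smooth hp hΩo hw fun φ h1 hc hs1 => ?_
    have h := hweak φ h1 hc hs1
    rw [← setInt_of_tsupport hs1 (g := fun x => ⟪Fp p (gradient w x), gradient φ x⟫) (fun x hx => by
        show ⟪Fp p (gradient w x), gradient φ x⟫ = 0
        rw [gradient_eq_zero_of_notMem hx, inner_zero_right]),
      ← setInt_of_tsupport hs1 (g := fun x => (w x) ^ (p - 1) * φ x) (fun x hx => by
        show (w x) ^ (p - 1) * φ x = 0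
        rw [image_eq_zero_of_notMem_tsupport hx, mul_zero])]
    rw [setIntegral_congr_fun hΩo.measurableSet (g := fun x => ‖gradient u x‖ ^ (p - 2) * ⟪gradient u x, gradient φ x⟫)
        (fun x hx => by
          show ⟪Fp p (gradient w x), gradient φ x⟫ = ‖gradient u x‖ ^ (p - 2) * ⟪gradient u x, gradient φ x⟫
          rw [hgr x hx, Fp, real_inner_smul_left]),
      setIntegral_congr_fun hΩo.measurableSet (f := fun x => (w x) ^ (p - 1) * φ x) (g := fun x => (u x) ^ (p - 1) * φ x)
        (fun x hx => by
          show (w x) ^ (p - 1) * φ x = (u x) ^ (p - 1) * φ x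
          rw [hwΩ x hx])]
    exact h
  have hRay : ∀ t, ∀ φ : EuclideanSpace ℝ (Fin N) → ℝ, ContDiff ℝ 1 φ → HasCompactSupport φ →
      tsupport φ ⊆ Om N R₀ R₁ t → lam t * ∫ x, |φ x| ^ p ≤ ∫ x, ‖gradient φ x‖ ^ p :=
    fun t φ h1 hc hs1 => rayleigh_of_smooth hp (hop t) (fun ψ a b c => lam1_rayleigh hp ψ a b c) h1 hc hs1
  -- extension by zero
  classical
  set v : EuclideanSpace ℝ (Fin N) → ℝ := fun x => if x ∈ Ω then w x else 0 with hv
  have hvc : Continuous v := by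
    refine Continuous.if (fun x hx => ?_) hw.continuous continuous_const
    have hx' : x ∈ frontier Ω := hx
    rw [hwu x (frontier_subset_closure hx'), hbd x hx']
  have hv0 : ∀ x ∈ Ω, 0 < v x := fun x hx => by
    rw [hv]; simp only [if_pos hx]; rw [hwΩ x hx]; exact hpos x hx
  have hvo : ∀ x, x ∉ Ω → v x = 0 := fun x hx => by rw [hv]; simp only [if_neg hx]
  have hwv : ∀ x ∈ Ω, w x = v x := fun x hx => by rw [hv]; simp only [if_pos hx]
  have hmem : ∀ x : EuclideanSpace ℝ (Fin N), R₀ + s < ‖x‖ → ‖x‖ < R₁ → x ∈ Ω := by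
    intro x h1 h2
    rw [hΩ, hΩe]
    refine ⟨by rwa [mem_ball_zero_iff], fun h => ?_⟩
    rw [mem_closedBall, dist_eq_norm] at h
    have := norm_sub_norm_le x (s • e1 N)
    rw [norm_smul, he, Real.norm_of_nonneg hs.le, mul_one] at this
    linarith
  have hrank : 1 < Module.rank ℝ (EuclideanSpace ℝ (Fin N)) := by
    rw [← Module.finrank_eq_rank, finrank_euclideanSpace_fin]
    exact_mod_cast hN
  have HS : Shell p (lam s) (e1 N) (R₀ + s) R₁ w := by
    refine ⟨hp, he, by linarith, by linarith, lam1_nonneg _ _, hw, fun x h1 h2 => ?_, fun x hx => ?_, ?_, ?_, ?_⟩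
    · rw [hwv x (hmem x h1 h2)]; exact hv0 x (hmem x h1 h2)
    · have hxc : x ∈ closure Ω := by
        have h1 : x ∈ {y : EuclideanSpace ℝ (Fin N) | R₀ + s < ‖y‖} ∩ closure (ball 0 R₁) := by
          refine ⟨?_, ?_⟩
          · show R₀ + s < ‖x‖
            rw [hx]; linarith
          · rw [closure_ball _ (by linarith : R₁ ≠ 0), mem_closedBall_zero_iff, hx]
        have h2 := (isOpen_lt continuous_const continuous_norm).inter_closure h1
        refine closure_mono ?_ h2
        rintro y ⟨hy1, hy2⟩
        exact hmem y hy1 (mem_ball_zero_iff.1 hy2)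
      have hxn : x ∉ Ω := fun h => by
        rw [hΩ, hΩe] at h
        have := mem_ball_zero_iff.1 h.1
        linarith
      rw [hwu x hxc]
      exact hbd x (by rw [frontier, hΩo.interior_eq]; exact ⟨hxc, hxn⟩)
    · intro φ h1 hc hs1
      exact hwk φ h1 hc (hs1.trans fun x hx => hmem x hx.1 hx.2)
    · intro x y hxy h1 h2 hle
      have := mono_sphere hp hrank he hs hR₀ (hΩe s) hw hwk hvc hv0 hvo hwv hxy h1 h2 hle
      rwa [hwv x (hmem x h1 h2), hwv y (hmem y (hxy ▸ h1) (hxy ▸ h2))]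
    · refine av_zero_of_radial he (by linarith) (by linarith) (continuous_Qx hp _ _ hw) ?_
      intro a b κ ha hb hκ h1 h2
      have := noether_radial (Ω := fun t => Om N R₀ R₁ t) hp he hs hR₀ ha hb hΩe (lam1_nonneg _ _) hRay hd hw hwk hvc hv0 hvo hwv
        (κ := fun r => κ r * r) (hκ.continuous.mul continuous_id) (fun r hr => by simp only [h1 r hr, zero_mul])
        (fun r hr => by simp only [h2 r hr, zero_mul])
      rw [← this]
      congr 1; funext x
      rw [← Qx_eq]; ring
  obtain ⟨r₁, hr1, hr2, hr⟩ := HS.radial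
  refine ⟨r₁, ⟨hr1, hr2⟩, fun x h1 h2 => ?_⟩
  set y := x - (2 * x ⟨0, by omega⟩) • e1 N with hy
  have hxy : ‖x‖ = ‖y‖ := by
    have h3 : ‖y‖ ^ 2 = ‖x‖ ^ 2 := by
      rw [hy, norm_sub_sq_real, real_inner_smul_right, inner_e1 hN0, norm_smul, he, mul_one,
        Real.norm_eq_abs, sq_abs]
      ring
    exact ((sq_eq_sq₀ (norm_nonneg _) (norm_nonneg _)).1 h3).symm
  have h := hr x y hxy h1 h2
  rwa [hwΩ x (hmem x (by linarith) h2), hwΩ y (hmem y (by rw [← hxy]; linarith) (by rw [← hxy]; exact h2))] at h
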